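/- Let n ≥ 5, p ≥ 1, n/(n−4) < s < (n+4)/(n−4), and 0 < R < ∞. Let U = (u_1, …, u_p) be a nonnegative superharmonic C⁴ solution of Δ² u_i = |U|^{s−1} u_i on the punctured ball B_R \ {0} ⊂ ℝ^n whose origin is a non-removable singularity. Then |U(x)| = (1 + o(1)) K₀(n,s)^{1/(s−1)} |x|^{−4/(s−1)} as x → 0; equivalently, lim_{x→0} |x|^{4/(s−1)} |U(x)| = K₀(n,s)^{1/(s−1)}. -/

import Mathlib

open MeasureTheory Metric Filter Topology

/-- The Euclidean Laplacian: sum of second partial derivatives. -/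
noncomputable def lap {n : ℕ} (u : EuclideanSpace ℝ (Fin n) → ℝ)
    (x : EuclideanSpace ℝ (Fin n)) : ℝ :=
  ∑ i : Fin n,
    fderiv ℝ (fun y => fderiv ℝ u y (EuclideanSpace.single i 1)) x
      (EuclideanSpace.single i 1)

/-- The bi-Laplacian Δ² = Δ ∘ Δ. -/
noncomputable def bilap {n : ℕ} (u : EuclideanSpace ℝ (Fin n) → ℝ) :
    EuclideanSpace ℝ (Fin n) → ℝ :=
  lap (lap u)

/-- The pointwise Euclidean norm |U(x)| of a p-map U. -/
noncomputable def vnorm {n p : ℕ} (U : Fin p → EuclideanSpace ℝ (Fin n) → ℝ)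
    (x : EuclideanSpace ℝ (Fin n)) : ℝ :=
  Real.sqrt (∑ i, U i x ^ 2)

/-- The constant K₀(n,s). -/
noncomputable def K0 (n : ℕ) (s : ℝ) : ℝ :=
  8 / (s - 1) ^ 4 *
    (((n : ℝ) - 2) * ((n : ℝ) - 4) * (s - 1) ^ 3
      + 2 * ((n : ℝ) ^ 2 - 10 * (n : ℝ) + 20) * (s - 1) ^ 2
      - 16 * ((n : ℝ) - 4) * (s - 1) + 32)

set_option linter.all false

abbrev EE (n : ℕ) := EuclideanSpace ℝ (Fin n)

/-- The Riesz kernel `‖x‖^(4-n)`. -/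
noncomputable def rk {n : ℕ} (x : EE n) : ℝ := ‖x‖ ^ ((4 : ℝ) - n)

lemma EE_nontrivial {n : ℕ} (hn : 5 ≤ n) : Nontrivial (EE n) := by
  haveI : Nonempty (Fin n) := ⟨⟨0, by omega⟩⟩
  infer_instance

lemma rk_nonneg {n : ℕ} (x : EE n) : 0 ≤ rk x := Real.rpow_nonneg (norm_nonneg _) _

lemma rk_pos {n : ℕ} {x : EE n} (hx : x ≠ 0) : 0 < rk x :=
  Real.rpow_pos_of_pos (norm_pos_iff.2 hx) _

lemma rk_meas {n : ℕ} : Measurable (rk (n := n)) := by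
  unfold rk; fun_prop

lemma normpow_meas {n : ℕ} (a : ℝ) : Measurable (fun z : EE n => ‖z‖ ^ a) := by
  fun_prop

lemma rk_sub_comm {n : ℕ} (x y : EE n) : rk (x - y) = rk (y - x) := by
  unfold rk; rw [norm_sub_rev]

lemma int_ball {n : ℕ} (hn : 5 ≤ n) {a : ℝ} (ha : -(n:ℝ) < a) (r : ℝ) :
    IntegrableOn (fun z : EE n => ‖z‖ ^ a) (ball 0 r) := by
  haveI := EE_nontrivial hn
  rcases le_or_gt r 0 with hr | hr
  · rw [ball_eq_empty.2 hr]; exact integrableOn_empty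
  rw [integrableOn_fun_norm_addHaar volume (f := fun y => y ^ a)]
  have h : IntegrableOn (fun y : ℝ => y ^ (a + (n - 1))) (Set.Ioo 0 r) := by
    rw [intervalIntegral.integrableOn_Ioo_rpow_iff hr]; linarith
  refine h.congr_fun ?_ measurableSet_Ioo
  intro y hy
  have hy0 : 0 < y := hy.1
  simp only [finrank_euclideanSpace, Fintype.card_fin, smul_eq_mul]
  rw [Real.rpow_add hy0, mul_comm]
  congr 1
  rw [← Real.rpow_natCast]; congr 1
  push_cast [Nat.cast_sub (show 1 ≤ n by omega)]; ring

lemma int_compl {n : ℕ} (hn : 5 ≤ n) {a : ℝ} (ha : a < -(n:ℝ)) {r : ℝ} (hr : 0 < r) :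
    IntegrableOn (fun z : EE n => ‖z‖ ^ a) {z | r ≤ ‖z‖} := by
  haveI := EE_nontrivial hn
  have hm : MeasurableSet {z : EE n | r ≤ ‖z‖} := measurableSet_le measurable_const measurable_norm
  rw [← integrable_indicator_iff hm]
  have h : IntegrableOn (fun y : ℝ => y ^ (a + (n - 1))) (Set.Ioi (r/2)) := by
    apply integrableOn_Ioi_rpow_of_lt <;> linarith
  have h2 := (integrable_fun_norm_addHaar (volume : Measure (EE n))
    (f := (Set.Ici r).indicator (fun y => y ^ a))).2 (by
      rw [← integrable_indicator_iff measurableSet_Ioi]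
      rw [← integrable_indicator_iff measurableSet_Ioi] at h
      refine h.mono ?_ ?_
      · apply Measurable.aestronglyMeasurable
        apply Measurable.indicator _ measurableSet_Ioi
        refine Measurable.smul (f := fun y : ℝ => y ^ (Module.finrank ℝ (EE n) - 1)) (by fun_prop) ?_
        exact Measurable.indicator (by fun_prop) measurableSet_Ici
      · filter_upwards with y
        by_cases h1 : r ≤ y
        · have hy0 : 0 < y := by linarith
          have : r / 2 < y := by linarith
          simp only [finrank_euclideanSpace, Fintype.card_fin, smul_eq_mul, Set.indicator,
            Set.mem_Ioi, hy0, if_true, Set.mem_Ici, h1, this]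
          apply le_of_eq
          congr 1
          rw [Real.rpow_add hy0, mul_comm]
          congr 1
          rw [← Real.rpow_natCast]; congr 1
          push_cast [Nat.cast_sub (show 1 ≤ n by omega)]; ring
        · simp [Set.indicator, h1])
  refine h2.congr ?_
  filter_upwards with x
  simp [Set.indicator]

lemma rk_not_integrable {n : ℕ} (hn : 5 ≤ n) : ¬ Integrable (rk (n := n)) := by
  haveI := EE_nontrivial hn
  intro h
  unfold rk at h
  rw [integrable_fun_norm_addHaar (volume : Measure (EE n)) (f := fun y => y ^ ((4:ℝ) - n))] at h
  have h2 : IntegrableOn (fun y : ℝ => y ^ (3:ℝ)) (Set.Ioi 1) := by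
    refine (h.mono_set (Set.Ioi_subset_Ioi zero_le_one)).congr_fun ?_ measurableSet_Ioi
    intro y hy
    have hy0 : 0 < y := lt_trans one_pos hy
    simp only [finrank_euclideanSpace, Fintype.card_fin, smul_eq_mul]
    rw [← Real.rpow_natCast, ← Real.rpow_add hy0]
    congr 1
    push_cast [Nat.cast_sub (show 1 ≤ n by omega)]; ring
  rw [integrableOn_Ioi_rpow_iff one_pos] at h2
  linarith

lemma rk_sub_not_integrable {n : ℕ} (hn : 5 ≤ n) (x : EE n) :
    ¬ Integrable (fun z => rk (x - z)) := by
  intro h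
  exact rk_not_integrable hn (by simpa using h.comp_sub_left x)

lemma normpow_smul {n : ℕ} {r : ℝ} (hr : 0 < r) (a : ℝ) (z : EE n) :
    ‖r • z‖ ^ a = r ^ a * ‖z‖ ^ a := by
  rw [norm_smul, Real.norm_of_nonneg hr.le, Real.mul_rpow hr.le (norm_nonneg _)]

lemma integral_ball_scale {n : ℕ} {a : ℝ} {r : ℝ} (hr : 0 < r) :
    ∫ z in ball (0 : EE n) r, ‖z‖ ^ a = r ^ (n + a) * ∫ z in ball (0 : EE n) 1, ‖z‖ ^ a := by
  have h := Measure.setIntegral_comp_smul_of_pos (volume : Measure (EE n))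
    (fun z : EE n => ‖z‖ ^ a) (ball 0 1) hr
  simp only [normpow_smul hr, finrank_euclideanSpace, Fintype.card_fin] at h
  rw [integral_const_mul, _root_.smul_ball hr.ne', smul_zero, Real.norm_of_nonneg hr.le, mul_one] at h
  rw [Real.rpow_add hr, Real.rpow_natCast, mul_assoc, h, smul_eq_mul]
  field_simp

open scoped Pointwise in
lemma integral_compl_scale {n : ℕ} {a : ℝ} {r : ℝ} (hr : 0 < r) :
    ∫ z in {z : EE n | r ≤ ‖z‖}, ‖z‖ ^ a
      = r ^ (n + a) * ∫ z in {z : EE n | 1 ≤ ‖z‖}, ‖z‖ ^ a := by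
  have h := Measure.setIntegral_comp_smul_of_pos (volume : Measure (EE n))
    (fun z : EE n => ‖z‖ ^ a) {z : EE n | 1 ≤ ‖z‖} hr
  have hs : r • {z : EE n | 1 ≤ ‖z‖} = {z : EE n | r ≤ ‖z‖} := by
    ext z
    rw [Set.mem_smul_set_iff_inv_smul_mem₀ hr.ne']
    simp only [Set.mem_setOf_eq, norm_smul, norm_inv, Real.norm_of_nonneg hr.le]
    rw [inv_mul_eq_div, le_div_iff₀ hr, one_mul]
  simp only [normpow_smul hr, finrank_euclideanSpace, Fintype.card_fin] at h
  rw [integral_const_mul, hs] at h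
  rw [Real.rpow_add hr, Real.rpow_natCast, mul_assoc, h, smul_eq_mul]
  field_simp

/-- translation of ball integrals of powers -/
lemma int_ball_sub {n : ℕ} (hn : 5 ≤ n) {a : ℝ} (ha : -(n:ℝ) < a) (x : EE n) (r : ℝ) :
    IntegrableOn (fun z : EE n => ‖x - z‖ ^ a) (ball x r) := by
  have h := int_ball hn ha r
  rw [← integrable_indicator_iff measurableSet_ball] at h ⊢
  refine (h.comp_sub_left x).congr ?_
  filter_upwards with z
  simp only [Set.indicator, mem_ball, dist_eq_norm, norm_sub_rev z x, sub_zero]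

lemma integral_ball_sub {n : ℕ} {a : ℝ} (x : EE n) {r : ℝ} (hr : 0 < r) :
    ∫ z in ball x r, ‖x - z‖ ^ a = r ^ (n + a) * ∫ z in ball (0 : EE n) 1, ‖z‖ ^ a := by
  rw [← integral_ball_scale hr, ← integral_indicator measurableSet_ball,
    ← integral_indicator measurableSet_ball, ← integral_sub_left_eq_self _ volume x]
  congr 1; ext z
  simp only [Set.indicator, mem_ball, dist_zero_right, dist_eq_norm]
  simp [norm_sub_rev]

lemma rk_int_ball {n : ℕ} (hn : 5 ≤ n) (x : EE n) (r : ℝ) :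
    IntegrableOn (fun z => rk (x - z)) (ball x r) :=
  int_ball_sub hn (by linarith) x r

/-- unit ball mass of the kernel -/
noncomputable def kc (n : ℕ) : ℝ := ∫ z in ball (0 : EE n) 1, rk z

lemma kc_nonneg (n : ℕ) : 0 ≤ kc n := integral_nonneg fun _ => rk_nonneg _

lemma rk_integral_ball {n : ℕ} (x : EE n) {r : ℝ} (hr : 0 < r) :
    ∫ z in ball x r, rk (x - z) = kc n * r ^ (4 : ℝ) := by
  unfold rk kc
  rw [integral_ball_sub x hr, mul_comm]
  congr 2; ring

lemma rk_int_bdd {n : ℕ} (hn : 5 ≤ n) (x : EE n) {S : Set (EE n)} (hS : Bornology.IsBounded S) :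
    IntegrableOn (fun z => rk (x - z)) S := by
  obtain ⟨r, hr⟩ := hS.subset_ball x
  exact (rk_int_ball hn x r).mono_set hr

lemma n4pos {n : ℕ} (hn : 5 ≤ n) : (0:ℝ) < (n:ℝ) - 4 := by
  have : (5:ℝ) ≤ n := by exact_mod_cast hn
  linarith

/-- powers with nonpositive exponent are antitone -/
lemma rpow_anti {a b e : ℝ} (ha : 0 < a) (hab : a ≤ b) (he : e ≤ 0) : b ^ e ≤ a ^ e :=
  Real.rpow_le_rpow_of_nonpos ha hab he

lemma meas_le_norm {n : ℕ} (r : ℝ) : MeasurableSet {z : EE n | r ≤ ‖z‖} :=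
  measurableSet_le measurable_const measurable_norm

lemma rk_le {n : ℕ} (hn : 5 ≤ n) {x : EE n} {t : ℝ} (ht : 0 < t) (h : t ≤ ‖x‖) :
    rk x ≤ t ^ ((4:ℝ) - n) := by
  have := n4pos hn
  exact rpow_anti ht h (by linarith)

lemma pot_pointwise {n : ℕ} (hn : 5 ≤ n) {θ : ℝ} (hθ : 0 < θ) (x : EE n) (hx : x ≠ 0) (y : EE n) :
    rk (x - y) * ‖y‖ ^ (-4 - θ) ≤
      (ball (0 : EE n) (‖x‖/2)).indicator (fun y => (‖x‖/2) ^ ((4:ℝ)-n) * ‖y‖ ^ (-4-θ)) y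
      + (ball x (‖x‖/2)).indicator (fun y => (‖x‖/2) ^ (-4-θ) * rk (x - y)) y
      + {z : EE n | ‖x‖/2 ≤ ‖z‖}.indicator (fun y => 3 ^ ((n:ℝ)-4) * ‖y‖ ^ (-(n:ℝ)-θ)) y := by
  have h4 := n4pos hn
  have hx0 : 0 < ‖x‖ := norm_pos_iff.2 hx
  have i1 : 0 ≤ (ball (0 : EE n) (‖x‖/2)).indicator
      (fun y => (‖x‖/2) ^ ((4:ℝ)-n) * ‖y‖ ^ (-4-θ)) y :=
    Set.indicator_nonneg (fun _ _ => by positivity) _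
  have i2 : 0 ≤ (ball x (‖x‖/2)).indicator (fun y => (‖x‖/2) ^ (-4-θ) * rk (x - y)) y :=
    Set.indicator_nonneg (fun _ _ => mul_nonneg (by positivity) (rk_nonneg _)) _
  have i3 : 0 ≤ {z : EE n | ‖x‖/2 ≤ ‖z‖}.indicator
      (fun y => (3:ℝ) ^ ((n:ℝ)-4) * ‖y‖ ^ (-(n:ℝ)-θ)) y :=
    Set.indicator_nonneg (fun _ _ => by positivity) _
  by_cases h1 : ‖y‖ < ‖x‖/2
  · have : y ∈ ball (0 : EE n) (‖x‖/2) := by simpa using h1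
    rw [Set.indicator_of_mem this]
    have hk : rk (x - y) ≤ (‖x‖/2) ^ ((4:ℝ)-n) := by
      apply rk_le hn (by positivity)
      have := norm_sub_norm_le x y
      linarith
    have := mul_le_mul_of_nonneg_right hk (show 0 ≤ ‖y‖ ^ (-4-θ) by positivity)
    linarith
  · push Not at h1
    by_cases h2 : ‖x - y‖ < ‖x‖/2
    · have : y ∈ ball x (‖x‖/2) := by rw [mem_ball, dist_eq_norm, norm_sub_rev]; exact h2
      rw [Set.indicator_of_mem this]
      have : ‖y‖ ^ (-4-θ) ≤ (‖x‖/2) ^ (-4-θ) := rpow_anti (by positivity) h1 (by linarith)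
      have := mul_le_mul_of_nonneg_left this (rk_nonneg (x - y))
      linarith
    · push Not at h2
      have : y ∈ {z : EE n | ‖x‖/2 ≤ ‖z‖} := h1
      rw [Set.indicator_of_mem this]
      have hy0 : 0 < ‖y‖ := by linarith
      have h3 : ‖y‖ / 3 ≤ ‖x - y‖ := by
        have : ‖y‖ ≤ ‖x‖ + ‖x - y‖ := by
          have := norm_sub_le x (x - y); simpa using this
        linarith
      have hk := rk_le hn (by positivity) h3
      have : (‖y‖/3) ^ ((4:ℝ)-n) * ‖y‖ ^ (-4-θ) = 3 ^ ((n:ℝ)-4) * ‖y‖ ^ (-(n:ℝ)-θ) := by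
        rw [Real.div_rpow hy0.le (by norm_num), show -(n:ℝ)-θ = (4-n) + (-4-θ) by ring,
          Real.rpow_add hy0, show (n:ℝ)-4 = -((4:ℝ)-n) by ring, Real.rpow_neg (by norm_num)]
        field_simp
      have := mul_le_mul_of_nonneg_right hk (show 0 ≤ ‖y‖ ^ (-4-θ) by positivity)
      linarith

lemma pot_bound {n : ℕ} (hn : 5 ≤ n) {θ : ℝ} (hθ : 0 < θ) (hθ2 : θ < n - 4) :
    ∃ C : ℝ, 0 ≤ C ∧ ∀ x : EE n, x ≠ 0 →
      Integrable (fun y => rk (x - y) * ‖y‖ ^ (-4 - θ)) ∧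
      ∫ y, rk (x - y) * ‖y‖ ^ (-4 - θ) ≤ C * ‖x‖ ^ (-θ) := by
  have h4 := n4pos hn
  set I1 := ∫ z in ball (0 : EE n) 1, ‖z‖ ^ (-4-θ)
  set I3 := ∫ z in {z : EE n | 1 ≤ ‖z‖}, ‖z‖ ^ (-(n:ℝ)-θ)
  have hI1 : 0 ≤ I1 := integral_nonneg fun _ => by positivity
  have hI3 : 0 ≤ I3 := integral_nonneg fun _ => by positivity
  have hkc := kc_nonneg n
  refine ⟨(1/2) ^ (-θ) * (I1 + kc n + 3 ^ ((n:ℝ)-4) * I3), by positivity, fun x hx => ?_⟩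
  have hx0 : 0 < ‖x‖ := norm_pos_iff.2 hx
  have hx2 : 0 < ‖x‖/2 := by positivity
  have f1 : Integrable ((ball (0 : EE n) (‖x‖/2)).indicator
      (fun y => (‖x‖/2) ^ ((4:ℝ)-n) * ‖y‖ ^ (-4-θ))) := by
    rw [integrable_indicator_iff measurableSet_ball]
    exact (int_ball hn (by linarith) _).const_mul _
  have f2 : Integrable ((ball x (‖x‖/2)).indicator (fun y => (‖x‖/2) ^ (-4-θ) * rk (x - y))) := by
    rw [integrable_indicator_iff measurableSet_ball]
    exact (rk_int_ball hn _ _).const_mul _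
  have f3 : Integrable ({z : EE n | ‖x‖/2 ≤ ‖z‖}.indicator
      (fun y => (3:ℝ) ^ ((n:ℝ)-4) * ‖y‖ ^ (-(n:ℝ)-θ))) := by
    rw [integrable_indicator_iff (meas_le_norm _)]
    exact (int_compl hn (by linarith) hx2).const_mul _
  have fi := (f1.add f2).add f3
  have hIntg : Integrable (fun y => rk (x - y) * ‖y‖ ^ (-4 - θ)) := by
    refine fi.mono' ?_ ?_
    · apply Measurable.aestronglyMeasurable
      exact (rk_meas.comp (measurable_const.sub measurable_id)).mul (normpow_meas _)
    · filter_upwards with y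
      rw [Real.norm_of_nonneg (mul_nonneg (rk_nonneg _) (by positivity))]
      exact pot_pointwise hn hθ x hx y
  refine ⟨hIntg, ?_⟩
  have h := integral_mono hIntg fi (fun y => pot_pointwise hn hθ x hx y)
  refine h.trans (le_of_eq ?_)
  rw [integral_add' (f1.add f2) f3, integral_add' f1 f2, integral_indicator measurableSet_ball,
    integral_indicator measurableSet_ball, integral_indicator (meas_le_norm _),
    integral_const_mul, integral_const_mul, integral_const_mul, integral_ball_scale hx2,
    integral_compl_scale hx2, rk_integral_ball x hx2]
  have e1 : (‖x‖/2) ^ ((4:ℝ)-n) * ((‖x‖/2) ^ ((n:ℝ) + (-4-θ)) * I1) = (‖x‖/2) ^ (-θ) * I1 := by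
    rw [← mul_assoc, ← Real.rpow_add hx2]; congr 2; ring
  have e2 : (‖x‖/2) ^ (-4-θ) * (kc n * (‖x‖/2) ^ (4:ℝ)) = (‖x‖/2) ^ (-θ) * kc n := by
    rw [mul_comm (kc n), ← mul_assoc, ← Real.rpow_add hx2]; congr 2; ring
  have e3 : (n:ℝ) + (-(n:ℝ)-θ) = -θ := by ring
  rw [e1, e2, e3]
  rw [show ‖x‖/2 = (1/2) * ‖x‖ by ring, Real.mul_rpow (by norm_num) hx0.le]
  ring

lemma ms_pointwise {n : ℕ} (hn : 5 ≤ n) {m : ℝ} (hm : (n:ℝ) < m) {ρ : ℝ} (hρ : 0 < ρ)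
    (y : EE n) (hy : y ≠ 0) (z : EE n) (hz : ρ ≤ ‖z‖) :
    ‖y‖ ^ ((n:ℝ)-4) * (rk (y - z) * ‖z‖ ^ (-m)) ≤
      2 ^ ((n:ℝ)-4) * ‖z‖ ^ (-m) + (ball y (‖y‖/2)).indicator (fun z => rk (y - z) *
        (if 2*ρ/3 ≤ ‖y‖ then 2 ^ m * ‖y‖ ^ ((n:ℝ) - 4 - m) else 0)) z := by
  have h4 := n4pos hn
  have hy0 : 0 < ‖y‖ := norm_pos_iff.2 hy
  by_cases h2 : ‖y - z‖ < ‖y‖/2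
  · have : z ∈ ball y (‖y‖/2) := by rw [mem_ball, dist_eq_norm, norm_sub_rev]; exact h2
    rw [Set.indicator_of_mem this]
    have a1 : ‖z‖ ≤ ‖y‖ + ‖y - z‖ := by
      have := norm_sub_le y (y - z); simpa using this
    have a2 : ‖y‖ ≤ ‖z‖ + ‖y - z‖ := by
      have := norm_add_le z (y - z); simpa using this
    rw [if_pos (by linarith)]
    have : ‖z‖ ^ (-m) ≤ (‖y‖/2) ^ (-m) := rpow_anti (by positivity) (by linarith) (by linarith)
    have e : ‖y‖ ^ ((n:ℝ)-4) * (‖y‖/2) ^ (-m) = 2 ^ m * ‖y‖ ^ ((n:ℝ) - 4 - m) := by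
      rw [Real.div_rpow hy0.le (by norm_num), sub_eq_add_neg ((n:ℝ)-4) m,
        Real.rpow_add hy0, Real.rpow_neg (by norm_num : (0:ℝ) ≤ 2)]
      field_simp
    have p : 0 ≤ (2:ℝ) ^ ((n:ℝ)-4) * ‖z‖ ^ (-m) := by positivity
    calc _ = rk (y - z) * (‖y‖ ^ ((n:ℝ)-4) * ‖z‖ ^ (-m)) := by ring
      _ ≤ rk (y - z) * (‖y‖ ^ ((n:ℝ)-4) * (‖y‖/2) ^ (-m)) := by
        have := rk_nonneg (y - z); gcongr
      _ ≤ _ := by rw [e]; linarith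
  · push Not at h2
    have i2 : 0 ≤ (ball y (‖y‖/2)).indicator (fun z => rk (y - z) *
        (if 2*ρ/3 ≤ ‖y‖ then 2 ^ m * ‖y‖ ^ ((n:ℝ) - 4 - m) else 0)) z := by
      apply Set.indicator_nonneg
      intro z _
      have := rk_nonneg (y - z)
      split_ifs <;> positivity
    have hk := rk_le hn (by positivity) h2
    have e : ‖y‖ ^ ((n:ℝ)-4) * (‖y‖/2) ^ ((4:ℝ)-n) = 2 ^ ((n:ℝ)-4) := by
      rw [Real.div_rpow hy0.le (by norm_num), show (4:ℝ)-n = -((n:ℝ)-4) by ring,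
        Real.rpow_neg hy0.le, Real.rpow_neg (by norm_num)]
      field_simp
    calc _ = ‖y‖ ^ ((n:ℝ)-4) * rk (y - z) * ‖z‖ ^ (-m) := by ring
      _ ≤ ‖y‖ ^ ((n:ℝ)-4) * (‖y‖/2) ^ ((4:ℝ)-n) * ‖z‖ ^ (-m) := by gcongr
      _ ≤ _ := by rw [e]; linarith

lemma ms_bound {n : ℕ} (hn : 5 ≤ n) {m : ℝ} (hm : (n:ℝ) < m) :
    ∃ C : ℝ, 0 ≤ C ∧ ∀ ρ : ℝ, 0 < ρ → ∀ y : EE n, y ≠ 0 →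
      IntegrableOn (fun z => rk (y - z) * ‖z‖ ^ (-m)) {z | ρ ≤ ‖z‖} ∧
      ‖y‖ ^ ((n:ℝ)-4) * ∫ z in {z | ρ ≤ ‖z‖}, rk (y - z) * ‖z‖ ^ (-m) ≤ C * ρ ^ ((n:ℝ) - m) := by
  have h4 := n4pos hn
  set I3 := ∫ z in {z : EE n | 1 ≤ ‖z‖}, ‖z‖ ^ (-m)
  have hI3 : 0 ≤ I3 := integral_nonneg fun _ => by positivity
  have hkc := kc_nonneg n
  refine ⟨2 ^ ((n:ℝ)-4) * I3 + kc n * (1/2) ^ (4:ℝ) * 2 ^ m * (2/3) ^ ((n:ℝ) - m),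
    by positivity, fun ρ hρ y hy => ?_⟩
  have hy0 : 0 < ‖y‖ := norm_pos_iff.2 hy
  have hy2 : 0 < ‖y‖/2 := by positivity
  set c := (if 2*ρ/3 ≤ ‖y‖ then (2:ℝ) ^ m * ‖y‖ ^ ((n:ℝ) - 4 - m) else 0) with hc
  have hc0 : 0 ≤ c := by rw [hc]; split_ifs <;> positivity
  have f1 : IntegrableOn (fun z : EE n => (2:ℝ) ^ ((n:ℝ)-4) * ‖z‖ ^ (-m)) {z | ρ ≤ ‖z‖} :=
    (int_compl hn (by linarith) hρ).const_mul _
  have f2' : Integrable ((ball y (‖y‖/2)).indicator (fun z => rk (y - z) * c)) := by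
    rw [integrable_indicator_iff measurableSet_ball]
    exact (rk_int_ball hn _ _).mul_const _
  have f2 : IntegrableOn ((ball y (‖y‖/2)).indicator (fun z => rk (y - z) * c))
      {z | ρ ≤ ‖z‖} := f2'.integrableOn
  have fi := f1.add f2
  have hmm : AEStronglyMeasurable (fun z => rk (y - z) * ‖z‖ ^ (-m))
      (volume.restrict {z : EE n | ρ ≤ ‖z‖}) := by
    apply Measurable.aestronglyMeasurable
    exact (rk_meas.comp (measurable_const.sub measurable_id)).mul (normpow_meas _)
  have hpt : ∀ᵐ z ∂(volume.restrict {z : EE n | ρ ≤ ‖z‖}),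
      ‖y‖ ^ ((n:ℝ)-4) * (rk (y - z) * ‖z‖ ^ (-m)) ≤ 2 ^ ((n:ℝ)-4) * ‖z‖ ^ (-m) +
        (ball y (‖y‖/2)).indicator (fun z => rk (y - z) * c) z := by
    filter_upwards [ae_restrict_mem (meas_le_norm ρ)] with z hz
    exact ms_pointwise hn hm hρ y hy z hz
  have hIntg' : IntegrableOn (fun z => ‖y‖ ^ ((n:ℝ)-4) * (rk (y - z) * ‖z‖ ^ (-m)))
      {z : EE n | ρ ≤ ‖z‖} := by
    refine Integrable.mono' fi (hmm.const_mul _) ?_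
    filter_upwards [hpt] with z hz
    rw [Real.norm_of_nonneg (by have := rk_nonneg (y - z); positivity)]
    exact hz
  have hIntg : IntegrableOn (fun z => rk (y - z) * ‖z‖ ^ (-m)) {z : EE n | ρ ≤ ‖z‖} := by
    have := hIntg'.const_mul ((‖y‖ ^ ((n:ℝ)-4))⁻¹)
    refine this.congr ?_
    filter_upwards with z
    have : ‖y‖ ^ ((n:ℝ)-4) ≠ 0 := by positivity
    field_simp
  refine ⟨hIntg, ?_⟩
  rw [← integral_const_mul]
  have h := integral_mono_ae hIntg' fi hpt
  refine h.trans ?_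
  have e0 : ∫ z in {z : EE n | ρ ≤ ‖z‖}, ((2:ℝ) ^ ((n:ℝ)-4) * ‖z‖ ^ (-m) +
        (ball y (‖y‖/2)).indicator (fun z => rk (y - z) * c) z) =
      (∫ z in {z : EE n | ρ ≤ ‖z‖}, (2:ℝ) ^ ((n:ℝ)-4) * ‖z‖ ^ (-m)) +
      ∫ z in {z : EE n | ρ ≤ ‖z‖}, (ball y (‖y‖/2)).indicator (fun z => rk (y - z) * c) z :=
    integral_add f1 f2
  rw [show ((fun z : EE n => (2:ℝ) ^ ((n:ℝ)-4) * ‖z‖ ^ (-m)) + (ball y (‖y‖/2)).indicator (fun z => rk (y - z) * c)) = fun z => ((2:ℝ) ^ ((n:ℝ)-4) * ‖z‖ ^ (-m) +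
        (ball y (‖y‖/2)).indicator (fun z => rk (y - z) * c) z) from rfl, e0, integral_const_mul, integral_compl_scale hρ]
  have h2 : ∫ z in {z : EE n | ρ ≤ ‖z‖}, (ball y (‖y‖/2)).indicator (fun z => rk (y - z) * c) z
      ≤ kc n * (‖y‖/2) ^ (4:ℝ) * c := by
    rw [← rk_integral_ball y hy2, ← integral_mul_const, ← integral_indicator measurableSet_ball]
    apply setIntegral_le_integral f2'
    filter_upwards with z
    exact Set.indicator_nonneg (fun z _ => mul_nonneg (rk_nonneg _) hc0) _
  have h3 : kc n * (‖y‖/2) ^ (4:ℝ) * c ≤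
      kc n * (1/2) ^ (4:ℝ) * 2 ^ m * (2/3) ^ ((n:ℝ) - m) * ρ ^ ((n:ℝ) - m) := by
    rw [hc]
    split_ifs with hif
    · have : ‖y‖ ^ ((n:ℝ)-m) ≤ (2*ρ/3) ^ ((n:ℝ)-m) :=
        rpow_anti (by positivity) hif (by linarith)
      rw [show 2*ρ/3 = 2/3*ρ by ring, Real.mul_rpow (by norm_num) hρ.le] at this
      calc _ = kc n * (1/2) ^ (4:ℝ) * 2 ^ m * (‖y‖ ^ ((n:ℝ)-m)) := by
            rw [show ‖y‖/2 = (1/2) * ‖y‖ by ring, Real.mul_rpow (by norm_num) hy0.le,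
              show (n:ℝ)-m = 4 + ((n:ℝ) - 4 - m) by ring, Real.rpow_add hy0]
            ring
        _ ≤ kc n * (1/2) ^ (4:ℝ) * 2 ^ m * ((2/3) ^ ((n:ℝ) - m) * ρ ^ ((n:ℝ) - m)) := by
            gcongr
        _ = _ := by ring
    · rw [mul_zero]; positivity
  rw [← sub_eq_add_neg]
  calc _ ≤ 2 ^ ((n:ℝ)-4) * (ρ ^ ((n:ℝ)-m) * I3) + kc n * (‖y‖/2) ^ (4:ℝ) * c := by gcongr
    _ ≤ 2 ^ ((n:ℝ)-4) * (ρ ^ ((n:ℝ)-m) * I3) + kc n * (1/2) ^ (4:ℝ) * 2 ^ m * (2/3) ^ ((n:ℝ) - m) * ρ ^ ((n:ℝ) - m) := by gcongr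
    _ = _ := by ring

lemma rk_eq_inv {n : ℕ} (hn : 5 ≤ n) (x : EE n) : rk x = (‖x‖ ^ (n-4))⁻¹ := by
  unfold rk
  rw [show (4:ℝ) - n = -((n-4 : ℕ) : ℝ) by rw [Nat.cast_sub (by omega)]; push_cast; ring,
    Real.rpow_neg (norm_nonneg _), Real.rpow_natCast]

lemma pow_sub_one_bound (m : ℕ) {q : ℝ} (h0 : 0 ≤ q) (h3 : q ≤ 3) :
    |q ^ m - 1| ≤ m * 3 ^ m * |q - 1| := by
  induction m with
  | zero => simp
  | succ k ih =>
    have : q ^ (k+1) - 1 = q * (q ^ k - 1) + (q - 1) := by ring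
    rw [this]
    have h1 : |q * (q ^ k - 1)| ≤ 3 * (k * 3 ^ k * |q - 1|) := by
      rw [abs_mul, abs_of_nonneg h0]
      gcongr
    have h2 : (1:ℝ) ≤ 3 ^ (k+1) := one_le_pow₀ (by norm_num)
    have h4 := abs_nonneg (q - 1)
    calc _ ≤ |q * (q ^ k - 1)| + |q - 1| := abs_add_le _ _
      _ ≤ 3 * (k * 3 ^ k * |q - 1|) + 3 ^ (k+1) * |q - 1| := by nlinarith
      _ = _ := by push_cast; ring

/-- oscillation of the kernel -/
lemma rk_osc {n : ℕ} (hn : 5 ≤ n) {a x x' z : EE n} {s : ℝ} (hs : 0 < s)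
    (hx : x ∈ ball a s) (hx' : x' ∈ ball a s) (hz : z ∉ ball a (2*s)) :
    |rk (x - z) - rk (x' - z)| ≤ (n:ℝ) * 3 ^ n * (‖x - x'‖ / s) * rk (x' - z) := by
  rw [mem_ball, dist_eq_norm] at hx hx' hz
  push Not at hz
  set A := ‖x - z‖ with hA
  set B := ‖x' - z‖ with hB
  have hza : 2*s ≤ ‖x - a‖ + A := by
    calc 2*s ≤ ‖z - a‖ := hz
      _ = ‖(x - a) - (x - z)‖ := by congr 1; abel
      _ ≤ _ := norm_sub_le _ _
  have hzb : 2*s ≤ ‖x' - a‖ + B := by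
    calc 2*s ≤ ‖z - a‖ := hz
      _ = ‖(x' - a) - (x' - z)‖ := by congr 1; abel
      _ ≤ _ := norm_sub_le _ _
  have hAs : s < A := by linarith
  have hBs : s < B := by linarith
  have hAB : |B - A| ≤ ‖x - x'‖ := by
    calc |B - A| ≤ ‖(x' - z) - (x - z)‖ := abs_norm_sub_norm_le _ _
      _ = ‖x' - x‖ := by congr 1; abel
      _ = _ := norm_sub_rev _ _
  have hxx : ‖x - x'‖ ≤ ‖x - a‖ + ‖x' - a‖ := by
    calc _ = ‖(x - a) - (x' - a)‖ := by congr 1; abel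
      _ ≤ _ := norm_sub_le _ _
  have hB3 : B ≤ 3 * A := by have := (abs_le.1 hAB).2; linarith
  have hA0 : 0 < A := hs.trans hAs
  have hB0 : 0 < B := hs.trans hBs
  rw [rk_eq_inv hn, rk_eq_inv hn, ← hA, ← hB]
  set m := n - 4
  have e1 : (A ^ m)⁻¹ - (B ^ m)⁻¹ = ((B/A)^m - 1) * (B^m)⁻¹ := by
    rw [div_pow]; field_simp
  rw [e1, abs_mul, abs_of_pos (by positivity : 0 < (B^m)⁻¹)]
  gcongr
  have h := pow_sub_one_bound m (by positivity : 0 ≤ B/A) (by rw [div_le_iff₀ hA0]; linarith)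
  refine h.trans ?_
  have h2 : |B/A - 1| ≤ ‖x - x'‖ / s := by
    rw [show B/A - 1 = (B - A)/A by field_simp, abs_div, abs_of_pos hA0]
    gcongr
  have hmn : m ≤ n := Nat.sub_le _ _
  have h3 : (m:ℝ) ≤ n := by exact_mod_cast hmn
  have h4 : (3:ℝ)^m ≤ 3^n := pow_le_pow_right₀ (by norm_num) hmn
  gcongr

lemma rk_ball2 {n : ℕ} (hn : 5 ≤ n) {a x : EE n} {s : ℝ} (hs : 0 < s) (hx : x ∈ ball a s) :
    ∫ z in ball a (2*s), rk (x - z) ≤ kc n * (3*s)^(4:ℝ) := by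
  rw [← rk_integral_ball x (by positivity : 0 < 3*s)]
  apply setIntegral_mono_set (rk_int_ball hn _ _)
  · filter_upwards with z using rk_nonneg _
  · apply HasSubset.Subset.eventuallyLE
    intro z hz
    rw [mem_ball] at *
    have := dist_triangle z a x
    rw [dist_comm a x] at this
    linarith

lemma rk_small_set {n : ℕ} (hn : 5 ≤ n) (x : EE n) {t : ℝ} (ht : 0 < t) {S : Set (EE n)}
    (hS : MeasurableSet S) (hSf : volume S ≠ ⊤) :
    IntegrableOn (fun z => rk (x - z)) S ∧
    ∫ z in S, rk (x - z) ≤ kc n * t^(4:ℝ) + t^((4:ℝ)-n) * volume.real S := by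
  have hpt : ∀ z, rk (x - z) ≤ (ball x t).indicator (fun z => rk (x - z)) z + t^((4:ℝ)-n) := by
    intro z
    by_cases hz : z ∈ ball x t
    · rw [Set.indicator_of_mem hz]
      have : 0 ≤ t^((4:ℝ)-n) := by positivity
      linarith
    · rw [Set.indicator_of_notMem hz, zero_add]
      apply rk_le hn ht
      rw [mem_ball, dist_eq_norm, norm_sub_rev] at hz
      linarith
  have i1 : Integrable ((ball x t).indicator (fun z => rk (x - z))) := by
    rw [integrable_indicator_iff measurableSet_ball]; exact rk_int_ball hn _ _
  have i2 : IntegrableOn (fun _ : EE n => t^((4:ℝ)-n)) S := integrableOn_const hSf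
  have i3 : IntegrableOn (fun z => (ball x t).indicator (fun z => rk (x - z)) z + t^((4:ℝ)-n)) S :=
    i1.integrableOn.add i2
  have i4 : IntegrableOn (fun z => rk (x - z)) S := by
    refine Integrable.mono' i3 (rk_meas.comp (measurable_const.sub measurable_id)).aestronglyMeasurable ?_
    filter_upwards with z
    rw [Real.norm_of_nonneg (rk_nonneg _)]; exact hpt z
  refine ⟨i4, (setIntegral_mono i4 i3 hpt).trans ?_⟩
  rw [integral_add i1.integrableOn i2, ← rk_integral_ball x ht]
  have h2 : ∫ z in S, (ball x t).indicator (fun z => rk (x - z)) z ≤ ∫ z in ball x t, rk (x - z) := by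
    rw [← integral_indicator measurableSet_ball]
    apply setIntegral_le_integral i1
    filter_upwards with z
    exact Set.indicator_nonneg (fun z _ => rk_nonneg _) _
  have h3 : ∫ z in S, t^((4:ℝ)-n) = t^((4:ℝ)-n) * volume.real S := by
    simp [mul_comm]
  rw [h3]; linarith

/-- small potential of a mild singularity near the origin -/
lemma rk_mild {n : ℕ} (hn : 5 ≤ n) {b : ℝ} (hb0 : 0 < b) (hb : b < 4) :
    ∃ C : ℝ, 0 ≤ C ∧ ∀ s : ℝ, 0 < s → ∀ x ∈ ball (0 : EE n) s,
      IntegrableOn (fun z => rk (x - z) * ‖z‖ ^ (-b)) (ball 0 s) ∧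
      ∫ z in ball (0 : EE n) s, rk (x - z) * ‖z‖ ^ (-b) ≤ C * s ^ (4 - b) := by
  have hn4 := n4pos hn
  set I := ∫ z in ball (0 : EE n) 1, ‖z‖ ^ ((4:ℝ) - n - b) with hI
  have hI0 : 0 ≤ I := integral_nonneg fun _ => by positivity
  refine ⟨I + 2 ^ (4 - b) * I, by positivity, fun s hs x hx => ?_⟩
  have hsub : ball (0 : EE n) s ⊆ ball x (2*s) := by
    intro z hz
    rw [mem_ball] at *
    have := dist_triangle z 0 x
    rw [dist_comm 0 x] at this
    linarith
  have hx0 : -(n:ℝ) < (4:ℝ) - n - b := by linarith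
  have i1 : IntegrableOn (fun z : EE n => ‖z‖ ^ ((4:ℝ) - n - b)) (ball 0 s) := int_ball hn hx0 s
  have i2' : IntegrableOn (fun z : EE n => ‖x - z‖ ^ ((4:ℝ) - n - b)) (ball x (2*s)) :=
    int_ball_sub hn hx0 x _
  have i2 := i2'.mono_set hsub
  have hae : ∀ᵐ z : EE n ∂(volume.restrict (ball 0 s)), z ≠ 0 ∧ z ≠ x := by
    apply ae_restrict_of_ae
    haveI := EE_nontrivial hn
    have h1 : ∀ᵐ z : EE n, z ≠ 0 := by simp [ae_iff, measure_singleton]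
    have h2 : ∀ᵐ z : EE n, z ≠ x := by simp [ae_iff, measure_singleton]
    filter_upwards [h1, h2] with z a b using ⟨a, b⟩
  have hpt : ∀ᵐ z : EE n ∂(volume.restrict (ball 0 s)), rk (x - z) * ‖z‖ ^ (-b) ≤
      ‖z‖ ^ ((4:ℝ) - n - b) + ‖x - z‖ ^ ((4:ℝ) - n - b) := by
    filter_upwards [hae] with z hz
    have hz0 : 0 < ‖z‖ := norm_pos_iff.2 hz.1
    have hz1 : 0 < ‖x - z‖ := norm_pos_iff.2 (sub_ne_zero.2 (Ne.symm hz.2))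
    have p1 : 0 ≤ ‖z‖ ^ ((4:ℝ) - n - b) := by positivity
    have p2 : 0 ≤ ‖x - z‖ ^ ((4:ℝ) - n - b) := by positivity
    unfold rk
    rcases le_total ‖z‖ ‖x - z‖ with h | h
    · have : ‖x - z‖ ^ ((4:ℝ)-n) * ‖z‖ ^ (-b) ≤ ‖z‖ ^ ((4:ℝ)-n) * ‖z‖ ^ (-b) := by
        gcongr ?_ * _
        exact rpow_anti hz0 h (by linarith)
      rw [← Real.rpow_add hz0, ← sub_eq_add_neg] at this
      linarith
    · have : ‖x - z‖ ^ ((4:ℝ)-n) * ‖z‖ ^ (-b) ≤ ‖x - z‖ ^ ((4:ℝ)-n) * ‖x - z‖ ^ (-b) := by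
        gcongr _ * ?_
        exact rpow_anti hz1 h (by linarith)
      rw [← Real.rpow_add hz1, ← sub_eq_add_neg] at this
      linarith
  have i3 : IntegrableOn (fun z : EE n => ‖z‖ ^ ((4:ℝ) - n - b) + ‖x - z‖ ^ ((4:ℝ) - n - b)) (ball 0 s) :=
    i1.add i2
  have i4 : IntegrableOn (fun z => rk (x - z) * ‖z‖ ^ (-b)) (ball 0 s) := by
    refine Integrable.mono' i3 ((rk_meas.comp (measurable_const.sub measurable_id)).mul
      (normpow_meas _)).aestronglyMeasurable ?_
    filter_upwards [hpt] with z hz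
    rw [Real.norm_of_nonneg (mul_nonneg (rk_nonneg _) (by positivity))]; exact hz
  refine ⟨i4, (integral_mono_ae i4 i3 hpt).trans ?_⟩
  rw [integral_add i1 i2, integral_ball_scale hs]
  have h2 : ∫ z in ball (0 : EE n) s, ‖x - z‖ ^ ((4:ℝ) - n - b) ≤
      ∫ z in ball x (2*s), ‖x - z‖ ^ ((4:ℝ) - n - b) := by
    apply setIntegral_mono_set i2'
    · filter_upwards with z; positivity
    · exact hsub.eventuallyLE
  rw [integral_ball_sub x (by positivity : 0 < 2*s)] at h2
  rw [show (n:ℝ) + (4 - n - b) = 4 - b by ring] at *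
  rw [Real.mul_rpow (by norm_num) hs.le] at h2
  calc _ ≤ s ^ (4-b) * I + 2 ^ (4-b) * s ^ (4-b) * I := by gcongr
    _ = _ := by ring

noncomputable def ev {n : ℕ} (i : Fin n) : EE n := EuclideanSpace.single i 1

noncomputable def dd {n : ℕ} (i : Fin n) (u : EE n → ℝ) (x : EE n) : ℝ := fderiv ℝ u x (ev i)

lemma lap_eq_dd {n : ℕ} (u : EE n → ℝ) (x : EE n) : lap u x = ∑ i, dd i (dd i u) x := rfl

lemma dd_contDiffOn {n : ℕ} {i : Fin n} {u : EE n → ℝ} {Ω : Set (EE n)} (hΩ : IsOpen Ω)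
    {m k : WithTop ℕ∞} (h : ContDiffOn ℝ k u Ω) (hmk : m + 1 ≤ k) : ContDiffOn ℝ m (dd i u) Ω :=
  (h.fderiv_of_isOpen hΩ hmk).clm_apply contDiffOn_const

lemma lap_contDiffOn {n : ℕ} {u : EE n → ℝ} {Ω : Set (EE n)} (hΩ : IsOpen Ω)
    {m k l : WithTop ℕ∞} (h : ContDiffOn ℝ l u Ω) (hmk : m + 1 ≤ k) (hkl : k + 1 ≤ l) :
    ContDiffOn ℝ m (lap u) Ω := by
  have : lap u = fun x => ∑ i, dd i (dd i u) x := rfl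
  rw [this]
  exact ContDiffOn.sum fun i _ => dd_contDiffOn hΩ (dd_contDiffOn hΩ h hkl) hmk

lemma h21 : (1:WithTop ℕ∞) + 1 ≤ 2 := by norm_num
lemma h32 : (2:WithTop ℕ∞) + 1 ≤ 3 := by norm_num
lemma h43 : (3:WithTop ℕ∞) + 1 ≤ 4 := by norm_num
lemma h10 : (0:WithTop ℕ∞) + 1 ≤ 1 := by norm_num

lemma lap_C2 {n : ℕ} {u : EE n → ℝ} {Ω : Set (EE n)} (hΩ : IsOpen Ω)
    (h : ContDiffOn ℝ 4 u Ω) : ContDiffOn ℝ 2 (lap u) Ω := lap_contDiffOn hΩ h h32 h43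

lemma lap_C0 {n : ℕ} {u : EE n → ℝ} {Ω : Set (EE n)} (hΩ : IsOpen Ω)
    (h : ContDiffOn ℝ 2 u Ω) : ContinuousOn (lap u) Ω :=
  (lap_contDiffOn hΩ h h10 h21).continuousOn

lemma bilap_C0 {n : ℕ} {u : EE n → ℝ} {Ω : Set (EE n)} (hΩ : IsOpen Ω)
    (h : ContDiffOn ℝ 4 u Ω) : ContinuousOn (bilap u) Ω := lap_C0 hΩ (lap_C2 hΩ h)

lemma lap_congr {n : ℕ} {u v : EE n → ℝ} {x : EE n} (h : u =ᶠ[𝓝 x] v) :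
    lap u =ᶠ[𝓝 x] lap v := by
  have h1 : ∀ i : Fin n, dd i (dd i u) =ᶠ[𝓝 x] dd i (dd i v) := by
    intro i
    have a : dd i u =ᶠ[𝓝 x] dd i v := (h.fderiv (𝕜 := ℝ)).mono fun y hy => by simp [dd, hy]
    exact (a.fderiv (𝕜 := ℝ)).mono fun y hy => by simp [dd] at hy ⊢; rw [hy]
  filter_upwards [eventually_all.2 h1] with y hy
  rw [lap_eq_dd, lap_eq_dd]
  exact Finset.sum_congr rfl fun i _ => hy i

lemma bilap_congr {n : ℕ} {u v : EE n → ℝ} {x : EE n} (h : u =ᶠ[𝓝 x] v) :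
    bilap u =ᶠ[𝓝 x] bilap v := lap_congr (lap_congr h)

lemma dd_const_mul {n : ℕ} (i : Fin n) (c : ℝ) (v : EE n → ℝ) :
    dd i (fun y => c * v y) = fun y => c * dd i v y := by
  funext y
  simp only [dd]
  have e : (fun y => c * v y) = c • v := by ext; simp
  rw [e, fderiv_const_smul_field]; simp

lemma lap_const_mul {n : ℕ} (u : EE n → ℝ) (c : ℝ) (x : EE n) :
    lap (fun y => c * u y) x = c * lap u x := by
  rw [lap_eq_dd, lap_eq_dd, Finset.mul_sum]
  refine Finset.sum_congr rfl fun i _ => ?_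
  rw [dd_const_mul, dd_const_mul]

lemma lap_smul {n : ℕ} (u : EE n → ℝ) (c : ℝ) (x : EE n) :
    lap (fun y => u (c • y)) x = c ^ 2 * lap u (c • x) := by
  rw [lap_eq_dd, lap_eq_dd, Finset.mul_sum]
  refine Finset.sum_congr rfl fun i _ => ?_
  have key : ∀ v : EE n → ℝ, dd i (fun y => v (c • y)) = fun y => c * dd i v (c • y) := by
    intro v; funext y
    simp only [dd]
    rw [fderiv_comp_smul]; simp
  rw [key, dd_const_mul, key]
  simp; ring

lemma bilap_smul {n : ℕ} (u : EE n → ℝ) (c : ℝ) (x : EE n) :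
    bilap (fun y => u (c • y)) x = c ^ 4 * bilap u (c • x) := by
  unfold bilap
  have : lap (fun y => u (c • y)) = fun y => c^2 * lap u (c • y) := by
    funext y; exact lap_smul u c y
  rw [this, lap_const_mul, lap_smul]; ring

lemma bilap_const_mul {n : ℕ} (u : EE n → ℝ) (c : ℝ) (x : EE n) :
    bilap (fun y => c * u y) x = c * bilap u x := by
  unfold bilap
  have : lap (fun y => c * u y) = fun y => c * lap u y := by
    funext y; exact lap_const_mul u c y
  rw [this, lap_const_mul]

lemma int_prod {n : ℕ} {φ ψ : EE n → ℝ} {Ω : Set (EE n)} (hφ : Continuous φ)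
    (hc : HasCompactSupport φ) (hs : tsupport φ ⊆ Ω) (hψ : ContinuousOn ψ Ω) :
    Integrable (fun x => φ x * ψ x) := by
  have h1 : IntegrableOn (fun x => φ x * ψ x) (tsupport φ) :=
    (hφ.continuousOn.mul (hψ.mono hs)).integrableOn_compact hc
  rw [integrableOn_iff_integrable_of_support_subset] at h1
  · exact h1
  · intro x hx
    apply subset_tsupport
    intro h
    simp [h] at hx

lemma dd_tsupport {n : ℕ} (i : Fin n) (φ : EE n → ℝ) : tsupport (dd i φ) ⊆ tsupport φ :=
  tsupport_fderiv_apply_subset ℝ _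

lemma dd_cs {n : ℕ} (i : Fin n) {φ : EE n → ℝ} (h : HasCompactSupport φ) :
    HasCompactSupport (dd i φ) := h.fderiv_apply ℝ _

lemma ibp1 {n : ℕ} {φ ψ : EE n → ℝ} {Ω : Set (EE n)} (hΩ : IsOpen Ω) (hφ : ContDiff ℝ 1 φ)
    (hc : HasCompactSupport φ) (hs : tsupport φ ⊆ Ω) (hψ : ContDiffOn ℝ 1 ψ Ω) (i : Fin n) :
    ∫ x, φ x * dd i ψ x = - ∫ x, dd i φ x * ψ x := by
  have c1 : Continuous (dd i φ) := by
    rw [← continuousOn_univ]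
    exact (dd_contDiffOn isOpen_univ hφ.contDiffOn h10).continuousOn
  apply integral_mul_fderiv_eq_neg_fderiv_mul_of_integrable
  · exact int_prod c1 (dd_cs i hc) ((dd_tsupport i φ).trans hs) hψ.continuousOn
  · exact int_prod hφ.continuous hc hs (dd_contDiffOn hΩ hψ h10).continuousOn
  · exact int_prod hφ.continuous hc hs hψ.continuousOn
  · intro x _; exact (hφ.differentiable (by norm_num)) x
  · intro x hx
    exact (hψ.contDiffAt (hΩ.mem_nhds (hs hx))).differentiableAt (by norm_num)

lemma dd_contDiff {n : ℕ} {i : Fin n} {u : EE n → ℝ} 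
    {m k : WithTop ℕ∞} (h : ContDiff ℝ k u) (hmk : m + 1 ≤ k) : ContDiff ℝ m (dd i u) := by
  rw [← contDiffOn_univ]; exact dd_contDiffOn isOpen_univ h.contDiffOn hmk

lemma lap_tsupport {n : ℕ} (φ : EE n → ℝ) : tsupport (lap φ) ⊆ tsupport φ := by
  apply closure_minimal _ (isClosed_tsupport _)
  intro x hx
  by_contra h
  have : φ =ᶠ[𝓝 x] fun _ => 0 := notMem_tsupport_iff_eventuallyEq.1 h
  have h2 := (lap_congr this).eq_of_nhds
  apply hx
  rw [h2, lap_eq_dd]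
  have : ∀ i : Fin n, dd i (fun _ : EE n => (0:ℝ)) = fun _ => 0 := by
    intro i; funext y; simp [dd]
  simp [this]

lemma ibp_lap {n : ℕ} {φ ψ : EE n → ℝ} {Ω : Set (EE n)} (hΩ : IsOpen Ω) (hφ : ContDiff ℝ 2 φ)
    (hc : HasCompactSupport φ) (hs : tsupport φ ⊆ Ω) (hψ : ContDiffOn ℝ 2 ψ Ω) :
    ∫ x, φ x * lap ψ x = ∫ x, lap φ x * ψ x := by
  have d1 : ∀ i, ContDiff ℝ 1 (dd i φ) := fun i => dd_contDiff hφ h21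
  have e1 : ∀ i, ContDiffOn ℝ 1 (dd i ψ) Ω := fun i => dd_contDiffOn hΩ hψ h21
  have d2 : ∀ i, Continuous (dd i (dd i φ)) := fun i => (dd_contDiff (d1 i) h10).continuous
  have e2 : ∀ i, ContinuousOn (dd i (dd i ψ)) Ω := fun i => (dd_contDiffOn hΩ (e1 i) h10).continuousOn
  have i12 : (1:WithTop ℕ∞) ≤ 2 := by norm_num
  simp only [lap_eq_dd, Finset.mul_sum, Finset.sum_mul]
  rw [integral_finsetSum, integral_finsetSum]
  · refine Finset.sum_congr rfl fun i _ => ?_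
    rw [ibp1 hΩ (hφ.of_le i12) hc hs (e1 i) i,
      ibp1 hΩ (d1 i) (dd_cs i hc) ((dd_tsupport i φ).trans hs) (hψ.of_le i12) i, neg_neg]
  · intro i _
    exact int_prod (d2 i) (dd_cs i (dd_cs i hc)) (((dd_tsupport i _).trans (dd_tsupport i φ)).trans hs)
      hψ.continuousOn
  · intro i _
    exact int_prod hφ.continuous hc hs (e2 i)

lemma ibp_bilap {n : ℕ} {φ ψ : EE n → ℝ} {Ω : Set (EE n)} (hΩ : IsOpen Ω) (hφ : ContDiff ℝ 4 φ)
    (hc : HasCompactSupport φ) (hs : tsupport φ ⊆ Ω) (hψ : ContDiffOn ℝ 4 ψ Ω) :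
    ∫ x, φ x * bilap ψ x = ∫ x, bilap φ x * ψ x := by
  have i24 : (2:WithTop ℕ∞) ≤ 4 := by norm_num
  have l2 : ContDiff ℝ 2 (lap φ) := by
    rw [← contDiffOn_univ]; exact lap_C2 isOpen_univ hφ.contDiffOn
  have hcl : HasCompactSupport (lap φ) := hc.of_isClosed_subset (isClosed_tsupport _) (lap_tsupport φ)
  unfold bilap
  rw [ibp_lap hΩ (hφ.of_le i24) hc hs (lap_C2 hΩ hψ),
    ibp_lap hΩ l2 hcl ((lap_tsupport φ).trans hs) (hψ.of_le i24)]

lemma norm_sq_eq_sum {n : ℕ} (x : EE n) : ‖x‖^2 = ∑ i, (x i)^2 := by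
  rw [EuclideanSpace.norm_sq_eq]; simp

lemma dd_rad {n : ℕ} (i : Fin n) {a x : EE n} {G : ℝ → ℝ} {g : ℝ} (h : HasDerivAt G g (‖x-a‖^2)) :
    dd i (fun y => G (‖y-a‖^2)) x = g * (2 * (x i - a i)) := by
  have h1 : HasFDerivAt (fun y : EE n => ‖y - a‖^2) (2 • innerSL ℝ (x - a)) x := by
    have := ((hasFDerivAt_id x).sub_const a).norm_sq
    simpa using this
  have h2 := h.comp_hasFDerivAt x h1
  unfold dd
  have h3 : fderiv ℝ (fun y => G (‖y-a‖^2)) x = g • (2 • innerSL ℝ (x - a)) := h2.fderiv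
  rw [h3]
  simp [ev, EuclideanSpace.inner_single_right]

lemma lap_rad {n : ℕ} {a x : EE n} {G G1 : ℝ → ℝ} {g2 : ℝ}
    (h1 : ∀ᶠ r in 𝓝 (‖x-a‖^2), HasDerivAt G (G1 r) r) (h2 : HasDerivAt G1 g2 (‖x-a‖^2)) :
    lap (fun y => G (‖y-a‖^2)) x = 4 * ‖x-a‖^2 * g2 + 2 * n * G1 (‖x-a‖^2) := by
  have hc : Tendsto (fun y : EE n => ‖y-a‖^2) (𝓝 x) (𝓝 (‖x-a‖^2)) :=
    Continuous.tendsto (by fun_prop) x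
  have hi : ∀ i : Fin n, dd i (dd i (fun y => G (‖y-a‖^2))) x =
      g2 * (2 * (x i - a i)) * (2 * (x i - a i)) + G1 (‖x-a‖^2) * 2 := by
    intro i
    have e : dd i (fun y => G (‖y-a‖^2)) =ᶠ[𝓝 x] fun y => G1 (‖y-a‖^2) * (2 * (y i - a i)) := by
      filter_upwards [hc.eventually h1] with y hy using dd_rad i hy
    have e2 : dd i (dd i (fun y => G (‖y-a‖^2))) x
        = dd i (fun y => G1 (‖y-a‖^2) * (2 * (y i - a i))) x := by
      unfold dd at e ⊢; rw [e.fderiv_eq]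
    have d1 : DifferentiableAt ℝ (fun y : EE n => G1 (‖y-a‖^2)) x := by
      have : DifferentiableAt ℝ (fun y : EE n => ‖y-a‖^2) x := by
        apply DifferentiableAt.norm_sq ℝ; fun_prop
      exact h2.differentiableAt.comp x this
    have d2 : HasFDerivAt (fun y : EE n => 2 * (y i - a i)) ((2:ℝ) • (EuclideanSpace.proj i : EE n →L[ℝ] ℝ)) x := by
      have : HasFDerivAt (fun y : EE n => y i) (EuclideanSpace.proj i : EE n →L[ℝ] ℝ) x :=
        (EuclideanSpace.proj i : EE n →L[ℝ] ℝ).hasFDerivAt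
      exact (this.sub_const _).const_mul 2
    rw [e2]
    unfold dd
    rw [fderiv_fun_mul d1 d2.differentiableAt, d2.fderiv]
    have := dd_rad i (a := a) (x := x) h2
    unfold dd at this
    simp [this]
    simp [ev]; ring
  rw [lap_eq_dd, Finset.sum_congr rfl fun i _ => hi i, Finset.sum_add_distrib]
  have : ∑ i : Fin n, g2 * (2 * (x i - a i)) * (2 * (x i - a i)) = 4 * g2 * ‖x-a‖^2 := by
    rw [norm_sq_eq_sum, Finset.mul_sum]
    refine Finset.sum_congr rfl fun i _ => ?_
    simp; ring
  rw [this]; simp; ring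

/-- regularised kernel -/
noncomputable def bub {n : ℕ} (e : ℝ) (a y : EE n) : ℝ := (‖y-a‖^2 + e^2) ^ (-(((n:ℝ)-4)/2))

lemma hasDeriv_q {e r b : ℝ} (h : 0 < r + e^2) :
    HasDerivAt (fun r => (r + e^2)^b) (b * (r+e^2)^(b-1)) r := by
  have h1 : HasDerivAt (fun r : ℝ => r + e^2) 1 r := (hasDerivAt_id r).add_const _
  have := h1.rpow_const (p := b) (Or.inl h.ne')
  simpa using this

lemma bilap_bub {n : ℕ} {e : ℝ} (he : 0 < e) (a y : EE n) :
    bilap (bub e a) y = (n-4)*(n-2)*n*(n+2) * e^4 * (‖y-a‖^2+e^2) ^ (-((n:ℝ)+4)/2) := by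
  set α : ℝ := ((n:ℝ)-4)/2 with hα
  have hpos : ∀ r : ℝ, 0 ≤ r → 0 < r + e^2 := fun r hr => by positivity
  have hev : ∀ z : EE n, ∀ᶠ r in 𝓝 (‖z-a‖^2), 0 < r + e^2 := fun z =>
    (continuous_id.add continuous_const).tendsto _ |>.eventually (lt_mem_nhds (hpos _ (sq_nonneg _)))
  have L1 : lap (bub e a) = fun z => (-4*α) * (‖z-a‖^2+e^2)^(-α-1) + (-4*e^2*α*(α+1)) * (‖z-a‖^2+e^2)^(-α-2) := by
    funext z
    have hz := hpos (‖z-a‖^2) (by positivity)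
    have := lap_rad (a := a) (x := z) (G := fun r => (r+e^2)^(-α)) (G1 := fun r => -α * (r+e^2)^(-α-1))
      ((hev z).mono fun r hr => hasDeriv_q hr) ((hasDeriv_q hz).const_mul _)
    unfold bub
    rw [this]
    rw [show -α-1-1 = -α-2 by ring, show -α - 1 = (-α-2) + 1 by ring, Real.rpow_add_one hz.ne']
    rw [show (n:ℝ) = 2*α+4 by rw [hα]; ring]
    ring
  unfold bilap
  rw [L1]
  have hz := hpos (‖y-a‖^2) (by positivity)
  have d1 : ∀ r : ℝ, 0 < r + e^2 → HasDerivAt (fun r => (-4*α) * (r+e^2)^(-α-1) + (-4*e^2*α*(α+1)) * (r+e^2)^(-α-2))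
      ((-4*α) * ((-α-1) * (r+e^2)^(-α-1-1)) + (-4*e^2*α*(α+1)) * ((-α-2)*(r+e^2)^(-α-2-1))) r := fun r hr =>
    ((hasDeriv_q hr).const_mul _).add ((hasDeriv_q hr).const_mul _)
  have d2 : HasDerivAt (fun r => (-4*α) * ((-α-1) * (r+e^2)^(-α-1-1)) + (-4*e^2*α*(α+1)) * ((-α-2)*(r+e^2)^(-α-2-1)))
      ((-4*α) * ((-α-1) * ((-α-1-1)*(‖y-a‖^2+e^2)^(-α-1-1-1))) + (-4*e^2*α*(α+1)) * ((-α-2)*((-α-2-1)*(‖y-a‖^2+e^2)^(-α-2-1-1)))) (‖y-a‖^2) :=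
    (((hasDeriv_q hz).const_mul _).const_mul _).add (((hasDeriv_q hz).const_mul _).const_mul _)
  have := lap_rad (a := a) (x := y) ((hev y).mono d1) d2
  rw [this]
  set X := ‖y-a‖^2+e^2 with hX
  have q1 : X^(-α-1-1-1) = X^(-α-4) * X := by
    rw [← Real.rpow_add_one hz.ne']; congr 1; ring
  have q2 : X^(-α-2-1) = X^(-α-4) * X := by
    rw [← Real.rpow_add_one hz.ne']; congr 1; ring
  have q3 : X^(-α-1-1) = X^(-α-4) * X * X := by
    rw [← Real.rpow_add_one hz.ne', ← Real.rpow_add_one hz.ne']; congr 1; ring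
  have q4 : X^(-α-2-1-1) = X^(-α-4) := by congr 1; ring
  rw [q1, q2, q3, q4, show -((n:ℝ)+4)/2 = -α-4 by rw [hα]; ring]
  generalize X^(-α-4) = Q
  rw [show ‖y-a‖^2 = X - e^2 by rw [hX]; ring]
  clear_value X
  rw [show (n:ℝ) = 2*α+4 by rw [hα]; ring]
  ring

section joint
variable {P : Type*} [NormedAddCommGroup P] [NormedSpace ℝ P]

noncomputable def ddJ {n : ℕ} (i : Fin n) (F : P × EE n → ℝ) (z : P × EE n) : ℝ :=
  fderiv ℝ F z (0, ev i)
noncomputable def lapJ {n : ℕ} (F : P × EE n → ℝ) (z : P × EE n) : ℝ := ∑ i, ddJ i (ddJ i F) z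

lemma ddJ_contDiffOn {n : ℕ} {i : Fin n} {F : P × EE n → ℝ} {O : Set (P × EE n)} (hO : IsOpen O)
    {m k : WithTop ℕ∞} (h : ContDiffOn ℝ k F O) (hmk : m + 1 ≤ k) : ContDiffOn ℝ m (ddJ i F) O :=
  (h.fderiv_of_isOpen hO hmk).clm_apply contDiffOn_const

lemma ddJ_section {n : ℕ} {i : Fin n} {F : P × EE n → ℝ} {p : P} {y : EE n}
    (h : DifferentiableAt ℝ F (p, y)) : dd i (fun y => F (p, y)) y = ddJ i F (p, y) := by
  unfold dd ddJ
  have h1 : HasFDerivAt (fun y : EE n => (p, y)) (ContinuousLinearMap.inr ℝ P (EE n)) y :=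
    hasFDerivAt_prodMk_right p y
  have := h.hasFDerivAt.comp y h1
  have e : fderiv ℝ (fun y => F (p, y)) y = (fderiv ℝ F (p,y)).comp (ContinuousLinearMap.inr ℝ P (EE n)) :=
    this.fderiv
  rw [e]; simp

lemma lapJ_section {n : ℕ} {F : P × EE n → ℝ} {O : Set (P × EE n)} (hO : IsOpen O)
    (h : ContDiffOn ℝ 2 F O) {p : P} {y : EE n} (hy : (p,y) ∈ O) :
    lap (fun y => F (p, y)) y = lapJ F (p, y) := by
  rw [lap_eq_dd]; unfold lapJ
  refine Finset.sum_congr rfl fun i _ => ?_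
  have h1 : ContDiffOn ℝ 1 (ddJ i F) O := ddJ_contDiffOn hO h h21
  have hev : ∀ᶠ y' in 𝓝 y, (p, y') ∈ O :=
    (Continuous.tendsto (by fun_prop : Continuous fun y' : EE n => (p, y')) y).eventually (hO.mem_nhds hy)
  have e : dd i (fun y => F (p, y)) =ᶠ[𝓝 y] fun y => ddJ i F (p, y) := by
    filter_upwards [hev] with y' hy'
    exact ddJ_section ((h.contDiffAt (hO.mem_nhds hy')).differentiableAt (by norm_num))
  have e2 : dd i (dd i (fun y => F (p, y))) y = dd i (fun y => ddJ i F (p, y)) y := by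
    unfold dd at e ⊢; rw [e.fderiv_eq]
  rw [e2]
  exact ddJ_section ((h1.contDiffAt (hO.mem_nhds hy)).differentiableAt (by norm_num))

lemma lapJ_contDiffOn {n : ℕ} {F : P × EE n → ℝ} {O : Set (P × EE n)} (hO : IsOpen O)
    {m k l : WithTop ℕ∞} (h : ContDiffOn ℝ l F O) (hmk : m + 1 ≤ k) (hkl : k + 1 ≤ l) :
    ContDiffOn ℝ m (lapJ F) O := by
  have : lapJ F = fun x => ∑ i, ddJ i (ddJ i F) x := rfl
  rw [this]
  exact ContDiffOn.sum fun i _ => ddJ_contDiffOn hO (ddJ_contDiffOn hO h hkl) hmk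

lemma bilap_section_bound {n : ℕ} {F : P × EE n → ℝ} {O K : Set (P × EE n)} (hO : IsOpen O)
    (h : ContDiffOn ℝ 4 F O) (hK : IsCompact K) (hKO : K ⊆ O) :
    ∃ C : ℝ, 0 ≤ C ∧ ∀ p y, (p, y) ∈ K → |bilap (fun y => F (p, y)) y| ≤ C := by
  have c2 : ContDiffOn ℝ 2 (lapJ F) O := lapJ_contDiffOn hO h h32 h43
  have c0 : ContinuousOn (lapJ (lapJ F)) O := (lapJ_contDiffOn hO c2 h10 h21).continuousOn
  obtain ⟨C, hC⟩ := hK.exists_bound_of_continuousOn (c0.mono hKO)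
  refine ⟨max C 0, le_max_right _ _, fun p y hy => ?_⟩
  have i24 : (2:WithTop ℕ∞) ≤ 4 := by norm_num
  have hev : ∀ᶠ y' in 𝓝 y, (p, y') ∈ O :=
    (Continuous.tendsto (by fun_prop : Continuous fun y' : EE n => (p, y')) y).eventually
      (hO.mem_nhds (hKO hy))
  have e : lap (fun y => F (p, y)) =ᶠ[𝓝 y] fun y => lapJ F (p, y) := by
    filter_upwards [hev] with y' hy'
    exact lapJ_section hO (h.of_le i24) hy'
  have e2 : bilap (fun y => F (p, y)) y = lapJ (lapJ F) (p, y) := by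
    unfold bilap
    rw [(lap_congr e).eq_of_nhds]
    exact lapJ_section hO c2 (hKO hy)
  rw [e2]
  exact (hC _ hy).trans (le_max_left _ _)
lemma lap_section_bound {n : ℕ} {F : P × EE n → ℝ} {O K : Set (P × EE n)} (hO : IsOpen O)
    (h : ContDiffOn ℝ 2 F O) (hK : IsCompact K) (hKO : K ⊆ O) :
    ∃ C : ℝ, 0 ≤ C ∧ ∀ p y, (p, y) ∈ K → |lap (fun y => F (p, y)) y| ≤ C := by
  have c0 : ContinuousOn (lapJ F) O := (lapJ_contDiffOn hO h h10 h21).continuousOn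
  obtain ⟨C, hC⟩ := hK.exists_bound_of_continuousOn (c0.mono hKO)
  refine ⟨max C 0, le_max_right _ _, fun p y hy => ?_⟩
  rw [lapJ_section hO h (hKO hy)]
  exact (hC _ hy).trans (le_max_left _ _)
end joint

noncomputable def cutI {n : ℕ} (y : EE n) : ℝ := Real.smoothTransition ((‖y‖^2 - 1)/3)

lemma cutI_contDiff {n : ℕ} {k : ℕ∞} : ContDiff ℝ k (cutI (n := n)) := by
  unfold cutI
  exact Real.smoothTransition.contDiff.comp (((contDiff_norm_sq ℝ).sub contDiff_const).div_const _)

lemma cutI_zero {n : ℕ} {y : EE n} (h : ‖y‖ ≤ 1) : cutI y = 0 := by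
  apply Real.smoothTransition.zero_of_nonpos
  have : ‖y‖^2 ≤ 1 := pow_le_one₀ (norm_nonneg _) h
  linarith

lemma cutI_one {n : ℕ} {y : EE n} (h : 2 ≤ ‖y‖) : cutI y = 1 := by
  apply Real.smoothTransition.one_of_one_le
  have : 2^2 ≤ ‖y‖^2 := by gcongr
  linarith

lemma cutI_nonneg {n : ℕ} (y : EE n) : 0 ≤ cutI y := Real.smoothTransition.nonneg _
lemma cutI_le_one {n : ℕ} (y : EE n) : cutI y ≤ 1 := Real.smoothTransition.le_one _

noncomputable def chi {n : ℕ} (δ ρ : ℝ) (y : EE n) : ℝ := cutI (δ⁻¹ • y) * (1 - cutI (ρ⁻¹ • y))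

lemma chi_contDiff {n : ℕ} {k : ℕ∞} (δ ρ : ℝ) : ContDiff ℝ k (chi (n := n) δ ρ) := by
  unfold chi
  exact (cutI_contDiff.comp (contDiff_const_smul _)).mul
    (contDiff_const.sub (cutI_contDiff.comp (contDiff_const_smul _)))

lemma chi_nonneg {n : ℕ} (δ ρ : ℝ) (y : EE n) : 0 ≤ chi δ ρ y :=
  mul_nonneg (cutI_nonneg _) (sub_nonneg.2 (cutI_le_one _))
lemma chi_le_one {n : ℕ} (δ ρ : ℝ) (y : EE n) : chi δ ρ y ≤ 1 :=
  mul_le_one₀ (cutI_le_one _) (sub_nonneg.2 (cutI_le_one _)) (by linarith [cutI_nonneg (ρ⁻¹ • y)])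

lemma norm_inv_smul {n : ℕ} {δ : ℝ} (hδ : 0 < δ) (y : EE n) : ‖δ⁻¹ • y‖ = ‖y‖ / δ := by
  rw [norm_smul, norm_inv, Real.norm_of_nonneg hδ.le]; field_simp

lemma cut_bound {n : ℕ} {X : EE n → ℝ} (hX : ContDiff ℝ 4 X) {K : Set ((EE n × ℝ × ℝ) × EE n)}
    (hK : IsCompact K) (hpos : ∀ z ∈ K, 0 < ‖z.1.2.1 • z.2 - z.1.1‖^2 + z.1.2.2^2) :
    ∃ C : ℝ, 0 ≤ C ∧ ∀ a b e y, ((a,b,e),y) ∈ K → |bilap (fun y => X y * bub e a (b • y)) y| ≤ C := by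
  set O : Set ((EE n × ℝ × ℝ) × EE n) := {z | 0 < ‖z.1.2.1 • z.2 - z.1.1‖^2 + z.1.2.2^2} with hO
  have hOo : IsOpen O := by
    apply isOpen_lt continuous_const
    fun_prop
  have hF : ContDiffOn ℝ 4 (fun z : (EE n × ℝ × ℝ) × EE n => X z.2 * bub z.1.2.2 z.1.1 (z.1.2.1 • z.2)) O := by
    apply ContDiffOn.mul
    · exact (hX.comp contDiff_snd).contDiffOn
    · unfold bub
      intro z hz
      apply ContDiffAt.contDiffWithinAt
      apply ContDiffAt.rpow_const_of_ne
      · apply ContDiffAt.add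
        · apply ContDiffAt.norm_sq ℝ
          fun_prop
        · fun_prop
      · exact (ne_of_gt hz)
  obtain ⟨C, hC, h⟩ := bilap_section_bound hOo hF hK hpos
  exact ⟨C, hC, fun a b e y hy => h (a,b,e) y hy⟩

lemma inner_bound {n : ℕ} {X : EE n → ℝ} (hX : ContDiff ℝ 4 X) {x : EE n} (hx : x ≠ 0) :
    ∃ C : ℝ, 0 ≤ C ∧ ∀ δ e : ℝ, 0 < δ → δ ≤ ‖x‖/4 → 0 ≤ e → e ≤ 1 → ∀ y : EE n, ‖y‖ ≤ 2*δ →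
      |bilap (fun y => X (δ⁻¹ • y) * bub e x y) y| ≤ C * (δ^4)⁻¹ := by
  have hx0 : 0 < ‖x‖ := norm_pos_iff.2 hx
  have hK : IsCompact ((({x} : Set (EE n)) ×ˢ (Set.Icc (0:ℝ) (‖x‖/4)) ×ˢ (Set.Icc (0:ℝ) 1)) ×ˢ (closedBall (0 : EE n) 2)) :=
    (isCompact_singleton.prod (isCompact_Icc.prod isCompact_Icc)).prod (isCompact_closedBall _ _)
  obtain ⟨C, hC, h⟩ := cut_bound hX hK (by
    rintro ⟨⟨a,b,e⟩,y⟩ ⟨⟨h1,h2,h3⟩,h4⟩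
    simp only [Set.mem_singleton_iff, Set.mem_Icc, mem_closedBall, dist_zero_right] at h1 h2 h3 h4
    subst h1
    have : 0 < ‖b • y - a‖ := by
      have h5 : ‖a‖ ≤ ‖b • y‖ + ‖b • y - a‖ := by
        calc ‖a‖ = ‖b • y - (b • y - a)‖ := by congr 1; abel
          _ ≤ _ := norm_sub_le _ _
      rw [norm_smul, Real.norm_of_nonneg h2.1] at h5
      have : b * ‖y‖ ≤ (‖a‖/4) * 2 := by
        apply mul_le_mul h2.2 h4 (norm_nonneg _) (by positivity)
      linarith
    show 0 < ‖b • y - a‖^2 + e^2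
    positivity)
  refine ⟨C, hC, fun δ e hδ hδx he he1 y hy => ?_⟩
  have e1 : (fun y => X (δ⁻¹ • y) * bub e x y) = fun y => (fun z => X z * bub e x (δ • z)) (δ⁻¹ • y) := by
    funext y; simp [smul_smul, hδ.ne']
  rw [e1, bilap_smul (fun z => X z * bub e x (δ • z)), abs_mul, inv_pow, abs_of_pos (by positivity : (0:ℝ) < (δ^4)⁻¹), mul_comm]
  gcongr
  apply h x δ e
  refine ⟨⟨rfl, ⟨hδ.le, hδx⟩, he, he1⟩, ?_⟩
  rw [mem_closedBall, dist_zero_right, norm_inv_smul hδ, div_le_iff₀ hδ]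
  exact hy

lemma bub_scale {n : ℕ} (hn : 5 ≤ n) {ρ : ℝ} (hρ : 0 < ρ) (e : ℝ) (x z : EE n) :
    bub e x (ρ • z) = ρ ^ ((4:ℝ) - n) * bub (e/ρ) (ρ⁻¹ • x) ((1:ℝ) • z) := by
  unfold bub
  have h1 : ‖ρ • z - x‖^2 + e^2 = ρ^2 * (‖(1:ℝ) • z - ρ⁻¹ • x‖^2 + (e/ρ)^2) := by
    have : ρ • z - x = ρ • ((1:ℝ) • z - ρ⁻¹ • x) := by
      rw [smul_sub, smul_smul, smul_smul, mul_inv_cancel₀ hρ.ne']; simp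
    rw [this, norm_smul, Real.norm_of_nonneg hρ.le]; field_simp
  rw [h1, Real.mul_rpow (by positivity) (by positivity), ← Real.rpow_natCast ρ 2, ← Real.rpow_mul hρ.le]
  congr 2; push_cast; ring

lemma outer_bound {n : ℕ} (hn : 5 ≤ n) {X : EE n → ℝ} (hX : ContDiff ℝ 4 X) (x : EE n) :
    ∃ C : ℝ, 0 ≤ C ∧ ∀ ρ e : ℝ, 1 ≤ ρ → 2*‖x‖ ≤ ρ → 0 ≤ e → e ≤ 1 → ∀ y : EE n, ρ ≤ ‖y‖ → ‖y‖ ≤ 2*ρ →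
      |bilap (fun y => X (ρ⁻¹ • y) * bub e x y) y| ≤ C * (ρ^n)⁻¹ := by
  have hK : IsCompact (((closedBall (0 : EE n) (1/2)) ×ˢ ({1} : Set ℝ) ×ˢ (Set.Icc (0:ℝ) 1)) ×ˢ
      (closedBall (0 : EE n) 2 ∩ {y | 1 ≤ ‖y‖})) :=
    ((isCompact_closedBall _ _).prod (isCompact_singleton.prod isCompact_Icc)).prod
      ((isCompact_closedBall _ _).inter_right (isClosed_le continuous_const continuous_norm))
  obtain ⟨C, hC, h⟩ := cut_bound hX hK (by
    rintro ⟨⟨a,b,e⟩,y⟩ ⟨⟨h1,h2,h3⟩,h4,h6⟩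
    simp only [Set.mem_singleton_iff, Set.mem_Icc, mem_closedBall, dist_zero_right, Set.mem_setOf_eq] at h1 h2 h3 h4 h6
    subst h2
    have : 0 < ‖(1:ℝ) • y - a‖ := by
      rw [one_smul]
      have h5 := norm_sub_norm_le y a
      linarith
    show 0 < ‖(1:ℝ) • y - a‖^2 + e^2
    positivity)
  refine ⟨C, hC, fun ρ e hρ1 hρx he he1 y hy hy2 => ?_⟩
  have hρ : 0 < ρ := by linarith
  have e1 : (fun y => X (ρ⁻¹ • y) * bub e x y) = fun y => (fun z => ρ ^ ((4:ℝ) - n) * (X z * bub (e/ρ) (ρ⁻¹ • x) ((1:ℝ) • z))) (ρ⁻¹ • y) := by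
    funext y
    have : y = ρ • ρ⁻¹ • y := by simp [smul_smul, hρ.ne']
    conv_lhs => rw [show bub e x y = bub e x (ρ • ρ⁻¹ • y) by rw [← this]]
    rw [bub_scale hn hρ]; ring
  rw [e1, bilap_smul (fun z => ρ ^ ((4:ℝ) - n) * (X z * bub (e/ρ) (ρ⁻¹ • x) ((1:ℝ) • z))), bilap_const_mul, ← mul_assoc, abs_mul]
  have e2 : (ρ⁻¹)^4 * ρ ^ ((4:ℝ) - n) = (ρ^n)⁻¹ := by
    rw [Real.rpow_sub hρ, Real.rpow_natCast, show (4:ℝ) = ((4:ℕ):ℝ) by norm_num, Real.rpow_natCast]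
    field_simp
  rw [e2, abs_of_pos (by positivity : 0 < (ρ^n)⁻¹), mul_comm]
  gcongr
  apply h
  refine ⟨⟨?_, rfl, by positivity, ?_⟩, ?_, ?_⟩
  · rw [mem_closedBall, dist_zero_right, norm_inv_smul hρ, div_le_iff₀ hρ]; linarith
  · rw [div_le_one hρ]; linarith
  · rw [mem_closedBall, dist_zero_right, norm_inv_smul hρ, div_le_iff₀ hρ]; linarith
  · show 1 ≤ ‖ρ⁻¹ • y‖
    rw [norm_inv_smul hρ, le_div_iff₀ hρ]; linarith

lemma cutI_eq_zero_near {n : ℕ} {δ : ℝ} (hδ : 0 < δ) {y : EE n} (h : ‖y‖ < δ) :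
    (fun y : EE n => cutI (δ⁻¹ • y)) =ᶠ[𝓝 y] fun _ => 0 := by
  have : ∀ᶠ z : EE n in 𝓝 y, ‖z‖ < δ := (continuous_norm.tendsto y).eventually (gt_mem_nhds h)
  filter_upwards [this] with z hz
  apply cutI_zero; rw [norm_inv_smul hδ, div_le_one hδ]; exact hz.le

lemma cutI_eq_one_near {n : ℕ} {δ : ℝ} (hδ : 0 < δ) {y : EE n} (h : 2*δ < ‖y‖) :
    (fun y : EE n => cutI (δ⁻¹ • y)) =ᶠ[𝓝 y] fun _ => 1 := by
  have : ∀ᶠ z : EE n in 𝓝 y, 2*δ < ‖z‖ := (continuous_norm.tendsto y).eventually (lt_mem_nhds h)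
  filter_upwards [this] with z hz
  apply cutI_one; rw [norm_inv_smul hδ, le_div_iff₀ hδ]; exact hz.le

lemma bilap_zero_fun {n : ℕ} (y : EE n) : bilap (fun _ : EE n => (0:ℝ)) y = 0 := by
  have := bilap_const_mul (fun _ : EE n => (0:ℝ)) 0 y
  simpa using this

lemma test_bound {n : ℕ} (hn : 5 ≤ n) {x : EE n} (hx : x ≠ 0) :
    ∃ C : ℝ, 0 ≤ C ∧ ∀ δ ρ e : ℝ, 0 < δ → δ ≤ ‖x‖/4 → 1 ≤ ρ → 2*‖x‖ ≤ ρ → 0 < e → e ≤ 1 → ∀ y : EE n,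
      |bilap (fun y => chi δ ρ y * bub e x y) y - chi δ ρ y * bilap (bub e x) y| ≤
        {y : EE n | δ ≤ ‖y‖ ∧ ‖y‖ ≤ 2*δ}.indicator (fun _ => C * (δ^4)⁻¹) y +
        {y : EE n | ρ ≤ ‖y‖ ∧ ‖y‖ ≤ 2*ρ}.indicator (fun _ => C * (ρ^n)⁻¹) y := by
  obtain ⟨C1, hC1, h1⟩ := inner_bound (n := n) (X := cutI) (cutI_contDiff (k := 4)) hx
  obtain ⟨C2, hC2, h2⟩ := inner_bound (n := n) (X := fun _ => 1) contDiff_const hx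
  obtain ⟨C3, hC3, h3⟩ := outer_bound hn (X := fun y => 1 - cutI y) (contDiff_const.sub (cutI_contDiff (k := 4))) x
  obtain ⟨C4, hC4, h4⟩ := outer_bound hn (X := fun _ => 1) contDiff_const x
  have hx0 : 0 < ‖x‖ := norm_pos_iff.2 hx
  refine ⟨C1+C2+C3+C4, by positivity, fun δ ρ e hδ hδx hρ1 hρx he he1 y => ?_⟩
  have hρ : 0 < ρ := by linarith
  have hδρ : 2*δ < ρ := by linarith
  have hA : 0 ≤ {y : EE n | δ ≤ ‖y‖ ∧ ‖y‖ ≤ 2*δ}.indicator (fun _ => (C1+C2+C3+C4) * (δ^4)⁻¹) y :=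
    Set.indicator_nonneg (fun _ _ => by positivity) _
  have hB : 0 ≤ {y : EE n | ρ ≤ ‖y‖ ∧ ‖y‖ ≤ 2*ρ}.indicator (fun _ => (C1+C2+C3+C4) * (ρ^n)⁻¹) y :=
    Set.indicator_nonneg (fun _ _ => by positivity) _
  have hch : |chi δ ρ y| ≤ 1 := by rw [abs_of_nonneg (chi_nonneg _ _ _)]; exact chi_le_one _ _ _
  have key : ∀ A B A' B' M: ℝ, |A| ≤ A' * M → |B| ≤ B' * M → 0 ≤ M → A' + B' ≤ C1+C2+C3+C4 → 
      |A - chi δ ρ y * B| ≤ (C1+C2+C3+C4) * M := by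
    intro A B A' B' M hA hB hM hAB
    have : |chi δ ρ y * B| ≤ 1 * (B' * M) := by rw [abs_mul]; gcongr
    calc _ ≤ |A| + |chi δ ρ y * B| := abs_sub _ _
      _ ≤ A' * M + 1 * (B' * M) := by gcongr
      _ = (A'+B') * M := by ring
      _ ≤ _ := by gcongr
  rcases lt_or_ge ‖y‖ δ with hy | hy
  · have e0 : (fun y => chi δ ρ y * bub e x y) =ᶠ[𝓝 y] fun _ => 0 := by
      filter_upwards [cutI_eq_zero_near hδ hy] with z hz
      simp [chi, hz]
    rw [(bilap_congr e0).eq_of_nhds, bilap_zero_fun]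
    have : chi δ ρ y = 0 := by
      have := (cutI_eq_zero_near hδ hy).eq_of_nhds
      simp [chi, this]
    rw [this]; simp only [zero_mul, sub_zero, abs_zero]; positivity
  rcases le_or_gt ‖y‖ (2*δ) with hy2 | hy2
  · rw [Set.indicator_of_mem (show y ∈ {y : EE n | δ ≤ ‖y‖ ∧ ‖y‖ ≤ 2*δ} from ⟨hy, hy2⟩)]
    have e0 : (fun y => chi δ ρ y * bub e x y) =ᶠ[𝓝 y] fun y => cutI (δ⁻¹ • y) * bub e x y := by
      filter_upwards [cutI_eq_zero_near hρ (show ‖y‖ < ρ by linarith)] with z hz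
      simp [chi, hz]
    rw [(bilap_congr e0).eq_of_nhds]
    have a1 := h1 δ e hδ hδx he.le he1 y hy2
    have a2 := h2 δ e hδ hδx he.le he1 y hy2
    simp only [one_mul] at a2
    have := key _ _ _ _ _ a1 a2 (by positivity) (by linarith)
    exact this.trans (by linarith)
  rcases lt_or_ge ‖y‖ ρ with hy3 | hy3
  · have e0 : (fun y => chi δ ρ y * bub e x y) =ᶠ[𝓝 y] bub e x := by
      filter_upwards [cutI_eq_zero_near hρ hy3, cutI_eq_one_near hδ hy2] with z hz hz2
      simp [chi, hz, hz2]
    rw [(bilap_congr e0).eq_of_nhds]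
    have : chi δ ρ y = 1 := by
      have h1 := (cutI_eq_zero_near hρ hy3).eq_of_nhds
      have h2 := (cutI_eq_one_near hδ hy2).eq_of_nhds
      simp [chi, h1, h2]
    rw [this]; simp only [one_mul, sub_self, abs_zero]; positivity
  rcases le_or_gt ‖y‖ (2*ρ) with hy4 | hy4
  · rw [Set.indicator_of_mem (show y ∈ {y : EE n | ρ ≤ ‖y‖ ∧ ‖y‖ ≤ 2*ρ} from ⟨hy3, hy4⟩)]
    have e0 : (fun y => chi δ ρ y * bub e x y) =ᶠ[𝓝 y] fun y => (1 - cutI (ρ⁻¹ • y)) * bub e x y := by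
      filter_upwards [cutI_eq_one_near hδ hy2] with z hz
      simp [chi, hz]
    rw [(bilap_congr e0).eq_of_nhds]
    have a1 := h3 ρ e hρ1 hρx he.le he1 y hy3 hy4
    have a2 := h4 ρ e hρ1 hρx he.le he1 y hy3 hy4
    simp only [one_mul] at a2
    have := key _ _ _ _ _ a1 a2 (by positivity) (by linarith)
    exact this.trans (by linarith)
  · have e0 : (fun y => chi δ ρ y * bub e x y) =ᶠ[𝓝 y] fun _ => 0 := by
      filter_upwards [cutI_eq_one_near hρ hy4] with z hz
      simp [chi, hz]
    rw [(bilap_congr e0).eq_of_nhds, bilap_zero_fun]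
    have : chi δ ρ y = 0 := by
      have := (cutI_eq_one_near hρ hy4).eq_of_nhds
      simp [chi, this]
    rw [this]; simp only [zero_mul, sub_zero, abs_zero]; positivity

noncomputable def cP {n : ℕ} (z : EE n) : ℝ :=
  ((n:ℝ)-4)*(n-2)*n*(n+2) * (1 + ‖z‖^2) ^ (-((n:ℝ)+4)/2)
noncomputable def c0 (n : ℕ) : ℝ := ∫ z : EE n, cP z

lemma cn_pos {n : ℕ} (hn : 5 ≤ n) : (0:ℝ) < ((n:ℝ)-4)*(n-2)*n*(n+2) := by
  have h : (5:ℝ) ≤ n := by exact_mod_cast hn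
  have : (0:ℝ) < (n:ℝ) - 4 := by linarith
  have : (0:ℝ) < (n:ℝ) - 2 := by linarith
  positivity

lemma cP_int {n : ℕ} : Integrable (cP (n := n)) := by
  unfold cP
  apply Integrable.const_mul
  apply integrable_rpow_neg_one_add_norm_sq
  simp

lemma cP_pos {n : ℕ} (hn : 5 ≤ n) (z : EE n) : 0 < cP z := by
  unfold cP; have := cn_pos hn; positivity

lemma c0_pos {n : ℕ} (hn : 5 ≤ n) : 0 < c0 n := by
  unfold c0
  rw [integral_pos_iff_support_of_nonneg (fun z => (cP_pos hn z).le) cP_int]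
  have : Function.support (cP (n := n)) = Set.univ := by
    ext z; simp [(cP_pos hn z).ne']
  rw [this]; exact isOpen_univ.measure_pos _ ⟨0, trivial⟩

lemma bub_approx {n : ℕ} (hn : 5 ≤ n) {g : EE n → ℝ} (hg : Continuous g) (hc : HasCompactSupport g) (x : EE n) :
    Tendsto (fun e : ℝ => ∫ y, g y * bilap (bub e x) y) (𝓝[>] 0) (𝓝 (c0 n * g x)) := by
  have e1 : ∀ᶠ e : ℝ in 𝓝[>] 0, ∫ z, g (x + e • z) * cP z = ∫ y, g y * bilap (bub e x) y := by
    filter_upwards [self_mem_nhdsWithin] with e he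
    have he : 0 < e := he
    have h1 : ∀ z : EE n, g (x + e • z) * cP z = e ^ n * (fun y => g y * bilap (bub e x) y) (x + e • z) := by
      intro z
      simp only
      rw [bilap_bub he]
      have : ‖x + e • z - x‖^2 + e^2 = e^2 * (1 + ‖z‖^2) := by
        rw [add_sub_cancel_left, norm_smul, Real.norm_of_nonneg he.le]; ring
      rw [this, Real.mul_rpow (by positivity) (by positivity), ← Real.rpow_natCast e 2, ← Real.rpow_mul he.le]
      have h2 : e ^ (((2:ℕ):ℝ) * (-((n:ℝ)+4)/2)) = (e^n)⁻¹ * (e^4)⁻¹ := by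
        rw [show ((2:ℕ):ℝ) * (-((n:ℝ)+4)/2) = -(((n+4:ℕ):ℝ)) by push_cast; ring, Real.rpow_neg he.le,
          Real.rpow_natCast, pow_add, mul_inv]
      rw [h2]; unfold cP; field_simp
    simp_rw [h1]
    rw [integral_const_mul, Measure.integral_comp_smul (μ := volume) (fun w => (fun y => g y * bilap (bub e x) y) (x + w)) e]
    rw [integral_add_left_eq_self (fun y => g y * bilap (bub e x) y) x]
    simp [abs_of_pos he]
    field_simp
  apply Tendsto.congr' e1
  have e2 : c0 n * g x = ∫ z : EE n, g x * cP z := by rw [integral_const_mul, c0, mul_comm]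
  rw [e2]
  obtain ⟨M, hM⟩ := hc.exists_bound_of_continuous hg
  apply tendsto_integral_filter_of_dominated_convergence (fun z => M * cP z)
  · filter_upwards with e
    have : Continuous (fun z : EE n => g (x + e • z)) := by fun_prop
    exact this.aestronglyMeasurable.mul cP_int.aestronglyMeasurable
  · filter_upwards with e
    filter_upwards with z
    rw [norm_mul, Real.norm_of_nonneg (cP_pos hn z).le]
    gcongr
    · exact (cP_pos hn z).le
    · exact hM _
  · exact cP_int.const_mul _
  · filter_upwards with z
    have : Continuous (fun e : ℝ => g (x + e • z) * cP z) := by fun_prop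
    have := this.tendsto 0
    simp only [zero_smul, add_zero] at this
    exact this.mono_left nhdsWithin_le_nhds

lemma bub_le {n : ℕ} (hn : 5 ≤ n) (e : ℝ) {x y : EE n} (h : y ≠ x) : bub e x y ≤ rk (x - y) := by
  have hp : 0 < ‖y - x‖ := norm_pos_iff.2 (sub_ne_zero.2 h)
  have hn4 := n4pos hn
  rw [rk_sub_comm]
  unfold bub rk
  calc (‖y-x‖^2 + e^2) ^ (-(((n:ℝ)-4)/2)) ≤ (‖y-x‖^2) ^ (-(((n:ℝ)-4)/2)) :=
        rpow_anti (by positivity) (by nlinarith [sq_nonneg e]) (by linarith)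
    _ = _ := by
        rw [← Real.rpow_natCast ‖y-x‖ 2, ← Real.rpow_mul hp.le]; congr 1; push_cast; ring

lemma bub_nonneg {n : ℕ} (e : ℝ) (x y : EE n) : 0 ≤ bub e x y := by unfold bub; positivity

lemma bub_contDiff {n : ℕ} {e : ℝ} (he : 0 < e) (x : EE n) {k : ℕ∞} : ContDiff ℝ k (bub e x) := by
  unfold bub
  rw [contDiff_iff_contDiffAt]
  intro y
  apply ContDiffAt.rpow_const_of_ne
  · apply ContDiffAt.add
    · apply ContDiffAt.norm_sq ℝ; fun_prop
    · fun_prop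
  · positivity

lemma bub_tendsto {n : ℕ} {x y : EE n} (h : y ≠ x) :
    Tendsto (fun e : ℝ => bub e x y) (𝓝[>] 0) (𝓝 (rk (x - y))) := by
  have hp : 0 < ‖y - x‖ := norm_pos_iff.2 (sub_ne_zero.2 h)
  have e1 : rk (x - y) = bub 0 x y := by
    rw [rk_sub_comm]
    unfold bub rk
    rw [show ‖y-x‖^2 + 0^2 = ‖y-x‖^2 by ring,
       ← Real.rpow_natCast ‖y-x‖ 2, ← Real.rpow_mul hp.le]; congr 1; push_cast; ring
  rw [e1]
  have : ContinuousAt (fun e : ℝ => bub e x y) 0 := by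
    unfold bub
    apply ContinuousAt.rpow_const (by fun_prop)
    left; positivity
  exact this.tendsto.mono_left nhdsWithin_le_nhds

lemma ae_ne {n : ℕ} (hn : 5 ≤ n) (x : EE n) : ∀ᵐ z : EE n, z ≠ x := by
  haveI := EE_nontrivial hn
  simp [ae_iff, measure_singleton]

lemma chi_support {n : ℕ} {δ ρ : ℝ} (hδ : 0 < δ) (hρ : 0 < ρ) :
    tsupport (chi (n := n) δ ρ) ⊆ {y | δ ≤ ‖y‖ ∧ ‖y‖ ≤ 2*ρ} := by
  apply closure_minimal
  · intro y hy
    by_contra h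
    simp only [Set.mem_setOf_eq, not_and_or, not_le] at h
    apply hy
    rcases h with h | h
    · have := (cutI_eq_zero_near hδ h).eq_of_nhds
      simp [chi, this]
    · have := (cutI_eq_one_near hρ h).eq_of_nhds
      simp [chi, this]
  · exact (isClosed_le continuous_const continuous_norm).inter (isClosed_le continuous_norm continuous_const)

lemma annulus_compact {n : ℕ} (a b : ℝ) : IsCompact {y : EE n | a ≤ ‖y‖ ∧ ‖y‖ ≤ b} := by
  have : {y : EE n | a ≤ ‖y‖ ∧ ‖y‖ ≤ b} = closedBall 0 b ∩ {y | a ≤ ‖y‖} := by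
    ext y; simp [and_comm]
  rw [this]
  exact (isCompact_closedBall _ _).inter_right (isClosed_le continuous_const continuous_norm)

lemma chi_cs {n : ℕ} {δ ρ : ℝ} (hδ : 0 < δ) (hρ : 0 < ρ) : HasCompactSupport (chi (n := n) δ ρ) :=
  (annulus_compact δ (2*ρ)).of_isClosed_subset (isClosed_tsupport _) (chi_support hδ hρ)

lemma chi_eq_one {n : ℕ} {δ ρ : ℝ} (hδ : 0 < δ) (hρ : 0 < ρ) {y : EE n} (h1 : 2*δ < ‖y‖) (h2 : ‖y‖ < ρ) :
    chi δ ρ y = 1 := by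
  have a1 := (cutI_eq_zero_near hρ h2).eq_of_nhds
  have a2 := (cutI_eq_one_near hδ h1).eq_of_nhds
  simp [chi, a1, a2]

lemma rep_approx {n : ℕ} (hn : 5 ≤ n) {x : EE n} (hx : x ≠ 0) {ψ : EE n → ℝ} (hψ : ContDiffOn ℝ 4 ψ {0}ᶜ)
    (hIntg : Integrable (fun y => rk (x - y) * bilap ψ y)) :
    ∃ C : ℝ, 0 ≤ C ∧ ∀ δ ρ : ℝ, 0 < δ → δ ≤ ‖x‖/4 → 1 ≤ ρ → 2*‖x‖ ≤ ρ →
      |(∫ y, chi δ ρ y * (rk (x - y) * bilap ψ y)) - c0 n * ψ x| ≤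
        C * ((δ^4)⁻¹ * ∫ y in {y : EE n | δ ≤ ‖y‖ ∧ ‖y‖ ≤ 2*δ}, |ψ y|) +
        C * ((ρ^n)⁻¹ * ∫ y in {y : EE n | ρ ≤ ‖y‖ ∧ ‖y‖ ≤ 2*ρ}, |ψ y|) := by
  obtain ⟨C, hC, hb⟩ := test_bound hn hx
  have hx0 : 0 < ‖x‖ := norm_pos_iff.2 hx
  have hO : IsOpen ({0}ᶜ : Set (EE n)) := isOpen_compl_singleton
  refine ⟨C, hC, fun δ ρ hδ hδx hρ1 hρx => ?_⟩
  have hρ : 0 < ρ := by linarith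
  have hsub : {y : EE n | δ ≤ ‖y‖ ∧ ‖y‖ ≤ 2*ρ} ⊆ {0}ᶜ := by
    rintro y ⟨h1, _⟩ rfl
    simp at h1; linarith
  have hchic : Continuous (chi (n := n) δ ρ) := (chi_contDiff (k := 4) δ ρ).continuous
  have hchis : tsupport (chi (n := n) δ ρ) ⊆ {0}ᶜ := (chi_support hδ hρ).trans hsub
  have hψc : ContinuousOn ψ {0}ᶜ := hψ.continuousOn
  -- g = chi ψ continuous
  have hg : Continuous (fun y => chi δ ρ y * ψ y) := by
    rw [continuous_iff_continuousAt]
    intro y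
    by_cases hy : y = 0
    · have : (fun y => chi δ ρ y * ψ y) =ᶠ[𝓝 y] fun _ => 0 := by
        filter_upwards [cutI_eq_zero_near hδ (show ‖y‖ < δ by rw [hy]; simpa using hδ)] with z hz
        simp [chi, hz]
      exact continuousAt_const.congr this.symm
    · exact hchic.continuousAt.mul (hψc.continuousAt (hO.mem_nhds hy))
  have hgc : HasCompactSupport (fun y => chi δ ρ y * ψ y) := (chi_cs hδ hρ).mul_right
  have T1 := bub_approx hn hg hgc x
  have T2 : Tendsto (fun e : ℝ => ∫ y, (chi δ ρ y * bub e x y) * bilap ψ y) (𝓝[>] 0)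
      (𝓝 (∫ y, chi δ ρ y * (rk (x - y) * bilap ψ y))) := by
    apply tendsto_integral_filter_of_dominated_convergence (fun y => |rk (x - y) * bilap ψ y|)
    · filter_upwards [self_mem_nhdsWithin] with e he
      have hc1 : Continuous (fun y => chi δ ρ y * bub e x y) := hchic.mul (bub_contDiff (k := 4) he x).continuous
      have hcs : HasCompactSupport (fun y => chi δ ρ y * bub e x y) := (chi_cs hδ hρ).mul_right
      exact (int_prod hc1 hcs ((tsupport_mul_subset_left).trans hchis) (bilap_C0 hO hψ)).aestronglyMeasurable
    · filter_upwards with e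
      filter_upwards [ae_ne hn x] with y hy
      rw [Real.norm_eq_abs, abs_mul, abs_mul, abs_mul]
      gcongr
      rw [abs_of_nonneg (chi_nonneg _ _ _), abs_of_nonneg (bub_nonneg _ _ _), abs_of_nonneg (rk_nonneg _)]
      calc _ ≤ 1 * bub e x y := by gcongr; exact bub_nonneg _ _ _; exact chi_le_one _ _ _
        _ ≤ _ := by rw [one_mul]; exact bub_le hn e hy
    · exact hIntg.abs
    · filter_upwards [ae_ne hn x] with y hy
      have := ((bub_tendsto hy).const_mul (chi δ ρ y)).mul_const (bilap ψ y)
      rw [mul_assoc] at this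
      exact this
  have hA1 : MeasurableSet {y : EE n | δ ≤ ‖y‖ ∧ ‖y‖ ≤ 2*δ} := (annulus_compact _ _).measurableSet
  have hA2 : MeasurableSet {y : EE n | ρ ≤ ‖y‖ ∧ ‖y‖ ≤ 2*ρ} := (annulus_compact _ _).measurableSet
  have iA1 : IntegrableOn (fun y => |ψ y|) {y : EE n | δ ≤ ‖y‖ ∧ ‖y‖ ≤ 2*δ} :=
    ((hψc.mono (by rintro y ⟨h1, _⟩ rfl; simp at h1; linarith)).abs).integrableOn_compact (annulus_compact _ _)
  have iA2 : IntegrableOn (fun y => |ψ y|) {y : EE n | ρ ≤ ‖y‖ ∧ ‖y‖ ≤ 2*ρ} :=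
    ((hψc.mono (by rintro y ⟨h1, _⟩ rfl; simp at h1; linarith)).abs).integrableOn_compact (annulus_compact _ _)
  refine le_of_tendsto (T2.sub T1 |>.abs |> fun h => by
    have hx1 : chi δ ρ x = 1 := chi_eq_one hδ hρ (by linarith) (by linarith)
    simpa only [hx1, one_mul] using h) ?_
  have hle1 : ∀ᶠ e : ℝ in 𝓝[>] 0, e ≤ 1 :=
    (eventually_le_nhds (by norm_num : (0:ℝ) < 1)).filter_mono nhdsWithin_le_nhds
  filter_upwards [self_mem_nhdsWithin, hle1] with e he he1
  have he : 0 < e := he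
  have hcd : ContDiff ℝ 4 (fun y => chi δ ρ y * bub e x y) :=
    (chi_contDiff (k := 4) δ ρ).mul (bub_contDiff (k := 4) he x)
  have hcs : HasCompactSupport (fun y => chi δ ρ y * bub e x y) := (chi_cs hδ hρ).mul_right
  have hts : tsupport (fun y => chi δ ρ y * bub e x y) ⊆ {0}ᶜ := (tsupport_mul_subset_left).trans hchis
  have hbl : Continuous (bilap (fun y => chi δ ρ y * bub e x y)) := by
    rw [← continuousOn_univ]; exact bilap_C0 isOpen_univ hcd.contDiffOn
  have hblb : Continuous (bilap (bub e x)) := by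
    rw [← continuousOn_univ]; exact bilap_C0 isOpen_univ (bub_contDiff (k := 4) he x).contDiffOn
  have htb : tsupport (bilap (fun y => chi δ ρ y * bub e x y)) ⊆ tsupport (fun y => chi δ ρ y * bub e x y) :=
    (lap_tsupport _).trans (lap_tsupport _)
  rw [ibp_bilap hO hcd hcs hts hψ]
  have j1 : Integrable (fun y => bilap (fun y => chi δ ρ y * bub e x y) y * ψ y) :=
    int_prod hbl (hcs.of_isClosed_subset (isClosed_tsupport _) htb) (htb.trans hts) hψc
  have j2 : Integrable (fun y => chi δ ρ y * ψ y * bilap (bub e x) y) :=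
    int_prod hg hgc (Set.subset_univ _) hblb.continuousOn
  rw [← integral_sub j1 j2]
  have k1 : Integrable ({y : EE n | δ ≤ ‖y‖ ∧ ‖y‖ ≤ 2*δ}.indicator (fun y => C * (δ^4)⁻¹ * |ψ y|)) := by
    rw [integrable_indicator_iff hA1]; exact iA1.const_mul _
  have k2 : Integrable ({y : EE n | ρ ≤ ‖y‖ ∧ ‖y‖ ≤ 2*ρ}.indicator (fun y => C * (ρ^n)⁻¹ * |ψ y|)) := by
    rw [integrable_indicator_iff hA2]; exact iA2.const_mul _
  have hfin := norm_integral_le_of_norm_le (k1.add k2) (f := fun y => bilap (fun y => chi δ ρ y * bub e x y) y * ψ y - chi δ ρ y * ψ y * bilap (bub e x) y)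
    (by
      filter_upwards with y
      rw [show bilap (fun y => chi δ ρ y * bub e x y) y * ψ y - chi δ ρ y * ψ y * bilap (bub e x) y =
        (bilap (fun y => chi δ ρ y * bub e x y) y - chi δ ρ y * bilap (bub e x) y) * ψ y by ring,
        Real.norm_eq_abs, abs_mul]
      refine (mul_le_mul_of_nonneg_right (hb δ ρ e hδ hδx hρ1 hρx he he1 y) (abs_nonneg _)).trans ?_
      rw [add_mul]
      apply le_of_eq
      simp only [Pi.add_apply, Set.indicator_apply]
      split_ifs <;> ring)
  refine hfin.trans (le_of_eq ?_)
  rw [integral_add' k1 k2, integral_indicator hA1, integral_indicator hA2, integral_const_mul, integral_const_mul]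
  ring

/-- integral representation -/
lemma rep {n : ℕ} (hn : 5 ≤ n) {x : EE n} (hx : x ≠ 0) {ψ : EE n → ℝ} (hψ : ContDiffOn ℝ 4 ψ {0}ᶜ)
    (hIntg : Integrable (fun y => rk (x - y) * bilap ψ y))
    (h1 : Tendsto (fun δ : ℝ => (δ^4)⁻¹ * ∫ y in {y : EE n | δ ≤ ‖y‖ ∧ ‖y‖ ≤ 2*δ}, |ψ y|) (𝓝[>] 0) (𝓝 0))
    (h2 : Tendsto (fun ρ : ℝ => (ρ^n)⁻¹ * ∫ y in {y : EE n | ρ ≤ ‖y‖ ∧ ‖y‖ ≤ 2*ρ}, |ψ y|) atTop (𝓝 0)) :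
    c0 n * ψ x = ∫ y, rk (x - y) * bilap ψ y := by
  obtain ⟨C, hC, h⟩ := rep_approx hn hx hψ hIntg
  have hx0 : 0 < ‖x‖ := norm_pos_iff.2 hx
  have t0 : Tendsto (fun ρ : ℝ => ρ⁻¹) atTop (𝓝[>] 0) := tendsto_inv_atTop_nhdsGT_zero
  have t1 := (((h1.comp t0).const_mul C).add (h2.const_mul C))
  simp only [mul_zero, add_zero] at t1
  have t2 : Tendsto (fun ρ : ℝ => (∫ y, chi ρ⁻¹ ρ y * (rk (x - y) * bilap ψ y)) - c0 n * ψ x) atTop (𝓝 0) := by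
    apply squeeze_zero_norm' _ t1
    filter_upwards [eventually_ge_atTop 1, eventually_ge_atTop (2*‖x‖), eventually_ge_atTop (4/‖x‖)] with ρ a b c
    have hρ : 0 < ρ := by linarith
    apply h ρ⁻¹ ρ (by positivity) _ a b
    rw [div_le_iff₀ hx0] at c
    rw [inv_le_iff_one_le_mul₀ hρ]; linarith
  have t3 : Tendsto (fun ρ : ℝ => ∫ y, chi ρ⁻¹ ρ y * (rk (x - y) * bilap ψ y)) atTop
      (𝓝 (∫ y, rk (x - y) * bilap ψ y)) := by
    apply tendsto_integral_filter_of_dominated_convergence (fun y => |rk (x - y) * bilap ψ y|)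
    · filter_upwards with ρ
      exact (chi_contDiff (k := 4) _ _).continuous.aestronglyMeasurable.mul hIntg.aestronglyMeasurable
    · filter_upwards with ρ
      filter_upwards with y
      rw [Real.norm_eq_abs, abs_mul, abs_of_nonneg (chi_nonneg _ _ _)]
      calc _ ≤ 1 * |rk (x - y) * bilap ψ y| := by gcongr; exact chi_le_one _ _ _
        _ = _ := one_mul _
    · exact hIntg.abs
    · filter_upwards [ae_ne hn 0] with y hy
      have hy0 : 0 < ‖y‖ := norm_pos_iff.2 hy
      apply tendsto_const_nhds.congr'
      filter_upwards [eventually_gt_atTop ‖y‖, eventually_gt_atTop (2/‖y‖)] with ρ a b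
      have hρ : 0 < ρ := by linarith
      rw [chi_eq_one (by positivity) hρ _ a, one_mul]
      rw [div_lt_iff₀ hy0] at b
      rw [← div_eq_mul_inv, div_lt_iff₀ hρ]; linarith
  have := tendsto_nhds_unique t2 (t3.sub_const _)
  linarith

lemma maxpow_deriv (k : ℕ) (hk : 2 ≤ k) (t : ℝ) :
    HasDerivAt (fun t : ℝ => (max t 0)^k) (k * (max t 0)^(k-1)) t := by
  rcases lt_trichotomy t 0 with h | h | h
  · have e : (fun t : ℝ => (max t 0)^k) =ᶠ[𝓝 t] fun _ => 0 := by
      filter_upwards [eventually_lt_nhds h] with r hr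
      rw [max_eq_right hr.le, zero_pow (by omega)]
    rw [max_eq_right h.le, zero_pow (by omega), mul_zero]
    exact (hasDerivAt_const t (0:ℝ)).congr_of_eventuallyEq e
  · subst h
    simp only [max_self]
    rw [zero_pow (by omega), mul_zero]
    rw [hasDerivAt_iff_isLittleO_nhds_zero]
    simp only [zero_add, max_self, smul_zero, sub_zero]
    rw [zero_pow (by omega)]
    simp only [sub_zero]
    have h2 : (fun h : ℝ => (max h 0)^k) =O[𝓝 0] fun h => h^2 := by
      apply Asymptotics.IsBigO.of_bound 1
      filter_upwards [eventually_abs_sub_lt (0:ℝ) one_pos] with h hh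
      have h1 : max h 0 ≤ |h| := max_le (le_abs_self _) (abs_nonneg _)
      have h0 : 0 ≤ max h 0 := le_max_right _ _
      simp only [Real.norm_eq_abs, sub_zero, one_mul] at *
      rw [abs_pow, abs_pow, abs_of_nonneg h0]
      calc max h 0 ^ k ≤ |h|^k := by gcongr
        _ ≤ |h|^2 := pow_le_pow_of_le_one (abs_nonneg _) hh.le hk
    have h3 : (fun h : ℝ => h^2) =o[𝓝 0] fun h => h := by
      have := Asymptotics.isLittleO_pow_id (𝕜 := ℝ) (n := 2) (by norm_num)
      simpa using this
    exact h2.trans_isLittleO h3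
  · have e : (fun t : ℝ => (max t 0)^k) =ᶠ[𝓝 t] fun t => t^k := by
      filter_upwards [eventually_gt_nhds h] with r hr
      rw [max_eq_left hr.le]
    rw [max_eq_left h.le]
    exact (hasDerivAt_pow k t).congr_of_eventuallyEq e

lemma maxpow_C2 : ContDiff ℝ 2 (fun t : ℝ => (max t 0)^3) := by
  rw [show (2:WithTop ℕ∞) = 1 + 1 by norm_num, contDiff_succ_iff_deriv]
  have d1 : deriv (fun t : ℝ => (max t 0)^3) = fun t => 3 * (max t 0)^2 := by
    ext t; exact_mod_cast (maxpow_deriv 3 (by norm_num) t).deriv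
  refine ⟨fun t => (maxpow_deriv 3 (by norm_num) t).differentiableAt, by simp, ?_⟩
  rw [d1]
  apply ContDiff.mul contDiff_const
  rw [contDiff_one_iff_deriv]
  refine ⟨fun t => (maxpow_deriv 2 (by norm_num) t).differentiableAt, ?_⟩
  have d2 : deriv (fun t : ℝ => (max t 0)^2) = fun t => 2 * (max t 0)^1 := by
    ext t; exact_mod_cast (maxpow_deriv 2 (by norm_num) t).deriv
  rw [d2]; fun_prop

/-- inner cut-off, subharmonic -/
noncomputable def icut {n : ℕ} (τ : ℝ) (y : EE n) : ℝ := (max (1 - τ / ‖y‖^2) 0)^3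

lemma icut_lap {n : ℕ} (hn : 5 ≤ n) {τ : ℝ} (hτ : 0 ≤ τ) {y : EE n} (hy : y ≠ 0) : 0 ≤ lap (icut τ) y := by
  have hq : 0 < ‖y‖^2 := by have := norm_pos_iff.2 hy; positivity
  have hn4 := n4pos hn
  have dv : ∀ r : ℝ, r ≠ 0 → HasDerivAt (fun r => 1 - τ / r) (τ / r^2) r := by
    intro r hr
    have := ((hasDerivAt_const r τ).div (hasDerivAt_id r) hr).const_sub 1
    exact this.congr_deriv (by simp; ring)
  have e1 : ∀ r : ℝ, r ≠ 0 → HasDerivAt (fun r => (max (1 - τ / r) 0)^3) (3 * (max (1 - τ / r) 0)^2 * (τ/r^2)) r := by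
    intro r hr
    have := (maxpow_deriv 3 (by norm_num) (1 - τ/r)).comp r (dv r hr)
    exact this.congr_deriv (by norm_num)
  have e2 : HasDerivAt (fun r => 3 * (max (1 - τ / r) 0)^2 * (τ/r^2))
      (3 * (2 * (max (1 - τ / ‖y‖^2) 0)* (τ/(‖y‖^2)^2)) * (τ/(‖y‖^2)^2) +
       3 * (max (1 - τ / ‖y‖^2) 0)^2 * (-2*τ/(‖y‖^2)^3)) (‖y‖^2) := by
    have h2 := ((maxpow_deriv 2 (by norm_num) (1 - τ/‖y‖^2)).comp (‖y‖^2) (dv (‖y‖^2) hq.ne')).const_mul 3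
    have h3 := (hasDerivAt_const (‖y‖^2) τ).div (hasDerivAt_pow 2 (‖y‖^2)) (by positivity)
    refine (h2.mul h3).congr_deriv ?_
    have : ‖y‖ ≠ 0 := norm_ne_zero_iff.2 hy
    simp only [Function.comp, Pi.div_apply]
    generalize max (1 - τ / ‖y‖^2) 0 = m
    push_cast
    field_simp
    ring
  have := lap_rad (n := n) (a := 0) (x := y) (G := fun r => (max (1 - τ / r) 0)^3)
    (by rw [sub_zero]; filter_upwards [eventually_ne_nhds hq.ne'] with r hr using e1 r hr) (by rw [sub_zero]; exact e2)
  simp only [sub_zero] at this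
  unfold icut
  rw [this]
  set q := ‖y‖^2
  set m := max (1 - τ / q) 0
  have hm : 0 ≤ m := le_max_right _ _
  have : 4 * q * (3 * (2 * m * (τ / q ^ 2)) * (τ / q ^ 2) + 3 * m ^ 2 * (-2 * τ / q ^ 3)) +
    2 * ↑n * (3 * m ^ 2 * (τ / q ^ 2)) = 24 * m * τ^2/q^3 + 6 * (n-4) * m^2 * τ / q^2 := by
    field_simp; ring
  rw [this]; positivity

noncomputable def ocut {n : ℕ} (ρ : ℝ) (y : EE n) : ℝ := 1 - cutI (ρ⁻¹ • y)

lemma ocut_contDiff {n : ℕ} {k : ℕ∞} (ρ : ℝ) : ContDiff ℝ k (ocut (n := n) ρ) := by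
  unfold ocut
  exact contDiff_const.sub (cutI_contDiff.comp (by fun_prop))

lemma ocut_one_near {n : ℕ} {ρ : ℝ} (hρ : 0 < ρ) {y : EE n} (h : ‖y‖ < ρ) : ocut ρ =ᶠ[𝓝 y] fun _ => 1 := by
  filter_upwards [cutI_eq_zero_near hρ h] with z hz
  simp [ocut, hz]
lemma ocut_zero_near {n : ℕ} {ρ : ℝ} (hρ : 0 < ρ) {y : EE n} (h : 2*ρ < ‖y‖) : ocut ρ =ᶠ[𝓝 y] fun _ => 0 := by
  filter_upwards [cutI_eq_one_near hρ h] with z hz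
  simp [ocut, hz]
lemma ocut_nonneg {n : ℕ} (ρ : ℝ) (y : EE n) : 0 ≤ ocut ρ y := by
  unfold ocut; linarith [cutI_le_one (ρ⁻¹ • y)]
lemma ocut_le_one {n : ℕ} (ρ : ℝ) (y : EE n) : ocut ρ y ≤ 1 := by
  unfold ocut; linarith [cutI_nonneg (ρ⁻¹ • y)]
lemma ocut_tsupport {n : ℕ} {ρ : ℝ} (hρ : 0 < ρ) : tsupport (ocut (n := n) ρ) ⊆ closedBall 0 (2*ρ) := by
  apply closure_minimal _ isClosed_closedBall
  intro y hy
  by_contra h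
  simp at h
  exact hy (ocut_zero_near hρ h).eq_of_nhds

lemma icut_zero_near {n : ℕ} {τ : ℝ} (hτ : 0 < τ) {y : EE n} (hy : ‖y‖^2 < τ) (y0 : y ≠ 0) : icut τ =ᶠ[𝓝 y] fun _ => 0 := by
  have : ∀ᶠ z in 𝓝 y, ‖z‖^2 < τ := (by fun_prop : Continuous fun z : EE n => ‖z‖^2).continuousAt.eventually_lt_const hy
  filter_upwards [this, eventually_ne_nhds y0] with z hz z0
  have : 0 < ‖z‖^2 := by have := norm_pos_iff.2 z0; positivity
  have : 1 < τ / ‖z‖^2 := by rw [lt_div_iff₀ this]; linarith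
  simp [icut, max_eq_right (show 1 - τ/‖z‖^2 ≤ 0 by linarith)]

/-- the test function -/
noncomputable def tf {n : ℕ} (ρ τ : ℝ) (y : EE n) : ℝ := if y = 0 then 0 else ocut ρ y * icut τ y

lemma tf_ev {n : ℕ} (ρ τ : ℝ) {y : EE n} (y0 : y ≠ 0) : tf ρ τ =ᶠ[𝓝 y] fun y => ocut ρ y * icut τ y := by
  filter_upwards [eventually_ne_nhds y0] with z z0
  simp [tf, z0]

lemma tf_zero {n : ℕ} {ρ τ : ℝ} (hτ : 0 < τ) {y : EE n} (hy : ‖y‖^2 < τ) : tf ρ τ y = 0 := by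
  by_cases h : y = 0
  · simp [tf, h]
  · rw [(tf_ev ρ τ h).eq_of_nhds, (icut_zero_near hτ hy h).eq_of_nhds, mul_zero]

lemma tf_zero_near {n : ℕ} {ρ τ : ℝ} (hτ : 0 < τ) : tf (n := n) ρ τ =ᶠ[𝓝 0] fun _ => 0 := by
  have : ∀ᶠ z in 𝓝 (0 : EE n), ‖z‖^2 < τ :=
    (by fun_prop : Continuous fun z : EE n => ‖z‖^2).continuousAt.eventually_lt_const (by simpa using hτ)
  filter_upwards [this] with z hz using tf_zero hτ hz

lemma icutJ {n : ℕ} (ρ : ℝ) : ContDiffOn ℝ 2 (fun z : ℝ × EE n => ocut ρ z.2 * icut z.1 z.2) {z | z.2 ≠ 0} := by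
  apply ContDiffOn.mul
  · exact ((ocut_contDiff (k := 2) ρ).comp contDiff_snd).contDiffOn
  · unfold icut
    apply maxpow_C2.comp_contDiffOn (f := fun z : ℝ × EE n => 1 - z.1/‖z.2‖^2)
    apply contDiffOn_const.sub
    apply ContDiffOn.div contDiff_fst.contDiffOn
    · exact (contDiff_snd.norm_sq ℝ).contDiffOn
    · intro z hz; have := norm_pos_iff.2 (show z.2 ≠ 0 from hz); positivity

lemma tf_C2 {n : ℕ} {ρ τ : ℝ} (hτ : 0 < τ) : ContDiff ℝ 2 (tf (n := n) ρ τ) := by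
  rw [contDiff_iff_contDiffAt]
  intro y
  by_cases h : y = 0
  · rw [h]; exact contDiffAt_const.congr_of_eventuallyEq (tf_zero_near hτ)
  · refine ContDiffAt.congr_of_eventuallyEq ?_ (tf_ev ρ τ h)
    have h1 : ContDiffAt ℝ 2 (fun z : ℝ × EE n => ocut ρ z.2 * icut z.1 z.2) (τ, y) :=
      (icutJ ρ).contDiffAt ((isOpen_ne.preimage continuous_snd).mem_nhds h)
    exact h1.comp y (contDiffAt_const.prodMk contDiffAt_id)

lemma tf_tsupport {n : ℕ} {ρ τ : ℝ} (hρ : 0 < ρ) (hτ : 0 < τ) :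
    tsupport (tf (n := n) ρ τ) ⊆ closedBall 0 (2*ρ) \ {0} := by
  intro y hy
  constructor
  · apply ocut_tsupport hρ
    refine closure_mono ?_ hy
    intro z hz
    by_cases h : z = 0
    · simp [tf, h] at hz
    · simp only [Function.mem_support, tf, h, if_false] at hz
      exact left_ne_zero_of_mul hz
  · intro h0
    rw [Set.mem_singleton_iff] at h0
    subst h0
    exact (notMem_tsupport_iff_eventuallyEq.2 (tf_zero_near hτ)) hy

lemma tf_nonneg {n : ℕ} {ρ τ : ℝ} (y : EE n) : 0 ≤ tf ρ τ y := by
  unfold tf; split_ifs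
  · exact le_rfl
  · exact mul_nonneg (ocut_nonneg _ _) (by unfold icut; positivity)

/-- integrability of `bilap u` -/
lemma bilap_int {n : ℕ} (hn : 5 ≤ n) {R ρ : ℝ} (hρ : 0 < ρ) (hρR : 2*ρ < R) {u : EE n → ℝ}
    (hu : ContDiffOn ℝ 4 u (ball 0 R \ {0})) (hsup : ∀ x ∈ ball (0 : EE n) R \ {0}, 0 < - lap u x)
    (hpos : ∀ x ∈ ball (0 : EE n) R \ {0}, 0 ≤ bilap u x) : IntegrableOn (bilap u) (ball 0 ρ) := by
  have hΩ : IsOpen (ball (0 : EE n) R \ {0}) := isOpen_ball.sdiff isClosed_singleton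
  set A := {y : EE n | ρ ≤ ‖y‖ ∧ ‖y‖ ≤ 2*ρ} with hA
  have hAm : MeasurableSet A := (annulus_compact _ _).measurableSet
  have hK : IsCompact ((Set.Icc (0:ℝ) 1) ×ˢ A) := isCompact_Icc.prod (annulus_compact _ _)
  obtain ⟨C, hC, hb⟩ := lap_section_bound (isOpen_ne.preimage continuous_snd : IsOpen {z : ℝ × EE n | z.2 ≠ 0}) (icutJ ρ) hK (by
    rintro ⟨t, y⟩ ⟨_, h1, _⟩ h0
    simp only at h0 h1
    rw [h0, norm_zero] at h1; linarith)
  have hAΩ : A ⊆ ball 0 R \ {0} := by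
    rintro y ⟨h1, h2⟩
    refine ⟨by simp; linarith, ?_⟩
    rintro rfl
    simp at h1; linarith
  have hlc : ContinuousOn (lap u) (ball 0 R \ {0}) := (lap_C2 hΩ hu).continuousOn
  have iA : IntegrableOn (fun y => C * |lap u y|) A :=
    ((hlc.mono hAΩ).abs.integrableOn_compact (annulus_compact _ _)).const_mul C
  set M := ∫ y in A, C * |lap u y|
  have key : ∀ τ : ℝ, 0 < τ → τ ≤ 1 → ∫ y, tf ρ τ y * bilap u y ≤ M := by
    intro τ hτ hτ1
    have hts : tsupport (tf (n := n) ρ τ) ⊆ ball 0 R \ {0} := by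
      refine (tf_tsupport hρ hτ).trans ?_
      exact Set.diff_subset_diff_left (closedBall_subset_ball hρR)
    have hcs : HasCompactSupport (tf (n := n) ρ τ) :=
      (isCompact_closedBall (0 : EE n) (2*ρ)).of_isClosed_subset (isClosed_tsupport _)
        ((tf_tsupport hρ hτ).trans Set.diff_subset)
    unfold bilap
    rw [ibp_lap hΩ (tf_C2 hτ) hcs hts (lap_C2 hΩ hu)]
    rw [show M = ∫ y, A.indicator (fun y => C * |lap u y|) y from (integral_indicator hAm).symm]
    apply integral_mono
    · apply int_prod _ _ ((lap_tsupport _).trans hts) hlc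
      · rw [← continuousOn_univ]; exact lap_C0 isOpen_univ (tf_C2 hτ).contDiffOn
      · exact hcs.of_isClosed_subset (isClosed_tsupport _) (lap_tsupport _)
    · rw [integrable_indicator_iff hAm]; exact iA
    · intro y
      simp only
      by_cases hy : y ∈ tsupport (tf ρ τ)
      swap
      · have : lap (tf ρ τ) y = 0 := by
          by_contra h
          exact hy (lap_tsupport _ (subset_tsupport _ h))
        rw [this, zero_mul]
        apply Set.indicator_nonneg; intro _ _; positivity
      have y0 : y ≠ 0 := (hts hy).2
      have hy2 := (tf_tsupport hρ hτ hy).1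
      rw [mem_closedBall_zero_iff] at hy2
      have hl := hsup y (hts hy)
      by_cases hyρ : ‖y‖ < ρ
      · have e1 : tf ρ τ =ᶠ[𝓝 y] icut τ := by
          filter_upwards [tf_ev ρ τ y0, ocut_one_near hρ hyρ] with z h1 h2
          rw [h1, h2, one_mul]
        rw [(lap_congr e1).eq_of_nhds]
        have := icut_lap hn hτ.le y0
        have hnot : y ∉ A := fun h => absurd h.1 (by linarith)
        rw [Set.indicator_of_notMem hnot]
        nlinarith
      · have hyA : y ∈ A := ⟨by linarith, hy2⟩
        rw [Set.indicator_of_mem hyA, (lap_congr (tf_ev ρ τ y0)).eq_of_nhds]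
        have := hb τ y ⟨⟨hτ.le, hτ1⟩, hyA⟩
        calc _ ≤ _ := le_abs_self _
          _ = |lap (fun y => ocut ρ y * icut τ y) y| * |lap u y| := abs_mul _ _
          _ ≤ _ := by gcongr
  -- pass to the limit
  have hbc := bilap_C0 hΩ hu
  have mem : ∀ y : EE n, y ≠ 0 → ‖y‖ < ρ → y ∈ ball (0 : EE n) R \ {0} := fun y h0 h1 => ⟨by simp; linarith, h0⟩
  have hcov : AECover (volume.restrict (ball (0 : EE n) ρ)) (atTop : Filter ℕ) (fun k => {y : EE n | 1/((k:ℝ)+1) ≤ ‖y‖}) := by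
    refine ⟨?_, fun e => meas_le_norm _⟩
    refine ae_restrict_of_ae ?_
    filter_upwards [ae_ne hn 0] with y hy
    exact tendsto_one_div_add_atTop_nhds_zero_nat.eventually (eventually_le_nhds (norm_pos_iff.2 hy))
  have hIntg : ∀ e : ℝ, 0 < e → IntegrableOn (bilap u) ({y : EE n | e ≤ ‖y‖} ∩ ball 0 ρ) := by
    intro e he
    apply IntegrableOn.mono_set (t := {y : EE n | e ≤ ‖y‖ ∧ ‖y‖ ≤ ρ})
    · apply (hbc.mono _).integrableOn_compact (annulus_compact _ _)
      rintro y ⟨h1, h2⟩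
      exact ⟨by simp; linarith, by rintro rfl; simp at h1; linarith⟩
    · rintro y ⟨h1, h2⟩
      exact ⟨h1, by simp at h2; exact h2.le⟩
  have ae_pos : ∀ᵐ y ∂(volume.restrict (ball (0 : EE n) ρ)), 0 ≤ bilap u y := by
    rw [ae_restrict_iff' measurableSet_ball]
    filter_upwards [ae_ne hn 0] with y hy hyb
    exact hpos y (mem y hy (by simpa using hyb))
  have hfin : ∀ e : ℝ, 0 < e → e ≤ 1 → ∫ y in {y : EE n | e ≤ ‖y‖} ∩ ball 0 ρ, bilap u y ≤ 8 * M := by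
    intro e he he1
    have hτ : 0 < e^2/2 := by positivity
    have hS : MeasurableSet ({y : EE n | e ≤ ‖y‖} ∩ ball 0 ρ) := (meas_le_norm e).inter measurableSet_ball
    have hk := key (e^2/2) hτ (by nlinarith)
    have hts : tsupport (tf (n := n) ρ (e^2/2)) ⊆ ball 0 R \ {0} := by
      refine (tf_tsupport hρ hτ).trans ?_
      exact Set.diff_subset_diff_left (closedBall_subset_ball hρR)
    have hcs : HasCompactSupport (tf (n := n) ρ (e^2/2)) :=
      (isCompact_closedBall (0 : EE n) (2*ρ)).of_isClosed_subset (isClosed_tsupport _)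
        ((tf_tsupport hρ hτ).trans Set.diff_subset)
    have hi := int_prod (tf_C2 hτ).continuous hcs hts hbc
    rw [← integral_indicator hS]
    calc _ ≤ ∫ y, 8 * (tf ρ (e^2/2) y * bilap u y) := by
          apply integral_mono _ (hi.const_mul 8)
          · intro y
            by_cases hy : y ∈ {y : EE n | e ≤ ‖y‖} ∩ ball 0 ρ
            · simp only
              rw [Set.indicator_of_mem hy]
              have h1 : e ≤ ‖y‖ := hy.1
              have h2 : ‖y‖ < ρ := by simpa using hy.2
              have y0 : y ≠ 0 := by rintro rfl; simp at h1; linarith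
              have hp := hpos y (mem y y0 h2)
              have : 1/8 ≤ tf ρ (e^2/2) y := by
                rw [(tf_ev _ _ y0).eq_of_nhds, (ocut_one_near hρ h2).eq_of_nhds, one_mul]
                unfold icut
                have : 1/2 ≤ max (1 - e^2/2/‖y‖^2) 0 := by
                  apply le_max_of_le_left
                  have : e^2/2/‖y‖^2 ≤ 1/2 := by
                    rw [div_le_iff₀ (by positivity)]; nlinarith
                  linarith
                calc (1:ℝ)/8 = (1/2)^3 := by norm_num
                  _ ≤ _ := by gcongr
              nlinarith
            · simp only
              rw [Set.indicator_of_notMem hy]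
              by_cases hy' : y ∈ tsupport (tf ρ (e^2/2))
              · have := hpos y (hts hy')
                have := tf_nonneg (ρ := ρ) (τ := e^2/2) y
                positivity
              · rw [image_eq_zero_of_notMem_tsupport hy']; simp
          · rw [integrable_indicator_iff hS]; exact hIntg e he
      _ ≤ 8 * M := by rw [integral_const_mul]; linarith
  apply hcov.integrable_of_integral_bounded_of_nonneg_ae (I := 8*M)
  · intro k
    rw [IntegrableOn, Measure.restrict_restrict (meas_le_norm _)]
    exact hIntg _ (by positivity)
  · exact ae_pos
  · filter_upwards with k
    rw [Measure.restrict_restrict (meas_le_norm _)]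
    refine hfin _ (by positivity) ?_
    rw [div_le_one (by positivity)]; linarith [Nat.cast_nonneg (α := ℝ) k]

lemma pot_int {n : ℕ} (hn : 5 ≤ n) {F : EE n → ℝ} (hF : Integrable F) {x : EE n} {t M : ℝ} (ht : 0 < t)
    (hb : ∀ y ∈ ball x t, |F y| ≤ M) : Integrable (fun y => rk (x - y) * F y) := by
  have hm : AEStronglyMeasurable (fun y => rk (x - y) * F y) volume :=
    (rk_meas.comp (measurable_const.sub measurable_id)).aestronglyMeasurable.mul hF.aestronglyMeasurable
  rw [← integrableOn_univ, ← Set.union_compl_self (ball x t)]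
  apply IntegrableOn.union
  · apply Integrable.mono' ((rk_int_ball hn x t).const_mul M) hm.restrict
    rw [ae_restrict_iff' measurableSet_ball]
    filter_upwards with y hy
    rw [Real.norm_eq_abs, abs_mul, abs_of_nonneg (rk_nonneg _), mul_comm]
    exact mul_le_mul_of_nonneg_right (hb y hy) (rk_nonneg _)
  · apply Integrable.mono' ((hF.abs.const_mul (t ^ ((4:ℝ)-n))).integrableOn) hm.restrict
    rw [ae_restrict_iff' measurableSet_ball.compl]
    filter_upwards with y hy
    rw [Real.norm_eq_abs, abs_mul, abs_of_nonneg (rk_nonneg _)]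
    gcongr
    apply rk_le hn ht
    simp [dist_eq_norm] at hy
    rwa [norm_sub_rev]

lemma vol_closedBall {n : ℕ} (hn : 5 ≤ n) {r : ℝ} (hr : 0 < r) :
    volume.real (closedBall (0 : EE n) r) = r^n * volume.real (closedBall (0 : EE n) 1) := by
  haveI := EE_nontrivial hn
  have := Measure.addHaar_real_closedBall' (volume : Measure (EE n)) 0 hr.le
  rw [this]
  simp

/-- the inner decay condition from integrability -/
lemma inner_decay {n : ℕ} (hn : 5 ≤ n) {s : ℝ} (hs : (n:ℝ)/(n-4) < s) {ρ : ℝ} (hρ : 0 < ρ) {u f : EE n → ℝ}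
    (hc : ContinuousOn u {y | y ≠ 0 ∧ ‖y‖ < ρ})
    (hf : IntegrableOn f (ball 0 ρ)) (hu : ∀ y ≠ 0, ‖y‖ < ρ → 0 ≤ u y) (huf : ∀ y ≠ 0, ‖y‖ < ρ → u y ^ s ≤ f y) :
    Tendsto (fun δ : ℝ => (δ^4)⁻¹ * ∫ y in {y : EE n | δ ≤ ‖y‖ ∧ ‖y‖ ≤ 2*δ}, |u y|) (𝓝[>] 0) (𝓝 0) := by
  have hn4 := n4pos hn
  have hs1 : 1 < s := by
    refine lt_trans ?_ hs
    rw [lt_div_iff₀ hn4]; linarith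
  have hs0 : 0 < s - 1 := by linarith
  set κ : ℝ := n - 4*s/(s-1) with hκ
  have hκ0 : 0 < κ := by
    rw [hκ, sub_pos, div_lt_iff₀ hs0]
    rw [div_lt_iff₀ hn4] at hs; nlinarith
  set v := volume.real (closedBall (0 : EE n) 1) with hv
  have t1 : Tendsto (fun δ : ℝ => ∫ y in {y : EE n | δ ≤ ‖y‖ ∧ ‖y‖ ≤ 2*δ}, |f y|) (𝓝[>] 0) (𝓝 0) := by
    have e : ∀ᶠ δ : ℝ in 𝓝[>] 0, ∫ y in ball (0 : EE n) ρ, {y : EE n | δ ≤ ‖y‖ ∧ ‖y‖ ≤ 2*δ}.indicator (fun y => |f y|) y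
        = ∫ y in {y : EE n | δ ≤ ‖y‖ ∧ ‖y‖ ≤ 2*δ}, |f y| := by
      filter_upwards [(eventually_lt_nhds (show (0:ℝ) < ρ/2 by positivity)).filter_mono nhdsWithin_le_nhds] with δ hδ
      rw [setIntegral_indicator (annulus_compact _ _).measurableSet]
      congr 2
      rw [Set.inter_eq_right]
      rintro y ⟨_, h⟩
      simp; linarith
    apply Tendsto.congr' e
    have e0 : (0:ℝ) = ∫ y in ball (0 : EE n) ρ, (0:ℝ) := by simp
    suffices hh : Tendsto (fun δ : ℝ => ∫ y in ball (0 : EE n) ρ, {y : EE n | δ ≤ ‖y‖ ∧ ‖y‖ ≤ 2*δ}.indicator (fun y => |f y|) y) (𝓝[>] 0) (𝓝 (∫ y in ball (0 : EE n) ρ, (0:ℝ))) by rwa [← e0] at hh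
    apply tendsto_integral_filter_of_dominated_convergence (fun y => |f y|)
    · filter_upwards with δ
      exact hf.abs.aestronglyMeasurable.indicator (annulus_compact _ _).measurableSet
    · filter_upwards with δ
      filter_upwards with y
      refine (norm_indicator_le_norm_self _ _).trans ?_
      simp
    · exact hf.abs
    · apply ae_restrict_of_ae
      filter_upwards [ae_ne hn 0] with y hy
      apply tendsto_const_nhds.congr'
      have hy0 := norm_pos_iff.2 hy
      filter_upwards [(eventually_lt_nhds (show (0:ℝ) < ‖y‖/2 by positivity)).filter_mono nhdsWithin_le_nhds] with δ hδ
      rw [Set.indicator_of_notMem]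
      rintro ⟨_, h⟩
      linarith
  have t2 : Tendsto (fun δ : ℝ => 2^n * v * δ ^ κ) (𝓝[>] 0) (𝓝 0) := by
    have : Tendsto (fun δ : ℝ => δ ^ κ) (𝓝 0) (𝓝 (0 ^ κ)) := (Real.continuousAt_rpow_const 0 κ (Or.inr hκ0.le)).tendsto
    rw [Real.zero_rpow hκ0.ne'] at this
    simpa using (this.const_mul (2^n * v)).mono_left nhdsWithin_le_nhds
  have t3 := t1.add t2
  rw [add_zero] at t3
  apply squeeze_zero' _ _ t3
  · filter_upwards [self_mem_nhdsWithin] with δ hδ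
    have : (0:ℝ) < δ := hδ
    positivity
  · filter_upwards [self_mem_nhdsWithin, (eventually_lt_nhds (show (0:ℝ) < ρ/2 by positivity)).filter_mono nhdsWithin_le_nhds] with δ hδ hδρ
    have hδ : 0 < δ := hδ
    have hAm : MeasurableSet {y : EE n | δ ≤ ‖y‖ ∧ ‖y‖ ≤ 2*δ} := (annulus_compact _ _).measurableSet
    have hAb : {y : EE n | δ ≤ ‖y‖ ∧ ‖y‖ ≤ 2*δ} ⊆ closedBall 0 (2*δ) := fun y hy => by simpa using hy.2
    have hAρ : ∀ y ∈ {y : EE n | δ ≤ ‖y‖ ∧ ‖y‖ ≤ 2*δ}, y ≠ 0 ∧ ‖y‖ < ρ := by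
      rintro y ⟨h1, h2⟩
      exact ⟨by rintro rfl; simp at h1; linarith, by linarith⟩
    have hfA : IntegrableOn (fun y => |f y|) {y : EE n | δ ≤ ‖y‖ ∧ ‖y‖ ≤ 2*δ} := by
      apply IntegrableOn.mono_set hf.abs
      intro y hy; simpa using (hAρ y hy).2
    have hfin : volume {y : EE n | δ ≤ ‖y‖ ∧ ‖y‖ ≤ 2*δ} ≠ ⊤ := (annulus_compact _ _).measure_lt_top.ne
    rw [← integral_const_mul]
    calc _ ≤ ∫ y in {y : EE n | δ ≤ ‖y‖ ∧ ‖y‖ ≤ 2*δ}, (|f y| + δ ^ (-(4*s/(s-1)))) := by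
          apply setIntegral_mono_on
          · have h9 : IntegrableOn (fun y => |u y|) {y : EE n | δ ≤ ‖y‖ ∧ ‖y‖ ≤ 2*δ} := (hc.mono hAρ).abs.integrableOn_compact (annulus_compact _ _)
            exact Integrable.const_mul h9 _
          · exact hfA.add (integrableOn_const hfin)
          · exact hAm
          · intro y hy
            obtain ⟨y0, yρ⟩ := hAρ y hy
            have h0 := hu y y0 yρ
            have h1 := huf y y0 yρ
            rw [abs_of_nonneg h0, abs_of_nonneg ((Real.rpow_nonneg h0 _).trans h1)]
            rcases le_total ((δ^4)⁻¹) (u y ^ (s-1)) with hc | hc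
            · have : (δ^4)⁻¹ * u y ≤ u y ^ s := by
                rcases h0.eq_or_lt with h00 | h00
                · rw [← h00]; simp; positivity
                calc (δ^4)⁻¹ * u y ≤ u y ^ (s-1) * u y := by gcongr
                  _ = u y ^ s := by rw [← Real.rpow_add_one h00.ne']; ring_nf
              have : 0 ≤ δ ^ (-(4*s/(s-1))) := by positivity
              linarith
            · have hup : u y ≤ δ ^ (-(4/(s-1))) := by
                have := Real.rpow_le_rpow (by positivity) hc (show 0 ≤ 1/(s-1) by positivity)
                rw [← Real.rpow_mul h0, mul_one_div_cancel hs0.ne', Real.rpow_one] at this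
                refine this.trans (le_of_eq ?_)
                rw [← Real.rpow_natCast, ← Real.rpow_neg hδ.le, ← Real.rpow_mul hδ.le]
                congr 1; push_cast; ring
              have : (δ^4)⁻¹ * u y ≤ δ ^ (-(4*s/(s-1))) := by
                calc (δ^4)⁻¹ * u y ≤ (δ^4)⁻¹ * δ ^ (-(4/(s-1))) := by gcongr
                  _ = _ := by
                    rw [← Real.rpow_natCast, ← Real.rpow_neg hδ.le, ← Real.rpow_add hδ]
                    congr 1; push_cast; field_simp; ring
              have : 0 ≤ u y ^ s := by positivity
              linarith
      _ = (∫ y in {y : EE n | δ ≤ ‖y‖ ∧ ‖y‖ ≤ 2*δ}, |f y|) + volume.real {y : EE n | δ ≤ ‖y‖ ∧ ‖y‖ ≤ 2*δ} * δ ^ (-(4*s/(s-1))) := by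
          rw [integral_add hfA (integrableOn_const hfin)]
          simp
      _ ≤ _ := by
          refine add_le_add le_rfl ?_
          have : volume.real {y : EE n | δ ≤ ‖y‖ ∧ ‖y‖ ≤ 2*δ} ≤ (2*δ)^n * v := by
            rw [← vol_closedBall hn (by positivity)]
            exact measureReal_mono hAb (isCompact_closedBall _ _).measure_lt_top.ne
          calc _ ≤ (2*δ)^n * v * δ ^ (-(4*s/(s-1))) := by gcongr
            _ = 2^n * v * (δ ^ (n:ℝ) * δ ^ (-(4*s/(s-1)))) := by rw [mul_pow, Real.rpow_natCast]; ring
            _ = _ := by rw [← Real.rpow_add hδ]; rfl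

/-- local representation of a component -/
lemma rep_local {n : ℕ} (hn : 5 ≤ n) {s : ℝ} (hs : (n:ℝ)/(n-4) < s) {R ρ : ℝ} (hρ : 0 < ρ) (hρR : 4*ρ < R) {u : EE n → ℝ}
    (hu : ContDiffOn ℝ 4 u (ball 0 R \ {0})) (hu0 : ∀ x ∈ ball (0 : EE n) R \ {0}, 0 ≤ u x)
    (hf : IntegrableOn (bilap u) (ball 0 (2*ρ)))
    (huf : ∀ x ∈ ball (0 : EE n) R \ {0}, u x ^ s ≤ bilap u x) :
    ∃ h : EE n → ℝ, (∃ L, 0 ≤ L ∧ (∀ x ∈ ball (0 : EE n) ρ, |h x| ≤ L) ∧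
      ∀ x ∈ ball (0 : EE n) ρ, ∀ x' ∈ ball (0 : EE n) ρ, |h x - h x'| ≤ L * ‖x - x'‖) ∧
      ∀ x ∈ ball (0 : EE n) ρ, x ≠ 0 → IntegrableOn (fun z => rk (x - z) * bilap u z) (ball 0 (2*ρ)) ∧
        u x = (c0 n)⁻¹ * (∫ z in ball 0 (2*ρ), rk (x - z) * bilap u z) + h x := by
  have hΩ : IsOpen (ball (0 : EE n) R \ {0}) := isOpen_ball.sdiff isClosed_singleton
  have h2ρ : 0 < 2*ρ := by linarith
  set ψ : EE n → ℝ := fun y => ocut (2*ρ) y * u y with hψd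
  have hψ : ContDiffOn ℝ 4 ψ {0}ᶜ := by
    intro y hy
    apply ContDiffAt.contDiffWithinAt
    by_cases hyR : ‖y‖ < R
    · exact (ocut_contDiff (k := 4) _).contDiffAt.mul (hu.contDiffAt (hΩ.mem_nhds ⟨by simpa using hyR, hy⟩))
    · have : ψ =ᶠ[𝓝 y] fun _ => 0 := by
        filter_upwards [ocut_zero_near h2ρ (show 2*(2*ρ) < ‖y‖ by linarith)] with z hz
        simp [ψ, hz]
      exact contDiffAt_const.congr_of_eventuallyEq this
  have hO : IsOpen ({0}ᶜ : Set (EE n)) := isOpen_compl_singleton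
  have hbc := bilap_C0 hO hψ
  have b1 : ∀ y : EE n, ‖y‖ < 2*ρ → bilap ψ y = bilap u y := by
    intro y hy
    apply (bilap_congr _).eq_of_nhds
    filter_upwards [ocut_one_near h2ρ hy] with z hz
    simp [ψ, hz]
  have b2 : ∀ y : EE n, 4*ρ < ‖y‖ → bilap ψ y = 0 := by
    intro y hy
    rw [← bilap_zero_fun y]
    apply (bilap_congr _).eq_of_nhds
    filter_upwards [ocut_zero_near h2ρ (show 2*(2*ρ) < ‖y‖ by linarith)] with z hz
    simp [ψ, hz]
  set A := {y : EE n | 2*ρ ≤ ‖y‖ ∧ ‖y‖ ≤ 4*ρ} with hA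
  have hAc : IsCompact A := annulus_compact _ _
  have hA0 : A ⊆ {0}ᶜ := by
    rintro y ⟨h1, _⟩ rfl
    simp at h1; linarith
  have iA : IntegrableOn (bilap ψ) A := (hbc.mono hA0).integrableOn_compact hAc
  have iB : IntegrableOn (bilap ψ) (ball 0 (2*ρ)) := by
    apply hf.congr_fun _ measurableSet_ball
    intro y hy
    exact (b1 y (by simpa using hy)).symm
  have hU : ball (0 : EE n) (2*ρ) ∪ {y | 2*ρ ≤ ‖y‖} = Set.univ := by
    ext y; simp [lt_or_ge]
  have iC : IntegrableOn (bilap ψ) {y | 2*ρ ≤ ‖y‖} := by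
    apply iA.of_forall_diff_eq_zero (meas_le_norm _)
    rintro y ⟨h1, h2⟩
    apply b2
    by_contra h
    exact h2 ⟨h1, not_lt.1 h⟩
  have iAll : Integrable (bilap ψ) := by
    rw [← integrableOn_univ, ← hU]; exact iB.union iC
  have hdisj : Disjoint (ball (0 : EE n) (2*ρ)) {y | 2*ρ ≤ ‖y‖} := by
    rw [Set.disjoint_left]; intro y h1 h2
    simp at h1 h2; linarith
  have iP : ∀ x : EE n, x ≠ 0 → Integrable (fun y => rk (x - y) * bilap ψ y) := by
    intro x hx
    have hx0 := norm_pos_iff.2 hx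
    have hsub : closedBall x (‖x‖/2) ⊆ {0}ᶜ := by
      rintro y hy rfl
      simp at hy; linarith
    obtain ⟨M, hM⟩ := (isCompact_closedBall x (‖x‖/2)).exists_bound_of_continuousOn (hbc.mono hsub)
    exact pot_int hn iAll (t := ‖x‖/2) (by positivity) (fun y hy => hM y (ball_subset_closedBall hy))
  obtain ⟨MA, hMA⟩ := hAc.exists_bound_of_continuousOn (hbc.mono hA0)
  have d1 : Tendsto (fun δ : ℝ => (δ^4)⁻¹ * ∫ y in {y : EE n | δ ≤ ‖y‖ ∧ ‖y‖ ≤ 2*δ}, |ψ y|) (𝓝[>] 0) (𝓝 0) := by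
    have hin : ∀ y : EE n, y ≠ 0 → ‖y‖ < 2*ρ → y ∈ ball (0 : EE n) R \ {0} := fun y h0 h => ⟨by simp; linarith, h0⟩
    have hin2 : ∀ y : EE n, ‖y‖ < 2*ρ → ψ y = u y := by
      intro y hy; simp [ψ, (ocut_one_near h2ρ hy).eq_of_nhds]
    apply inner_decay hn hs h2ρ (u := ψ) (hψ.continuousOn.mono (fun y hy => hy.1)) hf
    · intro y h0 h1; rw [hin2 y h1]; exact hu0 y (hin y h0 h1)
    · intro y h0 h1; rw [hin2 y h1]; exact huf y (hin y h0 h1)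
  have d2 : Tendsto (fun r : ℝ => (r^n)⁻¹ * ∫ y in {y : EE n | r ≤ ‖y‖ ∧ ‖y‖ ≤ 2*r}, |ψ y|) atTop (𝓝 0) := by
    apply tendsto_const_nhds.congr'
    filter_upwards [eventually_gt_atTop (4*ρ)] with r hr
    rw [setIntegral_eq_zero_of_forall_eq_zero, mul_zero]
    rintro y ⟨h1, _⟩
    simp [ψ, (ocut_zero_near h2ρ (show 2*(2*ρ) < ‖y‖ by linarith)).eq_of_nhds]
  have hc0 := c0_pos hn
  set h : EE n → ℝ := fun x => (c0 n)⁻¹ * ∫ y in {y | 2*ρ ≤ ‖y‖}, rk (x - y) * bilap ψ y with hh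
  have iC2 : ∀ x ∈ ball (0 : EE n) ρ, IntegrableOn (fun y => rk (x - y) * bilap ψ y) {y | 2*ρ ≤ ‖y‖} := by
    intro x hx
    have hx' : ‖x‖ < ρ := by simpa using hx
    apply Integrable.mono' (iC.abs.const_mul (ρ ^ ((4:ℝ)-n)))
    · exact (rk_meas.comp (measurable_const.sub measurable_id)).aestronglyMeasurable.mul iC.aestronglyMeasurable
    · rw [ae_restrict_iff' (meas_le_norm _)]
      filter_upwards with y hy
      rw [Real.norm_eq_abs, abs_mul, abs_of_nonneg (rk_nonneg _)]
      gcongr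
      apply rk_le hn hρ
      have := norm_sub_norm_le y x
      rw [norm_sub_rev] at this
      have hy : 2*ρ ≤ ‖y‖ := hy
      linarith
  have rkb : ∀ x ∈ ball (0 : EE n) ρ, ∀ y : EE n, 2*ρ ≤ ‖y‖ → rk (x - y) ≤ ρ ^ ((4:ℝ)-n) := by
    intro x hx y hy
    have hx' : ‖x‖ < ρ := by simpa using hx
    apply rk_le hn hρ
    have := norm_sub_norm_le y x
    rw [norm_sub_rev] at this
    linarith
  set I := ∫ y in {y | 2*ρ ≤ ‖y‖}, |bilap ψ y| with hI
  have hI0 : 0 ≤ I := by positivity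
  set L1 := (c0 n)⁻¹ * (ρ ^ ((4:ℝ)-n) * I) with hL1
  set L2 := (c0 n)⁻¹ * ((n:ℝ) * 3 ^ n * ρ⁻¹ * ρ ^ ((4:ℝ)-n) * I) with hL2
  have hL10 : 0 ≤ L1 := by positivity
  have hL20 : 0 ≤ L2 := by positivity
  refine ⟨h, ⟨L1 + L2, by positivity, ?_, ?_⟩, ?_⟩
  · intro x hx
    have : |h x| ≤ L1 := by
      rw [hh]; simp only
      rw [abs_mul, abs_of_pos (inv_pos.2 hc0), hL1]
      gcongr
      rw [hI, ← integral_const_mul, ← Real.norm_eq_abs]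
      apply norm_integral_le_of_norm_le (iC.abs.const_mul _)
      rw [ae_restrict_iff' (meas_le_norm _)]
      filter_upwards with y hy
      rw [Real.norm_eq_abs, abs_mul, abs_of_nonneg (rk_nonneg _)]
      gcongr
      exact rkb x hx y hy
    linarith
  · intro x hx x' hx'
    have : |h x - h x'| ≤ L2 * ‖x - x'‖ := by
      rw [hh]; simp only
      rw [← mul_sub, abs_mul, abs_of_pos (inv_pos.2 hc0), hL2, mul_assoc]
      gcongr
      rw [← integral_sub (iC2 x hx) (iC2 x' hx')]
      rw [show (n:ℝ) * 3 ^ n * ρ⁻¹ * ρ ^ ((4:ℝ)-n) * I * ‖x - x'‖ = (n:ℝ) * 3 ^ n * ρ⁻¹ * ρ ^ ((4:ℝ)-n) * ‖x - x'‖ * I by ring]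
      rw [hI, ← integral_const_mul, ← Real.norm_eq_abs]
      apply norm_integral_le_of_norm_le (iC.abs.const_mul _)
      rw [ae_restrict_iff' (meas_le_norm _)]
      filter_upwards with y hy
      have hy : 2*ρ ≤ ‖y‖ := hy
      rw [Real.norm_eq_abs, ← sub_mul, abs_mul]
      gcongr
      refine (rk_osc hn hρ hx hx' (by simpa using hy)).trans ?_
      rw [show (n:ℝ) * 3 ^ n * (‖x - x'‖ / ρ) * rk (x' - y) = (n:ℝ) * 3 ^ n * ρ⁻¹ * rk (x' - y) * ‖x - x'‖ by
        field_simp]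
      gcongr
      exact rkb x' hx' y hy
    have h3 : 0 ≤ L1 * ‖x - x'‖ := by positivity
    nlinarith
  · intro x hx hx0
    have hxρ : ‖x‖ < ρ := by simpa using hx
    have e1 : ∫ z in ball 0 (2*ρ), rk (x - z) * bilap u z = ∫ z in ball 0 (2*ρ), rk (x - z) * bilap ψ z := by
      apply setIntegral_congr_fun measurableSet_ball
      intro y hy
      simp only
      rw [b1 y (by simpa using hy)]
    constructor
    · apply (iP x hx0).integrableOn.congr_fun _ measurableSet_ball
      intro y hy
      simp only
      rw [b1 y (by simpa using hy)]
    · have := rep hn hx0 hψ (iP x hx0) d1 d2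
      have hxx : ψ x = u x := by simp [ψ, (ocut_one_near h2ρ (show ‖x‖ < 2*ρ by linarith)).eq_of_nhds]
      rw [← hxx, e1, hh]
      simp only
      rw [← mul_add, ← setIntegral_union hdisj (meas_le_norm _) (iP x hx0).integrableOn (iP x hx0).integrableOn, hU, setIntegral_univ, ← this]
      field_simp

/-- nonlinearity -/
noncomputable def nl {p : ℕ} (s : ℝ) (v : EE p) (i : Fin p) : ℝ := ‖v‖ ^ (s - 1) * v i

lemma abs_coord_le {p : ℕ} (v : EE p) (i : Fin p) : |v i| ≤ ‖v‖ := PiLp.norm_apply_le v i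

lemma nl_cont {p : ℕ} {s : ℝ} (hs : 1 < s) (i : Fin p) : Continuous (fun v : EE p => nl s v i) := by
  unfold nl
  exact (continuous_norm.rpow_const (fun _ => Or.inr (by linarith))).mul (by fun_prop)

lemma nl_nonneg {p : ℕ} {s : ℝ} {v : EE p} {i : Fin p} (h : 0 ≤ v i) : 0 ≤ nl s v i := by
  unfold nl; positivity

lemma nl_abs_le {p : ℕ} {s : ℝ} (hs : 1 < s) (v : EE p) (i : Fin p) : |nl s v i| ≤ ‖v‖ ^ s := by
  unfold nl
  rw [abs_mul, abs_of_nonneg (by positivity)]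
  calc _ ≤ ‖v‖^(s-1) * ‖v‖ := by gcongr; exact abs_coord_le v i
    _ = ‖v‖^s := by
      rcases (norm_nonneg v).eq_or_lt with h | h
      · rw [← h]; simp; rw [Real.zero_rpow (by linarith)]
      · rw [← Real.rpow_add_one h.ne']; ring_nf

lemma nl_smul {p : ℕ} {s : ℝ} {t : ℝ} (ht : 0 < t) (v : EE p) (i : Fin p) : nl s (t • v) i = t ^ s * nl s v i := by
  unfold nl
  rw [norm_smul, Real.norm_of_nonneg ht.le, Real.mul_rpow ht.le (norm_nonneg _)]
  have : t ^ s = t ^ (s-1) * t := by rw [← Real.rpow_add_one ht.ne']; ring_nf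
  rw [this]
  simp; ring

lemma nl_eq_zero {p : ℕ} {s : ℝ} {v : EE p} {i : Fin p} (h : nl s v i = 0) (hv : 0 ≤ v i) : v i = 0 := by
  by_contra h0
  have h1 : 0 < v i := lt_of_le_of_ne hv (Ne.symm h0)
  have h2 : 0 < ‖v‖ := lt_of_lt_of_le h1 ((le_abs_self _).trans (abs_coord_le v i))
  have : 0 < nl s v i := by unfold nl; positivity
  linarith

def IsSol {n p : ℕ} (s c : ℝ) (V : EE n → EE p) (z0 : EE n) : Prop :=
  (∀ z i, 0 ≤ V z i) ∧ ContinuousOn V {z0}ᶜ ∧ ∀ y ≠ z0, ∀ i, Integrable (fun z => rk (y - z) * nl s (V z) i) ∧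
    V y i = c * ∫ z, rk (y - z) * nl s (V z) i

noncomputable def iv {n : ℕ} (l : ℝ) (z : EE n) : EE n := (l/‖z‖)^2 • z

lemma iv_eq {n : ℕ} (l : ℝ) : iv (n := n) l = EuclideanGeometry.inversion 0 l := by
  ext1 z; simp [iv, EuclideanGeometry.inversion]

lemma norm_iv {n : ℕ} (l : ℝ) {z : EE n} (hz : z ≠ 0) : ‖iv l z‖ = l^2/‖z‖ := by
  have := norm_pos_iff.2 hz
  unfold iv; rw [norm_smul, Real.norm_of_nonneg (by positivity)]; field_simp

lemma iv_ne {n : ℕ} {l : ℝ} (hl : 0 < l) {z : EE n} (hz : z ≠ 0) : iv l z ≠ 0 := by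
  rw [← norm_pos_iff, norm_iv l hz]; have := norm_pos_iff.2 hz; positivity

lemma iv_iv {n : ℕ} {l : ℝ} (hl : 0 < l) {z : EE n} (hz : z ≠ 0) : iv l (iv l z) = z := by
  rw [iv_eq]; exact EuclideanGeometry.inversion_inversion 0 hl.ne' z

lemma iv_cont {n : ℕ} (l : ℝ) : ContinuousOn (iv (n := n) l) {0}ᶜ := by
  unfold iv
  refine ContinuousOn.smul (f := fun z : EE n => (l/‖z‖)^2) (g := fun z => z) ?_ continuousOn_id
  refine ContinuousOn.pow (f := fun z : EE n => (l/‖z‖)) ?_ 2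
  exact continuousOn_const.div continuous_norm.continuousOn (fun z hz => norm_ne_zero_iff.2 hz)

lemma dist_iv {n : ℕ} (l : ℝ) {y z : EE n} (hy : y ≠ 0) (hz : z ≠ 0) :
    ‖iv l y - iv l z‖ = l^2/(‖y‖*‖z‖) * ‖y - z‖ := by
  have := EuclideanGeometry.dist_inversion_inversion hy hz l
  rw [← iv_eq] at this
  simpa [dist_eq_norm] using this

lemma meas_lt_norm {n : ℕ} (r : ℝ) : MeasurableSet {z : EE n | r < ‖z‖} :=
  (isOpen_lt continuous_const continuous_norm).measurableSet

lemma iv_image {n : ℕ} {l : ℝ} (hl : 0 < l) : Set.image (iv l) {z : EE n | l < ‖z‖} = ball 0 l \ {0} := by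
  ext w
  constructor
  · rintro ⟨z, hz, rfl⟩
    have hz : l < ‖z‖ := hz
    have z0 : z ≠ 0 := by rintro rfl; simp at hz; linarith
    refine ⟨?_, iv_ne hl z0⟩
    rw [mem_ball_zero_iff, norm_iv l z0, div_lt_iff₀ (by linarith)]
    nlinarith
  · rintro ⟨h1, h2⟩
    have w0 : w ≠ 0 := h2
    refine ⟨iv l w, ?_, iv_iv hl w0⟩
    have := norm_pos_iff.2 w0
    rw [mem_ball_zero_iff] at h1
    show l < ‖iv l w‖
    rw [norm_iv l w0, lt_div_iff₀ this]
    nlinarith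

lemma iv_inj {n : ℕ} {l : ℝ} (hl : 0 < l) : Set.InjOn (iv l) {z : EE n | l < ‖z‖} := by
  intro a ha b hb h
  have a0 : a ≠ 0 := by rintro rfl; simp at ha; linarith
  have b0 : b ≠ 0 := by rintro rfl; simp at hb; linarith
  rw [← iv_iv hl a0, h, iv_iv hl b0]

lemma ball_ae {n : ℕ} (hn : 5 ≤ n) (l : ℝ) : (ball (0 : EE n) l \ {0} : Set (EE n)) =ᵐ[volume] ball 0 l := by
  haveI := EE_nontrivial hn
  apply diff_null_ae_eq_self
  simp

lemma iv_det {n : ℕ} {l : ℝ} {z : EE n} :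
   |(((l / dist z 0) ^ 2 • ((ℝ ∙ (z - 0))ᗮ.reflection : EE n →L[ℝ] EE n)) : EE n →L[ℝ] EE n).det| = (l/‖z‖)^(2*n) := by
  rw [ContinuousLinearMap.det]
  have : ((((l / dist z 0) ^ 2 • ((ℝ ∙ (z - 0))ᗮ.reflection : EE n →L[ℝ] EE n)) : EE n →L[ℝ] EE n) : EE n →ₗ[ℝ] EE n)
     = (l / dist z 0) ^ 2 • ((ℝ ∙ (z - 0))ᗮ.reflection.toLinearMap) := rfl
  rw [this, LinearMap.det_smul, Submodule.det_reflection, abs_mul, abs_pow, abs_pow, abs_pow]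
  simp
  rw [← pow_mul]

lemma cov {n : ℕ} (hn : 5 ≤ n) {l : ℝ} (hl : 0 < l) (g : EE n → ℝ) :
    (IntegrableOn g (ball 0 l) ↔ IntegrableOn (fun z => (l/‖z‖)^(2*n) * g (iv l z)) {z | l < ‖z‖}) ∧
    ∫ z in ball 0 l, g z = ∫ z in {z | l < ‖z‖}, (l/‖z‖)^(2*n) * g (iv l z) := by
  have hd : ∀ z ∈ {z : EE n | l < ‖z‖}, HasFDerivWithinAt (iv l)
      (((l / dist z 0) ^ 2 • ((ℝ ∙ (z - 0))ᗮ.reflection : EE n →L[ℝ] EE n))) {z | l < ‖z‖} z := by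
    intro z hz
    rw [iv_eq]
    apply (EuclideanGeometry.hasFDerivAt_inversion _).hasFDerivWithinAt
    rintro rfl; simp at hz; linarith
  have h1 := integrableOn_image_iff_integrableOn_abs_det_fderiv_smul volume (meas_lt_norm l) hd (iv_inj hl) g
  have h2 := integral_image_eq_integral_abs_det_fderiv_smul volume (meas_lt_norm l) hd (iv_inj hl) g
  simp_rw [iv_det, smul_eq_mul] at h1 h2
  rw [iv_image hl] at h1 h2
  rw [integrableOn_congr_set_ae (ball_ae hn l)] at h1
  rw [setIntegral_congr_set (ball_ae hn l)] at h2
  exact ⟨h1, h2⟩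

noncomputable def k2 {n : ℕ} (l : ℝ) (y z : EE n) : ℝ := rk (y - iv l z) * (l/‖z‖)^((n:ℝ)-4)

lemma rk_mul_pow {n : ℕ} (x : EE n) {t : ℝ} (ht : 0 < t) : rk x * t^((n:ℝ)-4) = (‖x‖ / t) ^ ((4:ℝ)-n) := by
  unfold rk
  rw [Real.div_rpow (norm_nonneg _) ht.le, div_eq_mul_inv, ← Real.rpow_neg ht.le]
  ring_nf

lemma k2_eq {n : ℕ} {l : ℝ} (hl : 0 < l) (y : EE n) {z : EE n} (hz : z ≠ 0) :
    k2 l y z = (‖y - iv l z‖ * ‖z‖ / l) ^ ((4:ℝ)-n) := by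
  have := norm_pos_iff.2 hz
  unfold k2
  rw [rk_mul_pow _ (by positivity)]
  congr 1; field_simp

lemma k2_symm {n : ℕ} {l : ℝ} (hl : 0 < l) {y z : EE n} (hy : y ≠ 0) (hz : z ≠ 0) : k2 l y z = k2 l z y := by
  rw [k2_eq hl y hz, k2_eq hl z hy]
  have h := dist_iv l (iv_ne hl hy) hz
  rw [iv_iv hl hy, norm_iv l hy] at h
  have := norm_pos_iff.2 hz
  have := norm_pos_iff.2 hy
  rw [h, norm_sub_rev z]
  congr 1
  field_simp

lemma k2_nonneg {n : ℕ} {l : ℝ} (hl : 0 < l) (y z : EE n) : 0 ≤ k2 l y z := by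
  unfold k2; exact mul_nonneg (rk_nonneg _) (by positivity)

lemma k2_lt {n : ℕ} (hn : 5 ≤ n) {l : ℝ} (hl : 0 < l) {y z : EE n} (hy : l < ‖y‖) (hz : l < ‖z‖) (hyz : y ≠ z) :
    k2 l y z < rk (y - z) := by
  have z0 : z ≠ 0 := by rintro rfl; simp at hz; linarith
  rw [k2_eq hl y z0]
  unfold rk
  have h1 : 0 < ‖y - z‖ := norm_pos_iff.2 (sub_ne_zero.2 hyz)
  have hzp : 0 < ‖z‖ := by linarith
  apply Real.rpow_lt_rpow_of_neg h1
  · apply lt_of_pow_lt_pow_left₀ 2 (by positivity)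
    have e1 : (‖y - iv l z‖ * ‖z‖ / l)^2 = ‖y‖^2*‖z‖^2/l^2 - 2 * inner ℝ y z + l^2 := by
      rw [div_pow, mul_pow, norm_sub_sq_real, iv, inner_smul_right, norm_smul, Real.norm_of_nonneg (by positivity)]
      field_simp
    rw [e1, norm_sub_sq_real]
    have : ‖y‖^2*‖z‖^2/l^2 + l^2 - ‖y‖^2 - ‖z‖^2 = (‖y‖^2-l^2)*(‖z‖^2-l^2)/l^2 := by field_simp; ring
    have h2 : 0 < (‖y‖^2-l^2)*(‖z‖^2-l^2)/l^2 := by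
      have : 0 < ‖y‖^2-l^2 := by nlinarith
      have : 0 < ‖z‖^2-l^2 := by nlinarith
      positivity
    linarith
  · have := n4pos hn; linarith

lemma rk_iv {n : ℕ} {l : ℝ} (hl : 0 < l) {y z : EE n} (hy : y ≠ 0) (hz : z ≠ 0) :
    (l/‖y‖)^((n:ℝ)-4) * k2 l (iv l y) z = rk (y - z) := by
  have h1 := norm_pos_iff.2 hz
  have h2 := norm_pos_iff.2 hy
  unfold k2
  rw [mul_comm, mul_assoc, ← Real.mul_rpow (by positivity) (by positivity), rk_mul_pow _ (by positivity), dist_iv l hy hz]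
  unfold rk
  congr 1
  field_simp

noncomputable def Vl {n p : ℕ} (l : ℝ) (V : EE n → EE p) (y : EE n) : EE p := (l/‖y‖)^((n:ℝ)-4) • V (iv l y)

noncomputable def ta (n : ℕ) (s : ℝ) : ℝ := n + 4 - (n-4)*s

lemma vl_transf {n p : ℕ} {s l : ℝ} (hl : 0 < l) (V : EE n → EE p) {z : EE n} (hz : z ≠ 0) (y : EE n) (i : Fin p) :
    (l/‖z‖)^(2*n) * (rk (y - iv l z) * nl s (V (iv l z)) i) = k2 l y z * ((l/‖z‖)^(ta n s) * nl s (Vl l V z) i) := by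
  have h1 := norm_pos_iff.2 hz
  have ha : 0 < l/‖z‖ := by positivity
  unfold Vl k2
  rw [nl_smul (by positivity)]
  rw [← Real.rpow_mul ha.le, ← Real.rpow_natCast]
  have : (l/‖z‖)^(((2*n:ℕ):ℝ)) = (l/‖z‖)^((n:ℝ)-4) * ((l/‖z‖)^(ta n s) * (l/‖z‖)^(((n:ℝ)-4)*s)) := by
    rw [← Real.rpow_add ha, ← Real.rpow_add ha]; congr 1; unfold ta; push_cast; ring
  rw [this]; ring

/-- integral formula for the difference -/
lemma ms_formula {n p : ℕ} (hn : 5 ≤ n) {s c : ℝ} {V : EE n → EE p} {z0 : EE n} (hV : IsSol s c V z0)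
    {l : ℝ} (hl : 0 < l) (hlz : l < ‖z0‖) {y : EE n} (hy : l < ‖y‖) (hyz : y ≠ z0) (i : Fin p) :
    IntegrableOn (fun z => (rk (y - z) - k2 l y z) * ((l/‖z‖)^(ta n s) * nl s (Vl l V z) i - nl s (V z) i)) {z | l < ‖z‖} ∧
    Vl l V y i - V y i = c * ∫ z in {z | l < ‖z‖}, (rk (y - z) - k2 l y z) * ((l/‖z‖)^(ta n s) * nl s (Vl l V z) i - nl s (V z) i) := by
  have y0 : y ≠ 0 := by rintro rfl; simp at hy; linarith
  have hyp := norm_pos_iff.2 y0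
  have hz0' : ∀ z ∈ {z : EE n | l < ‖z‖}, z ≠ 0 := by
    rintro z hz rfl; simp at hz; linarith
  have hiv : iv l y ≠ z0 := by
    intro h
    have := norm_iv l y0
    rw [h] at this
    have h2 : l^2/‖y‖ < l := by rw [div_lt_iff₀ hyp]; nlinarith
    linarith
  obtain ⟨I1, e1⟩ := hV.2.2 y hyz i
  obtain ⟨I2, e2⟩ := hV.2.2 (iv l y) hiv i
  have hEm := meas_lt_norm (n := n) l
  have hUc : ((ball (0 : EE n) l)ᶜ : Set (EE n)) = {z | l ≤ ‖z‖} := by ext; simp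
  have hU : ({z | l ≤ ‖z‖} : Set (EE n)) =ᵐ[volume] ({z | l < ‖z‖} : Set (EE n)) := by
    haveI := EE_nontrivial hn
    have hs : volume (sphere (0 : EE n) l) = 0 := Measure.addHaar_sphere _ _ _
    have : ∀ᵐ z : EE n, z ∉ sphere (0 : EE n) l := measure_eq_zero_iff_ae_notMem.1 hs
    filter_upwards [this] with z hz
    simp at hz
    apply propext
    exact ⟨fun h => lt_of_le_of_ne h (Ne.symm hz), fun h => le_of_lt h⟩
  have split : ∀ g : EE n → ℝ, Integrable g → ∫ z, g z = (∫ z in {z | l < ‖z‖}, g z) + ∫ z in {z | l < ‖z‖}, (l/‖z‖)^(2*n) * g (iv l z) := by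
    intro g hg
    rw [← (cov hn hl g).2, ← integral_add_compl (s := ball (0:EE n) l) measurableSet_ball hg, hUc, setIntegral_congr_set hU, add_comm]
  have ja := I1.integrableOn (s := {z : EE n | l < ‖z‖})
  have jb := ((cov hn hl _).1).1 (I1.integrableOn (s := ball 0 l))
  have jc := I2.integrableOn (s := {z : EE n | l < ‖z‖})
  have jd := ((cov hn hl _).1).1 (I2.integrableOn (s := ball 0 l))
  rw [split _ I1] at e1
  rw [split _ I2] at e2
  have qb : ∀ z ∈ {z : EE n | l < ‖z‖}, (l/‖z‖)^(2*n) * (rk (y - iv l z) * nl s (V (iv l z)) i) = k2 l y z * ((l/‖z‖)^(ta n s) * nl s (Vl l V z) i) :=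
    fun z hz => vl_transf hl V (hz0' z hz) y i
  have qd : ∀ z ∈ {z : EE n | l < ‖z‖}, (l/‖y‖)^((n:ℝ)-4) * ((l/‖z‖)^(2*n) * (rk (iv l y - iv l z) * nl s (V (iv l z)) i)) = rk (y - z) * ((l/‖z‖)^(ta n s) * nl s (Vl l V z) i) := by
    intro z hz
    rw [vl_transf hl V (hz0' z hz), ← mul_assoc, rk_iv hl y0 (hz0' z hz)]
  have qc : ∀ z ∈ {z : EE n | l < ‖z‖}, (l/‖y‖)^((n:ℝ)-4) * (rk (iv l y - z) * nl s (V z) i) = k2 l y z * nl s (V z) i := by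
    intro z hz
    rw [k2_symm hl y0 (hz0' z hz), k2, rk_sub_comm z]; ring
  have ev : Vl l V y i = c * ((∫ z in {z | l < ‖z‖}, k2 l y z * nl s (V z) i) + ∫ z in {z | l < ‖z‖}, rk (y - z) * ((l/‖z‖)^(ta n s) * nl s (Vl l V z) i)) := by
    rw [← setIntegral_congr_fun hEm qc, ← setIntegral_congr_fun hEm qd, integral_const_mul, integral_const_mul]
    have : Vl l V y i = (l/‖y‖)^((n:ℝ)-4) * V (iv l y) i := by simp [Vl]
    rw [this, e2]; ring
  rw [setIntegral_congr_fun hEm qb] at e1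
  have kb := jb.congr_fun qb hEm
  have kc := IntegrableOn.congr_fun (jc.const_mul ((l/‖y‖)^((n:ℝ)-4))) qc hEm
  have kd := IntegrableOn.congr_fun (jd.const_mul ((l/‖y‖)^((n:ℝ)-4))) qd hEm
  have hfun : (fun z => (rk (y - z) - k2 l y z) * ((l/‖z‖)^(ta n s) * nl s (Vl l V z) i - nl s (V z) i)) =
     fun z => (k2 l y z * nl s (V z) i + rk (y - z) * ((l/‖z‖)^(ta n s) * nl s (Vl l V z) i)) -
       (rk (y - z) * nl s (V z) i + k2 l y z * ((l/‖z‖)^(ta n s) * nl s (Vl l V z) i)) := by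
    ext z; ring
  rw [hfun]
  refine ⟨(kc.add kd).sub (ja.add kb), ?_⟩
  have t1 := integral_add kc kd
  have t2 := integral_add ja kb
  have t3 := integral_sub (kc.add kd) (ja.add kb)
  simp only [Pi.add_apply] at t1 t2 t3
  rw [t3, t1, t2, ev, e1]; ring

lemma norm_le_sum {p : ℕ} (v : EE p) : ‖v‖ ≤ ∑ j, |v j| := by
  rw [EuclideanSpace.norm_eq]
  apply Real.sqrt_le_iff.2
  refine ⟨Finset.sum_nonneg (fun _ _ => abs_nonneg _), ?_⟩
  simpa using Finset.sum_sq_le_sq_sum_of_nonneg (s := Finset.univ) (f := fun j => |v j|) (fun _ _ => abs_nonneg _)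

lemma norm_mono_coord {p : ℕ} {v w : EE p} (h : ∀ j, |v j| ≤ |w j|) : ‖v‖ ≤ ‖w‖ := by
  rw [EuclideanSpace.norm_eq, EuclideanSpace.norm_eq]
  apply Real.sqrt_le_sqrt
  apply Finset.sum_le_sum
  intro j _
  have := h j
  simp only [Real.norm_eq_abs]
  gcongr

lemma pow_diff {A M e : ℝ} (he : 0 < e) (hM : 0 ≤ M) (hMA : M ≤ A) :
    (A^e - M^e) * M ≤ max 1 e * A^e * (A - M) := by
  rcases (hM.trans hMA).eq_or_lt with h | hA
  · have : M = 0 := by linarith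
    rw [this, ← h]; simp
  set t := M / A with ht
  have t0 : 0 ≤ t := by positivity
  have t1 : t ≤ 1 := by rw [ht, div_le_one hA]; exact hMA
  have hMt : M = t * A := by rw [ht]; field_simp
  have b := one_add_mul_self_le_rpow_one_add (s := t - 1) (by linarith) (p := max 1 e) (le_max_left _ _)
  rw [show 1 + (t - 1) = t by ring] at b
  have b2 : t ^ (max 1 e) ≤ t ^ e := Real.rpow_le_rpow_of_exponent_ge_of_imp t0 t1 (le_max_right _ _) (by intro _ h; exact absurd h (by positivity))
  have hAe : 0 < A^e := by positivity
  rw [hMt, Real.mul_rpow t0 hA.le]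
  have h1 : 1 - t^e ≤ max 1 e * (1 - t) := by nlinarith
  have h2 : (1 - t^e) * t ≤ max 1 e * (1 - t) := by
    have : t^e ≤ 1 := Real.rpow_le_one t0 t1 he.le
    nlinarith
  calc (A^e - t^e*A^e)*(t*A) = ((1 - t^e) * t) * (A^e*A) := by ring
    _ ≤ (max 1 e * (1 - t)) * (A^e*A) := by gcongr
    _ = _ := by ring

lemma nl_diff {p : ℕ} {s : ℝ} (hs : 1 < s) {a b : EE p} (ha : ∀ j, 0 ≤ a j) (hb : ∀ j, 0 ≤ b j) (i : Fin p) :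
    nl s a i - nl s b i ≤ (1 + max 1 (s-1)) * ‖a‖^(s-1) * ∑ j, max (a j - b j) 0 := by
  set m : EE p := WithLp.toLp 2 (fun j => min (a j) (b j)) with hm
  have mj : ∀ j, m j = min (a j) (b j) := fun j => rfl
  have m0 : ∀ j, 0 ≤ m j := fun j => by rw [mj]; exact le_min (ha j) (hb j)
  set d := ∑ j, max (a j - b j) 0 with hd
  have dj : ∀ j, a j - m j = max (a j - b j) 0 := by
    intro j; rw [mj]; rcases le_total (a j) (b j) with h | h
    · rw [min_eq_left h, max_eq_right (by linarith)]; ring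
    · rw [min_eq_right h, max_eq_left (by linarith)]
  have hdn : ‖a - m‖ ≤ d := by
    refine (norm_le_sum _).trans (le_of_eq ?_)
    apply Finset.sum_congr rfl
    intro j _
    rw [← dj j, PiLp.sub_apply, abs_of_nonneg]
    rw [dj]; exact le_max_right _ _
  have hma : ‖m‖ ≤ ‖a‖ := norm_mono_coord (fun j => by rw [abs_of_nonneg (m0 j), abs_of_nonneg (ha j), mj]; exact min_le_left _ _)
  have hmb : ‖m‖ ≤ ‖b‖ := norm_mono_coord (fun j => by rw [abs_of_nonneg (m0 j), abs_of_nonneg (hb j), mj]; exact min_le_right _ _)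
  have h1 : nl s m i ≤ nl s b i := by
    unfold nl
    have : m i ≤ b i := by rw [mj]; exact min_le_right _ _
    have := m0 i
    gcongr
  have hA : ‖a‖ - ‖m‖ ≤ d := (norm_sub_norm_le a m).trans hdn
  have h2 := pow_diff (e := s - 1) (by linarith) (norm_nonneg m) hma
  have hi : a i - m i ≤ d := by
    rw [dj]; exact Finset.single_le_sum (f := fun j => max (a j - b j) 0) (fun _ _ => le_max_right _ _) (Finset.mem_univ i)
  have hmi : m i ≤ ‖m‖ := (le_abs_self _).trans (abs_coord_le m i)
  have hpm : ‖m‖^(s-1) ≤ ‖a‖^(s-1) := Real.rpow_le_rpow (norm_nonneg _) hma (by linarith)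
  have hap : 0 ≤ ‖a‖^(s-1) := by positivity
  have hmx : 0 < max 1 (s-1) := by positivity
  calc nl s a i - nl s b i ≤ nl s a i - nl s m i := by linarith
    _ = ‖a‖^(s-1) * (a i - m i) + (‖a‖^(s-1) - ‖m‖^(s-1)) * m i := by unfold nl; ring
    _ ≤ ‖a‖^(s-1) * d + (‖a‖^(s-1) - ‖m‖^(s-1)) * ‖m‖ := by
        gcongr
    _ ≤ ‖a‖^(s-1) * d + max 1 (s-1) * ‖a‖^(s-1) * d := by
        have : max 1 (s-1) * ‖a‖^(s-1) * (‖a‖ - ‖m‖) ≤ max 1 (s-1) * ‖a‖^(s-1) * d := by gcongr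
        linarith
    _ = _ := by ring

lemma Vl_nonneg {n p : ℕ} {V : EE n → EE p} (hV : ∀ z i, 0 ≤ V z i) {l : ℝ} (hl : 0 < l) (z : EE n) (i : Fin p) : 0 ≤ Vl l V z i := by
  unfold Vl; simp; exact mul_nonneg (by positivity) (hV _ _)

lemma norm_Vl {n p : ℕ} {V : EE n → EE p} {l M : ℝ} (hl : 0 < l) (hM : ∀ z ∈ closedBall (0:EE n) l, ‖V z‖ ≤ M) {z : EE n} (hz : l < ‖z‖) :
    ‖Vl l V z‖ ≤ (l/‖z‖)^((n:ℝ)-4) * M := by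
  unfold Vl
  have z0 : z ≠ 0 := by rintro rfl; simp at hz; linarith
  have zp := norm_pos_iff.2 z0
  rw [norm_smul, Real.norm_of_nonneg (by positivity)]
  gcongr
  apply hM
  rw [mem_closedBall_zero_iff, norm_iv l z0, div_le_iff₀ zp]; nlinarith

/-- the constant -/
noncomputable def msC (p : ℕ) (s : ℝ) : ℝ := p * (1 + max 1 (s-1))

lemma msC_nonneg (p : ℕ) (s : ℝ) : 0 ≤ msC p s := by unfold msC; positivity

lemma ms_halve {n p : ℕ} (hn : 5 ≤ n) {s c : ℝ} (hs : 1 < s) (hta : 0 < ta n s) (hc : 0 < c)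
    {V : EE n → EE p} {z0 : EE n} (hV : IsSol s c V z0)
    {l : ℝ} (hl : 0 < l) (hlz : l < ‖z0‖) {M B S : ℝ} (hM : ∀ z ∈ closedBall (0:EE n) l, ‖V z‖ ≤ M)
    {E : Set (EE n)} (hEm : MeasurableSet E) (hEl : E ⊆ {z | l ≤ ‖z‖})
    (hE : ∀ z, l < ‖z‖ → z ≠ z0 → z ∉ E → ∀ j, Vl l V z j ≤ V z j)
    (hB : ∀ y : EE n, l < ‖y‖ → IntegrableOn (fun z => rk (y - z) * ‖z‖^(-((n:ℝ)+4))) E ∧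
       ‖y‖^((n:ℝ)-4) * ∫ z in E, rk (y - z) * ‖z‖^(-((n:ℝ)+4)) ≤ B)
    (hsm : c * msC p s * M^(s-1) * l^(8:ℝ) * B ≤ 1/2) (hS : 0 ≤ S)
    (hD : ∀ z, l < ‖z‖ → z ≠ z0 → ∑ j, max (Vl l V z j - V z j) 0 ≤ S * ‖z‖^((4:ℝ)-n)) :
    ∀ z, l < ‖z‖ → z ≠ z0 → ∑ j, max (Vl l V z j - V z j) 0 ≤ S/2 * ‖z‖^((4:ℝ)-n) := by
  intro y hy hyz
  have yp : 0 < ‖y‖ := hl.trans hy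
  have hM0 : 0 ≤ M := (norm_nonneg _).trans (hM 0 (by simp [hl.le]))
  obtain ⟨hBi, hBb⟩ := hB y hy
  set K := (1 + max 1 (s-1)) * M^(s-1) * l^(8:ℝ) * S with hK
  have hKn : 0 ≤ K := by positivity
  have hq : ‖y‖^((4:ℝ)-n) * ‖y‖^((n:ℝ)-4) = 1 := by
    rw [← Real.rpow_add yp]; simp
  have key : ∀ i, Vl l V y i - V y i ≤ c * (K * (B * ‖y‖^((4:ℝ)-n))) := by
    intro i
    obtain ⟨I1, e1⟩ := ms_formula hn hV hl hlz hy hyz i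
    rw [e1]
    apply mul_le_mul_of_nonneg_left _ hc.le
    have hg : Integrable (E.indicator (fun z => K * (rk (y - z) * ‖z‖^(-((n:ℝ)+4))))) :=
      IntegrableOn.integrable_indicator (Integrable.const_mul hBi K) hEm
    calc _ ≤ ∫ z in {z | l < ‖z‖}, E.indicator (fun z => K * (rk (y - z) * ‖z‖^(-((n:ℝ)+4)))) z := by
          apply integral_mono_ae I1 hg.integrableOn
          filter_upwards [ae_restrict_mem (meas_lt_norm l), ae_restrict_of_ae (ae_ne hn z0), ae_restrict_of_ae (ae_ne hn y)] with z hz hzz hzy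
          have hz : l < ‖z‖ := hz
          have zp : 0 < ‖z‖ := hl.trans hz
          have hk : 0 ≤ rk (y - z) - k2 l y z := by
            have := k2_lt hn hl hy hz (Ne.symm hzy); linarith
          have hk' : rk (y - z) - k2 l y z ≤ rk (y - z) := by
            have := k2_nonneg hl y z; linarith
          have hd := nl_diff hs (Vl_nonneg hV.1 hl z) (hV.1 z) i
          have hlz1 : (l/‖z‖)^(ta n s) ≥ 0 := by positivity
          have hlz2 : (l/‖z‖)^(ta n s) ≤ 1 := Real.rpow_le_one (by positivity) (by rw [div_le_one zp]; exact hz.le) hta.le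
          have hX1 : ∀ i, (l/‖z‖)^(ta n s) * nl s (Vl l V z) i - nl s (V z) i ≤ (l/‖z‖)^(ta n s) * (nl s (Vl l V z) i - nl s (V z) i) := by
            intro i
            have := nl_nonneg (s := s) (hV.1 z i)
            nlinarith
          by_cases hzE : z ∈ E
          · rw [Set.indicator_of_mem hzE]
            have hDz := hD z hz hzz
            have hnV := norm_Vl hl hM hz
            have hpw : ‖Vl l V z‖^(s-1) ≤ ((l/‖z‖)^((n:ℝ)-4) * M)^(s-1) := Real.rpow_le_rpow (norm_nonneg _) hnV (by linarith)
            rw [Real.mul_rpow (by positivity) hM0, ← Real.rpow_mul (by positivity)] at hpw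
            have hb : nl s (Vl l V z) i - nl s (V z) i ≤ (1 + max 1 (s-1)) * ((l/‖z‖)^(((n:ℝ)-4)*(s-1)) * M^(s-1)) * (S * ‖z‖^((4:ℝ)-n)) := by
              refine hd.trans ?_
              gcongr
            have hX : (l/‖z‖)^(ta n s) * nl s (Vl l V z) i - nl s (V z) i ≤ K * ‖z‖^(-((n:ℝ)+4)) := by
              refine (hX1 i).trans ?_
              calc _ ≤ (l/‖z‖)^(ta n s) * ((1 + max 1 (s-1)) * ((l/‖z‖)^(((n:ℝ)-4)*(s-1)) * M^(s-1)) * (S * ‖z‖^((4:ℝ)-n))) := by gcongr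
                _ = ((l/‖z‖)^(ta n s) * (l/‖z‖)^(((n:ℝ)-4)*(s-1))) * ‖z‖^((4:ℝ)-n) * ((1 + max 1 (s-1)) * M^(s-1) * S) := by ring
                _ = l^(8:ℝ) * ‖z‖^(-((n:ℝ)+4)) * ((1 + max 1 (s-1)) * M^(s-1) * S) := by
                  rw [← Real.rpow_add (by positivity), show ta n s + ((n:ℝ)-4)*(s-1) = 8 by unfold ta; ring, Real.div_rpow hl.le zp.le,
                    div_eq_mul_inv, ← Real.rpow_neg zp.le, mul_assoc (l^(8:ℝ)), ← Real.rpow_add zp]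
                  congr 3; ring
                _ = _ := by rw [hK]; ring
            calc _ ≤ (rk (y - z) - k2 l y z) * (K * ‖z‖^(-((n:ℝ)+4))) := by gcongr
              _ ≤ rk (y - z) * (K * ‖z‖^(-((n:ℝ)+4))) := by gcongr
              _ = _ := by ring
          · rw [Set.indicator_of_notMem hzE]
            apply mul_nonpos_of_nonneg_of_nonpos hk
            refine (hX1 i).trans ?_
            apply mul_nonpos_of_nonneg_of_nonpos hlz1
            refine hd.trans (le_of_eq ?_)
            rw [Finset.sum_eq_zero, mul_zero]
            intro j _
            exact max_eq_right (by have := hE z hz hzz hzE j; linarith)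
      _ ≤ ∫ z, E.indicator (fun z => K * (rk (y - z) * ‖z‖^(-((n:ℝ)+4)))) z := by
          apply setIntegral_le_integral hg
          apply Eventually.of_forall
          intro z
          apply Set.indicator_nonneg
          intro z _
          exact mul_nonneg hKn (mul_nonneg (rk_nonneg _) (by positivity))
      _ = K * ∫ z in E, rk (y - z) * ‖z‖^(-((n:ℝ)+4)) := by
          rw [integral_indicator hEm, integral_const_mul]
      _ ≤ K * (B * ‖y‖^((4:ℝ)-n)) := by
          gcongr
          calc _ = (‖y‖^((4:ℝ)-n) * ‖y‖^((n:ℝ)-4)) * ∫ z in E, rk (y - z) * ‖z‖^(-((n:ℝ)+4)) := by rw [hq, one_mul]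
            _ = (‖y‖^((n:ℝ)-4) * ∫ z in E, rk (y - z) * ‖z‖^(-((n:ℝ)+4))) * ‖y‖^((4:ℝ)-n) := by ring
            _ ≤ _ := by gcongr
  have hB0 : 0 ≤ B := by
    refine le_trans ?_ hBb
    apply mul_nonneg (by positivity)
    exact integral_nonneg (fun z => mul_nonneg (rk_nonneg _) (by positivity))
  calc ∑ j, max (Vl l V y j - V y j) 0 ≤ ∑ j : Fin p, c * (K * (B * ‖y‖^((4:ℝ)-n))) := by
        apply Finset.sum_le_sum
        intro j _
        exact max_le (key j) (by positivity)
    _ = (c * msC p s * M^(s-1) * l^(8:ℝ) * B) * (S * ‖y‖^((4:ℝ)-n)) := by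
        simp [hK, msC]; ring
    _ ≤ 1/2 * (S * ‖y‖^((4:ℝ)-n)) := by gcongr
    _ = _ := by ring

lemma ms_close {n p : ℕ} (hn : 5 ≤ n) {s c : ℝ} (hs : 1 < s) (hta : 0 < ta n s) (hc : 0 < c)
    {V : EE n → EE p} {z0 : EE n} (hV : IsSol s c V z0)
    {l : ℝ} (hl : 0 < l) (hlz : l < ‖z0‖) {M B : ℝ} (hM : ∀ z ∈ closedBall (0:EE n) l, ‖V z‖ ≤ M)
    {E : Set (EE n)} (hEm : MeasurableSet E) (hEl : E ⊆ {z | l ≤ ‖z‖})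
    (hE : ∀ z, l < ‖z‖ → z ≠ z0 → z ∉ E → ∀ j, Vl l V z j ≤ V z j)
    (hB : ∀ y : EE n, l < ‖y‖ → IntegrableOn (fun z => rk (y - z) * ‖z‖^(-((n:ℝ)+4))) E ∧
       ‖y‖^((n:ℝ)-4) * ∫ z in E, rk (y - z) * ‖z‖^(-((n:ℝ)+4)) ≤ B)
    (hsm : c * msC p s * M^(s-1) * l^(8:ℝ) * B ≤ 1/2) :
    ∀ z, l < ‖z‖ → z ≠ z0 → ∀ j, Vl l V z j ≤ V z j := by
  have hM0 : 0 ≤ M := (norm_nonneg _).trans (hM 0 (by simp [hl.le]))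
  set S0 := p * (l^((n:ℝ)-4) * M) with hS0
  have hS0n : 0 ≤ S0 := by positivity
  have it : ∀ k : ℕ, ∀ z, l < ‖z‖ → z ≠ z0 → ∑ j, max (Vl l V z j - V z j) 0 ≤ S0/2^k * ‖z‖^((4:ℝ)-n) := by
    intro k
    induction k with
    | zero =>
      intro z hz hzz
      have zp : 0 < ‖z‖ := hl.trans hz
      have hnV := norm_Vl hl hM hz
      have : ∀ j : Fin p, max (Vl l V z j - V z j) 0 ≤ (l/‖z‖)^((n:ℝ)-4) * M := by
        intro j
        apply max_le _ (by positivity)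
        have := (le_abs_self _).trans (abs_coord_le (Vl l V z) j)
        have := hV.1 z j
        linarith
      calc _ ≤ ∑ j : Fin p, (l/‖z‖)^((n:ℝ)-4) * M := Finset.sum_le_sum (fun j _ => this j)
        _ = _ := by
          rw [hS0, Real.div_rpow hl.le zp.le, show (4:ℝ)-n = -((n:ℝ)-4) by ring, Real.rpow_neg zp.le]
          simp; ring
    | succ k ih =>
      have := ms_halve hn hs hta hc hV hl hlz hM hEm hEl hE hB hsm (by positivity) ih
      rw [pow_succ, ← div_div]; exact this
  intro z hz hzz j
  have lim : Tendsto (fun k : ℕ => S0/2^k * ‖z‖^((4:ℝ)-n)) atTop (𝓝 0) := by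
    have : Tendsto (fun k : ℕ => (1/2:ℝ)^k) atTop (𝓝 0) := tendsto_pow_atTop_nhds_zero_of_lt_one (by norm_num) (by norm_num)
    have := (this.const_mul S0).mul_const (‖z‖^((4:ℝ)-n))
    simp only [mul_zero, zero_mul] at this
    refine this.congr (fun k => ?_)
    simp [div_eq_mul_inv]
  have h1 := ge_of_tendsto' lim (fun k => it k z hz hzz)
  have h2 : max (Vl l V z j - V z j) 0 ≤ ∑ j, max (Vl l V z j - V z j) 0 :=
    Finset.single_le_sum (f := fun j => max (Vl l V z j - V z j) 0) (fun _ _ => le_max_right _ _) (Finset.mem_univ j)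
  have := le_max_left (Vl l V z j - V z j) 0
  linarith

lemma sol_zero {n p : ℕ} (hn : 5 ≤ n) {s c : ℝ} (hc : 0 < c) {V : EE n → EE p} {z0 : EE n} (hV : IsSol s c V z0)
    {y : EE n} (hy : y ≠ z0) {i : Fin p} (h : V y i = 0) : ∀ z ≠ z0, V z i = 0 := by
  obtain ⟨I, e⟩ := hV.2.2 y hy i
  have h1 : ∫ z, rk (y - z) * nl s (V z) i = 0 := by
    rw [h] at e
    rcases mul_eq_zero.1 e.symm with h | h
    · linarith
    · exact h
  rw [integral_eq_zero_iff_of_nonneg (fun z => mul_nonneg (rk_nonneg _) (nl_nonneg (hV.1 z i))) I] at h1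
  intro z hz
  rw [(hV.2.2 z hz i).2]
  have : ∫ w, rk (z - w) * nl s (V w) i = 0 := by
    rw [← integral_zero (EE n) ℝ (μ := volume)]
    apply integral_congr_ae
    filter_upwards [h1, ae_ne hn y] with w hw hwy
    simp only [Pi.zero_apply] at hw
    rcases mul_eq_zero.1 hw with h | h
    · exact absurd h (rk_pos (sub_ne_zero.2 (Ne.symm hwy))).ne'
    · rw [h]; simp
  rw [this, mul_zero]

lemma Vl_cont {n p : ℕ} {V : EE n → EE p} {z0 : EE n} (hV : ContinuousOn V {z0}ᶜ) {l : ℝ} (hl : 0 < l) (hlz : l < ‖z0‖) :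
    ContinuousOn (Vl l V) {z | l < ‖z‖} := by
  unfold Vl
  have z0' : ∀ z ∈ {z : EE n | l < ‖z‖}, z ≠ 0 := by rintro z hz rfl; simp at hz; linarith
  refine ContinuousOn.smul (f := fun z : EE n => (l/‖z‖)^((n:ℝ)-4)) (g := fun z => V (iv l z)) ?_ ?_
  · refine ContinuousOn.rpow_const (f := fun z : EE n => l/‖z‖) ?_ ?_
    · exact continuousOn_const.div continuous_norm.continuousOn (fun z hz => norm_ne_zero_iff.2 (z0' z hz))
    · intro z hz
      have := norm_pos_iff.2 (z0' z hz)
      left; positivity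
  · refine ContinuousOn.comp (g := V) (f := iv l) hV ((iv_cont l).mono (fun z hz => z0' z hz)) ?_
    intro z hz h
    have h : iv l z = z0 := h
    have h1 := norm_iv l (z0' z hz)
    have hz : l < ‖z‖ := hz
    rw [h] at h1
    have h2 : l^2/‖z‖ < l := by rw [div_lt_iff₀ (by linarith)]; nlinarith
    linarith

lemma Vl_cont_l {n p : ℕ} {V : EE n → EE p} {z0 : EE n} (hV : ContinuousOn V {z0}ᶜ) {l : ℝ} (hl : 0 < l) (hlz : l < ‖z0‖)
    {z : EE n} (hz : l < ‖z‖) : ContinuousAt (fun l => Vl l V z) l := by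
  unfold Vl
  have zp : 0 < ‖z‖ := hl.trans hz
  have z00 := norm_pos_iff.1 zp
  refine ContinuousAt.smul (f := fun l : ℝ => (l/‖z‖)^((n:ℝ)-4)) (g := fun l => V (iv l z)) ?_ ?_
  · refine ContinuousAt.rpow_const (f := fun l : ℝ => l/‖z‖) ?_ ?_
    · fun_prop
    · left; positivity
  · refine ContinuousAt.comp (g := V) (f := fun l => iv l z) ?_ ?_
    · apply hV.continuousAt
      apply isOpen_compl_singleton.mem_nhds
      intro h
      have h : iv l z = z0 := h
      have h1 := norm_iv l z00
      rw [h] at h1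
      have h2 : l^2/‖z‖ < l := by rw [div_lt_iff₀ (by linarith)]; nlinarith
      linarith
    · unfold iv; fun_prop

def MSP {n p : ℕ} (V : EE n → EE p) (z0 : EE n) (l : ℝ) : Prop := ∀ z, l < ‖z‖ → z ≠ z0 → ∀ j, Vl l V z j ≤ V z j

lemma nl_mono {p : ℕ} {s : ℝ} (hs : 1 < s) {a b : EE p} (ha : ∀ j, 0 ≤ a j) (hab : ∀ j, a j ≤ b j) (i : Fin p) : nl s a i ≤ nl s b i := by
  unfold nl
  have h1 : ‖a‖ ≤ ‖b‖ := norm_mono_coord (fun j => by rw [abs_of_nonneg (ha j), abs_of_nonneg ((ha j).trans (hab j))]; exact hab j)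
  have := hab i
  have := ha i
  gcongr

lemma ms_strict {n p : ℕ} (hn : 5 ≤ n) {s c : ℝ} (hs : 1 < s) (hta : 0 < ta n s) (hc : 0 < c)
    {V : EE n → EE p} {z0 : EE n} (hV : IsSol s c V z0) {l : ℝ} (hl : 0 < l) (hlz : l < ‖z0‖) (hP : MSP V z0 l) (i : Fin p) :
    (∀ z, l < ‖z‖ → z ≠ z0 → Vl l V z i < V z i) ∨ ∀ z ≠ z0, V z i = 0 := by
  by_cases h : ∀ z, l < ‖z‖ → z ≠ z0 → Vl l V z i < V z i
  · exact Or.inl h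
  right
  push Not at h
  obtain ⟨y, hy, hyz, hle⟩ := h
  have heq : Vl l V y i - V y i = 0 := by have := hP y hy hyz i; linarith
  obtain ⟨I, e⟩ := ms_formula hn hV hl hlz hy hyz i
  rw [heq] at e
  have h1 : ∫ z in {z | l < ‖z‖}, -((rk (y - z) - k2 l y z) * ((l/‖z‖)^(ta n s) * nl s (Vl l V z) i - nl s (V z) i)) = 0 := by
    rw [integral_neg]
    rcases mul_eq_zero.1 e.symm with h | h
    · linarith
    · rw [h, neg_zero]
  have pt : ∀ z, l < ‖z‖ → z ≠ z0 → (l/‖z‖)^(ta n s) * nl s (Vl l V z) i - nl s (V z) i ≤ 0 := by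
    intro z hz hzz
    have zp := hl.trans hz
    have a1 := nl_mono hs (Vl_nonneg hV.1 hl z) (hP z hz hzz) i
    have a2 := nl_nonneg (s := s) (Vl_nonneg hV.1 hl z i)
    have hlz2 : (l/‖z‖)^(ta n s) ≤ 1 := Real.rpow_le_one (by positivity) (by rw [div_le_one zp]; exact hz.le) hta.le
    nlinarith
  have hpos : 0 ≤ᵐ[volume.restrict {z : EE n | l < ‖z‖}] fun z => -((rk (y - z) - k2 l y z) * ((l/‖z‖)^(ta n s) * nl s (Vl l V z) i - nl s (V z) i)) := by
    filter_upwards [ae_restrict_mem (meas_lt_norm l), ae_restrict_of_ae (ae_ne hn z0), ae_restrict_of_ae (ae_ne hn y)] with z hz hzz hzy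
    have := k2_lt hn hl hy hz (Ne.symm hzy)
    have := pt z hz hzz
    simp only [Pi.zero_apply]
    nlinarith
  replace h1 := (integral_eq_zero_iff_of_nonneg_ae hpos I.neg).1 h1
  have : ∃ z, l < ‖z‖ ∧ z ≠ z0 ∧ V z i = 0 := by
    have hvol : volume {z : EE n | l < ‖z‖} ≠ 0 := by
      apply (IsOpen.measure_pos _ (isOpen_lt continuous_const continuous_norm) ⟨y, hy⟩).ne'
    haveI : NeBot (ae (volume.restrict {z : EE n | l < ‖z‖})) := by
      rw [ae_neBot]; simpa using hvol
    have hev := (h1.and ((ae_restrict_mem (meas_lt_norm l)).and ((ae_restrict_of_ae (ae_ne hn z0)).and (ae_restrict_of_ae (ae_ne hn y))))).exists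
    obtain ⟨z, hz1, hz, hzz, hzy⟩ := hev
    have hz : l < ‖z‖ := hz
    have zp := hl.trans hz
    refine ⟨z, hz, hzz, ?_⟩
    simp only [Pi.zero_apply, neg_eq_zero] at hz1
    rcases mul_eq_zero.1 hz1 with h | h
    · have := k2_lt hn hl hy hz (Ne.symm hzy); linarith
    · have a1 := nl_mono hs (Vl_nonneg hV.1 hl z) (hP z hz hzz) i
      have a2 := nl_nonneg (s := s) (Vl_nonneg hV.1 hl z i)
      have hlz2 : (l/‖z‖)^(ta n s) < 1 := Real.rpow_lt_one (by positivity) (by rw [div_lt_one zp]; exact hz) hta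
      have a3 : nl s (Vl l V z) i = 0 := by
        by_contra hne
        have : 0 < nl s (Vl l V z) i := lt_of_le_of_ne a2 (Ne.symm hne)
        nlinarith
      have : nl s (V z) i = 0 := by rw [a3] at h; linarith
      exact nl_eq_zero this (hV.1 z i)
  obtain ⟨z, _, hzz, hz0⟩ := this
  exact sol_zero hn hc hV hzz hz0

lemma V_bdd {n p : ℕ} {V : EE n → EE p} {z0 : EE n} (hV : ContinuousOn V {z0}ᶜ) {b : ℝ} (hb : b < ‖z0‖) :
    ∃ M, 0 < M ∧ ∀ z ∈ closedBall (0:EE n) b, ‖V z‖ ≤ M := by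
  obtain ⟨C, hC⟩ := (isCompact_closedBall (0:EE n) b).exists_bound_of_continuousOn (hV.mono (by
    rintro z hz rfl; simp at hz; linarith))
  exact ⟨max C 1, by positivity, fun z hz => (hC z hz).trans (le_max_left _ _)⟩

lemma ms_start {n p : ℕ} (hn : 5 ≤ n) {s c : ℝ} (hs : 1 < s) (hta : 0 < ta n s) (hc : 0 < c)
    {V : EE n → EE p} {z0 : EE n} (hV : IsSol s c V z0) (hz0 : z0 ≠ 0) : ∃ a > 0, ∀ l, 0 < l → l ≤ a → MSP V z0 l := by
  have zp := norm_pos_iff.2 hz0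
  obtain ⟨M, hM0, hM⟩ := V_bdd hV.2.1 (show ‖z0‖/2 < ‖z0‖ by linarith)
  obtain ⟨C, hC0, hC⟩ := ms_bound hn (m := (n:ℝ)+4) (by linarith)
  set K := c * msC p s * M^(s-1) * C with hK
  have hK0 : 0 ≤ K := by have := msC_nonneg p s; positivity
  have : Tendsto (fun l : ℝ => K * l^(4:ℝ)) (𝓝 0) (𝓝 0) := by
    have : ContinuousAt (fun l : ℝ => K * l^(4:ℝ)) 0 := by
      exact (Real.continuousAt_rpow_const 0 4 (Or.inr (by norm_num))).const_mul K
    simpa [ContinuousAt] using this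
  have hev := this.eventually (gt_mem_nhds (show (0:ℝ) < 1/2 by norm_num))
  obtain ⟨a, ha, hball⟩ := Metric.eventually_nhds_iff.1 hev
  refine ⟨min (a/2) (‖z0‖/2), by positivity, fun l hl hla => ?_⟩
  have h1 : l ≤ a/2 := hla.trans (min_le_left _ _)
  have h2 : l ≤ ‖z0‖/2 := hla.trans (min_le_right _ _)
  have h3 := hball (y := l) (by rw [dist_zero_right, Real.norm_of_nonneg hl.le]; linarith)
  refine ms_close hn hs hta hc hV hl (by linarith) (M := M) (B := C * l^((n:ℝ) - ((n:ℝ)+4)))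
    (fun z hz => hM z (closedBall_subset_closedBall h2 hz)) (meas_le_norm l) subset_rfl
    (fun z hz _ hzE => absurd hz.le hzE) ?_ ?_
  · intro y hy
    exact hC l hl y (norm_pos_iff.1 (hl.trans hy))
  · rw [show (n:ℝ) - ((n:ℝ)+4) = -4 by ring]
    have : l^(8:ℝ) * l^(-4:ℝ) = l^(4:ℝ) := by rw [← Real.rpow_add hl]; norm_num
    calc _ = K * (l^(8:ℝ) * l^(-4:ℝ)) := by rw [hK]; ring
      _ ≤ _ := by rw [this]; exact h3.le

/-- the bad set -/
def badS {n p : ℕ} (V : EE n → EE p) (z0 : EE n) (l : ℝ) : Set (EE n) := {z | l < ‖z‖ ∧ z ≠ z0 ∧ ∃ j, V z j < Vl l V z j}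

lemma badS_open {n p : ℕ} {V : EE n → EE p} {z0 : EE n} (hV : ContinuousOn V {z0}ᶜ) {l : ℝ} (hl : 0 < l) (hlz : l < ‖z0‖) :
    IsOpen (badS V z0 l) := by
  have : badS V z0 l = ⋃ j, (({z : EE n | l < ‖z‖} ∩ {z0}ᶜ) ∩ {z | V z j < Vl l V z j}) := by
    ext z; simp [badS, and_assoc]
  rw [this]
  apply isOpen_iUnion
  intro j
  have ho : IsOpen ({z : EE n | l < ‖z‖} ∩ {z0}ᶜ) := (isOpen_lt continuous_const continuous_norm).inter isOpen_compl_singleton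
  have hc1 : ContinuousOn (fun z => Vl l V z j - V z j) ({z : EE n | l < ‖z‖} ∩ {z0}ᶜ) := by
    apply ContinuousOn.sub
    · exact (EuclideanSpace.proj (𝕜 := ℝ) j).continuous.comp_continuousOn ((Vl_cont hV hl hlz).mono Set.inter_subset_left)
    · exact (EuclideanSpace.proj (𝕜 := ℝ) j).continuous.comp_continuousOn (hV.mono Set.inter_subset_right)
  have := hc1.isOpen_inter_preimage ho (isOpen_Ioi (a := (0:ℝ)))
  convert this using 2
  ext z; simp

lemma small_F {n : ℕ} (hn : 5 ≤ n) {l0 Λ t : ℝ} (hl0 : 0 < l0) (hΛ : 1 ≤ Λ) (ht : 0 < t) {F : Set (EE n)} (hF : MeasurableSet F)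
    (hFb : F ⊆ ball 0 Λ) (hFl : ∀ z ∈ F, l0 ≤ ‖z‖) {y : EE n} (hy : y ≠ 0) :
    IntegrableOn (fun z => rk (y - z) * ‖z‖^(-((n:ℝ)+4))) F ∧
    ‖y‖^((n:ℝ)-4) * ∫ z in F, rk (y - z) * ‖z‖^(-((n:ℝ)+4)) ≤
      (2*Λ)^((n:ℝ)-4) * l0^(-((n:ℝ)+4)) * (kc n * t^(4:ℝ) + (t^((4:ℝ)-n) + 1) * volume.real F) := by
  have yp := norm_pos_iff.2 hy
  have hfin : volume F ≠ ⊤ := ((measure_mono hFb).trans_lt measure_ball_lt_top).ne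
  obtain ⟨I1, b1⟩ := rk_small_set hn y ht hF hfin
  have hw : ∀ z ∈ F, ‖z‖^(-((n:ℝ)+4)) ≤ l0^(-((n:ℝ)+4)) := fun z hz => rpow_anti hl0 (hFl z hz) (by have := n4pos hn; linarith)
  have I2 : IntegrableOn (fun z => rk (y - z) * ‖z‖^(-((n:ℝ)+4))) F := by
    refine Integrable.mono' (Integrable.mul_const I1 (l0^(-((n:ℝ)+4)))) ?_ ?_
    · exact ((rk_meas.comp (measurable_const.sub measurable_id)).mul (normpow_meas _)).aestronglyMeasurable
    · filter_upwards [ae_restrict_mem hF] with z hz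
      rw [Real.norm_of_nonneg (mul_nonneg (rk_nonneg _) (by positivity))]
      exact mul_le_mul_of_nonneg_left (hw z hz) (rk_nonneg _)
  refine ⟨I2, ?_⟩
  have b2 : ∫ z in F, rk (y - z) * ‖z‖^(-((n:ℝ)+4)) ≤ (∫ z in F, rk (y - z)) * l0^(-((n:ℝ)+4)) := by
    rw [← integral_mul_const]
    exact setIntegral_mono_on I2 (Integrable.mul_const I1 _) hF (fun z hz => mul_le_mul_of_nonneg_left (hw z hz) (rk_nonneg _))
  have hn4 := n4pos hn
  have hv : 0 ≤ volume.real F := measureReal_nonneg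
  have hk := kc_nonneg n
  have hi0 : 0 ≤ ∫ z in F, rk (y - z) := integral_nonneg (fun z => rk_nonneg _)
  have main : ‖y‖^((n:ℝ)-4) * ∫ z in F, rk (y - z) ≤ (2*Λ)^((n:ℝ)-4) * (kc n * t^(4:ℝ) + (t^((4:ℝ)-n) + 1) * volume.real F) := by
    rcases le_or_gt ‖y‖ (2*Λ) with h | h
    · have : ∫ z in F, rk (y - z) ≤ kc n * t^(4:ℝ) + (t^((4:ℝ)-n) + 1) * volume.real F := by linarith
      gcongr
    · have b3 : ∫ z in F, rk (y - z) ≤ (‖y‖/2)^((4:ℝ)-n) * volume.real F := by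
        calc _ ≤ ∫ z in F, (‖y‖/2)^((4:ℝ)-n) := by
              apply setIntegral_mono_on I1 (integrableOn_const hfin) hF
              intro z hz
              apply rk_le hn (by positivity)
              have h1 := hFb hz
              rw [mem_ball_zero_iff] at h1
              have := norm_sub_norm_le y z
              linarith
          _ = _ := by simp [mul_comm]
      have e : ‖y‖^((n:ℝ)-4) * (‖y‖/2)^((4:ℝ)-n) = 2^((n:ℝ)-4) := by
        rw [show (4:ℝ)-n = -((n:ℝ)-4) by ring, Real.rpow_neg (by positivity), ← div_eq_mul_inv, ← Real.div_rpow (by positivity) (by positivity)]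
        congr 1; field_simp
      calc _ ≤ ‖y‖^((n:ℝ)-4) * ((‖y‖/2)^((4:ℝ)-n) * volume.real F) := by gcongr
        _ = 2^((n:ℝ)-4) * volume.real F := by rw [← mul_assoc, e]
        _ ≤ (2*Λ)^((n:ℝ)-4) * (kc n * t^(4:ℝ) + (t^((4:ℝ)-n) + 1) * volume.real F) := by
          gcongr
          · linarith
          · have : 0 ≤ kc n * t^(4:ℝ) := by positivity
            have : 0 ≤ t^((4:ℝ)-n) * volume.real F := by positivity
            linarith
  calc _ ≤ ‖y‖^((n:ℝ)-4) * ((∫ z in F, rk (y - z)) * l0^(-((n:ℝ)+4))) := by gcongr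
    _ = (‖y‖^((n:ℝ)-4) * (∫ z in F, rk (y - z))) * l0^(-((n:ℝ)+4)) := by ring
    _ ≤ ((2*Λ)^((n:ℝ)-4) * (kc n * t^(4:ℝ) + (t^((4:ℝ)-n) + 1) * volume.real F)) * l0^(-((n:ℝ)+4)) := by gcongr
    _ = _ := by ring

lemma ms_step {n p : ℕ} (hn : 5 ≤ n) {s c : ℝ} (hs : 1 < s) (hta : 0 < ta n s) (hc : 0 < c)
    {V : EE n → EE p} {z0 : EE n} (hV : IsSol s c V z0) {l0 b : ℝ} (hl0 : 0 < l0) (hb : l0 < b) (hbz : b < ‖z0‖)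
    (hP : MSP V z0 l0) : ∃ l, l0 < l ∧ l ≤ b ∧ MSP V z0 l := by
  obtain ⟨M, hM0, hM⟩ := V_bdd hV.2.1 hbz
  obtain ⟨C, hC0, hC⟩ := ms_bound hn (m := (n:ℝ)+4) (by linarith)
  have hb0 : 0 < b := hl0.trans hb
  set K := c * msC p s * M^(s-1) * b^(8:ℝ) with hK
  have hmsC := msC_nonneg p s
  have hK0 : 0 ≤ K := by positivity
  obtain ⟨Λ, hΛ1, hΛ2, hΛb⟩ : ∃ Λ : ℝ, 1 ≤ Λ ∧ K * (C * Λ^(-4:ℝ)) < 1/4 ∧ b < Λ := by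
    have : Tendsto (fun Λ : ℝ => K * (C * Λ^(-4:ℝ))) atTop (𝓝 0) := by
      simpa using ((tendsto_rpow_neg_atTop (show (0:ℝ) < 4 by norm_num)).const_mul C).const_mul K
    have h := (this.eventually (gt_mem_nhds (show (0:ℝ) < 1/4 by norm_num))).and ((eventually_ge_atTop 1).and (eventually_gt_atTop b))
    obtain ⟨Λ, h1, h2, h3⟩ := h.exists
    exact ⟨Λ, h2, h1, h3⟩
  set W := (2*Λ)^((n:ℝ)-4) * l0^(-((n:ℝ)+4)) with hW
  have hW0 : 0 ≤ W := by positivity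
  obtain ⟨t, ht, htK⟩ : ∃ t : ℝ, 0 < t ∧ K * W * kc n * t^(4:ℝ) < 1/8 := by
    have : ContinuousAt (fun t : ℝ => K * W * kc n * t^(4:ℝ)) 0 := (Real.continuousAt_rpow_const 0 4 (Or.inr (by norm_num))).const_mul _
    have h0 : Tendsto (fun t : ℝ => K * W * kc n * t^(4:ℝ)) (𝓝[>] 0) (𝓝 0) := by
      have := this.tendsto.mono_left (nhdsWithin_le_nhds (s := Set.Ioi 0))
      simpa using this
    obtain ⟨t, h1, h2⟩ := ((h0.eventually (gt_mem_nhds (show (0:ℝ) < 1/8 by norm_num))).and self_mem_nhdsWithin).exists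
    exact ⟨t, h2, h1⟩
  set lk : ℕ → ℝ := fun k => l0 + (b - l0) / ((k:ℝ)+1) with hlk
  have lk1 : ∀ k, l0 < lk k := fun k => by
    have : 0 < (b - l0) / ((k:ℝ)+1) := div_pos (by linarith) (by positivity)
    simp only [hlk]; linarith
  have lk2 : ∀ k, lk k ≤ b := fun k => by
    have : (b - l0) / ((k:ℝ)+1) ≤ b - l0 := div_le_self (by linarith) (by have h0 : (0:ℝ) ≤ k := k.cast_nonneg; linarith)
    simp only [hlk]; linarith
  have lklim : Tendsto lk atTop (𝓝 l0) := by
    have := (tendsto_one_div_add_atTop_nhds_zero_nat (𝕜 := ℝ)).const_mul (b - l0)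
    have := this.const_add l0
    simp only [mul_zero, add_zero] at this
    refine this.congr (fun k => ?_)
    simp only [hlk]; ring
  set F : ℕ → Set (EE n) := fun k => badS V z0 (lk k) ∩ ball 0 Λ with hF
  have Fm : ∀ k, MeasurableSet (F k) := fun k =>
    ((badS_open hV.2.1 (hl0.trans (lk1 k)) ((lk2 k).trans_lt hbz)).inter isOpen_ball).measurableSet
  have vol0 : Tendsto (fun k => volume (F k)) atTop (𝓝 0) := by
    have := tendsto_measure_of_ae_tendsto_indicator (μ := volume) atTop (A := (∅ : Set (EE n))) MeasurableSet.empty Fm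
      (B := ball 0 Λ) measurableSet_ball measure_ball_lt_top.ne (Eventually.of_forall (fun k => Set.inter_subset_right)) ?_
    · simpa using this
    haveI := EE_nontrivial hn
    have hsph : ∀ᵐ z : EE n, z ∉ sphere (0 : EE n) l0 := measure_eq_zero_iff_ae_notMem.1 (Measure.addHaar_sphere _ _ _)
    filter_upwards [hsph, ae_ne hn z0] with z hz hzz
    have hz : ‖z‖ ≠ l0 := by simpa using hz
    suffices ∀ᶠ k in atTop, ∀ j, Vl (lk k) V z j ≤ V z j ∨ ‖z‖ ≤ lk k by
      filter_upwards [this] with k hk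
      simp only [Set.mem_empty_iff_false, iff_false, hF]
      rintro ⟨⟨h1, h2, j, h3⟩, _⟩
      rcases hk j with h | h <;> linarith
    rw [eventually_all]
    intro j
    rcases lt_or_gt_of_ne hz with h | h
    · exact Eventually.of_forall (fun k => Or.inr (h.le.trans (lk1 k).le))
    · rcases ms_strict hn hs hta hc hV hl0 (hb.trans hbz) hP j with hst | hzero
      · have h1 := hst z h hzz
        have h2 : Tendsto (fun k => Vl (lk k) V z j) atTop (𝓝 (Vl l0 V z j)) := by
          have := (Vl_cont_l hV.2.1 hl0 (hb.trans hbz) h).tendsto.comp lklim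
          exact ((EuclideanSpace.proj (𝕜 := ℝ) j).continuous.tendsto _).comp this
        filter_upwards [h2.eventually (gt_mem_nhds h1)] with k hk
        exact Or.inl hk.le
      · apply Eventually.of_forall
        intro k
        by_cases hkz : ‖z‖ ≤ lk k
        · exact Or.inr hkz
        left
        have zp := norm_pos_iff.1 (hl0.trans h)
        have hkp := hl0.trans (lk1 k)
        have hne : iv (lk k) z ≠ z0 := by
          intro h
          have h1 := norm_iv (lk k) zp
          rw [h] at h1
          push Not at hkz
          have h2 : (lk k)^2/‖z‖ < lk k := by rw [div_lt_iff₀ (by linarith)]; nlinarith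
          have := lk2 k
          linarith
        rw [hzero z hzz]
        simp [Vl, hzero _ hne]
  have volr : Tendsto (fun k => K * W * (t^((4:ℝ)-n) + 1) * volume.real (F k)) atTop (𝓝 0) := by
    have := ((ENNReal.tendsto_toReal ENNReal.zero_ne_top).comp vol0).const_mul (K * W * (t^((4:ℝ)-n) + 1))
    simpa [Measure.real] using this
  obtain ⟨k, hk⟩ := (volr.eventually (gt_mem_nhds (show (0:ℝ) < 1/8 by norm_num))).exists
  have lkp := hl0.trans (lk1 k)
  refine ⟨lk k, lk1 k, lk2 k, ?_⟩
  have hdisj : Disjoint {z : EE n | Λ ≤ ‖z‖} (F k) := by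
    rw [Set.disjoint_left]
    rintro z hz ⟨_, h2⟩
    rw [mem_ball_zero_iff] at h2
    exact absurd hz (not_le.2 h2)
  refine ms_close hn hs hta hc hV lkp ((lk2 k).trans_lt hbz) (M := M)
    (B := C * Λ^(-4:ℝ) + W * (kc n * t^(4:ℝ) + (t^((4:ℝ)-n) + 1) * volume.real (F k)))
    (fun z hz => hM z (closedBall_subset_closedBall (lk2 k) hz)) (E := {z : EE n | Λ ≤ ‖z‖} ∪ F k)
    ((meas_le_norm Λ).union (Fm k)) ?_ ?_ ?_ ?_
  · rintro z (hz | hz)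
    · have := lk2 k
      have hz : Λ ≤ ‖z‖ := hz
      show lk k ≤ ‖z‖
      linarith
    · exact hz.1.1.le
  · intro z hz hzz hzE j
    by_contra h
    push Not at h
    apply hzE
    by_cases hzΛ : Λ ≤ ‖z‖
    · exact Or.inl hzΛ
    · right
      exact ⟨⟨hz, hzz, j, h⟩, by rw [mem_ball_zero_iff]; linarith⟩
  · intro y hy
    have y0 := norm_pos_iff.1 (lkp.trans hy)
    obtain ⟨i1, b1⟩ := hC Λ (by linarith) y y0
    obtain ⟨i2, b2⟩ := small_F hn hl0 hΛ1 ht (Fm k) Set.inter_subset_right (fun z hz => (lk1 k).le.trans hz.1.1.le) y0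
    refine ⟨i1.union i2, ?_⟩
    rw [setIntegral_union hdisj (Fm k) i1 i2, mul_add]
    rw [show (n:ℝ) - ((n:ℝ)+4) = -4 by ring] at b1
    linarith
  · have hkc := kc_nonneg n
    have hv : 0 ≤ volume.real (F k) := measureReal_nonneg
    have hB0 : 0 ≤ C * Λ^(-4:ℝ) + W * (kc n * t^(4:ℝ) + (t^((4:ℝ)-n) + 1) * volume.real (F k)) := by
      have : 0 < Λ := by linarith
      positivity
    calc _ ≤ c * msC p s * M^(s-1) * b^(8:ℝ) * (C * Λ^(-4:ℝ) + W * (kc n * t^(4:ℝ) + (t^((4:ℝ)-n) + 1) * volume.real (F k))) := by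
          have := lk2 k
          gcongr
      _ = K * (C * Λ^(-4:ℝ)) + K * W * kc n * t^(4:ℝ) + K * W * (t^((4:ℝ)-n) + 1) * volume.real (F k) := by rw [hK]; ring
      _ ≤ 1/2 := by linarith

theorem moving_spheres {n p : ℕ} (hn : 5 ≤ n) {s c : ℝ} (hs : 1 < s) (hta : 0 < ta n s) (hc : 0 < c)
    {V : EE n → EE p} {z0 : EE n} (hV : IsSol s c V z0) {l : ℝ} (hl : 0 < l) (hlz : l < ‖z0‖) : MSP V z0 l := by
  have hz0 : z0 ≠ 0 := norm_pos_iff.1 (hl.trans hlz)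
  obtain ⟨a, ha, hst⟩ := ms_start hn hs hta hc hV hz0
  by_cases hla : l ≤ a
  · exact hst l hl hla
  push Not at hla
  have hcl : IsClosed ({m | MSP V z0 m} ∩ Set.Icc a l) := by
    apply IsSeqClosed.isClosed
    intro x m hx hxm
    have hm : m ∈ Set.Icc a l := isClosed_Icc.mem_of_tendsto hxm (Eventually.of_forall (fun k => (hx k).2))
    refine ⟨?_, hm⟩
    intro z hz hzz j
    have h2 : Tendsto (fun k => Vl (x k) V z j) atTop (𝓝 (Vl m V z j)) := by
      have := (Vl_cont_l hV.2.1 (ha.trans_le hm.1) (hm.2.trans_lt hlz) hz).tendsto.comp hxm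
      exact ((EuclideanSpace.proj (𝕜 := ℝ) j).continuous.tendsto _).comp this
    apply le_of_tendsto h2
    filter_upwards [hxm.eventually (gt_mem_nhds hz)] with k hk
    exact (hx k).1 z hk hzz j
  have := hcl.Icc_subset_of_forall_exists_gt (hst a ha le_rfl) (by
    rintro x ⟨hx, hxi⟩ y hy
    have hy : x < y := hy
    obtain ⟨m, h1, h2, h3⟩ := ms_step hn hs hta hc hV (ha.trans_le hxi.1) (b := min y l) (lt_min hy hxi.2)
      ((min_le_right _ _).trans_lt hlz) hx
    exact ⟨m, h3, h1, h2.trans (min_le_left _ _)⟩)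
  exact this ⟨hla.le, le_rfl⟩

lemma IsSol_translate {n p : ℕ} {s c : ℝ} {V : EE n → EE p} {z0 : EE n} (hV : IsSol s c V z0) (x0 : EE n) :
    IsSol s c (fun z => V (z + x0)) (z0 - x0) := by
  refine ⟨fun z i => hV.1 _ i, ?_, ?_⟩
  · refine ContinuousOn.comp (g := V) (f := fun z => z + x0) hV.2.1 (by fun_prop) ?_
    intro z hz h
    apply hz
    have h : z + x0 = z0 := h
    simp [← h]
  · intro y hy i
    obtain ⟨I, e⟩ := hV.2.2 (y + x0) (by intro h; apply hy; simp [← h]) i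
    have hf : ∀ z, rk (y + x0 - (z + x0)) * nl s (V (z + x0)) i = rk (y - z) * nl s (V (z + x0)) i := by
      intro z; congr 2; abel
    constructor
    · have := I.comp_add_right x0
      simpa only [hf] using this
    · have := integral_add_right_eq_self (μ := volume) (fun z => rk (y + x0 - z) * nl s (V z) i) x0
      simp only [hf] at this
      rw [this]; exact e

lemma refl_ineq {n p : ℕ} (hn : 5 ≤ n) {s c : ℝ} (hs : 1 < s) (hta : 0 < ta n s) (hc : 0 < c)
    {V : EE n → EE p} (hV : IsSol s c V 0) {e b : EE n} (he : ‖e‖ = 1) (hb : inner ℝ b e < 0) (j : Fin p) :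
    V (b - (2 * inner ℝ b e) • e) j ≤ V b j := by
  set β := inner ℝ b e with hβ
  have b0 : b ≠ 0 := by rintro rfl; simp [hβ] at hb
  set N := ‖b‖^2 with hN
  set den : ℝ → ℝ := fun τ => 1 - 2*τ*β + τ^2*N with hden
  set q : ℝ → ℝ := fun τ => (1-τ^2)^2/den τ with hq
  set P : ℝ → EE n := fun τ => ((-2*β + τ*N + 2*τ - τ^3)/den τ) • e + q τ • b with hP
  have den0 : den 0 = 1 := by simp [hden]
  have q0 : q 0 = 1 := by simp [hq, den0]
  have P0 : P 0 = b - (2*β) • e := by simp [hP, q0, den0]; module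
  have hdc : Continuous den := by simp only [hden]; fun_prop
  have hqc : ContinuousAt q 0 := by
    simp only [hq]; exact ContinuousAt.div (by fun_prop) hdc.continuousAt (by simp [den0])
  have hPc : ContinuousAt P 0 := by
    simp only [hP]
    refine ContinuousAt.add (ContinuousAt.smul (f := fun τ => (-2*β + τ*N + 2*τ - τ^3)/den τ) (g := fun _ => e) ?_ continuousAt_const) (ContinuousAt.smul (f := q) (g := fun _ => b) hqc continuousAt_const)
    exact ContinuousAt.div (by fun_prop) hdc.continuousAt (by simp [den0])
  have a0 : b - (2*β) • e ≠ 0 := by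
    intro h
    have h1 : ‖b - (2*β) • e‖^2 = ‖b‖^2 := by
      rw [norm_sub_sq_real, inner_smul_right, norm_smul, he, ← hβ]
      simp [mul_pow, sq_abs]; ring
    rw [h] at h1
    have := norm_pos_iff.2 b0
    have h2 : 0 < ‖b‖^2 := by positivity
    rw [← h1] at h2; simp at h2
  have key : ∀ τ, 0 < τ → τ < 1 → (Real.sqrt (q τ))^((n:ℝ)-4) * V (P τ) j ≤ V b j := by
    intro τ h0 h1
    set t := 1/τ with ht
    have tp : 0 < t := by positivity
    set x0 := t • e with hx0
    set l := t - τ with hl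
    have ht1 : 1 < t := by rw [ht, lt_div_iff₀ h0]; linarith
    have lp : 0 < l := by rw [hl]; linarith
    have nx0 : ‖x0‖ = t := by rw [hx0, norm_smul, he, Real.norm_of_nonneg tp.le, mul_one]
    have ny2 : ‖b - x0‖^2 = t^2 - 2*t*β + N := by
      rw [norm_sub_sq_real, hx0, inner_smul_right, ← hβ, norm_smul, he, Real.norm_of_nonneg tp.le]; ring
    have hyl : l < ‖b - x0‖ := by
      apply lt_of_pow_lt_pow_left₀ 2 (norm_nonneg _)
      rw [ny2]
      have : 0 ≤ N := by positivity
      have : 0 < -(2*t*β) := by nlinarith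
      nlinarith
    have yp : 0 < ‖b - x0‖ := lp.trans hyl
    have ms := moving_spheres hn hs hta hc (IsSol_translate hV x0) lp (by rw [zero_sub, norm_neg, nx0, hl]; linarith)
    have := ms (b - x0) hyl (by rw [zero_sub, sub_eq_neg_self.ne]; exact b0) j
    simp only [Vl, PiLp.smul_apply, smul_eq_mul, sub_add_cancel] at this
    have denp : 0 < den τ := by
      simp only [hden]
      have : 0 ≤ N := by positivity
      have : 0 < -(2*τ*β) := by nlinarith
      nlinarith [sq_nonneg τ]
    have hden' : den τ = τ^2 * ‖b - x0‖^2 := by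
      rw [ny2, ht]; simp only [hden]; field_simp
    have hq' : q τ = (l/‖b - x0‖)^2 := by
      simp only [hq]; rw [hden', div_pow, hl, ht]; field_simp
    have hPe : iv l (b - x0) + x0 = P τ := by
      have h3 : (-2*β + τ*N + 2*τ - τ^3)/den τ = t - q τ * t := by
        simp only [hq, ht]
        field_simp
        simp only [hden]; ring
      simp only [hP, iv]
      rw [← hq', h3, hx0]; module
    rw [hPe] at this
    rw [hq', Real.sqrt_sq (by positivity)]
    exact this
  have hVc : ContinuousAt V (P 0) := by
    rw [P0]; exact hV.2.1.continuousAt (isOpen_compl_singleton.mem_nhds a0)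
  have hlim : ContinuousAt (fun τ => (Real.sqrt (q τ))^((n:ℝ)-4) * V (P τ) j) 0 := by
    refine ContinuousAt.mul (f := fun τ => (Real.sqrt (q τ))^((n:ℝ)-4)) (g := fun τ => V (P τ) j) ?_ ?_
    · refine ContinuousAt.rpow_const (f := fun τ => Real.sqrt (q τ)) ?_ (Or.inl (by simp [q0]))
      exact Real.continuous_sqrt.continuousAt.comp hqc
    · exact (EuclideanSpace.proj (𝕜 := ℝ) j).continuous.continuousAt.comp (ContinuousAt.comp (g := V) (f := P) hVc hPc)
  have hl2 := hlim.tendsto.mono_left (nhdsWithin_le_nhds (s := Set.Ioi 0))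
  have : (Real.sqrt (q 0))^((n:ℝ)-4) * V (P 0) j = V (b - (2*β) • e) j := by rw [q0, P0]; simp
  rw [this] at hl2
  apply le_of_tendsto hl2
  filter_upwards [Ioo_mem_nhdsGT (show (0:ℝ) < 1 by norm_num)] with τ hτ
  exact key τ hτ.1 hτ.2

theorem sol_radial {n p : ℕ} (hn : 5 ≤ n) {s c : ℝ} (hs : 1 < s) (hta : 0 < ta n s) (hc : 0 < c)
    {V : EE n → EE p} (hV : IsSol s c V 0) {a b : EE n} (hab : ‖a‖ = ‖b‖) : V a = V b := by
  have main : ∀ a b : EE n, ‖a‖ = ‖b‖ → a ≠ b → ∀ j, V a j ≤ V b j := by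
    intro a b hab hne j
    have hd : 0 < ‖a - b‖ := norm_pos_iff.2 (sub_ne_zero.2 hne)
    set e := (‖a - b‖⁻¹) • (a - b) with he
    have ne : ‖e‖ = 1 := by rw [he, norm_smul, norm_inv, norm_norm]; field_simp
    have h1 : ‖a - b‖^2 = 2*‖b‖^2 - 2 * inner ℝ a b := by
      rw [norm_sub_sq_real, hab]; ring
    have h2 : inner ℝ b e = -‖a - b‖/2 := by
      rw [he, inner_smul_right, inner_sub_right, real_inner_self_eq_norm_sq, real_inner_comm]
      field_simp; linarith
    have := refl_ineq hn hs hta hc hV ne (by rw [h2]; linarith) j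
    have h3 : b - (2 * inner ℝ b e) • e = a := by
      rw [h2, he, smul_smul, show 2 * (-‖a - b‖/2) * ‖a - b‖⁻¹ = -1 by field_simp]; module
    rwa [h3] at this
  by_cases hne : a = b
  · rw [hne]
  ext j
  exact le_antisymm (main a b hab hne j) (main b a hab.symm (Ne.symm hne) j)

/-- no nontrivial entire solutions -/
theorem sol_entire {n p : ℕ} (hn : 5 ≤ n) {s c : ℝ} (hs : 1 < s) (hta : 0 < ta n s) (hc : 0 < c)
    {V : EE n → EE p} (hV : ∀ z0, IsSol s c V z0) : ∀ z, V z = 0 := by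
  have hconst : ∀ a b, V a = V b := by
    intro a b
    set m := (1/2:ℝ) • (a + b) with hm
    have h := IsSol_translate (hV m) m
    rw [sub_self] at h
    have := sol_radial hn hs hta hc h (a := a - m) (b := b - m) (by
      have : b - m = -(a - m) := by rw [hm]; module
      rw [this, norm_neg])
    simpa using this
  intro z
  by_contra h
  obtain ⟨i, hi⟩ : ∃ i, V z i ≠ 0 := by
    by_contra h'
    push Not at h'
    apply h; ext i; simpa using h' i
  haveI := EE_nontrivial hn
  obtain ⟨w, hw⟩ := exists_ne z
  obtain ⟨I, _⟩ := (hV w).2.2 z hw.symm i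
  have : (fun y => rk (z - y) * nl s (V y) i) = fun y => rk (z - y) * nl s (V z) i := by
    ext y; rw [hconst y z]
  rw [this] at I
  apply rk_sub_not_integrable hn z
  have hne : nl s (V z) i ≠ 0 := fun h' => hi (nl_eq_zero h' ((hV w).1 z i))
  have := I.mul_const (nl s (V z) i)⁻¹
  refine this.congr (Eventually.of_forall (fun y => ?_))
  simp only; field_simp

lemma extract {n p : ℕ} {Ω : Set (EE n)} (hΩ : IsOpen Ω) (F : ℕ → EE n → EE p)
    (hb : ∀ x ∈ Ω, ∃ B : ℝ, ∀ᶠ j in atTop, ‖F j x‖ ≤ B)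
    (heq : ∀ x ∈ Ω, ∀ ε > 0, ∃ δ > 0, ∀ᶠ j in atTop, ∀ y ∈ ball x δ, ‖F j y - F j x‖ ≤ ε) :
    ∃ φ : ℕ → ℕ, StrictMono φ ∧ ∃ V : EE n → EE p, ContinuousOn V Ω ∧
      ∀ x ∈ Ω, Tendsto (fun j => F (φ j) x) atTop (𝓝 (V x)) := by
  have hU : (hyperfilter ℕ : Filter ℕ) ≤ atTop := by
    rw [← Nat.cofinite_eq_atTop]; exact hyperfilter_le_cofinite
  have hlim : ∀ x, ∃ v : EE p, x ∈ Ω → Tendsto (fun j => F j x) (hyperfilter ℕ) (𝓝 v) := by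
    intro x
    by_cases hx : x ∈ Ω
    · obtain ⟨B, hB⟩ := hb x hx
      have hmem : (closedBall (0 : EE p) B) ∈ (hyperfilter ℕ).map (fun j => F j x) := by
        have := hU hB
        rw [Ultrafilter.mem_map]
        filter_upwards [this] with j hj
        simpa using hj
      obtain ⟨v, _, hv⟩ := (isCompact_closedBall (0 : EE p) B).ultrafilter_le_nhds ((hyperfilter ℕ).map (fun j => F j x))
        (le_principal_iff.2 hmem)
      exact ⟨v, fun _ => hv⟩
    · exact ⟨0, fun h => absurd h hx⟩
  choose V hV using hlim
  have hVeq : ∀ x ∈ Ω, ∀ ε > 0, ∃ δ > 0, ball x δ ⊆ Ω ∧ (∀ᶠ j in atTop, ∀ y ∈ ball x δ, ‖F j y - F j x‖ ≤ ε) ∧ ∀ y ∈ ball x δ, ‖V y - V x‖ ≤ ε := by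
    intro x hx ε hε
    obtain ⟨δ, hδ, h⟩ := heq x hx ε hε
    obtain ⟨δ', hδ', h'⟩ := Metric.isOpen_iff.1 hΩ x hx
    refine ⟨min δ δ', by positivity, (ball_subset_ball (min_le_right _ _)).trans h', ?_, ?_⟩
    · filter_upwards [h] with j hj y hy
      exact hj y (ball_subset_ball (min_le_left _ _) hy)
    · intro y hy
      have hyΩ := h' (ball_subset_ball (min_le_right _ _) hy)
      have hy := ball_subset_ball (min_le_left _ _) hy
      apply le_of_tendsto ((hV y hyΩ).sub (hV x hx)).norm
      filter_upwards [hU h] with j hj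
      exact hj y hy
  set d := TopologicalSpace.denseSeq (EE n) with hd
  have hfr : ∀ m : ℕ, ∃ᶠ k in atTop, ∀ i ≤ m, d i ∈ Ω → ‖F k (d i) - V (d i)‖ < 1/((m:ℝ)+1) := by
    intro m
    have : ∀ᶠ k in (hyperfilter ℕ : Filter ℕ), ∀ i ≤ m, d i ∈ Ω → ‖F k (d i) - V (d i)‖ < 1/((m:ℝ)+1) := by
      refine (eventually_all_finite (Set.finite_Iic m)).2 ?_
      intro i _
      by_cases hi : d i ∈ Ω
      · have := (hV _ hi).eventually (ball_mem_nhds _ (show 0 < 1/((m:ℝ)+1) by positivity))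
        filter_upwards [this] with k hk _
        rwa [← dist_eq_norm]
      · exact Eventually.of_forall (fun k h => absurd h hi)
    exact this.frequently.filter_mono hU
  obtain ⟨φ, hφ, hφ2⟩ := extraction_forall_of_frequently hfr
  refine ⟨φ, hφ, V, ?_, ?_⟩
  · intro x hx
    apply ContinuousAt.continuousWithinAt
    rw [Metric.continuousAt_iff]
    intro ε hε
    obtain ⟨δ, hδ, _, _, h⟩ := hVeq x hx (ε/2) (by positivity)
    refine ⟨δ, hδ, fun {y} hy => ?_⟩
    rw [dist_eq_norm]
    have := h y hy
    linarith
  · intro x hx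
    rw [Metric.tendsto_atTop']
    intro ε hε
    obtain ⟨δ, hδ, hΩδ, h1, h2⟩ := hVeq x hx (ε/4) (by positivity)
    obtain ⟨i, hi⟩ := (TopologicalSpace.denseRange_denseSeq (EE n)).exists_dist_lt x hδ
    have hib : d i ∈ ball x δ := by rw [mem_ball, dist_comm]; exact hi
    have e1 := hφ.tendsto_atTop.eventually h1
    have e2 : ∀ᶠ m : ℕ in atTop, 1/((m:ℝ)+1) < ε/4 :=
      (tendsto_one_div_add_atTop_nhds_zero_nat (𝕜 := ℝ)).eventually (gt_mem_nhds (by positivity))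
    obtain ⟨N, hN⟩ := eventually_atTop.1 (e1.and (e2.and (eventually_ge_atTop i)))
    refine ⟨N, fun m hm => ?_⟩
    obtain ⟨a1, a2, a3⟩ := hN m hm.le
    have b1 := a1 (d i) hib
    have b2 := hφ2 m i a3 (hΩδ hib)
    have b3 := h2 (d i) hib
    rw [dist_eq_norm]
    calc ‖F (φ m) x - V x‖ = ‖-(F (φ m) (d i) - F (φ m) x) + (F (φ m) (d i) - V (d i)) + (V (d i) - V x)‖ := by congr 1; abel
      _ ≤ ‖F (φ m) (d i) - F (φ m) x‖ + ‖F (φ m) (d i) - V (d i)‖ + ‖V (d i) - V x‖ := by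
        refine (norm_add_le _ _).trans ?_
        gcongr
        refine (norm_add_le _ _).trans ?_
        rw [norm_neg]
      _ < ε := by linarith

lemma tail_osc {n : ℕ} (hn : 5 ≤ n) {x y y' : EE n} {σ : ℝ} (hσ : 0 < σ) (hy : y ∈ ball x σ) (hy' : y' ∈ ball x σ)
    {f : EE n → ℝ} (hf : ∀ z, 0 ≤ f z) (I : Integrable (fun z => rk (y - z) * f z)) (I' : Integrable (fun z => rk (y' - z) * f z))
    {A : Set (EE n)} (hA : MeasurableSet A) (hAx : Disjoint A (ball x (2*σ))) :
    |(∫ z in A, rk (y - z) * f z) - ∫ z in A, rk (y' - z) * f z| ≤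
      (n:ℝ) * 3 ^ n * (‖y - y'‖/σ) * ∫ z in A, rk (y' - z) * f z := by
  rw [← integral_sub I.integrableOn I'.integrableOn, ← Real.norm_eq_abs, ← integral_const_mul]
  apply norm_integral_le_of_norm_le (Integrable.const_mul I'.integrableOn _)
  filter_upwards [ae_restrict_mem hA] with z hz
  rw [← sub_mul, Real.norm_eq_abs, abs_mul, abs_of_nonneg (hf z), ← mul_assoc]
  apply mul_le_mul_of_nonneg_right _ (hf z)
  exact rk_osc hn hσ hy hy' (Set.disjoint_left.1 hAx hz)

lemma equi_one {n p : ℕ} (hn : 5 ≤ n) {s c : ℝ} (hs : 1 < s) (hc : 0 < c) {V : EE n → EE p} (hV : ∀ z i, 0 ≤ V z i)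
    {x y y' : EE n} {σ B η η' : ℝ} (hσ : 0 < σ) (hy : y ∈ ball x σ) (hy' : y' ∈ ball x σ) (i : Fin p)
    (I : Integrable (fun z => rk (y - z) * nl s (V z) i)) (I' : Integrable (fun z => rk (y' - z) * nl s (V z) i))
    (e : V y i = c * (∫ z, rk (y - z) * nl s (V z) i) + η) (e' : V y' i = c * (∫ z, rk (y' - z) * nl s (V z) i) + η')
    (hB : ∀ w ∈ ball x (2*σ), ‖V w‖ ≤ B) :
    |V y i - V y' i| ≤ 2 * c * (kc n * (3*σ)^(4:ℝ) * B^s) + (n:ℝ) * 3 ^ n * (‖y - y'‖/σ) * (B + |η'|) + |η - η'| := by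
  have hf : ∀ z, 0 ≤ nl s (V z) i := fun z => nl_nonneg (hV z i)
  have near : ∀ w ∈ ball x σ, Integrable (fun z => rk (w - z) * nl s (V z) i) → 0 ≤ (∫ z in ball x (2*σ), rk (w - z) * nl s (V z) i) ∧ ∫ z in ball x (2*σ), rk (w - z) * nl s (V z) i ≤ kc n * (3*σ)^(4:ℝ) * B^s := by
    intro w hw Iw
    refine ⟨integral_nonneg (fun z => mul_nonneg (rk_nonneg _) (hf z)), ?_⟩
    calc _ ≤ ∫ z in ball x (2*σ), rk (w - z) * B^s := by
          apply setIntegral_mono_on Iw.integrableOn (Integrable.mul_const (rk_int_bdd hn w isBounded_ball) _) measurableSet_ball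
          intro z hz
          apply mul_le_mul_of_nonneg_left _ (rk_nonneg _)
          refine (le_abs_self _).trans ((nl_abs_le hs _ _).trans ?_)
          exact Real.rpow_le_rpow (norm_nonneg _) (hB z hz) (by linarith)
      _ = (∫ z in ball x (2*σ), rk (w - z)) * B^s := integral_mul_const _ _
      _ ≤ _ := by
        have hB0 : 0 ≤ B := (norm_nonneg _).trans (hB x (mem_ball_self (by positivity)))
        gcongr
        exact rk_ball2 hn hσ hw
  obtain ⟨n1, n2⟩ := near y hy I
  obtain ⟨n3, n4⟩ := near y' hy' I'
  have far := tail_osc hn hσ hy hy' hf I I' (A := (ball x (2*σ))ᶜ) measurableSet_ball.compl disjoint_compl_left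
  have s1 := integral_add_compl (s := ball x (2*σ)) measurableSet_ball I
  have s2 := integral_add_compl (s := ball x (2*σ)) measurableSet_ball I'
  set a := ∫ z in ball x (2*σ), rk (y - z) * nl s (V z) i
  set a' := ∫ z in ball x (2*σ), rk (y' - z) * nl s (V z) i
  set t := ∫ z in (ball x (2*σ))ᶜ, rk (y - z) * nl s (V z) i
  set t' := ∫ z in (ball x (2*σ))ᶜ, rk (y' - z) * nl s (V z) i
  have ht' : c * t' ≤ B + |η'| := by
    have h1 : V y' i ≤ B := (le_abs_self _).trans ((abs_coord_le _ i).trans (hB y' (ball_subset_ball (by linarith) hy')))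
    have h2 := neg_abs_le η'
    have : 0 ≤ c * a' := by positivity
    rw [e', ← s2] at h1
    linarith
  have hk : 0 ≤ (n:ℝ) * 3 ^ n * (‖y - y'‖/σ) := by positivity
  rw [e, e', ← s1, ← s2]
  have heq : c * (a + t) + η - (c * (a' + t') + η') = c * (a - a') + c * (t - t') + (η - η') := by ring
  rw [heq]
  refine (abs_add_le _ _).trans ?_
  gcongr
  refine (abs_add_le _ _).trans ?_
  apply add_le_add
  · rw [abs_mul, abs_of_pos hc]
    have : |a - a'| ≤ 2 * (kc n * (3*σ)^(4:ℝ) * B^s) := by rw [abs_le]; constructor <;> linarith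
    calc c * |a - a'| ≤ c * (2 * (kc n * (3*σ)^(4:ℝ) * B^s)) := by gcongr
      _ = _ := by ring
  · rw [abs_mul, abs_of_pos hc]
    calc c * |t - t'| ≤ c * ((n:ℝ) * 3 ^ n * (‖y - y'‖/σ) * t') := by gcongr
      _ = (n:ℝ) * 3 ^ n * (‖y - y'‖/σ) * (c * t') := by ring
      _ ≤ _ := by gcongr

structure LocSol {n p : ℕ} (s c ρ L : ℝ) (W : EE n → EE p) (h : EE n → Fin p → ℝ) : Prop where
  rpos : 0 < ρ
  Lnn : 0 ≤ L
  nn : ∀ z i, 0 ≤ W z i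
  far : ∀ z, ρ/2 ≤ ‖z‖ → ‖W z‖ ≤ L
  zero : ∀ z, 2*ρ ≤ ‖z‖ → W z = 0
  cont : ContinuousOn W (ball 0 (2*ρ) \ {0})
  rep : ∀ x ∈ ball (0 : EE n) ρ, x ≠ 0 → ∀ i, Integrable (fun z => rk (x - z) * nl s (W z) i) ∧
    W x i = c * (∫ z, rk (x - z) * nl s (W z) i) + h x i
  hb : ∀ x ∈ ball (0 : EE n) ρ, ∀ i, |h x i| ≤ L
  hl : ∀ x ∈ ball (0 : EE n) ρ, ∀ x' ∈ ball (0 : EE n) ρ, ∀ i, |h x i - h x' i| ≤ L * ‖x - x'‖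

lemma locsol_setup {n p : ℕ} (hn : 5 ≤ n) {s : ℝ} (hs1 : (n : ℝ) / ((n : ℝ) - 4) < s) {R : ℝ} (hR : 0 < R)
    (U : Fin p → EE n → ℝ)
    (hnonneg : ∀ i, ∀ x ∈ ball (0 : EE n) R \ {0}, 0 ≤ U i x)
    (hC4 : ∀ i, ContDiffOn ℝ 4 (U i) (ball (0 : EE n) R \ {0}))
    (hsuper : ∀ i, ∀ x ∈ ball (0 : EE n) R \ {0}, 0 < -lap (U i) x)
    (hpde : ∀ i, ∀ x ∈ ball (0 : EE n) R \ {0}, bilap (U i) x = (vnorm U x) ^ (s - 1) * U i x) :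
    ∃ ρ L W h, ρ < R ∧ LocSol s (c0 n)⁻¹ ρ L W h ∧
      (∀ x ∈ ball (0 : EE n) ρ, x ≠ 0 → W x = WithLp.toLp 2 (fun i => U i x)) := by
  have h4 := n4pos hn
  have hs0 : 1 < s := lt_trans (by rw [lt_div_iff₀ h4]; linarith) hs1
  set ρ := R/5 with hρ
  have hρ0 : 0 < ρ := by positivity
  set T : EE n → EE p := fun z => WithLp.toLp 2 (fun i => U i z) with hT
  have hTv : ∀ z, vnorm U z = ‖T z‖ := by
    intro z
    rw [EuclideanSpace.norm_eq]; unfold vnorm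
    congr 1; apply Finset.sum_congr rfl; intro i _
    simp [hT]
  have hbl : ∀ i, ∀ x ∈ ball (0 : EE n) R \ {0}, bilap (U i) x = nl s (T x) i := by
    intro i x hx
    rw [hpde i x hx, hTv]; rfl
  have hpos : ∀ i, ∀ x ∈ ball (0 : EE n) R \ {0}, 0 ≤ bilap (U i) x := by
    intro i x hx
    rw [hbl i x hx]; exact nl_nonneg (hnonneg i x hx)
  have hpow : ∀ i, ∀ x ∈ ball (0 : EE n) R \ {0}, U i x ^ s ≤ bilap (U i) x := by
    intro i x hx
    rw [hbl i x hx]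
    have h0 := hnonneg i x hx
    have h1 : |T x i| ≤ ‖T x‖ := abs_coord_le _ _
    have h2 : T x i = U i x := rfl
    rw [h2, abs_of_nonneg h0] at h1
    unfold nl
    rw [h2]
    rcases h0.eq_or_lt with h0 | h0
    · rw [← h0, Real.zero_rpow (by linarith)]; simp
    · calc U i x ^ s = U i x ^ (s-1) * U i x := by
            rw [← Real.rpow_add_one h0.ne']; congr 1; ring
        _ ≤ _ := by gcongr
  have hIntg : ∀ i, IntegrableOn (bilap (U i)) (ball 0 (2*ρ)) := fun i =>
    bilap_int hn (by positivity) (by linarith) (hC4 i) (hsuper i) (hpos i)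
  have key := fun i => rep_local hn hs1 hρ0 (show 4*ρ < R by linarith) (hC4 i) (hnonneg i) (hIntg i) (hpow i)
  choose h hL hrep using key
  choose Li hLi0 hLib hLil using hL
  set S : Set (EE n) := ball 0 (2*ρ) \ {0} with hS
  have hSm : MeasurableSet S := measurableSet_ball.diff (measurableSet_singleton 0)
  have hSR : S ⊆ ball 0 R \ {0} := by
    intro z hz
    exact ⟨ball_subset_ball (by linarith) hz.1, hz.2⟩
  have hTc : ContinuousOn T (ball 0 R \ {0}) := by
    apply (PiLp.continuous_toLp 2 _).comp_continuousOn
    exact continuousOn_pi.2 (fun i => (hC4 i).continuousOn)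
  obtain ⟨M, hM⟩ := (annulus_compact (n := n) (ρ/2) (2*ρ)).exists_bound_of_continuousOn (f := T)
    (hTc.mono (fun z hz => ⟨by simp; linarith [hz.2], by
      simp; rintro rfl; have := hz.1; simp at this; linarith⟩))
  classical
  set W : EE n → EE p := S.indicator T with hW
  have hWS : ∀ z ∈ S, W z = T z := fun z hz => Set.indicator_of_mem hz _
  have hWS' : ∀ z, z ∉ S → W z = 0 := fun z hz => Set.indicator_of_notMem hz _
  have hLs : ∀ i, Li i ≤ ∑ j, Li j := fun i => Finset.single_le_sum (f := Li) (fun j _ => hLi0 j) (Finset.mem_univ i)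
  refine ⟨ρ, |M| + ∑ i, Li i, W, fun x i => h i x, by linarith, ?_, ?_⟩
  · refine ⟨hρ0, add_nonneg (abs_nonneg _) (Finset.sum_nonneg (fun i _ => hLi0 i)), ?_, ?_, ?_, ?_, ?_, ?_, ?_⟩
    · intro z i
      by_cases hz : z ∈ S
      · rw [hWS z hz]; exact hnonneg i z (hSR hz)
      · rw [hWS' z hz]; simp
    · intro z hz
      have hs0 : 0 ≤ ∑ i, Li i := Finset.sum_nonneg (fun i _ => hLi0 i)
      by_cases hz' : z ∈ S
      · rw [hWS z hz']
        have h1 := hz'.1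
        simp at h1
        have := hM z ⟨hz, h1.le⟩
        linarith [le_abs_self M]
      · rw [hWS' z hz']; simp; positivity
    · intro z hz
      apply hWS'
      intro h; have := h.1; simp at this; linarith
    · exact (hTc.mono hSR).congr hWS
    · intro x hx hx0 i
      obtain ⟨h1, h2⟩ := hrep i x hx hx0
      have hae : (S : Set (EE n)) =ᵐ[volume] ball 0 (2*ρ) := ball_ae hn _
      have e : (fun z => rk (x - z) * nl s (W z) i) = S.indicator (fun z => rk (x - z) * bilap (U i) z) := by
        funext z
        by_cases hz : z ∈ S
        · rw [Set.indicator_of_mem hz, hWS z hz, hbl i z (hSR hz)]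
        · rw [Set.indicator_of_notMem hz, hWS' z hz]; simp [nl]
      have h1' := h1.congr_set_ae hae
      refine ⟨?_, ?_⟩
      · rw [e]; exact IntegrableOn.integrable_indicator h1' hSm
      · rw [e, integral_indicator hSm, setIntegral_congr_set hae, ← h2,
          hWS x ⟨ball_subset_ball (by linarith) hx, hx0⟩]
    · intro x hx i
      exact (hLib i x hx).trans (by linarith [hLs i, abs_nonneg M])
    · intro x hx x' hx' i
      refine (hLil i x hx x' hx').trans ?_
      gcongr
      linarith [hLs i, abs_nonneg M]
  · intro x hx hx0
    exact hWS x ⟨ball_subset_ball (by linarith) hx, hx0⟩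

lemma loc_scale {n p : ℕ} (hn : 5 ≤ n) {s c ρ L : ℝ} (hs : 1 < s) {W : EE n → EE p} {h : EE n → Fin p → ℝ}
    (H : LocSol s c ρ L W h) {γ : ℝ} (hγ : γ = 4/(s-1)) (x0 : EE n) {r : ℝ} (hr : 0 < r) (y : EE n)
    (hy : x0 + r • y ∈ ball (0 : EE n) ρ) (hy0 : x0 + r • y ≠ 0) (i : Fin p) :
    Integrable (fun z => rk (y - z) * nl s (r^γ • W (x0 + r • z)) i) ∧
    (r^γ • W (x0 + r • y)) i = c * (∫ z, rk (y - z) * nl s (r^γ • W (x0 + r • z)) i) + r^γ * h (x0 + r • y) i := by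
  obtain ⟨h1, h2⟩ := H.rep _ hy hy0 i
  set x := x0 + r • y with hx
  set g : EE n → ℝ := fun z => rk (x - z) * nl s (W z) i with hg
  have hγs : γ * s = γ + 4 := by
    rw [hγ]; field_simp [show s - 1 ≠ 0 by linarith]; ring
  have e : (fun z => rk (y - z) * nl s (r^γ • W (x0 + r • z)) i) = fun z => r^(γ+n) * g (x0 + r • z) := by
    funext z
    rw [nl_smul (by positivity), ← Real.rpow_mul hr.le, hγs]
    have e1 : x - (x0 + r • z) = r • (y - z) := by rw [hx, smul_sub]; abel
    simp only [hg]
    rw [e1]; unfold rk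
    rw [normpow_smul hr, show γ + 4 = (γ + n) + (4 - n) by ring, Real.rpow_add hr (γ+n) (4-n)]
    ring
  have hi : Integrable (fun z => g (x0 + r • z)) := by
    have := (h1.comp_add_left x0)
    exact this.comp_smul hr.ne'
  have hii : ∫ z, g (x0 + r • z) = r^(-(n:ℝ)) * ∫ z, g z := by
    have := Measure.integral_comp_smul (volume : Measure (EE n)) (fun z => g (x0 + z)) r
    rw [this, integral_add_left_eq_self]
    simp only [finrank_euclideanSpace, Fintype.card_fin, smul_eq_mul]
    rw [abs_of_pos (by positivity), Real.rpow_neg hr.le, Real.rpow_natCast]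
  refine ⟨by rw [e]; exact Integrable.const_mul hi _, ?_⟩
  rw [e, integral_const_mul, hii, PiLp.smul_apply, h2, smul_eq_mul, ← mul_assoc (r^(γ+n)), ← Real.rpow_add hr]
  rw [show γ + n + -(n:ℝ) = γ by ring]
  ring

lemma equi_seq {n p : ℕ} (hn : 5 ≤ n) {s c : ℝ} (hs : 1 < s) (hc : 0 < c) {F : ℕ → EE n → EE p}
    (hF : ∀ j z i, 0 ≤ F j z i) {x : EE n} {σ0 B : ℝ} (hσ0 : 0 < σ0) {e : ℕ → ℝ} (he : Tendsto e atTop (𝓝 0))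
    (hB : ∀ᶠ j in atTop, ∀ w ∈ ball x (2*σ0), ‖F j w‖ ≤ B)
    (hrep : ∀ᶠ j in atTop, ∀ y ∈ ball x σ0, ∀ i, Integrable (fun z => rk (y - z) * nl s (F j z) i) ∧
      ∃ η, |η| ≤ e j ∧ F j y i = c * (∫ z, rk (y - z) * nl s (F j z) i) + η) :
    ∀ ε > 0, ∃ δ > 0, ∀ᶠ j in atTop, ∀ y ∈ ball x δ, ‖F j y - F j x‖ ≤ ε := by
  intro ε hε
  set B' := max B 0 with hB'
  have hB'0 : 0 ≤ B' := le_max_right _ _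
  set P : ℝ := (p:ℝ) + 1 with hP
  have hP0 : 0 < P := by positivity
  -- choose σ
  have ht : Tendsto (fun σ : ℝ => 2 * c * (kc n * (3*σ)^(4:ℝ) * B'^s)) (𝓝[>] 0) (𝓝 0) := by
    have : Continuous (fun σ : ℝ => 2 * c * (kc n * (3*σ)^(4:ℝ) * B'^s)) := by
      have := (Real.continuous_rpow_const (q := 4) (by norm_num)).comp (continuous_const.mul continuous_id : Continuous (fun σ : ℝ => 3*σ))
      have := ((continuous_const (y := kc n)).mul this).mul (continuous_const (y := B'^s))
      exact (continuous_const (y := 2*c)).mul this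
    have h := (this.tendsto 0).mono_left (nhdsWithin_le_nhds (s := Set.Ioi 0))
    have h0 : 2 * c * (kc n * (3*(0:ℝ))^(4:ℝ) * B'^s) = 0 := by norm_num
    rwa [h0] at h
  have hε3 : 0 < ε/(3*P) := by positivity
  have hev := (ht.eventually (gt_mem_nhds hε3)).and (Ioo_mem_nhdsGT hσ0)
  obtain ⟨σ, hσ1, hσ2⟩ := hev.exists
  have hσp : 0 < σ := hσ2.1
  set δ := min σ (ε/(3*P) * σ / ((n:ℝ)*3^n * (B' + 1) + 1)) with hδ
  have hd0 : 0 < (n:ℝ)*3^n * (B' + 1) + 1 := by positivity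
  have hδ0 : 0 < δ := by positivity
  refine ⟨δ, hδ0, ?_⟩
  have he1 : ∀ᶠ j in atTop, 2 * e j < min 1 (ε/(3*P)) := by
    have := he.const_mul 2
    simp only [mul_zero] at this
    exact this.eventually (gt_mem_nhds (by positivity))
  filter_upwards [hB, hrep, he1] with j hBj hj hej y hy
  have hyσ : y ∈ ball x σ := ball_subset_ball (min_le_left _ _) hy
  have hxσ : x ∈ ball x σ := mem_ball_self hσp
  have hcoord : ∀ i, |(F j y - F j x) i| ≤ ε/P := by
    intro i
    obtain ⟨I, η, hη, E⟩ := hj y (ball_subset_ball hσ2.2.le hyσ) i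
    obtain ⟨I', η', hη', E'⟩ := hj x (mem_ball_self hσ0) i
    have := equi_one hn hs hc (hF j) hσp hyσ hxσ i I I' E E' (B := B')
      (fun w hw => (hBj w (ball_subset_ball (by linarith [hσ2.2]) hw)).trans (le_max_left _ _))
    rw [PiLp.sub_apply]
    have m1 := min_le_left 1 (ε/(3*P))
    have m2 := min_le_right 1 (ε/(3*P))
    have t3 : |η - η'| ≤ ε/(3*P) := by
      have := abs_sub η η'
      linarith
    have hyx : ‖y - x‖ ≤ ε/(3*P) * σ / ((n:ℝ)*3^n * (B' + 1) + 1) := by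
      rw [← dist_eq_norm]; exact (mem_ball.1 hy).le.trans (min_le_right _ _)
    have hη1 : |η'| ≤ 1 := by
      have := abs_nonneg η'
      linarith
    have t2 : (n:ℝ) * 3 ^ n * (‖y - x‖/σ) * (B' + |η'|) ≤ ε/(3*P) := by
      rw [le_div_iff₀ hd0] at hyx
      have h1 : (n:ℝ) * 3 ^ n * (‖y - x‖/σ) * (B' + |η'|) ≤ (n:ℝ) * 3 ^ n * (‖y - x‖/σ) * (B' + 1) := by gcongr
      refine h1.trans ?_
      have : (n:ℝ) * 3 ^ n * (‖y - x‖/σ) * (B' + 1) = (‖y-x‖ * ((n:ℝ)*3^n * (B' + 1)))/σ := by ring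
      rw [this, div_le_iff₀ hσp]
      nlinarith [norm_nonneg (y - x)]
    have hsplit : ε/P = ε/(3*P) + ε/(3*P) + ε/(3*P) := by field_simp; ring
    rw [hsplit]
    linarith
  refine (norm_le_sum _).trans ((Finset.sum_le_sum (fun i _ => hcoord i)).trans ?_)
  simp only [Finset.sum_const, Finset.card_univ, Fintype.card_fin, nsmul_eq_mul]
  rw [mul_div_assoc', div_le_iff₀ hP0, hP]
  nlinarith

lemma limit_entire {n p : ℕ} (hn : 5 ≤ n) {s c : ℝ} (hs : 1 < s) (hc : 0 < c) {F : ℕ → EE n → EE p}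
    (hF : ∀ j z i, 0 ≤ F j z i) {B : ℝ} {e : ℕ → ℝ} (he : Tendsto e atTop (𝓝 0))
    (hrep : ∀ r > 0, ∀ᶠ j in atTop, ∀ y ∈ ball (0 : EE n) r, ‖F j y‖ ≤ B ∧ ContinuousOn (F j) (ball 0 r) ∧ ∀ i, Integrable (fun z => rk (y - z) * nl s (F j z) i) ∧
      ∃ η, |η| ≤ e j ∧ F j y i = c * (∫ z, rk (y - z) * nl s (F j z) i) + η)
    {V : EE n → EE p} (hVc : Continuous V) (hV : ∀ x, Tendsto (fun j => F j x) atTop (𝓝 (V x))) :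
    ∀ z0, IsSol s c V z0 := by
  have hco : ∀ z i, Tendsto (fun j => F j z i) atTop (𝓝 (V z i)) := fun z i =>
    (((EuclideanSpace.proj (𝕜 := ℝ) i).continuous.tendsto (V z)).comp (hV z))
  have hVnn : ∀ z i, 0 ≤ V z i := fun z i => ge_of_tendsto' (hco z i) (fun j => hF j z i)
  have hnlnn : ∀ z i, 0 ≤ nl s (V z) i := fun z i => nl_nonneg (hVnn z i)
  have hnlc : ∀ i, Continuous (fun z => nl s (V z) i) := fun i => (nl_cont hs i).comp hVc
  -- limit on balls
  have hball : ∀ i, ∀ y : EE n, ∀ r > 0, Tendsto (fun j => ∫ z in ball (0 : EE n) r, rk (y - z) * nl s (F j z) i) atTop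
      (𝓝 (∫ z in ball (0 : EE n) r, rk (y - z) * nl s (V z) i)) := by
    intro i y r hr
    apply tendsto_integral_filter_of_dominated_convergence (fun z => rk (y - z) * |B|^s)
    · filter_upwards [hrep r hr] with j hj
      have hcj := (hj 0 (mem_ball_self hr)).2.1
      apply AEStronglyMeasurable.mul
      · exact (rk_meas.comp (measurable_const.sub measurable_id)).aestronglyMeasurable
      · exact ((nl_cont hs i).comp_continuousOn hcj).aestronglyMeasurable measurableSet_ball
    · filter_upwards [hrep r hr] with j hj
      filter_upwards [ae_restrict_mem measurableSet_ball] with z hz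
      rw [norm_mul, Real.norm_eq_abs, Real.norm_eq_abs, abs_of_nonneg (rk_nonneg _)]
      gcongr
      · exact rk_nonneg _
      · refine (nl_abs_le hs _ _).trans ?_
        gcongr
        exact (hj z hz).1.trans (le_abs_self B)
    · exact Integrable.mul_const (rk_int_bdd hn y isBounded_ball) _
    · apply Eventually.of_forall
      intro z
      exact (((nl_cont hs i).tendsto _).comp (hV z)).const_mul _
  -- tail limit
  set T : Fin p → EE n → ℝ → ℝ := fun i y r => (V y i - c * ∫ z in ball (0 : EE n) r, rk (y - z) * nl s (V z) i) with hT
  have htail : ∀ i, ∀ y : EE n, ∀ r > 0, ‖y‖ < r → Tendsto (fun j => c * ∫ z in (ball (0 : EE n) r)ᶜ, rk (y - z) * nl s (F j z) i) atTop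
      (𝓝 (T i y r)) := by
    intro i y r hr hyr
    have h1 := (hco y i).sub ((hball i y r hr).const_mul c)
    rw [← tendsto_sub_nhds_zero_iff] at h1 ⊢
    apply squeeze_zero_norm' (a := fun j => |F j y i - c * (∫ z in ball (0 : EE n) r, rk (y - z) * nl s (F j z) i) - T i y r| + e j)
    · filter_upwards [hrep r hr] with j hj
      obtain ⟨I, η, hη, E⟩ := (hj y (by simpa using hyr)).2.2 i
      have := integral_add_compl (measurableSet_ball (x := (0 : EE n)) (ε := r)) I
      rw [← this, mul_add] at E
      rw [Real.norm_eq_abs]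
      have e1 : c * (∫ z in (ball (0 : EE n) r)ᶜ, rk (y - z) * nl s (F j z) i) - T i y r
        = (F j y i - c * (∫ z in ball (0 : EE n) r, rk (y - z) * nl s (F j z) i) - T i y r) - η := by rw [E]; ring
      rw [e1]
      exact (abs_sub _ _).trans (by linarith)
    · have := h1.abs.add he
      simpa using this
  have hTnn : ∀ i, ∀ y : EE n, ∀ r > 0, ‖y‖ < r → 0 ≤ T i y r := by
    intro i y r hr hyr
    apply ge_of_tendsto' (htail i y r hr hyr)
    intro j
    apply mul_nonneg hc.le
    apply integral_nonneg
    intro z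
    exact mul_nonneg (rk_nonneg _) (nl_nonneg (hF j z i))
  have hfnn : ∀ i, ∀ y z : EE n, 0 ≤ rk (y - z) * nl s (V z) i := fun i y z => mul_nonneg (rk_nonneg _) (hnlnn z i)
  have hIball : ∀ i, ∀ y : EE n, ∀ r : ℝ, IntegrableOn (fun z => rk (y - z) * nl s (V z) i) (ball 0 r) := by
    intro i y r
    obtain ⟨M, hM⟩ := (isCompact_closedBall (0 : EE n) r).exists_bound_of_continuousOn (hnlc i).continuousOn
    apply Integrable.mono' (Integrable.mul_const (rk_int_bdd hn y (isBounded_ball (x := (0 : EE n)) (r := r))) M)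
    · exact (AEStronglyMeasurable.mul ((rk_meas.comp (measurable_const.sub measurable_id)).aestronglyMeasurable) (hnlc i).aestronglyMeasurable)
    · filter_upwards [ae_restrict_mem measurableSet_ball] with z hz
      rw [norm_mul, Real.norm_eq_abs, abs_of_nonneg (rk_nonneg _)]
      exact mul_le_mul_of_nonneg_left (hM z (ball_subset_closedBall hz)) (rk_nonneg _)
  have hcov : AECover (volume : Measure (EE n)) (atTop : Filter ℕ) (fun k : ℕ => ball (0 : EE n) (k:ℝ)) :=
    aecover_ball tendsto_natCast_atTop_atTop
  have hInt : ∀ i, ∀ y : EE n, Integrable (fun z => rk (y - z) * nl s (V z) i) := by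
    intro i y
    apply hcov.integrable_of_integral_bounded_of_nonneg_ae (V y i / c)
    · intro k; exact hIball i y k
    · exact Eventually.of_forall (hfnn i y)
    · have h1 : ∀ᶠ k : ℕ in atTop, ‖y‖ + 1 ≤ (k:ℝ) := tendsto_natCast_atTop_atTop.eventually_ge_atTop _
      filter_upwards [h1] with k hk
      have := hTnn i y k (by linarith [norm_nonneg y]) (by linarith)
      rw [le_div_iff₀ hc]
      simp only [hT] at this
      linarith
  set κ : Fin p → EE n → ℝ := fun i y => V y i - c * ∫ z, rk (y - z) * nl s (V z) i with hκ
  have hTκ : ∀ i y, Tendsto (fun k : ℕ => T i y k) atTop (𝓝 (κ i y)) := by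
    intro i y
    exact tendsto_const_nhds.sub ((hcov.integral_tendsto_of_countably_generated (hInt i y)).const_mul c)
  have hκnn : ∀ i y, 0 ≤ κ i y := by
    intro i y
    apply ge_of_tendsto (hTκ i y)
    have h1 : ∀ᶠ k : ℕ in atTop, ‖y‖ + 1 ≤ (k:ℝ) := tendsto_natCast_atTop_atTop.eventually_ge_atTop _
    filter_upwards [h1] with k hk
    exact hTnn i y k (by linarith [norm_nonneg y]) (by linarith)
  have hκc : ∀ i y y', κ i y = κ i y' := by
    intro i y y'
    have hosc : ∀ᶠ k : ℕ in atTop, |T i y k - T i y' k| ≤ (n:ℝ) * 3 ^ n * (‖y - y'‖/((k:ℝ)/2)) * T i y' k := by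
      have h1 : ∀ᶠ k : ℕ in atTop, 2*(‖y‖ + ‖y'‖ + 1) ≤ (k:ℝ) := tendsto_natCast_atTop_atTop.eventually_ge_atTop _
      filter_upwards [h1] with k hk
      have n1 := norm_nonneg y
      have n2 := norm_nonneg y'
      have hk0 : (0:ℝ) < k := by linarith
      have L1 := htail i y k hk0 (by linarith)
      have L2 := htail i y' k hk0 (by linarith)
      apply le_of_tendsto_of_tendsto (L1.sub L2).abs (L2.const_mul _)
      filter_upwards [hrep k hk0] with j hj
      obtain ⟨I, -⟩ := (hj y (by simp; linarith)).2.2 i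
      obtain ⟨I', -⟩ := (hj y' (by simp; linarith)).2.2 i
      have := tail_osc hn (x := 0) (y := y) (y' := y') (σ := (k:ℝ)/2) (by positivity) (by simp; linarith) (by simp; linarith)
        (f := fun z => nl s (F j z) i) (fun z => nl_nonneg (hF j z i)) I I' (A := (ball (0 : EE n) (k:ℝ))ᶜ)
        measurableSet_ball.compl (by
          rw [show 2*((k:ℝ)/2) = k by ring]; exact disjoint_compl_left)
      have h2 := mul_le_mul_of_nonneg_left this hc.le
      rw [← mul_sub, abs_mul, abs_of_pos hc]
      linarith
    have hr : Tendsto (fun k : ℕ => (n:ℝ) * 3 ^ n * (‖y - y'‖/((k:ℝ)/2)) * T i y' k) atTop (𝓝 0) := by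
      have h0 : Tendsto (fun k : ℕ => ‖y - y'‖/((k:ℝ)/2)) atTop (𝓝 0) :=
        tendsto_const_nhds.div_atTop (tendsto_natCast_atTop_atTop.atTop_div_const (by norm_num))
      have := (h0.const_mul ((n:ℝ) * 3 ^ n)).mul (hTκ i y')
      simpa using this
    have := le_of_tendsto_of_tendsto ((hTκ i y).sub (hTκ i y')).abs hr hosc
    have := abs_nonpos_iff.1 this
    linarith
  have hκ0 : ∀ i y, κ i y = 0 := by
    intro i y
    by_contra hne
    have hpos : 0 < κ i y := lt_of_le_of_ne (hκnn i y) (Ne.symm hne)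
    have hlow : ∀ z, κ i y ≤ V z i := by
      intro z
      rw [hκc i y z]
      have : 0 ≤ c * ∫ w, rk (z - w) * nl s (V w) i := mul_nonneg hc.le (integral_nonneg (hfnn i z))
      simp only [hκ]; linarith
    have hnl : ∀ z, (κ i y)^s ≤ nl s (V z) i := by
      intro z
      unfold nl
      have h1 := hlow z
      have h2 : V z i ≤ ‖V z‖ := (le_abs_self _).trans (abs_coord_le _ _)
      calc (κ i y)^s = (κ i y)^(s-1) * κ i y := by
            rw [← Real.rpow_add_one hpos.ne']; congr 1; ring
        _ ≤ _ := by gcongr; linarith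
    apply rk_sub_not_integrable hn y
    have hp : 0 < (κ i y)^s := by positivity
    apply Integrable.mono' (Integrable.const_mul (hInt i y) ((κ i y)^s)⁻¹)
    · exact (rk_meas.comp (measurable_const.sub measurable_id)).aestronglyMeasurable
    · apply Eventually.of_forall
      intro z
      rw [Real.norm_eq_abs, abs_of_nonneg (rk_nonneg _)]
      rw [← div_eq_inv_mul, le_div_iff₀ hp]
      exact mul_le_mul_of_nonneg_left (hnl z) (rk_nonneg _)
  intro z0
  refine ⟨hVnn, hVc.continuousOn, fun y _ i => ⟨hInt i y, ?_⟩⟩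
  have := hκ0 i y
  simp only [hκ] at this
  linarith

lemma doubling {n p : ℕ} {s c ρ L : ℝ} {W : EE n → EE p} {h : EE n → Fin p → ℝ}
    (H : LocSol s c ρ L W h) {γ : ℝ} (hγ : 0 < γ) {x : EE n} (hx0 : x ≠ 0) (hx : ‖x‖ < ρ/2) {N : ℝ} (hN : 0 < N)
    (hbig : (2*N)^γ < ‖x‖^γ * ‖W x‖) :
    ∃ y : EE n, ∃ r : ℝ, 0 < r ∧ N * r < ρ ∧ r^γ * ‖W y‖ = 1 ∧ ∀ z, ‖z‖ < N/2 →
      y + r • z ∈ ball (0 : EE n) ρ ∧ y + r • z ≠ 0 ∧ r^γ * ‖W (y + r • z)‖ ≤ 2^γ := by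
  have hρ := H.rpos
  set d := ‖x‖/2 with hd
  have hxp : 0 < ‖x‖ := norm_pos_iff.2 hx0
  have hd0 : 0 < d := by positivity
  have hsub : ∀ z ∈ closedBall x d, z ∈ ball (0 : EE n) ρ ∧ z ≠ 0 := by
    intro z hz
    rw [mem_closedBall, dist_eq_norm] at hz
    have h1 : ‖z‖ ≤ ‖z - x‖ + ‖x‖ := by simpa using norm_add_le (z - x) x
    have h2 : ‖x‖ ≤ ‖z - x‖ + ‖z‖ := by
      have := norm_sub_le z (z - x)
      rw [show z - (z - x) = x by abel] at this; linarith
    constructor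
    · simp; linarith
    · rintro rfl; simp at h2 hz; linarith
  have hWc : ContinuousOn W (closedBall x d) := H.cont.mono (fun z hz =>
    ⟨ball_subset_ball (by linarith) (hsub z hz).1, (hsub z hz).2⟩)
  have hgc : ContinuousOn (fun z => (d - ‖z - x‖)^γ * ‖W z‖) (closedBall x d) := by
    apply ContinuousOn.mul
    · apply Continuous.continuousOn
      exact (Real.continuous_rpow_const hγ.le).comp (continuous_const.sub (continuous_id.sub continuous_const).norm)
    · exact hWc.norm
  obtain ⟨y, hy, hmax⟩ := (isCompact_closedBall x d).exists_isMaxOn ⟨x, mem_closedBall_self hd0.le⟩ hgc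
  have h1 := hmax (mem_closedBall_self hd0.le)
  simp only [Set.mem_setOf_eq, sub_self, norm_zero, sub_zero] at h1
  have hyd : ‖y - x‖ ≤ d := by rwa [← dist_eq_norm]
  set a := d - ‖y - x‖ with ha
  have ha0 : 0 ≤ a := by linarith
  have hNd : N^γ < d^γ * ‖W x‖ := by
    rw [Real.mul_rpow (by norm_num) hN.le] at hbig
    have : ‖x‖^γ = 2^γ * d^γ := by rw [← Real.mul_rpow (by norm_num) hd0.le, hd]; congr 1; ring
    rw [this] at hbig
    have h2 : (0:ℝ) < 2^γ := by positivity
    nlinarith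
  have hNy : N^γ < a^γ * ‖W y‖ := lt_of_lt_of_le hNd h1
  have hM : 0 < ‖W y‖ := by
    by_contra hM
    have : ‖W y‖ = 0 := le_antisymm (not_lt.1 hM) (norm_nonneg _)
    rw [this, mul_zero] at hNy
    have : 0 < N^γ := by positivity
    linarith
  set r := ‖W y‖^(-(1/γ)) with hr
  have hr0 : 0 < r := by positivity
  have hrM : r^γ * ‖W y‖ = 1 := by
    rw [hr, ← Real.rpow_mul hM.le, show -(1/γ)*γ = -1 by field_simp, Real.rpow_neg_one]
    field_simp
  have hNa : N * r < a := by
    by_contra hcon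
    push Not at hcon
    have h3 : a^γ ≤ (N*r)^γ := Real.rpow_le_rpow ha0 hcon hγ.le
    rw [Real.mul_rpow hN.le hr0.le] at h3
    have : a^γ * ‖W y‖ ≤ N^γ * (r^γ * ‖W y‖) := by nlinarith
    rw [hrM, mul_one] at this
    linarith
  have had : a ≤ d := by have := norm_nonneg (y - x); linarith
  refine ⟨y, r, hr0, by linarith, hrM, fun z hz => ?_⟩
  have hz1 : ‖r • z‖ ≤ a/2 := by
    rw [norm_smul, Real.norm_eq_abs, abs_of_pos hr0]
    nlinarith
  have hz2 : ‖y + r • z - x‖ ≤ ‖y - x‖ + a/2 := by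
    rw [show y + r • z - x = (y - x) + r • z by abel]
    exact (norm_add_le _ _).trans (by linarith)
  have hmem : y + r • z ∈ closedBall x d := by
    rw [mem_closedBall, dist_eq_norm]; linarith
  refine ⟨(hsub _ hmem).1, (hsub _ hmem).2, ?_⟩
  have h5 := hmax hmem
  simp only [Set.mem_setOf_eq] at h5
  have ha1 : 0 < a := by nlinarith
  have h6 : (a/2)^γ ≤ (d - ‖y + r • z - x‖)^γ := Real.rpow_le_rpow (by positivity) (by linarith) hγ.le
  have h7 : (a/2)^γ * ‖W (y + r • z)‖ ≤ a^γ * ‖W y‖ :=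
    (mul_le_mul_of_nonneg_right h6 (norm_nonneg _)).trans h5
  rw [Real.div_rpow ha0 (by norm_num)] at h7
  have h8 : 0 < a^γ := by positivity
  have h9 : (0:ℝ) < 2^γ := by positivity
  have h10 : ‖W (y + r • z)‖ ≤ 2^γ * ‖W y‖ := by
    rw [div_mul_eq_mul_div, div_le_iff₀ h9] at h7
    have : a^γ * ‖W (y + r • z)‖ ≤ a^γ * (2^γ * ‖W y‖) := by linarith
    exact le_of_mul_le_mul_left this h8
  calc r^γ * ‖W (y + r • z)‖ ≤ r^γ * (2^γ * ‖W y‖) := by gcongr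
    _ = 2^γ * (r^γ * ‖W y‖) := by ring
    _ = 2^γ := by rw [hrM, mul_one]

lemma upper_bound {n p : ℕ} (hn : 5 ≤ n) {s c ρ L : ℝ} (hs : 1 < s) (hta : 0 < ta n s) (hc : 0 < c)
    {W : EE n → EE p} {h : EE n → Fin p → ℝ} (H : LocSol s c ρ L W h) {γ : ℝ} (hγ : γ = 4/(s-1)) :
    ∃ C, 0 ≤ C ∧ ∀ x : EE n, x ≠ 0 → ‖W x‖ ≤ C * ‖x‖^(-γ) := by
  have hγ0 : 0 < γ := by rw [hγ]; apply div_pos (by norm_num); linarith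
  have hρ := H.rpos
  suffices hmain : ∃ C, ∀ x : EE n, x ≠ 0 → ‖x‖ < ρ/2 → ‖x‖^γ * ‖W x‖ ≤ C by
    obtain ⟨C, hC⟩ := hmain
    refine ⟨|C| + (2*ρ)^γ * L, by have := H.Lnn; positivity, fun x hx => ?_⟩
    have hxp : 0 < ‖x‖ := norm_pos_iff.2 hx
    have hxg : 0 < ‖x‖^γ := by positivity
    rw [Real.rpow_neg hxp.le, ← div_eq_mul_inv, le_div_iff₀ hxg]
    have hL := H.Lnn
    rcases lt_or_ge ‖x‖ (ρ/2) with h1 | h1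
    · have := hC x hx h1
      have h2 : 0 ≤ (2*ρ)^γ * L := by positivity
      linarith [le_abs_self C]
    · rcases lt_or_ge ‖x‖ (2*ρ) with h2 | h2
      · have h3 := H.far x h1
        have h4 : ‖x‖^γ ≤ (2*ρ)^γ := Real.rpow_le_rpow hxp.le h2.le hγ0.le
        have h5 : ‖W x‖ * ‖x‖^γ ≤ L * (2*ρ)^γ := by gcongr
        linarith [abs_nonneg C]
      · rw [H.zero x h2]; simp; positivity
  by_contra hcon
  push Not at hcon
  have hex : ∀ j : ℕ, ∃ y : EE n, ∃ r : ℝ, 0 < r ∧ ((j:ℝ)+1) * r < ρ ∧ r^γ * ‖W y‖ = 1 ∧ ∀ z, ‖z‖ < ((j:ℝ)+1)/2 →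
      y + r • z ∈ ball (0 : EE n) ρ ∧ y + r • z ≠ 0 ∧ r^γ * ‖W (y + r • z)‖ ≤ 2^γ := by
    intro j
    obtain ⟨x, hx0, hx, hb⟩ := hcon ((2*((j:ℝ)+1))^γ)
    exact doubling H hγ0 hx0 hx (by positivity) hb
  choose Y r hr0 hrN hr1 hY using hex
  set F : ℕ → EE n → EE p := fun j z => (r j)^γ • W (Y j + r j • z) with hF
  have hFn : ∀ j z, ‖F j z‖ = (r j)^γ * ‖W (Y j + r j • z)‖ := by
    intro j z
    simp only [hF]
    rw [norm_smul, Real.norm_eq_abs, abs_of_pos (by have := hr0 j; positivity)]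
  have hFnn : ∀ j z i, 0 ≤ F j z i := by
    intro j z i
    simp only [hF, PiLp.smul_apply, smul_eq_mul]
    exact mul_nonneg (by have := hr0 j; positivity) (H.nn _ _)
  set e : ℕ → ℝ := fun j => (r j)^γ * L with he
  have hrt : Tendsto r atTop (𝓝 0) := by
    apply squeeze_zero (fun j => (hr0 j).le) (g := fun j : ℕ => ρ / ((j:ℝ)+1))
    · intro j
      rw [le_div_iff₀ (by positivity)]; linarith [hrN j]
    · exact tendsto_const_nhds.div_atTop (tendsto_natCast_atTop_atTop.atTop_add tendsto_const_nhds)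
  have het : Tendsto e atTop (𝓝 0) := by
    have h1 := ((Real.continuous_rpow_const hγ0.le).tendsto 0).comp hrt
    rw [Real.zero_rpow hγ0.ne'] at h1
    have := h1.mul_const L
    simpa using this
  have hcontF : ∀ (j : ℕ) (t : ℝ), t ≤ ((j:ℝ)+1)/2 → ContinuousOn (F j) (ball 0 t) := by
    intro j t ht
    refine ContinuousOn.const_smul (g := fun z => W (Y j + r j • z)) ?_ ((r j)^γ)
    apply H.cont.comp (Continuous.continuousOn (continuous_const.add (continuous_id.const_smul (r j))))
    intro z hz
    have hz' : ‖z‖ < ((j:ℝ)+1)/2 := by simp at hz; linarith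
    exact ⟨ball_subset_ball (by linarith) (hY j z hz').1, (hY j z hz').2.1⟩
  have hrep : ∀ t > 0, ∀ᶠ j in atTop, ∀ y ∈ ball (0 : EE n) t, ‖F j y‖ ≤ 2^γ ∧ ContinuousOn (F j) (ball 0 t) ∧
      ∀ i, Integrable (fun z => rk (y - z) * nl s (F j z) i) ∧
      ∃ η, |η| ≤ e j ∧ F j y i = c * (∫ z, rk (y - z) * nl s (F j z) i) + η := by
    intro t ht
    have h1 : ∀ᶠ j : ℕ in atTop, 2*t ≤ (j:ℝ) := tendsto_natCast_atTop_atTop.eventually_ge_atTop _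
    filter_upwards [h1] with j hj y hy
    have hy' : ‖y‖ < ((j:ℝ)+1)/2 := by simp at hy; linarith
    obtain ⟨m1, m2, m3⟩ := hY j y hy'
    refine ⟨by rw [hFn]; exact m3, hcontF j t (by linarith), fun i => ?_⟩
    obtain ⟨I, E⟩ := loc_scale hn hs H hγ (Y j) (hr0 j) y m1 m2 i
    refine ⟨I, _, ?_, E⟩
    have hp : 0 < (r j)^γ := by have := hr0 j; positivity
    rw [abs_mul, abs_of_pos hp]
    exact mul_le_mul_of_nonneg_left (H.hb _ m1 i) hp.le
  obtain ⟨φ, hφ, V, hVc, hV⟩ := extract (Ω := Set.univ) isOpen_univ F (by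
      intro x _
      refine ⟨2^γ, ?_⟩
      filter_upwards [hrep (‖x‖+1) (by positivity)] with j hj
      exact (hj x (by simp)).1) (by
      intro x _
      have hh := hrep (‖x‖+3) (by positivity)
      have hsub : ∀ w ∈ ball x 2, w ∈ ball (0 : EE n) (‖x‖+3) := by
        intro w hw
        rw [mem_ball, dist_eq_norm] at hw
        have h1 : ‖w‖ ≤ ‖w - x‖ + ‖x‖ := by simpa using norm_add_le (w - x) x
        simp; linarith
      apply equi_seq hn hs hc hFnn (σ0 := 1) (B := 2^γ) one_pos het
      · filter_upwards [hh] with j hj w hw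
        exact (hj w (hsub w (by simpa using hw))).1
      · filter_upwards [hh] with j hj w hw
        exact (hj w (hsub w (ball_subset_ball (by norm_num) hw))).2.2)
  have hsol := limit_entire hn hs hc (F := fun j => F (φ j)) (fun j => hFnn (φ j)) (B := 2^γ) (e := fun j => e (φ j))
    (het.comp hφ.tendsto_atTop) (fun t ht => hφ.tendsto_atTop.eventually (hrep t ht)) (continuousOn_univ.1 hVc)
    (fun x => hV x (Set.mem_univ _))
  have hV0 := sol_entire hn hs hta hc hsol 0
  have h1 := (hV 0 (Set.mem_univ _)).norm
  rw [hV0, norm_zero] at h1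
  have h2 : (fun j => ‖F (φ j) 0‖) = fun _ => (1:ℝ) := by
    funext j
    rw [hFn]; simp [hr1]
  rw [h2] at h1
  have := tendsto_nhds_unique h1 tendsto_const_nhds
  norm_num at this

lemma blow_down {n p : ℕ} (hn : 5 ≤ n) {s c ρ L : ℝ} (hs : 1 < s) (hc : 0 < c)
    {W : EE n → EE p} {h : EE n → Fin p → ℝ} (H : LocSol s c ρ L W h) {γ : ℝ} (hγ : γ = 4/(s-1)) (hγn : γ < n - 4)
    {C : ℝ} (hC0 : 0 ≤ C) (hC : ∀ x : EE n, x ≠ 0 → ‖W x‖ ≤ C * ‖x‖^(-γ))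
    {r : ℕ → ℝ} (hr0 : ∀ j, 0 < r j) (hrt : Tendsto r atTop (𝓝 0)) :
    ∃ φ : ℕ → ℕ, StrictMono φ ∧ ∃ V : EE n → EE p, IsSol s c V 0 ∧ (∀ x ≠ 0, ‖V x‖ ≤ C * ‖x‖^(-γ)) ∧
      ∀ x ≠ 0, ∀ ξ : ℕ → EE n, Tendsto ξ atTop (𝓝 x) →
        Tendsto (fun j => (r (φ j))^γ • W (r (φ j) • ξ j)) atTop (𝓝 (V x)) := by
  have hγ0 : 0 < γ := by rw [hγ]; apply div_pos (by norm_num); linarith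
  have hγs : γ * s = γ + 4 := by
    rw [hγ]; field_simp [show s - 1 ≠ 0 by linarith]; ring
  have hρ := H.rpos
  set F : ℕ → EE n → EE p := fun j z => (r j)^γ • W (r j • z) with hF
  have hFnn : ∀ j z i, 0 ≤ F j z i := by
    intro j z i
    simp only [hF, PiLp.smul_apply, smul_eq_mul]
    exact mul_nonneg (by have := hr0 j; positivity) (H.nn _ _)
  have hFb : ∀ j, ∀ z ≠ 0, ‖F j z‖ ≤ C * ‖z‖^(-γ) := by
    intro j z hz
    have hrj := hr0 j
    simp only [hF]
    rw [norm_smul, Real.norm_eq_abs, abs_of_pos (by positivity)]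
    have h1 := hC (r j • z) (smul_ne_zero hrj.ne' hz)
    rw [normpow_smul hrj] at h1
    calc r j ^ γ * ‖W (r j • z)‖ ≤ r j ^ γ * (C * (r j ^ (-γ) * ‖z‖^(-γ))) := by gcongr
      _ = (r j ^ γ * r j ^ (-γ)) * (C * ‖z‖^(-γ)) := by ring
      _ = _ := by rw [← Real.rpow_add hrj]; simp
  set e : ℕ → ℝ := fun j => (r j)^γ * L with he
  have het : Tendsto e atTop (𝓝 0) := by
    have h1 := ((Real.continuous_rpow_const hγ0.le).tendsto 0).comp hrt
    rw [Real.zero_rpow hγ0.ne'] at h1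
    have := h1.mul_const L
    simpa using this
  have hrep : ∀ t > 0, ∀ᶠ j in atTop, ∀ y : EE n, ‖y‖ < t → y ≠ 0 → 
      ∀ i, Integrable (fun z => rk (y - z) * nl s (F j z) i) ∧
      ∃ η, |η| ≤ e j ∧ F j y i = c * (∫ z, rk (y - z) * nl s (F j z) i) + η := by
    intro t ht
    have h1 : ∀ᶠ j : ℕ in atTop, r j < ρ/t := hrt.eventually (gt_mem_nhds (by positivity))
    filter_upwards [h1] with j hj y hy hy0 i
    have hrj := hr0 j
    rw [lt_div_iff₀ ht] at hj
    have m1 : (0:EE n) + r j • y ∈ ball (0 : EE n) ρ := by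
      simp only [zero_add, mem_ball, dist_zero_right, norm_smul, Real.norm_eq_abs, abs_of_pos hrj]
      nlinarith
    have m2 : (0:EE n) + r j • y ≠ 0 := by
      rw [zero_add]; exact smul_ne_zero hrj.ne' hy0
    have E := loc_scale hn hs H hγ 0 hrj y m1 m2 i
    simp only [zero_add] at E m1
    refine ⟨E.1, _, ?_, E.2⟩
    have hp : 0 < (r j)^γ := by positivity
    rw [abs_mul, abs_of_pos hp]
    exact mul_le_mul_of_nonneg_left (H.hb _ m1 i) hp.le
  have heqi : ∀ x ∈ ({0}ᶜ : Set (EE n)), ∀ ε > 0, ∃ δ > 0, ∀ᶠ j in atTop, ∀ y ∈ ball x δ, ‖F j y - F j x‖ ≤ ε := by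
    intro x hx
    have hxp : 0 < ‖x‖ := norm_pos_iff.2 hx
    have hlow : ∀ w ∈ ball x (2*(‖x‖/4)), ‖x‖/2 ≤ ‖w‖ ∧ ‖w‖ < 2*‖x‖ := by
      intro w hw
      rw [mem_ball, dist_eq_norm] at hw
      have h1 : ‖w‖ ≤ ‖w - x‖ + ‖x‖ := by simpa using norm_add_le (w - x) x
      have h2 : ‖x‖ ≤ ‖w - x‖ + ‖w‖ := by
        have := norm_sub_le w (w - x)
        rw [show w - (w - x) = x by abel] at this; linarith
      constructor <;> linarith
    have hne : ∀ w ∈ ball x (2*(‖x‖/4)), w ≠ 0 := by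
      intro w hw h0
      have := (hlow w hw).1
      rw [h0, norm_zero] at this; linarith
    apply equi_seq hn hs hc hFnn (σ0 := ‖x‖/4) (B := C * (‖x‖/2)^(-γ)) (by positivity) het
    · apply Eventually.of_forall
      intro j w hw
      refine (hFb j w (hne w hw)).trans ?_
      apply mul_le_mul_of_nonneg_left _ hC0
      exact rpow_anti (by positivity) (hlow w hw).1 (by linarith)
    · filter_upwards [hrep (2*‖x‖) (by positivity)] with j hj w hw
      have hw' := ball_subset_ball (by linarith : ‖x‖/4 ≤ 2*(‖x‖/4)) hw
      exact hj w (hlow w hw').2 (hne w hw')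
  obtain ⟨φ, hφ, V, hVc, hV⟩ := extract (Ω := {0}ᶜ) isOpen_compl_singleton F (by
      intro x hx
      exact ⟨_, Eventually.of_forall (fun j => hFb j x hx)⟩) heqi
  classical
  set V' : EE n → EE p := ({0}ᶜ : Set (EE n)).indicator V with hV'
  have hV'e : ∀ x ≠ 0, V' x = V x := fun x hx => Set.indicator_of_mem (s := ({0}ᶜ : Set (EE n))) hx _
  have hVt : ∀ x ≠ 0, Tendsto (fun j => F (φ j) x) atTop (𝓝 (V' x)) := by
    intro x hx; rw [hV'e x hx]; exact hV x hx
  have hco : ∀ z ≠ 0, ∀ i, Tendsto (fun j => F (φ j) z i) atTop (𝓝 (V' z i)) := fun z hz i =>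
    (((EuclideanSpace.proj (𝕜 := ℝ) i).continuous.tendsto (V' z)).comp (hVt z hz))
  have hVb : ∀ x ≠ 0, ‖V' x‖ ≤ C * ‖x‖^(-γ) := fun x hx =>
    le_of_tendsto' (hVt x hx).norm (fun j => hFb _ x hx)
  have hnn : ∀ z i, 0 ≤ V' z i := by
    intro z i
    by_cases hz : z = 0
    · rw [hV', Set.indicator_of_notMem (by simpa using hz)]; simp
    · exact ge_of_tendsto' (hco z hz i) (fun j => hFnn _ z i)
  have hV'c : ContinuousOn V' {0}ᶜ := hVc.congr (fun z hz => hV'e z hz)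
  obtain ⟨K, hK0, hK⟩ := pot_bound hn hγ0 hγn
  have hnlb : ∀ (v : EE p) (z : EE n) (i : Fin p), z ≠ 0 → ‖v‖ ≤ C * ‖z‖^(-γ) → |nl s v i| ≤ C^s * ‖z‖^(-4-γ) := by
    intro v z i hz hv
    have hzp : 0 < ‖z‖ := norm_pos_iff.2 hz
    refine (nl_abs_le hs v i).trans ?_
    calc ‖v‖^s ≤ (C * ‖z‖^(-γ))^s := by gcongr
      _ = _ := by
        rw [Real.mul_rpow hC0 (by positivity), ← Real.rpow_mul hzp.le]
        congr 2; linarith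
  have hnlm : ∀ i, AEStronglyMeasurable (fun z => nl s (V' z) i) (volume : Measure (EE n)) := by
    intro i
    have h1 : ContinuousOn (fun z => nl s (V' z) i) {0}ᶜ := (nl_cont hs i).comp_continuousOn hV'c
    have h2 := h1.aestronglyMeasurable (μ := volume) (measurableSet_singleton (0 : EE n)).compl
    have h3 : (volume : Measure (EE n)).restrict {0}ᶜ = volume := by
      rw [Measure.restrict_eq_self_of_ae_mem]
      filter_upwards [ae_ne hn 0] with z hz using hz
    rwa [h3] at h2
  refine ⟨φ, hφ, V', ⟨hnn, hV'c, fun y hy i => ⟨?_, ?_⟩⟩, hVb, ?_⟩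
  · apply Integrable.mono' (Integrable.const_mul (hK y hy).1 (C^s))
    · exact (rk_meas.comp (measurable_const.sub measurable_id)).aestronglyMeasurable.mul (hnlm i)
    · filter_upwards [ae_ne hn 0] with z hz
      rw [norm_mul, Real.norm_eq_abs, Real.norm_eq_abs, abs_of_nonneg (rk_nonneg _)]
      have := mul_le_mul_of_nonneg_left (hnlb _ z i hz (hVb z hz)) (rk_nonneg (y - z))
      linarith
  · have hev := hφ.tendsto_atTop.eventually (hrep (‖y‖+1) (by positivity))
    have hI : Tendsto (fun j => ∫ z, rk (y - z) * nl s (F (φ j) z) i) atTop (𝓝 (∫ z, rk (y - z) * nl s (V' z) i)) := by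
      apply tendsto_integral_filter_of_dominated_convergence (fun z => C^s * (rk (y - z) * ‖z‖^(-4-γ)))
      · filter_upwards [hev] with j hj
        exact (hj y (by linarith) hy i).1.aestronglyMeasurable
      · apply Eventually.of_forall
        intro j
        filter_upwards [ae_ne hn 0] with z hz
        rw [norm_mul, Real.norm_eq_abs, Real.norm_eq_abs, abs_of_nonneg (rk_nonneg _)]
        have := mul_le_mul_of_nonneg_left (hnlb _ z i hz (hFb (φ j) z hz)) (rk_nonneg (y - z))
        linarith
      · exact Integrable.const_mul (hK y hy).1 (C^s)
      · filter_upwards [ae_ne hn 0] with z hz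
        exact (((nl_cont hs i).tendsto _).comp (hVt z hz)).const_mul _
    have h2 : Tendsto (fun j => F (φ j) y i) atTop (𝓝 (c * ∫ z, rk (y - z) * nl s (V' z) i)) := by
      have h3 := hI.const_mul c
      rw [← tendsto_sub_nhds_zero_iff] at h3 ⊢
      apply squeeze_zero_norm' (a := fun j => |c * (∫ z, rk (y - z) * nl s (F (φ j) z) i) - c * ∫ z, rk (y - z) * nl s (V' z) i| + e (φ j))
      · filter_upwards [hev] with j hj
        obtain ⟨_, η, hη, E⟩ := hj y (by linarith) hy i
        rw [E, Real.norm_eq_abs, add_sub_right_comm]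
        exact (abs_add_le _ _).trans (by linarith)
      · have := h3.abs.add (het.comp hφ.tendsto_atTop)
        simpa using this
    exact tendsto_nhds_unique (hco y hy i) h2
  · intro x hx ξ hξ
    have hbase := hVt x hx
    rw [Metric.tendsto_atTop] at hbase ⊢
    intro ε hε
    obtain ⟨N1, hN1⟩ := hbase (ε/2) (by positivity)
    obtain ⟨δ, hδ, hδ2⟩ := heqi x hx (ε/2) (by positivity)
    obtain ⟨N2, hN2⟩ := eventually_atTop.1 ((hφ.tendsto_atTop.eventually hδ2).and (hξ.eventually (ball_mem_nhds x hδ)))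
    refine ⟨max N1 N2, fun j hj => ?_⟩
    have h1 := hN1 j (le_trans (le_max_left _ _) hj)
    obtain ⟨h2, h3⟩ := hN2 j (le_trans (le_max_right _ _) hj)
    have h4 := h2 (ξ j) h3
    rw [← dist_eq_norm] at h4
    have := dist_triangle (F (φ j) (ξ j)) (F (φ j) x) (V' x)
    show dist (F (φ j) (ξ j)) (V' x) < ε
    linarith

lemma barbalat {f g : ℝ → ℝ} {L : ℝ} (hf : ∀ t, HasDerivAt f (g t) t) (hL : Tendsto f atTop (𝓝 L))
    (hg : UniformContinuous g) : Tendsto g atTop (𝓝 0) := by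
  rw [Metric.tendsto_atTop]
  intro ε hε
  obtain ⟨δ, hδ, hgd⟩ := Metric.uniformContinuous_iff.1 hg (ε/2) (by positivity)
  set k := δ/2 with hk
  have hk0 : 0 < k := by positivity
  obtain ⟨N, hN⟩ := Metric.tendsto_atTop.1 hL (ε*k/4) (by positivity)
  refine ⟨N, fun t ht => ?_⟩
  obtain ⟨τ, hτ, he⟩ := exists_hasDerivAt_eq_slope f g (show t < t + k by linarith)
    (fun x _ => (hf x).continuousAt.continuousWithinAt) (fun x _ => hf x)
  have h1 := hN t ht
  have h2 := hN (t+k) (by linarith)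
  rw [Real.dist_eq] at h1 h2
  have h3 : |g τ| < ε/2 := by
    rw [he, show t + k - t = k by ring, abs_div, abs_of_pos hk0, div_lt_iff₀ hk0]
    have : |f (t+k) - f t| ≤ |f (t+k) - L| + |f t - L| := by
      have := abs_sub (f (t+k) - L) (f t - L)
      rwa [show f (t+k) - L - (f t - L) = f (t+k) - f t by ring] at this
    linarith
  have h4 := hgd (show dist t τ < δ by rw [Real.dist_eq, abs_sub_lt_iff]; constructor <;> linarith [hτ.1, hτ.2])
  rw [Real.dist_eq] at h4 ⊢
  rw [sub_zero]
  have : |g t| ≤ |g t - g τ| + |g τ| := by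
    have := abs_add_le (g t - g τ) (g τ)
    rwa [sub_add_cancel] at this
  linarith

lemma uc_of_bdd_deriv {E : Type*} [NormedAddCommGroup E] [NormedSpace ℝ E] {f g : ℝ → E} {B : ℝ} (hf : ∀ t, HasDerivAt f (g t) t) (hB : ∀ t, ‖g t‖ ≤ B) :
    UniformContinuous f := by
  have hB0 : 0 ≤ B := (norm_nonneg _).trans (hB 0)
  have : LipschitzWith ⟨B, hB0⟩ f := lipschitzWith_of_nnnorm_deriv_le (fun t => (hf t).differentiableAt) (fun t => by
    rw [(hf t).deriv]; exact hB t)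
  exact this.uniformContinuous

structure OdeSol {p : ℕ} (s a0 a1 a2 a3 B : ℝ) (w0 w1 w2 w3 w4 : ℝ → EE p) : Prop where
  d0 : ∀ t, HasDerivAt w0 (w1 t) t
  d1 : ∀ t, HasDerivAt w1 (w2 t) t
  d2 : ∀ t, HasDerivAt w2 (w3 t) t
  d3 : ∀ t, HasDerivAt w3 (w4 t) t
  b0 : ∀ t, ‖w0 t‖ ≤ B
  b1 : ∀ t, ‖w1 t‖ ≤ B
  b2 : ∀ t, ‖w2 t‖ ≤ B
  b3 : ∀ t, ‖w3 t‖ ≤ B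
  b4 : ∀ t, ‖w4 t‖ ≤ B
  eq : ∀ t, w4 t + a3 • w3 t + a2 • w2 t + a1 • w1 t + a0 • w0 t = ‖w0 t‖^(s-1) • w0 t

lemma OdeSol.rev {p : ℕ} {s a0 a1 a2 a3 B : ℝ} {w0 w1 w2 w3 w4 : ℝ → EE p} (h : OdeSol s a0 a1 a2 a3 B w0 w1 w2 w3 w4) :
    OdeSol s a0 (-a1) a2 (-a3) B (fun t => w0 (-t)) (fun t => -w1 (-t)) (fun t => w2 (-t)) (fun t => -w3 (-t)) (fun t => w4 (-t)) := by
  have hr : ∀ {f g : ℝ → EE p}, (∀ t, HasDerivAt f (g t) t) → ∀ t, HasDerivAt (fun t => f (-t)) (-g (-t)) t := by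
    intro f g hf t
    have := (hf (-t)).scomp t (hasDerivAt_neg t)
    exact this.congr_deriv (by simp)
  constructor
  · exact hr h.d0
  · intro t; exact (hr h.d1 t).neg.congr_deriv (by simp)
  · exact hr h.d2
  · intro t; exact (hr h.d3 t).neg.congr_deriv (by simp)
  · exact fun t => h.b0 _
  · intro t; rw [norm_neg]; exact h.b1 _
  · exact fun t => h.b2 _
  · intro t; rw [norm_neg]; exact h.b3 _
  · exact fun t => h.b4 _
  · intro t
    rw [← h.eq (-t)]; simp

noncomputable def HH {p : ℕ} (s a0 a2 a3 : ℝ) (w0 w1 w2 w3 : ℝ → EE p) (t : ℝ) : ℝ :=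
  inner ℝ (w3 t) (w1 t) - ‖w2 t‖^2/2 + a3 * inner ℝ (w2 t) (w1 t) + a2 * ‖w1 t‖^2/2 + a0*‖w0 t‖^2/2 - ‖w0 t‖^(s+1)/(s+1)

lemma HH_deriv {p : ℕ} {s a0 a1 a2 a3 B : ℝ} (hs : 1 < s) {w0 w1 w2 w3 w4 : ℝ → EE p} (h : OdeSol s a0 a1 a2 a3 B w0 w1 w2 w3 w4) (t : ℝ) :
    HasDerivAt (HH s a0 a2 a3 w0 w1 w2 w3) (a3 * ‖w2 t‖^2 - a1*‖w1 t‖^2) t := by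
  have e1 := (h.d3 t).inner ℝ (h.d1 t)
  have e2 := (h.d2 t).norm_sq.div_const 2
  have e3 := ((h.d2 t).inner ℝ (h.d1 t)).const_mul a3
  have e4 := ((h.d1 t).norm_sq.const_mul a2).div_const 2
  have e5 := ((h.d0 t).norm_sq.const_mul a0).div_const 2
  have e6 := ((hasFDerivAt_norm_rpow (w0 t) (show 1 < s+1 by linarith)).comp_hasDerivAt t (h.d0 t)).div_const (s+1)
  have := ((((e1.sub e2).add e3).add e4).add e5).sub e6
  refine this.congr_deriv ?_
  have heq := congrArg (fun v => inner ℝ v (w1 t)) (h.eq t)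
  simp only [inner_add_left, real_inner_smul_left, real_inner_self_eq_norm_sq] at heq
  have hsne : s + 1 ≠ 0 := by linarith
  have e7 : ((s+1) * ‖w0 t‖^(s+1-2)) * inner ℝ (w0 t) (w1 t) / (s+1) = ‖w0 t‖^(s-1) * inner ℝ (w0 t) (w1 t) := by
    rw [show s+1-2 = s-1 by ring]; field_simp
  have e8 : inner ℝ (w1 t) (w3 t) = inner ℝ (w3 t) (w1 t) := real_inner_comm _ _
  simp only [ContinuousLinearMap.smul_apply, innerSL_apply_apply, smul_eq_mul, real_inner_self_eq_norm_sq]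
  rw [e7]
  have c1 : inner ℝ (w2 t) (w3 t) = inner ℝ (w3 t) (w2 t) := real_inner_comm _ _
  have c2 : inner ℝ (w1 t) (w2 t) = inner ℝ (w2 t) (w1 t) := real_inner_comm _ _
  rw [← heq]
  rw [c1, c2]
  ring

lemma mono_lim {f : ℝ → ℝ} {M : ℝ} (hM : ∀ t, |f t| ≤ M) (h : Monotone f ∨ Antitone f) : ∃ L, Tendsto f atTop (𝓝 L) := by
  rcases h with h | h
  · exact ⟨_, tendsto_atTop_ciSup h ⟨M, by rintro _ ⟨t, rfl⟩; exact (le_abs_self _).trans (hM t)⟩⟩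
  · exact ⟨_, tendsto_atTop_ciInf h ⟨-M, by rintro _ ⟨t, rfl⟩; exact (abs_le.1 (hM t)).1⟩⟩

lemma ode_lim {p : ℕ} {s a0 a1 a2 a3 B : ℝ} (hs : 1 < s) {w0 w1 w2 w3 w4 : ℝ → EE p}
    (h : OdeSol s a0 a1 a2 a3 B w0 w1 w2 w3 w4) (hsgn : (a3 < 0 ∧ 0 < a1) ∨ (0 < a3 ∧ a1 < 0)) :
    ∃ L, Tendsto (HH s a0 a2 a3 w0 w1 w2 w3) atTop (𝓝 L) ∧
      Tendsto (fun t => a0 * (s-1)/(2*(s+1)) * ‖w0 t‖^2) atTop (𝓝 L) ∧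
      Tendsto (fun t => (‖w0 t‖^(s-1) - a0) * ‖w0 t‖) atTop (𝓝 0) := by
  have hB0 : 0 ≤ B := (norm_nonneg _).trans (h.b0 0)
  have hHd := HH_deriv hs h
  have hin : ∀ {u v : ℝ → EE p}, (∀ t, ‖u t‖ ≤ B) → (∀ t, ‖v t‖ ≤ B) → ∀ t, |inner ℝ (u t) (v t)| ≤ B*B := by
    intro u v hu hv t
    refine (abs_real_inner_le_norm _ _).trans ?_
    have := hu t; have := hv t; gcongr
  have hsq : ∀ {u : ℝ → EE p}, (∀ t, ‖u t‖ ≤ B) → ∀ t, ‖u t‖^2 ≤ B*B := by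
    intro u hu t
    have := hu t
    nlinarith [norm_nonneg (u t)]
  have hHb : ∀ t, |HH s a0 a2 a3 w0 w1 w2 w3 t| ≤ B*B + B*B/2 + |a3| *(B*B) + |a2| *(B*B)/2 + |a0| *(B*B)/2 + B^(s+1)/(s+1) := by
    intro t
    unfold HH
    have t1 := hin h.b3 h.b1 t
    have t2 : |‖w2 t‖^2/2| ≤ B*B/2 := by
      rw [abs_of_nonneg (by positivity)]; linarith [hsq h.b2 t]
    have t3 : |a3 * inner ℝ (w2 t) (w1 t)| ≤ |a3| * (B*B) := by
      rw [abs_mul]; exact mul_le_mul_of_nonneg_left (hin h.b2 h.b1 t) (abs_nonneg _)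
    have t4 : |a2 * ‖w1 t‖^2/2| ≤ |a2| * (B*B)/2 := by
      rw [abs_div, abs_mul, abs_of_nonneg (sq_nonneg ‖w1 t‖), abs_of_pos (by norm_num : (0:ℝ) < 2)]
      have := mul_le_mul_of_nonneg_left (hsq h.b1 t) (abs_nonneg a2)
      linarith
    have t5 : |a0 * ‖w0 t‖^2/2| ≤ |a0| * (B*B)/2 := by
      rw [abs_div, abs_mul, abs_of_nonneg (sq_nonneg ‖w0 t‖), abs_of_pos (by norm_num : (0:ℝ) < 2)]
      have := mul_le_mul_of_nonneg_left (hsq h.b0 t) (abs_nonneg a0)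
      linarith
    have t6 : |‖w0 t‖^(s+1)/(s+1)| ≤ B^(s+1)/(s+1) := by
      have hs1 : 0 < s+1 := by linarith
      rw [abs_of_nonneg (by positivity)]
      have := h.b0 t
      gcongr
    rw [abs_le] at *
    constructor <;> linarith [t1.1, t1.2, t2.1, t2.2, t3.1, t3.2, t4.1, t4.2, t5.1, t5.2, t6.1, t6.2]
  have hmono : Monotone (HH s a0 a2 a3 w0 w1 w2 w3) ∨ Antitone (HH s a0 a2 a3 w0 w1 w2 w3) := by
    rcases hsgn with ⟨q1, q2⟩ | ⟨q1, q2⟩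
    · right
      apply antitone_of_hasDerivAt_nonpos hHd
      intro t
      have := sq_nonneg ‖w2 t‖; have := sq_nonneg ‖w1 t‖
      show a3 * ‖w2 t‖^2 - a1*‖w1 t‖^2 ≤ 0
      nlinarith
    · left
      apply monotone_of_hasDerivAt_nonneg hHd
      intro t
      have := sq_nonneg ‖w2 t‖; have := sq_nonneg ‖w1 t‖
      show 0 ≤ a3 * ‖w2 t‖^2 - a1*‖w1 t‖^2
      nlinarith
  obtain ⟨L, hL⟩ := mono_lim hHb hmono
  have hH'd : ∀ t, HasDerivAt (fun t => a3 * ‖w2 t‖^2 - a1*‖w1 t‖^2) (a3 * (2 * inner ℝ (w2 t) (w3 t)) - a1 * (2 * inner ℝ (w1 t) (w2 t))) t := by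
    intro t
    exact ((h.d2 t).norm_sq.const_mul a3).sub ((h.d1 t).norm_sq.const_mul a1)
  have hH'0 := barbalat hHd hL (uc_of_bdd_deriv hH'd (B := |a3| * (2*(B*B)) + |a1| * (2*(B*B))) (by
    intro t
    rw [Real.norm_eq_abs]
    refine (abs_sub _ _).trans ?_
    rw [abs_mul, abs_mul, abs_mul, abs_mul, abs_of_pos (by norm_num : (0:ℝ) < 2)]
    have := hin h.b2 h.b3 t
    have := hin h.b1 h.b2 t
    gcongr))
  have ha3 : 0 < |a3| := by rcases hsgn with q | q <;> [exact abs_pos.2 q.1.ne; exact abs_pos.2 q.1.ne']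
  have ha1 : 0 < |a1| := by rcases hsgn with q | q <;> [exact abs_pos.2 q.2.ne'; exact abs_pos.2 q.2.ne]
  have habs : ∀ t, |a3 * ‖w2 t‖^2 - a1*‖w1 t‖^2| = |a3| * ‖w2 t‖^2 + |a1| * ‖w1 t‖^2 := by
    intro t
    rcases hsgn with ⟨q1, q2⟩ | ⟨q1, q2⟩
    · rw [abs_of_neg q1, abs_of_pos q2, abs_of_nonpos]
      · ring
      · nlinarith [sq_nonneg ‖w2 t‖, sq_nonneg ‖w1 t‖]
    · rw [abs_of_pos q1, abs_of_neg q2, abs_of_nonneg]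
      · ring
      · nlinarith [sq_nonneg ‖w2 t‖, sq_nonneg ‖w1 t‖]
  have hH'a := hH'0.abs
  simp only [habs, abs_zero] at hH'a
  have sqz : ∀ {u : ℝ → EE p} {a : ℝ}, 0 < a → (∀ t, a * ‖u t‖^2 ≤ |a3| * ‖w2 t‖^2 + |a1| * ‖w1 t‖^2) → Tendsto u atTop (𝓝 0) := by
    intro u a ha hu
    have h1 : Tendsto (fun t => a * ‖u t‖^2) atTop (𝓝 0) := squeeze_zero (fun t => by positivity) hu hH'a
    have h2 : Tendsto (fun t => ‖u t‖^2) atTop (𝓝 0) := by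
      have := h1.const_mul a⁻¹
      simp only [mul_zero] at this
      refine this.congr (fun t => ?_)
      field_simp
    have h3 := h2.sqrt
    simp only [Real.sqrt_sq (norm_nonneg _), Real.sqrt_zero] at h3
    exact tendsto_zero_iff_norm_tendsto_zero.2 h3
  have hw2 : Tendsto w2 atTop (𝓝 0) := sqz ha3 (fun t => by have := sq_nonneg ‖w1 t‖; nlinarith)
  have hw1 : Tendsto w1 atTop (𝓝 0) := sqz ha1 (fun t => by have := sq_nonneg ‖w2 t‖; nlinarith)
  have vec : ∀ {u v : ℝ → EE p}, (∀ t, HasDerivAt u (v t) t) → Tendsto u atTop (𝓝 0) → UniformContinuous v → Tendsto v atTop (𝓝 0) := by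
    intro u v hu hu0 hv
    have hc : ∀ i, Tendsto (fun t => v t i) atTop (𝓝 0) := by
      intro i
      apply barbalat (f := fun t => u t i) (L := 0)
      · intro t
        exact ((EuclideanSpace.proj i : EE p →L[ℝ] ℝ).hasFDerivAt.comp_hasDerivAt t (hu t))
      · have := ((EuclideanSpace.proj i : EE p →L[ℝ] ℝ).continuous.tendsto 0).comp hu0
        simpa [Function.comp_def] using this
      · exact (EuclideanSpace.proj i : EE p →L[ℝ] ℝ).uniformContinuous.comp hv
    apply squeeze_zero_norm (fun t => norm_le_sum (v t))
    have := tendsto_finset_sum Finset.univ (fun i _ => (hc i).abs)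
    simpa using this
  have hw3 : Tendsto w3 atTop (𝓝 0) := vec h.d2 hw2 (uc_of_bdd_deriv h.d3 h.b4)
  have hw4 : Tendsto w4 atTop (𝓝 0) := by
    apply vec h.d3 hw3
    have u0 := uc_of_bdd_deriv h.d0 h.b1
    have u1 := uc_of_bdd_deriv h.d1 h.b2
    have u2 := uc_of_bdd_deriv h.d2 h.b3
    have u3 := uc_of_bdd_deriv h.d3 h.b4
    have hcN : Continuous (fun v : EE p => ‖v‖^(s-1) • v) := by
      apply Continuous.smul (f := fun v : EE p => ‖v‖^(s-1)) (g := fun v => v)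
      · exact (Real.continuous_rpow_const (by linarith)).comp continuous_norm
      · exact continuous_id
    have hN : UniformContinuous (fun t => ‖w0 t‖^(s-1) • w0 t) := by
      have h1 := (isCompact_closedBall (0 : EE p) B).uniformContinuousOn_of_continuous hcN.continuousOn
      rw [← uniformContinuousOn_univ] at u0 ⊢
      exact h1.comp u0 (fun t _ => by simpa using h.b0 t)
    have e : w4 = fun t => ‖w0 t‖^(s-1) • w0 t - a3 • w3 t - a2 • w2 t - a1 • w1 t - a0 • w0 t := by
      funext t
      rw [← h.eq t]; abel
    rw [e]
    exact (((hN.sub (u3.const_smul a3)).sub (u2.const_smul a2)).sub (u1.const_smul a1)).sub (u0.const_smul a0)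
  have hlim3 : Tendsto (fun t => (‖w0 t‖^(s-1) - a0) * ‖w0 t‖) atTop (𝓝 0) := by
    have h1 : Tendsto (fun t => (‖w0 t‖^(s-1) - a0) • w0 t) atTop (𝓝 0) := by
      have := ((hw4.add (hw3.const_smul a3)).add (hw2.const_smul a2)).add (hw1.const_smul a1)
      simp only [smul_zero, add_zero] at this
      refine this.congr (fun t => ?_)
      rw [sub_smul, ← h.eq t]; abel
    have h2 := h1.norm
    rw [norm_zero] at h2
    rw [tendsto_zero_iff_abs_tendsto_zero]
    refine h2.congr (fun t => ?_)
    rw [norm_smul, Real.norm_eq_abs, Function.comp, abs_mul, abs_of_nonneg (norm_nonneg (w0 t))]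
  refine ⟨L, hL, ?_, hlim3⟩
  -- compare H and κ |w|²
  have hdiff : Tendsto (fun t => HH s a0 a2 a3 w0 w1 w2 w3 t - a0 * (s-1)/(2*(s+1)) * ‖w0 t‖^2) atTop (𝓝 0) := by
    have k1 : Tendsto (fun t => inner ℝ (w3 t) (w1 t)) atTop (𝓝 0) := by
      have := hw3.inner (𝕜 := ℝ) hw1; simpa using this
    have k2 : Tendsto (fun t => ‖w2 t‖^2/2) atTop (𝓝 0) := by
      have := (hw2.norm.pow 2).div_const 2; simpa using this
    have k3 : Tendsto (fun t => a3 * inner ℝ (w2 t) (w1 t)) atTop (𝓝 0) := by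
      have := (hw2.inner (𝕜 := ℝ) hw1).const_mul a3; simpa using this
    have k4 : Tendsto (fun t => a2 * ‖w1 t‖^2/2) atTop (𝓝 0) := by
      have := ((hw1.norm.pow 2).const_mul a2).div_const 2; simpa using this
    have k5 : Tendsto (fun t => -(1/(s+1)) * (((‖w0 t‖^(s-1) - a0) * ‖w0 t‖) * ‖w0 t‖)) atTop (𝓝 0) := by
      have : Tendsto (fun t => ((‖w0 t‖^(s-1) - a0) * ‖w0 t‖) * ‖w0 t‖) atTop (𝓝 0) := by
        apply squeeze_zero_norm (a := fun t => |(‖w0 t‖^(s-1) - a0) * ‖w0 t‖| * B)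
        · intro t
          rw [Real.norm_eq_abs, abs_mul _ ‖w0 t‖, abs_of_nonneg (norm_nonneg (w0 t))]
          exact mul_le_mul_of_nonneg_left (h.b0 t) (abs_nonneg _)
        · have := hlim3.abs.mul_const B; simpa using this
      have := this.const_mul (-(1/(s+1))); simpa using this
    have := (((k1.sub k2).add k3).add k4).add k5
    simp only [sub_zero, add_zero] at this
    refine this.congr (fun t => ?_)
    unfold HH
    have hs1 : s + 1 ≠ 0 := by linarith
    have e : ‖w0 t‖^(s+1) = ‖w0 t‖^(s-1) * ‖w0 t‖ * ‖w0 t‖ := by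
      rcases (norm_nonneg (w0 t)).eq_or_lt with q | q
      · rw [← q, Real.zero_rpow hs1]; simp
      · rw [show s + 1 = (s-1) + 1 + 1 by ring, Real.rpow_add_one q.ne', Real.rpow_add_one q.ne']
    rw [e]
    field_simp
    ring
  have := hL.sub hdiff
  rw [sub_zero] at this
  refine this.congr (fun t => ?_)
  ring

lemma ode_const {p : ℕ} {s a0 a1 a2 a3 B : ℝ} (hs : 1 < s) {w0 w1 w2 w3 w4 : ℝ → EE p}
    (h : OdeSol s a0 a1 a2 a3 B w0 w1 w2 w3 w4) (h3 : a3 < 0) (h1 : 0 < a1) :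
    ∃ Lp Lm, Tendsto (fun t => a0 * (s-1)/(2*(s+1)) * ‖w0 t‖^2) atTop (𝓝 Lp) ∧
      Tendsto (fun t => (‖w0 t‖^(s-1) - a0) * ‖w0 t‖) atTop (𝓝 0) ∧
      Tendsto (fun t => a0 * (s-1)/(2*(s+1)) * ‖w0 (-t)‖^2) atTop (𝓝 Lm) ∧
      Tendsto (fun t => (‖w0 (-t)‖^(s-1) - a0) * ‖w0 (-t)‖) atTop (𝓝 0) ∧
      (Lm ≤ Lp → ∀ t t', w0 t = w0 t') := by
  obtain ⟨Lp, p1, p2, p3⟩ := ode_lim hs h (Or.inl ⟨h3, h1⟩)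
  obtain ⟨Lm, m1, m2, m3⟩ := ode_lim hs h.rev (Or.inr ⟨by linarith, by linarith⟩)
  refine ⟨Lp, Lm, p2, p3, m2, m3, fun hle => ?_⟩
  have hrev : ∀ t, HH s a0 a2 (-a3) (fun t => w0 (-t)) (fun t => -w1 (-t)) (fun t => w2 (-t)) (fun t => -w3 (-t)) t = HH s a0 a2 a3 w0 w1 w2 w3 (-t) := by
    intro t
    unfold HH
    simp
  have hHd := HH_deriv hs h
  have hanti : Antitone (HH s a0 a2 a3 w0 w1 w2 w3) := by
    apply antitone_of_hasDerivAt_nonpos hHd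
    intro t
    have := sq_nonneg ‖w2 t‖; have := sq_nonneg ‖w1 t‖
    show a3 * ‖w2 t‖^2 - a1*‖w1 t‖^2 ≤ 0
    nlinarith
  have hge : ∀ t, Lp ≤ HH s a0 a2 a3 w0 w1 w2 w3 t := fun t => hanti.le_of_tendsto p1 t
  have hle2 : ∀ t, HH s a0 a2 a3 w0 w1 w2 w3 t ≤ Lm := by
    intro t
    refine ge_of_tendsto m1 ?_
    filter_upwards [eventually_ge_atTop (-t)] with τ hτ
    rw [hrev]
    exact hanti (by linarith)
  have hc : HH s a0 a2 a3 w0 w1 w2 w3 = fun _ => Lp := by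
    funext t
    exact le_antisymm ((hle2 t).trans hle) (hge t)
  have hw1 : ∀ t, w1 t = 0 := by
    intro t
    have e1 := hHd t
    rw [hc] at e1
    have e2 := e1.unique (hasDerivAt_const t Lp)
    have q2 := sq_nonneg ‖w2 t‖
    have q1 := sq_nonneg ‖w1 t‖
    have : ‖w1 t‖^2 = 0 := by
      by_contra hne
      have : 0 < ‖w1 t‖^2 := lt_of_le_of_ne q1 (Ne.symm hne)
      nlinarith
    simpa using this
  intro t t'
  exact is_const_of_deriv_eq_zero (fun t => (h.d0 t).differentiableAt) (fun t => by rw [(h.d0 t).deriv, hw1 t]) t t'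

lemma fact1 {p : ℕ} {s a0 a1 a2 a3 B : ℝ} (hs : 1 < s) {w0 w1 w2 w3 w4 : ℝ → EE p}
    (h : OdeSol s a0 a1 a2 a3 B w0 w1 w2 w3 w4) (h3 : a3 < 0) (h1 : 0 < a1) (h0 : 0 < a0) {θ T : ℝ} (hθ0 : 0 ≤ θ) (hθ : θ^(s-1) < a0)
    (hb : ∀ t, t < T → ‖w0 t‖ ≤ θ) : ∀ t, w0 t = 0 := by
  obtain ⟨Lp, Lm, p2, p3, m2, m3, hc⟩ := ode_const hs h h3 h1
  have hk : 0 < a0 * (s-1)/(2*(s+1)) := by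
    have : 0 < s - 1 := by linarith
    have : 0 < s + 1 := by linarith
    positivity
  have hw : Tendsto (fun t => ‖w0 (-t)‖) atTop (𝓝 0) := by
    have e := (m3.abs).const_mul (a0 - θ^(s-1))⁻¹
    simp only [abs_zero, mul_zero] at e
    refine squeeze_zero' (Eventually.of_forall fun t => norm_nonneg _) ?_ e
    filter_upwards [eventually_gt_atTop (-T)] with t ht
    have hd : 0 < a0 - θ^(s-1) := by linarith
    have b := hb (-t) (by linarith)
    have b2 : ‖w0 (-t)‖^(s-1) ≤ θ^(s-1) := Real.rpow_le_rpow (norm_nonneg _) b (by linarith)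
    rw [abs_mul, abs_of_nonpos (by linarith), abs_of_nonneg (norm_nonneg _), ← mul_assoc]
    have : 1 ≤ (a0 - θ^(s-1))⁻¹ * -(‖w0 (-t)‖^(s-1) - a0) := by
      rw [inv_mul_eq_div, le_div_iff₀ hd]; linarith
    nlinarith [norm_nonneg (w0 (-t))]
  have hLm : Lm = 0 := by
    have := (hw.pow 2).const_mul (a0 * (s-1)/(2*(s+1)))
    simp only [ne_eq, OfNat.ofNat_ne_zero, not_false_eq_true, zero_pow, mul_zero] at this
    exact tendsto_nhds_unique m2 this
  have hLp : 0 ≤ Lp := ge_of_tendsto' p2 (fun t => by positivity)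
  have hcc := hc (by linarith)
  intro t
  have : Tendsto (fun τ => ‖w0 (-τ)‖) atTop (𝓝 ‖w0 t‖) := by
    refine tendsto_const_nhds.congr (fun τ => by rw [hcc t (-τ)])
  exact norm_eq_zero.1 (tendsto_nhds_unique this hw)

lemma fact2 {p : ℕ} {s a0 a1 a2 a3 B : ℝ} (hs : 1 < s) {w0 w1 w2 w3 w4 : ℝ → EE p}
    (h : OdeSol s a0 a1 a2 a3 B w0 w1 w2 w3 w4) (h3 : a3 < 0) (h1 : 0 < a1) (h0 : 0 < a0) {θ : ℝ} (hθ0 : 0 < θ)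
    (hb : ∀ t, θ ≤ ‖w0 t‖) : ∀ t, ‖w0 t‖ = a0^(1/(s-1)) := by
  obtain ⟨Lp, Lm, p2, p3, m2, m3, hc⟩ := ode_const hs h h3 h1
  have hs1 : 0 < s - 1 := by linarith
  have hlim : ∀ u : ℝ → EE p, (∀ t, θ ≤ ‖u t‖) → Tendsto (fun t => (‖u t‖^(s-1) - a0) * ‖u t‖) atTop (𝓝 0) → Tendsto (fun t => ‖u t‖) atTop (𝓝 (a0^(1/(s-1)))) := by
    intro u hu hl
    have e := (hl.abs).const_mul θ⁻¹
    simp only [abs_zero, mul_zero] at e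
    have e2 : Tendsto (fun t => ‖u t‖^(s-1) - a0) atTop (𝓝 0) := by
      refine squeeze_zero_norm (fun t => ?_) e
      rw [abs_mul, abs_of_nonneg (norm_nonneg (u t)), Real.norm_eq_abs, inv_mul_eq_div, le_div_iff₀ hθ0]
      exact mul_le_mul_of_nonneg_left (hu t) (abs_nonneg _)
    have e3 : Tendsto (fun t => ‖u t‖^(s-1)) atTop (𝓝 a0) := by
      have := e2.add_const a0
      simpa using this
    have e4 := e3.rpow_const (p := 1/(s-1)) (Or.inl h0.ne')
    refine e4.congr (fun t => ?_)
    rw [← Real.rpow_mul (norm_nonneg _), mul_one_div_cancel hs1.ne', Real.rpow_one]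
  have l1 := hlim w0 hb p3
  have l2 := hlim (fun t => w0 (-t)) (fun t => hb _) m3
  have hL : Lm = Lp := by
    have q1 := tendsto_nhds_unique p2 ((l1.pow 2).const_mul _)
    have q2 := tendsto_nhds_unique m2 ((l2.pow 2).const_mul _)
    rw [q1, q2]
  have hcc := hc hL.le
  intro t
  refine tendsto_nhds_unique ?_ l1
  exact tendsto_const_nhds.congr (fun τ => by rw [hcc t τ])

lemma bdd_inv_pos {r M : ℝ} (hr : 0 < r) {F : ℝ → ℝ} (hF : Continuous F) (hM : ∀ t, |F t| ≤ M) :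
    ∃ y : ℝ → ℝ, (∀ t, HasDerivAt y (r * y t + F t) t) ∧ ∀ t, |y t| ≤ M / r := by
  have hM0 : 0 ≤ M := (abs_nonneg _).trans (hM 0)
  set G : ℝ → ℝ := fun τ => Real.exp (-r*τ) * F τ with hG
  have hGc : Continuous G := by fun_prop
  have hGb : ∀ τ, ‖G τ‖ ≤ Real.exp (-r*τ) * M := by
    intro τ
    rw [hG]; simp only
    rw [norm_mul, Real.norm_eq_abs, Real.norm_eq_abs, abs_of_pos (Real.exp_pos _)]
    exact mul_le_mul_of_nonneg_left (hM τ) (Real.exp_pos _).le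
  have hei : ∀ c, IntegrableOn (fun τ => Real.exp (-r*τ) * M) (Set.Ioi c) := fun c =>
    (integrableOn_exp_mul_Ioi (by linarith : -r < 0) c).mul_const M
  have hGi : ∀ c, IntegrableOn G (Set.Ioi c) := fun c =>
    Integrable.mono' (hei c) hGc.aestronglyMeasurable (Eventually.of_forall hGb)
  set I := ∫ τ in Set.Ioi 0, G τ with hI
  refine ⟨fun t => Real.exp (r*t) * ((∫ τ in (0:ℝ)..t, G τ) - I), fun t => ?_, fun t => ?_⟩
  · have e1 : HasDerivAt (fun t => ∫ τ in (0:ℝ)..t, G τ) (G t) t :=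
      intervalIntegral.integral_hasDerivAt_right (hGc.intervalIntegrable _ _) (hGc.stronglyMeasurableAtFilter _ _) hGc.continuousAt
    have e2 : HasDerivAt (fun t => Real.exp (r*t)) (Real.exp (r*t) * r) t := by
      have := ((hasDerivAt_id t).const_mul r).exp
      simpa using this
    refine (e2.mul (e1.sub_const I)).congr_deriv ?_
    have : Real.exp (r*t) * G t = F t := by
      rw [hG]; simp only
      rw [← mul_assoc, ← Real.exp_add]; simp
    rw [this]; ring
  · have e : (∫ τ in (0:ℝ)..t, G τ) - I = -∫ τ in Set.Ioi t, G τ := by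
      have := intervalIntegral.integral_interval_add_Ioi (hGi 0) (hGi t)
      rw [hI, ← this]; ring
    simp only
    rw [e, abs_mul, abs_neg, abs_of_pos (Real.exp_pos _)]
    have b1 : |∫ τ in Set.Ioi t, G τ| ≤ ∫ τ in Set.Ioi t, Real.exp (-r*τ) * M := by
      rw [← Real.norm_eq_abs]
      exact norm_integral_le_of_norm_le (hei t) (Eventually.of_forall hGb)
    rw [integral_mul_const, integral_exp_mul_Ioi (by linarith : -r < 0)] at b1
    calc _ ≤ Real.exp (r*t) * (-Real.exp (-r*t) / -r * M) := mul_le_mul_of_nonneg_left b1 (Real.exp_pos _).le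
      _ = (Real.exp (r*t) * Real.exp (-r*t)) * (M/r) := by field_simp
      _ = M / r := by rw [← Real.exp_add]; simp

lemma bdd_inv {r M : ℝ} (hr : r ≠ 0) {F : ℝ → ℝ} (hF : Continuous F) (hM : ∀ t, |F t| ≤ M) :
    ∃ y : ℝ → ℝ, (∀ t, HasDerivAt y (r * y t + F t) t) ∧ ∃ B, ∀ t, |y t| ≤ B := by
  rcases lt_or_gt_of_ne hr with h | h
  · obtain ⟨z, hz, hb⟩ := bdd_inv_pos (r := -r) (M := M) (F := fun t => -F (-t)) (by linarith) (by fun_prop) (fun t => by rw [abs_neg]; exact hM _)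
    refine ⟨fun t => z (-t), fun t => ?_, _, fun t => hb _⟩
    refine ((hz (-t)).comp t (hasDerivAt_neg t)).congr_deriv ?_
    simp [add_comm]
  · obtain ⟨y, hy, hb⟩ := bdd_inv_pos h hF hM
    exact ⟨y, hy, _, hb⟩

lemma bdd_inv_contDiff {r : ℝ} {y F : ℝ → ℝ} (hy : ∀ t, HasDerivAt y (r * y t + F t) t) (k : ℕ) (hF : ContDiff ℝ k F) :
    ContDiff ℝ (k+1 : ℕ) y := by
  have hd : deriv y = fun t => r * y t + F t := funext fun t => (hy t).deriv
  have key : ∀ j : ℕ, j ≤ k + 1 → ContDiff ℝ j y := by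
    intro j
    induction j with
    | zero =>
      intro _
      simp only [Nat.cast_zero]
      exact contDiff_zero.2 (continuous_iff_continuousAt.2 fun t => (hy t).continuousAt)
    | succ j ih =>
      intro hj
      have h1 := ih (by omega)
      push_cast
      rw [contDiff_succ_iff_deriv]
      refine ⟨fun t => (hy t).differentiableAt, by simp, ?_⟩
      rw [hd]
      exact (contDiff_const.mul h1).add (hF.of_le (by exact_mod_cast (by omega : j ≤ k)))
  exact key _ le_rfl

noncomputable def RW {n : ℕ} (a : ℝ) (f : ℝ → ℝ) (y : EE n) : ℝ := ‖y‖^(-a) * f (Real.log ‖y‖)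

lemma RW_eq {n : ℕ} (a : ℝ) (f : ℝ → ℝ) : (RW a f : EE n → ℝ) = fun y => (fun q => q^(-a/2) * f (Real.log q / 2)) (‖y - 0‖^2) := by
  funext y
  unfold RW
  simp only [sub_zero]
  congr 1
  · rw [← Real.rpow_natCast, ← Real.rpow_mul (norm_nonneg _)]
    congr 1; push_cast; ring
  · congr 1
    rw [Real.log_pow]; push_cast; ring

lemma lap_RW {n : ℕ} {a : ℝ} {f g k : ℝ → ℝ} (hf : ∀ t, HasDerivAt f (a * f t + g t) t)
    (hg : ∀ t, HasDerivAt g ((a - n + 2) * g t + k t) t) {x : EE n} (hx : x ≠ 0) :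
    lap (RW a f) x = RW (a+2) k x := by
  have hx0 : 0 < ‖x - 0‖^2 := by have := norm_pos_iff.2 hx; rw [sub_zero]; positivity
  have hlog : ∀ q : ℝ, 0 < q → HasDerivAt (fun q => Real.log q / 2) (q⁻¹/2) q := fun q hq => (Real.hasDerivAt_log hq.ne').div_const 2
  have hpow : ∀ (b q : ℝ), 0 < q → HasDerivAt (fun q => q^b) (b * q^(b-1)) q := fun b q hq => Real.hasDerivAt_rpow_const (Or.inl hq.ne')
  rw [RW_eq, RW_eq]
  set q := ‖x - 0‖^2 with hq
  rw [lap_rad (G := fun q => q^(-a/2) * f (Real.log q / 2)) (G1 := fun q => q^(-a/2-1) * (g (Real.log q / 2)/2))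
    (g2 := (-a/2-1) * q^(-a/2-1-1) * (g (Real.log q / 2)/2) + q^(-a/2-1) * (((a - n + 2) * g (Real.log q / 2) + k (Real.log q / 2)) * (q⁻¹/2)/2))]
  · simp only
    rw [← hq]
    have e1 : q^(-a/2-1-1) = q^(-a/2-1) * q⁻¹ := by rw [Real.rpow_sub_one hx0.ne', div_eq_mul_inv]
    rw [e1, show -(a+2)/2 = -a/2-1 by ring]
    field_simp
    ring
  · filter_upwards [lt_mem_nhds hx0] with r hr
    refine ((hpow _ r hr).mul ((hf _).comp r (hlog r hr))).congr_deriv ?_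
    rw [Real.rpow_sub_one hr.ne']
    simp only [Function.comp]
    field_simp
    ring
  · exact ((hpow _ q hx0).mul (((hg _).comp q (hlog q hx0)).div_const 2))

lemma bilap_RW {n : ℕ} {γ : ℝ} {y1 y2 y3 y4 F : ℝ → ℝ}
    (h4 : ∀ t, HasDerivAt y4 (γ * y4 t + y3 t) t)
    (h3 : ∀ t, HasDerivAt y3 ((γ - n + 2) * y3 t + y2 t) t)
    (h2 : ∀ t, HasDerivAt y2 ((γ+2) * y2 t + y1 t) t)
    (h1 : ∀ t, HasDerivAt y1 ((γ + 2 - n + 2) * y1 t + F t) t) {x : EE n} (hx : x ≠ 0) :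
    bilap (RW γ y4) x = RW (γ+4) F x := by
  unfold bilap
  have e : lap (RW γ y4 : EE n → ℝ) =ᶠ[𝓝 x] RW (γ+2) y2 := by
    filter_upwards [isOpen_compl_singleton.mem_nhds hx] with z hz
    exact lap_RW h4 h3 hz
  rw [(lap_congr e).self_of_nhds, lap_RW h2 h1 hx, show γ+2+2 = γ+4 by ring]

lemma RW_contDiffOn {n : ℕ} {γ : ℝ} {f : ℝ → ℝ} (hf : ContDiff ℝ 4 f) : ContDiffOn ℝ 4 (RW γ f : EE n → ℝ) {0}ᶜ := by
  intro x hx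
  have hx' : x ≠ 0 := hx
  have hn : ContDiffAt ℝ 4 (fun y : EE n => ‖y‖) x := contDiffAt_norm ℝ hx'
  have h0 : ‖x‖ ≠ 0 := norm_ne_zero_iff.2 hx'
  apply ContDiffAt.contDiffWithinAt
  unfold RW
  exact (hn.rpow_const_of_ne h0).mul (hf.contDiffAt.comp x (hn.log h0))

lemma ann_int {n : ℕ} (hn : 5 ≤ n) {γ B : ℝ} (hγ : 0 < γ) (hB : 0 ≤ B) {ψ : EE n → ℝ} (hψ : ∀ y ≠ 0, |ψ y| ≤ B * ‖y‖^(-γ)) {δ : ℝ} (hδ : 0 < δ) :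
    |(∫ y in {y : EE n | δ ≤ ‖y‖ ∧ ‖y‖ ≤ 2*δ}, |ψ y|)| ≤ B * δ^(-γ) * ((2*δ)^n * volume.real (closedBall (0 : EE n) 1)) := by
  have hsub : {y : EE n | δ ≤ ‖y‖ ∧ ‖y‖ ≤ 2*δ} ⊆ closedBall (0 : EE n) (2*δ) := by
    intro y hy; simpa using hy.2
  have hfin : volume (closedBall (0 : EE n) (2*δ)) < ⊤ := measure_closedBall_lt_top
  rw [← vol_closedBall hn (by positivity : 0 < 2*δ), ← Real.norm_eq_abs]
  refine (norm_setIntegral_le_of_norm_le_const (C := B * δ^(-γ)) ((measure_mono hsub).trans_lt hfin) ?_).trans ?_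
  · intro y hy
    have hy0 : y ≠ 0 := by
      rintro rfl
      have := hy.1; rw [norm_zero] at this; linarith
    rw [Real.norm_eq_abs, abs_abs]
    refine (hψ y hy0).trans (mul_le_mul_of_nonneg_left ?_ hB)
    exact Real.rpow_le_rpow_of_nonpos hδ hy.1 (by linarith)
  · refine mul_le_mul_of_nonneg_left ?_ (by positivity)
    exact measureReal_mono hsub hfin.ne

lemma ann_h1 {n : ℕ} (hn : 5 ≤ n) {γ B : ℝ} (hγ : 0 < γ) (hγn : γ < n - 4) (hB : 0 ≤ B) {ψ : EE n → ℝ} (hψ : ∀ y ≠ 0, |ψ y| ≤ B * ‖y‖^(-γ)) :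
    Tendsto (fun δ : ℝ => (δ^4)⁻¹ * ∫ y in {y : EE n | δ ≤ ‖y‖ ∧ ‖y‖ ≤ 2*δ}, |ψ y|) (𝓝[>] 0) (𝓝 0) := by
  have t : Tendsto (fun δ : ℝ => (B * 2^n * volume.real (closedBall (0 : EE n) 1)) * δ^((n:ℝ)-4-γ)) (𝓝[>] 0) (𝓝 0) := by
    have h : Tendsto (fun δ : ℝ => δ^((n:ℝ)-4-γ)) (𝓝[>] 0) (𝓝 0) := by
      have := (Real.continuousAt_rpow_const (0:ℝ) ((n:ℝ)-4-γ) (Or.inr (by linarith))).tendsto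
      rw [Real.zero_rpow (by linarith)] at this
      exact this.mono_left nhdsWithin_le_nhds
    simpa using h.const_mul (B * 2^n * volume.real (closedBall (0 : EE n) 1))
  refine squeeze_zero_norm' ?_ t
  filter_upwards [self_mem_nhdsWithin] with δ hδ
  have hδ : 0 < δ := hδ
  rw [norm_mul, Real.norm_eq_abs, Real.norm_eq_abs, abs_of_pos (by positivity)]
  refine (mul_le_mul_of_nonneg_left (ann_int hn hγ hB hψ hδ) (by positivity)).trans_eq ?_
  have : δ^((n:ℝ)-4-γ) = (δ^4)⁻¹ * δ^n * δ^(-γ) := by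
    rw [← Real.rpow_natCast δ 4, ← Real.rpow_natCast δ n, ← Real.rpow_neg hδ.le, ← Real.rpow_add hδ, ← Real.rpow_add hδ]
    congr 1; push_cast; ring
  rw [this, mul_pow]; ring

lemma ann_h2 {n : ℕ} (hn : 5 ≤ n) {γ B : ℝ} (hγ : 0 < γ) (hB : 0 ≤ B) {ψ : EE n → ℝ} (hψ : ∀ y ≠ 0, |ψ y| ≤ B * ‖y‖^(-γ)) :
    Tendsto (fun ρ : ℝ => (ρ^n)⁻¹ * ∫ y in {y : EE n | ρ ≤ ‖y‖ ∧ ‖y‖ ≤ 2*ρ}, |ψ y|) atTop (𝓝 0) := by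
  have t : Tendsto (fun δ : ℝ => (B * 2^n * volume.real (closedBall (0 : EE n) 1)) * δ^(-γ)) atTop (𝓝 0) := by
    simpa using (tendsto_rpow_neg_atTop hγ).const_mul (B * 2^n * volume.real (closedBall (0 : EE n) 1))
  refine squeeze_zero_norm' ?_ t
  filter_upwards [eventually_gt_atTop 0] with δ hδ
  rw [norm_mul, Real.norm_eq_abs, Real.norm_eq_abs, abs_of_pos (by positivity)]
  refine (mul_le_mul_of_nonneg_left (ann_int hn hγ hB hψ hδ) (by positivity)).trans_eq ?_
  rw [mul_pow]; field_simp

lemma scalar_ode {r1 r2 r3 r4 B : ℝ} {y1 y2 y3 y4 F : ℝ → ℝ}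
    (h4 : ∀ t, HasDerivAt y4 (r4 * y4 t + y3 t) t)
    (h3 : ∀ t, HasDerivAt y3 (r3 * y3 t + y2 t) t)
    (h2 : ∀ t, HasDerivAt y2 (r2 * y2 t + y1 t) t)
    (h1 : ∀ t, HasDerivAt y1 (r1 * y1 t + F t) t)
    (b4 : ∀ t, |y4 t| ≤ B) (b3 : ∀ t, |y3 t| ≤ B) (b2 : ∀ t, |y2 t| ≤ B) (b1 : ∀ t, |y1 t| ≤ B) (bF : ∀ t, |F t| ≤ B) :
    ∃ (w1 w2 w3 w4 : ℝ → ℝ) (B' : ℝ), (∀ t, HasDerivAt y4 (w1 t) t) ∧ (∀ t, HasDerivAt w1 (w2 t) t) ∧ (∀ t, HasDerivAt w2 (w3 t) t) ∧ (∀ t, HasDerivAt w3 (w4 t) t) ∧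
      (∀ t, |y4 t| ≤ B') ∧ (∀ t, |w1 t| ≤ B') ∧ (∀ t, |w2 t| ≤ B') ∧ (∀ t, |w3 t| ≤ B') ∧ (∀ t, |w4 t| ≤ B') ∧
      ∀ t, w4 t + (-(r1+r2+r3+r4)) * w3 t + (r1*r2+r1*r3+r1*r4+r2*r3+r2*r4+r3*r4) * w2 t + (-(r1*r2*r3+r1*r2*r4+r1*r3*r4+r2*r3*r4)) * w1 t + (r1*r2*r3*r4) * y4 t = F t := by
  have hB0 : 0 ≤ B := (abs_nonneg _).trans (b1 0)
  have gen : ∀ c4 c3 c2 c1 cF : ℝ, ∃ B', ∀ t, |c4 * y4 t + c3 * y3 t + c2 * y2 t + c1 * y1 t + cF * F t| ≤ B' := by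
    intro c4 c3 c2 c1 cF
    refine ⟨|c4| * B + |c3| * B + |c2| * B + |c1| * B + |cF| * B, fun t => ?_⟩
    have e : ∀ c y : ℝ, |y| ≤ B → |c * y| ≤ |c| * B := fun c y h => by
      rw [abs_mul]; exact mul_le_mul_of_nonneg_left h (abs_nonneg _)
    have q4 := e c4 _ (b4 t)
    have q3 := e c3 _ (b3 t)
    have q2 := e c2 _ (b2 t)
    have q1 := e c1 _ (b1 t)
    have qF := e cF _ (bF t)
    rw [abs_le] at *
    constructor <;> linarith [q4.1, q4.2, q3.1, q3.2, q2.1, q2.2, q1.1, q1.2, qF.1, qF.2]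
  have hd : ∀ (c4 c3 c2 c1 : ℝ) t, HasDerivAt (fun t => c4 * y4 t + c3 * y3 t + c2 * y2 t + c1 * y1 t + 0 * F t)
      ((c4*r4) * y4 t + (c4 + c3*r3) * y3 t + (c3 + c2*r2) * y2 t + (c2 + c1*r1) * y1 t + c1 * F t) t := by
    intro c4 c3 c2 c1 t
    have := (((((h4 t).const_mul c4).add ((h3 t).const_mul c3)).add ((h2 t).const_mul c2)).add ((h1 t).const_mul c1))
    have e : (fun t => c4 * y4 t + c3 * y3 t + c2 * y2 t + c1 * y1 t + 0 * F t) = (fun t => c4 * y4 t + c3 * y3 t + c2 * y2 t + c1 * y1 t) := by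
      funext t; ring
    rw [e]
    refine this.congr_deriv (by ring)
  have e0 : y4 = fun t => 1 * y4 t + 0 * y3 t + 0 * y2 t + 0 * y1 t + 0 * F t := by funext t; ring
  obtain ⟨B1, hB1⟩ := gen r4 1 0 0 0
  obtain ⟨B2, hB2⟩ := gen (r4*r4) (r4 + r3) 1 0 0
  obtain ⟨B3, hB3⟩ := gen (r4*r4*r4) (r4*r4 + (r4+r3)*r3) (r4+r3+r2) 1 0
  obtain ⟨B4, hB4⟩ := gen (r4*r4*r4*r4) (r4*r4*r4 + (r4*r4 + (r4+r3)*r3)*r3) (r4*r4 + (r4+r3)*r3 + (r4+r3+r2)*r2) (r4+r3+r2+r1) 1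
  have hmax : B ≤ max B (max B1 (max B2 (max B3 B4))) ∧ B1 ≤ max B (max B1 (max B2 (max B3 B4))) ∧ B2 ≤ max B (max B1 (max B2 (max B3 B4))) ∧ B3 ≤ max B (max B1 (max B2 (max B3 B4))) ∧ B4 ≤ max B (max B1 (max B2 (max B3 B4))) := by
    refine ⟨?_, ?_, ?_, ?_, ?_⟩ <;> simp
  obtain ⟨m0, m1, m2, m3, m4⟩ := hmax
  refine ⟨_, _, _, _, max B (max B1 (max B2 (max B3 B4))), ?_, ?_, ?_, ?_, fun t => (b4 t).trans m0, fun t => (hB1 t).trans m1, fun t => (hB2 t).trans m2, fun t => (hB3 t).trans m3, fun t => (hB4 t).trans m4, ?_⟩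
  · intro t
    exact (h4 t).congr_deriv (by ring)
  · intro t
    exact (hd r4 1 0 0 t).congr_deriv (by ring)
  · intro t
    exact (hd _ _ _ _ t).congr_deriv (by ring)
  · intro t
    exact (hd _ _ _ _ t).congr_deriv (by ring)
  · intro t
    ring

lemma vec_deriv {p : ℕ} {f g : Fin p → ℝ → ℝ} {t : ℝ} (h : ∀ i, HasDerivAt (f i) (g i t) t) :
    HasDerivAt (fun t => (WithLp.toLp 2 (fun i => f i t) : EE p)) (WithLp.toLp 2 (fun i => g i t)) t := by
  have h1 : HasDerivAt (fun t => (fun i => f i t)) (fun i => g i t) t := hasDerivAt_pi.2 h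
  exact ((PiLp.continuousLinearEquiv 2 ℝ (fun _ : Fin p => ℝ)).symm.toContinuousLinearMap.hasFDerivAt.comp_hasDerivAt t h1)

lemma sol_scalar {n p : ℕ} (hn : 5 ≤ n) {s γ C : ℝ} (hs : 1 < s) (hta : 0 < ta n s) (hγ : γ = 4/(s-1)) (hγn : γ < n - 4)
    {V : EE n → EE p} (hV : IsSol s (c0 n)⁻¹ V 0) (hC0 : 0 ≤ C) (hC : ∀ x ≠ 0, ‖V x‖ ≤ C * ‖x‖^(-γ)) {e : EE n} (he : ‖e‖ = 1) (i : Fin p) :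
    ∃ (y1 y2 y3 y4 : ℝ → ℝ) (B : ℝ), (∀ t, HasDerivAt y4 (γ * y4 t + y3 t) t) ∧
    (∀ t, HasDerivAt y3 ((γ - n + 2) * y3 t + y2 t) t) ∧
    (∀ t, HasDerivAt y2 ((γ+2) * y2 t + y1 t) t) ∧
    (∀ t, HasDerivAt y1 ((γ + 2 - n + 2) * y1 t + nl s (Real.exp (γ*t) • V (Real.exp t • e)) i) t) ∧
    (∀ t, |y4 t| ≤ B) ∧ (∀ t, |y3 t| ≤ B) ∧ (∀ t, |y2 t| ≤ B) ∧ (∀ t, |y1 t| ≤ B) ∧ (∀ t, |nl s (Real.exp (γ*t) • V (Real.exp t • e)) i| ≤ B) ∧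
    ∀ t, y4 t = Real.exp (γ*t) * V (Real.exp t • e) i := by
  have hs1 : 0 < s - 1 := by linarith
  have hγ0 : 0 < γ := by rw [hγ]; positivity
  have hγs : γ * (s-1) = 4 := by rw [hγ]; field_simp
  have he0 : e ≠ 0 := by rintro rfl; simp at he
  have hne : ∀ t : ℝ, Real.exp t • e ≠ 0 := fun t => smul_ne_zero (Real.exp_pos t).ne' he0
  have hnorm : ∀ t : ℝ, ‖Real.exp t • e‖ = Real.exp t := fun t => by rw [norm_smul, he, mul_one, Real.norm_eq_abs, abs_of_pos (Real.exp_pos t)]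
  set w : ℝ → EE p := fun t => Real.exp (γ*t) • V (Real.exp t • e) with hw
  have hwc : Continuous w := by
    apply Continuous.smul (f := fun t => Real.exp (γ*t)) (g := fun t => V (Real.exp t • e))
    · fun_prop
    · exact ContinuousOn.comp_continuous (hV.2.1) (f := fun t : ℝ => Real.exp t • e) (by fun_prop) (fun t => hne t)
  have hwb : ∀ t, ‖w t‖ ≤ C := by
    intro t
    rw [hw]; simp only
    rw [norm_smul, Real.norm_eq_abs, abs_of_pos (Real.exp_pos _)]
    refine (mul_le_mul_of_nonneg_left (hC _ (hne t)) (Real.exp_pos _).le).trans_eq ?_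
    rw [hnorm, ← Real.exp_mul, show Real.exp (γ*t) * (C * Real.exp (t * -γ)) = C * (Real.exp (γ*t) * Real.exp (t * -γ)) by ring, ← Real.exp_add]
    rw [show γ*t + t * -γ = 0 by ring]; simp
  set F : ℝ → ℝ := fun t => nl s (w t) i with hF
  have hFc : Continuous F := (nl_cont hs i).comp hwc
  have hFb : ∀ t, |F t| ≤ C^s := fun t => (nl_abs_le hs _ i).trans (Real.rpow_le_rpow (norm_nonneg _) (hwb t) (by linarith))
  obtain ⟨y1, h1, B1, hb1⟩ := bdd_inv (r := γ+2-n+2) (by linarith) hFc hFb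
  have c1 : ContDiff ℝ (1:ℕ) y1 := bdd_inv_contDiff h1 0 (contDiff_zero.2 hFc)
  obtain ⟨y2, h2, B2, hb2⟩ := bdd_inv (r := γ+2) (by linarith) c1.continuous hb1
  have c2 : ContDiff ℝ (2:ℕ) y2 := bdd_inv_contDiff h2 1 c1
  obtain ⟨y3, h3, B3, hb3⟩ := bdd_inv (r := γ-n+2) (by linarith) c2.continuous hb2
  have c3 : ContDiff ℝ (3:ℕ) y3 := bdd_inv_contDiff h3 2 c2
  obtain ⟨y4, h4, B4, hb4⟩ := bdd_inv (r := γ) hγ0.ne' c3.continuous hb3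
  have c4 : ContDiff ℝ (4:ℕ) y4 := bdd_inv_contDiff h4 3 c3
  have hmax : C^s ≤ max (C^s) (max B1 (max B2 (max B3 B4))) ∧ B1 ≤ max (C^s) (max B1 (max B2 (max B3 B4))) ∧ B2 ≤ max (C^s) (max B1 (max B2 (max B3 B4))) ∧ B3 ≤ max (C^s) (max B1 (max B2 (max B3 B4))) ∧ B4 ≤ max (C^s) (max B1 (max B2 (max B3 B4))) := by
    refine ⟨?_, ?_, ?_, ?_, ?_⟩ <;> simp
  obtain ⟨m0, m1, m2, m3, m4⟩ := hmax
  refine ⟨y1, y2, y3, y4, _, h4, h3, h2, h1, fun t => (hb4 t).trans m4, fun t => (hb3 t).trans m3, fun t => (hb2 t).trans m2, fun t => (hb1 t).trans m1, fun t => (hFb t).trans m0, ?_⟩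
  -- bilap
  have hbil : ∀ x : EE n, x ≠ 0 → bilap (RW γ y4) x = nl s (V x) i := by
    intro x hx
    rw [bilap_RW h4 h3 h2 h1 hx]
    have hx0 : 0 < ‖x‖ := norm_pos_iff.2 hx
    unfold RW
    rw [hF]; simp only
    rw [hw]; simp only
    rw [nl_smul (Real.exp_pos _), Real.exp_log hx0]
    have e1 : V (‖x‖ • e) = V x := sol_radial hn hs hta (inv_pos.2 (c0_pos hn)) hV (by rw [norm_smul, he]; simp)
    rw [e1, ← Real.exp_mul, ← mul_assoc]
    have e2 : ‖x‖^(-(γ+4)) * Real.exp (γ * Real.log ‖x‖ * s) = 1 := by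
      rw [show γ * Real.log ‖x‖ * s = Real.log ‖x‖ * (γ*s) by ring, Real.exp_mul, Real.exp_log hx0, ← Real.rpow_add hx0]
      rw [show -(γ+4) + γ * s = 0 by linarith, Real.rpow_zero]
    rw [e2, one_mul]
  have hB4 : 0 ≤ B4 := (abs_nonneg _).trans (hb4 0)
  have hψb : ∀ y : EE n, y ≠ 0 → |(RW γ y4 : EE n → ℝ) y| ≤ B4 * ‖y‖^(-γ) := by
    intro y hy
    unfold RW
    rw [abs_mul, abs_of_nonneg (by positivity), mul_comm]
    exact mul_le_mul_of_nonneg_right (hb4 _) (by positivity)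
  have hrep : ∀ x : EE n, x ≠ 0 → (RW γ y4 : EE n → ℝ) x = V x i := by
    intro x hx
    have hae : (fun y => rk (x - y) * bilap (RW γ y4) y) =ᵐ[volume] fun y => rk (x - y) * nl s (V y) i := by
      filter_upwards [ae_ne hn (0 : EE n)] with y hy
      rw [hbil y hy]
    obtain ⟨hi, hv⟩ := hV.2.2 x hx i
    have := rep hn hx (RW_contDiffOn c4) (hi.congr hae.symm) (ann_h1 hn hγ0 hγn hB4 hψb) (ann_h2 hn hγ0 hB4 hψb)
    rw [integral_congr_ae hae] at this
    rw [hv, ← this, ← mul_assoc, inv_mul_cancel₀ (c0_pos hn).ne', one_mul]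
  intro t
  rw [← hrep _ (hne t)]
  unfold RW
  rw [hnorm, Real.log_exp, ← Real.exp_mul, ← mul_assoc, ← Real.exp_add]
  rw [show γ*t + t * -γ = 0 by ring]; simp

theorem ode_of_sol {n p : ℕ} (hn : 5 ≤ n) {s γ C : ℝ} (hs : 1 < s) (hta : 0 < ta n s) (hγ : γ = 4/(s-1)) (hγn : γ < n - 4)
    {V : EE n → EE p} (hV : IsSol s (c0 n)⁻¹ V 0) (hC0 : 0 ≤ C) (hC : ∀ x ≠ 0, ‖V x‖ ≤ C * ‖x‖^(-γ)) {e : EE n} (he : ‖e‖ = 1)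
    {r1 r2 r3 r4 : ℝ} (hr1 : r1 = γ+2-n+2) (hr2 : r2 = γ+2) (hr3 : r3 = γ-n+2) (hr4 : r4 = γ) :
    ∃ (w1 w2 w3 w4 : ℝ → EE p) (B : ℝ), OdeSol s (r1*r2*r3*r4) (-(r1*r2*r3+r1*r2*r4+r1*r3*r4+r2*r3*r4)) (r1*r2+r1*r3+r1*r4+r2*r3+r2*r4+r3*r4) (-(r1+r2+r3+r4)) B
      (fun t => Real.exp (γ*t) • V (Real.exp t • e)) w1 w2 w3 w4 := by
  have key : ∀ i : Fin p, ∃ (w0 w1 w2 w3 w4 : ℝ → ℝ) (B : ℝ), (∀ t, w0 t = Real.exp (γ*t) * V (Real.exp t • e) i) ∧ (∀ t, HasDerivAt w0 (w1 t) t) ∧ (∀ t, HasDerivAt w1 (w2 t) t) ∧ (∀ t, HasDerivAt w2 (w3 t) t) ∧ (∀ t, HasDerivAt w3 (w4 t) t) ∧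
      (∀ t, |w0 t| ≤ B) ∧ (∀ t, |w1 t| ≤ B) ∧ (∀ t, |w2 t| ≤ B) ∧ (∀ t, |w3 t| ≤ B) ∧ (∀ t, |w4 t| ≤ B) ∧
      ∀ t, w4 t + (-(r1+r2+r3+r4)) * w3 t + (r1*r2+r1*r3+r1*r4+r2*r3+r2*r4+r3*r4) * w2 t + (-(r1*r2*r3+r1*r2*r4+r1*r3*r4+r2*r3*r4)) * w1 t + (r1*r2*r3*r4) * w0 t = nl s (Real.exp (γ*t) • V (Real.exp t • e)) i := by
    intro i
    obtain ⟨y1, y2, y3, y4, B, h4, h3, h2, h1, b4, b3, b2, b1, bF, hy⟩ := sol_scalar hn hs hta hγ hγn hV hC0 hC he i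
    simp only [← hr1] at h1
    simp only [← hr2] at h2
    simp only [← hr3] at h3
    obtain ⟨w1, w2, w3, w4, B', q⟩ := scalar_ode (r4 := r4) (by simpa only [hr4] using h4) h3 h2 h1 b4 b3 b2 b1 bF
    exact ⟨y4, w1, w2, w3, w4, B', hy, q⟩
  choose w0 w1 w2 w3 w4 B hw0 d0 d1 d2 d3 b0 b1 b2 b3 b4 hode using key
  have e0 : (fun t => Real.exp (γ*t) • V (Real.exp t • e)) = fun t => (WithLp.toLp 2 (fun i => w0 i t) : EE p) := by
    funext t
    ext i
    simp [hw0]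
  have hb : ∀ {u : Fin p → ℝ → ℝ}, (∀ i t, |u i t| ≤ B i) → ∀ t, ‖(WithLp.toLp 2 (fun i => u i t) : EE p)‖ ≤ ∑ i, B i := by
    intro u hu t
    refine (norm_le_sum _).trans (Finset.sum_le_sum fun i _ => ?_)
    exact hu i t
  refine ⟨fun t => WithLp.toLp 2 (fun i => w1 i t), fun t => WithLp.toLp 2 (fun i => w2 i t), fun t => WithLp.toLp 2 (fun i => w3 i t), fun t => WithLp.toLp 2 (fun i => w4 i t), ∑ i, B i, ?_⟩
  constructor
  · rw [e0]; exact fun t => vec_deriv (fun i => d0 i t)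
  · exact fun t => vec_deriv (fun i => d1 i t)
  · exact fun t => vec_deriv (fun i => d2 i t)
  · exact fun t => vec_deriv (fun i => d3 i t)
  · intro t; have := hb b0 t; rw [← congrFun e0 t] at this; exact this
  · exact hb b1
  · exact hb b2
  · exact hb b3
  · exact hb b4
  · intro t
    ext i
    have := hode i t
    unfold nl at this
    simp only [PiLp.add_apply, PiLp.smul_apply, smul_eq_mul] at this ⊢
    rw [← this, hw0 i t]

noncomputable def KK (n : ℕ) (γ : ℝ) : ℝ := (γ+2-n+2)*(γ+2)*(γ-n+2)*γ

lemma KK_pos {n : ℕ} {γ : ℝ} (hγ0 : 0 < γ) (hγn : γ < n - 4) : 0 < KK n γ := by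
  unfold KK
  have h1 : 0 < n - 4 - γ := by linarith
  have h2 : 0 < n - 2 - γ := by linarith
  have : (γ+2-n+2)*(γ+2)*(γ-n+2)*γ = (n-4-γ)*(γ+2)*(n-2-γ)*γ := by ring
  rw [this]; positivity

lemma vode {n p : ℕ} (hn : 5 ≤ n) {s γ C : ℝ} (hs : 1 < s) (hta : 0 < ta n s) (hγ : γ = 4/(s-1)) (hγn : γ < n - 4) (hγm : ((n:ℝ)-4)/2 < γ)
    {V : EE n → EE p} (hV : IsSol s (c0 n)⁻¹ V 0) (hC0 : 0 ≤ C) (hC : ∀ x ≠ 0, ‖V x‖ ≤ C * ‖x‖^(-γ)) {e : EE n} (he : ‖e‖ = 1) :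
    ∃ (a1 a2 a3 : ℝ) (w1 w2 w3 w4 : ℝ → EE p) (B : ℝ), a3 < 0 ∧ 0 < a1 ∧ OdeSol s (KK n γ) a1 a2 a3 B
      (fun t => Real.exp (γ*t) • V (Real.exp t • e)) w1 w2 w3 w4 := by
  obtain ⟨w1, w2, w3, w4, B, h⟩ := ode_of_sol hn hs hta hγ hγn hV hC0 hC he rfl rfl rfl rfl
  refine ⟨_, _, _, w1, w2, w3, w4, B, ?_, ?_, h⟩
  · linarith
  · have hn' : (5:ℝ) ≤ n := by exact_mod_cast hn
    obtain ⟨ε, hε⟩ : ∃ ε, ε = γ - ((n:ℝ)-4)/2 := ⟨_, rfl⟩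
    obtain ⟨α, hα⟩ : ∃ α, α = ((n:ℝ)-4)/2 := ⟨_, rfl⟩
    have e1 : γ = ε + α := by linarith
    have e2 : (n:ℝ) = 2*α + 4 := by linarith
    have h1 : 0 < ε := by linarith
    have h2 : ε < α := by linarith
    rw [e2, e1]
    have : -((ε + α + 2 - (2 * α + 4) + 2) * (ε + α + 2) * (ε + α - (2 * α + 4) + 2) + (ε + α + 2 - (2 * α + 4) + 2) * (ε + α + 2) * (ε + α) + (ε + α + 2 - (2 * α + 4) + 2) * (ε + α - (2 * α + 4) + 2) * (ε + α) + (ε + α + 2) * (ε + α - (2 * α + 4) + 2) * (ε + α)) = 2*ε*(α^2 + (α+2)^2 - 2*ε^2) := by ring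
    rw [this]
    have : 0 < α^2 + (α+2)^2 - 2*ε^2 := by nlinarith
    positivity

lemma vfact1 {n p : ℕ} (hn : 5 ≤ n) {s γ C : ℝ} (hs : 1 < s) (hta : 0 < ta n s) (hγ : γ = 4/(s-1)) (hγn : γ < n - 4) (hγm : ((n:ℝ)-4)/2 < γ)
    {V : EE n → EE p} (hV : IsSol s (c0 n)⁻¹ V 0) (hC0 : 0 ≤ C) (hC : ∀ x ≠ 0, ‖V x‖ ≤ C * ‖x‖^(-γ)) {e : EE n} (he : ‖e‖ = 1)
    {θ : ℝ} (hθ0 : 0 ≤ θ) (hθ : θ^(s-1) < KK n γ) (hb : ∀ t, 0 < t → t < 1 → t^γ * ‖V (t • e)‖ ≤ θ) : V e = 0 := by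
  obtain ⟨a1, a2, a3, w1, w2, w3, w4, B, h3, h1, h⟩ := vode hn hs hta hγ hγn hγm hV hC0 hC he
  have hγ0 : 0 < γ := by rw [hγ]; have : 0 < s - 1 := by linarith
                         positivity
  have := fact1 hs h h3 h1 (KK_pos hγ0 hγn) (T := 0) hθ0 hθ (by
    intro t ht
    rw [norm_smul, Real.norm_eq_abs, abs_of_pos (Real.exp_pos _), mul_comm γ t, Real.exp_mul]
    exact hb _ (Real.exp_pos _) (by simpa using ht)) 0
  simpa using this

lemma vfact2 {n p : ℕ} (hn : 5 ≤ n) {s γ C : ℝ} (hs : 1 < s) (hta : 0 < ta n s) (hγ : γ = 4/(s-1)) (hγn : γ < n - 4) (hγm : ((n:ℝ)-4)/2 < γ)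
    {V : EE n → EE p} (hV : IsSol s (c0 n)⁻¹ V 0) (hC0 : 0 ≤ C) (hC : ∀ x ≠ 0, ‖V x‖ ≤ C * ‖x‖^(-γ)) {e : EE n} (he : ‖e‖ = 1)
    {θ : ℝ} (hθ0 : 0 < θ) (hb : ∀ t, 0 < t → θ ≤ t^γ * ‖V (t • e)‖) : ‖V e‖ = (KK n γ)^(1/(s-1)) := by
  obtain ⟨a1, a2, a3, w1, w2, w3, w4, B, h3, h1, h⟩ := vode hn hs hta hγ hγn hγm hV hC0 hC he
  have hγ0 : 0 < γ := by rw [hγ]; have : 0 < s - 1 := by linarith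
                         positivity
  have := fact2 hs h h3 h1 (KK_pos hγ0 hγn) hθ0 (by
    intro t
    rw [norm_smul, Real.norm_eq_abs, abs_of_pos (Real.exp_pos _), mul_comm γ t, Real.exp_mul]
    exact hb _ (Real.exp_pos _)) 0
  simpa using this

lemma seq_blow {n p : ℕ} (hn : 5 ≤ n) {s c ρ L : ℝ} (hs : 1 < s) (hc : 0 < c)
    {W : EE n → EE p} {h : EE n → Fin p → ℝ} (H : LocSol s c ρ L W h) {γ : ℝ} (hγ : γ = 4/(s-1)) (hγn : γ < n - 4)
    {C : ℝ} (hC0 : 0 ≤ C) (hC : ∀ x : EE n, x ≠ 0 → ‖W x‖ ≤ C * ‖x‖^(-γ))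
    {ns : ℕ → EE n} (h0 : ∀ j, ns j ≠ 0) (ht : Tendsto ns atTop (𝓝 0)) :
    ∃ ms : ℕ → ℕ, StrictMono ms ∧ ∃ V : EE n → EE p, IsSol s c V 0 ∧ (∀ x ≠ 0, ‖V x‖ ≤ C * ‖x‖^(-γ)) ∧
      (∀ x ≠ 0, Tendsto (fun j => ‖ns (ms j)‖^γ • W (‖ns (ms j)‖ • x)) atTop (𝓝 (V x))) ∧
      ∃ x, ‖x‖ = 1 ∧ Tendsto (fun j => ‖ns (ms j)‖^γ * ‖W (ns (ms j))‖) atTop (𝓝 ‖V x‖) := by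
  have hpos : ∀ j, 0 < ‖ns j‖ := fun j => norm_pos_iff.2 (h0 j)
  obtain ⟨x, hx, ψ, hψ, hψt⟩ := (isCompact_sphere (0 : EE n) 1).tendsto_subseq (x := fun j => ‖ns j‖⁻¹ • ns j) (by
    intro j
    simp only [mem_sphere_iff_norm, sub_zero]
    rw [norm_smul, norm_inv, norm_norm, inv_mul_cancel₀ (hpos j).ne'])
  have hx1 : ‖x‖ = 1 := by simpa using hx
  have hx0 : x ≠ 0 := by rintro rfl; simp at hx1
  have htn : Tendsto (fun j => ‖ns j‖) atTop (𝓝 0) := tendsto_zero_iff_norm_tendsto_zero.1 ht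
  obtain ⟨φ, hφ, V, hV, hVb, hVt⟩ := blow_down hn hs hc H hγ hγn hC0 hC (r := fun j => ‖ns (ψ j)‖) (fun j => hpos _)
    (htn.comp hψ.tendsto_atTop)
  refine ⟨ψ ∘ φ, hψ.comp hφ, V, hV, hVb, fun z hz => hVt z hz (fun _ => z) tendsto_const_nhds, x, hx1, ?_⟩
  have := (hVt x hx0 _ (hψt.comp hφ.tendsto_atTop)).norm
  refine this.congr (fun j => ?_)
  simp only [Function.comp]
  rw [norm_smul, smul_smul, mul_inv_cancel₀ (hpos _).ne', one_smul, Real.norm_eq_abs, abs_of_pos (Real.rpow_pos_of_pos (hpos _) _)]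

/-- shifting a sequence in the punctured neighbourhood -/
lemma seq_shift {n : ℕ} {ns : ℕ → EE n} (hns : Tendsto ns atTop (𝓝[≠] 0)) :
    ∃ N, (∀ j, ns (j+N) ≠ 0) ∧ Tendsto (fun j => ns (j+N)) atTop (𝓝 0) := by
  rw [tendsto_nhdsWithin_iff] at hns
  obtain ⟨N, hN⟩ := eventually_atTop.1 hns.2
  exact ⟨N, fun j => hN _ (by omega), (tendsto_add_atTop_iff_nat N).2 hns.1⟩

lemma caseA {n p : ℕ} (hn : 5 ≤ n) {s γ C ρ L : ℝ} (hs : 1 < s) (hta : 0 < ta n s) (hγ : γ = 4/(s-1)) (hγn : γ < n - 4) (hγm : ((n:ℝ)-4)/2 < γ)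
    {W : EE n → EE p} {h : EE n → Fin p → ℝ} (H : LocSol s (c0 n)⁻¹ ρ L W h)
    (hC0 : 0 ≤ C) (hC : ∀ x ≠ 0, ‖W x‖ ≤ C * ‖x‖^(-γ)) {e : EE n} (he : ‖e‖ = 1)
    {θ r0 : ℝ} (hθ0 : 0 < θ) (hr0 : 0 < r0) (hb : ∀ t, 0 < t → t < r0 → θ ≤ t^γ * ‖W (t • e)‖) :
    Tendsto (fun x => ‖x‖^γ * ‖W x‖) (𝓝[≠] 0) (𝓝 ((KK n γ)^(1/(s-1)))) := by
  have hc : 0 < (c0 n)⁻¹ := inv_pos.2 (c0_pos hn)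
  have he0 : e ≠ 0 := by rintro rfl; simp at he
  apply tendsto_of_subseq_tendsto
  intro ns hns
  obtain ⟨N, hN, hNt⟩ := seq_shift hns
  obtain ⟨ms, hms, V, hV, hVb, hVt, x, hx1, hxt⟩ := seq_blow hn hs hc H hγ hγn hC0 hC hN hNt
  refine ⟨fun j => ms j + N, ?_⟩
  have hVe : V x = V e := sol_radial hn hs hta hc hV (by rw [hx1, he])
  rw [hVe] at hxt
  rw [← vfact2 hn hs hta hγ hγn hγm hV hC0 hVb he hθ0 ?_]
  · exact hxt
  · intro t ht
    have l1 := ((hVt (t • e) (smul_ne_zero ht.ne' he0)).norm).const_mul (t^γ)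
    refine ge_of_tendsto l1 ?_
    have htn : Tendsto (fun j => ‖ns (ms j + N)‖) atTop (𝓝 0) := tendsto_zero_iff_norm_tendsto_zero.1 (hNt.comp hms.tendsto_atTop)
    have l2 : Tendsto (fun j => ‖ns (ms j + N)‖ * t) atTop (𝓝 0) := by simpa using htn.mul_const t
    filter_upwards [l2.eventually (gt_mem_nhds hr0)] with j hj
    have hp : 0 < ‖ns (ms j + N)‖ := norm_pos_iff.2 (hN _)
    have := hb _ (mul_pos hp ht) hj
    rw [norm_smul, smul_smul, Real.norm_eq_abs, abs_of_pos (Real.rpow_pos_of_pos hp _)]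
    rw [Real.mul_rpow hp.le ht.le] at this
    linarith

lemma caseB_rad {n p : ℕ} (hn : 5 ≤ n) {s γ C ρ L : ℝ} (hs : 1 < s) (hta : 0 < ta n s) (hγ : γ = 4/(s-1)) (hγn : γ < n - 4) (hγm : ((n:ℝ)-4)/2 < γ)
    {W : EE n → EE p} {h : EE n → Fin p → ℝ} (H : LocSol s (c0 n)⁻¹ ρ L W h)
    (hC0 : 0 ≤ C) (hC : ∀ x ≠ 0, ‖W x‖ ≤ C * ‖x‖^(-γ)) {e : EE n} (he : ‖e‖ = 1)
    (hb : ∀ θ > 0, ∀ r0 > 0, ∃ t, 0 < t ∧ t < r0 ∧ t^γ * ‖W (t • e)‖ < θ) :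
    ∀ ε > 0, ∃ r0 > 0, ∀ t, 0 < t → t < r0 → t^γ * ‖W (t • e)‖ < ε := by
  intro ε hε
  by_contra hcon
  push Not at hcon
  have hc : 0 < (c0 n)⁻¹ := inv_pos.2 (c0_pos hn)
  have he0 : e ≠ 0 := by rintro rfl; simp at he
  have hs1 : 0 < s - 1 := by linarith
  have hγ0 : 0 < γ := by rw [hγ]; positivity
  have hK := KK_pos hγ0 hγn
  set m := (KK n γ)^(1/(s-1)) with hm
  have hm0 : 0 < m := Real.rpow_pos_of_pos hK _
  set l := min ε (m/2) with hl
  have hl0 : 0 < l := lt_min hε (by positivity)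
  have hlK : l^(s-1) < KK n γ := by
    have h1 : l < m := (min_le_right _ _).trans_lt (by linarith)
    have h2 := Real.rpow_lt_rpow hl0.le h1 hs1
    rwa [hm, ← Real.rpow_mul hK.le, one_div_mul_cancel hs1.ne', Real.rpow_one] at h2
  set f : ℝ → ℝ := fun t => t^γ * ‖W (t • e)‖ with hf
  have hfc : ∀ a b, 0 < a → b < ρ → ContinuousOn f (Set.Icc a b) := by
    intro a b ha hb
    apply ContinuousOn.mul (f := fun t : ℝ => t^γ) (g := fun t => ‖W (t • e)‖)
    · exact (Real.continuous_rpow_const hγ0.le).continuousOn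
    · apply ContinuousOn.norm
      refine H.cont.comp (f := fun t : ℝ => t • e) (by fun_prop) ?_
      intro t ht
      have ht0 : 0 < t := ha.trans_le ht.1
      have := H.rpos
      refine ⟨?_, smul_ne_zero ht0.ne' he0⟩
      rw [mem_ball_zero_iff, norm_smul, he, mul_one, Real.norm_eq_abs, abs_of_pos ht0]
      linarith [ht.2]
  have key : ∀ j : ℕ, ∃ b r : ℝ, 0 < b ∧ b < r ∧ r < 1/((j:ℝ)+1) ∧ f b < 1/((j:ℝ)+1) ∧ l ≤ f r ∧ ∀ t, b ≤ t → t < r → f t < l := by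
    intro j
    have hj : (0:ℝ) < 1/((j:ℝ)+1) := by positivity
    obtain ⟨cc, hc0, hc1, hc2⟩ := hcon (min (1/((j:ℝ)+1)) ρ) (lt_min hj H.rpos)
    obtain ⟨b, hb0, hb1, hb2⟩ := hb (min (1/((j:ℝ)+1)) l) (lt_min hj hl0) cc hc0
    have hcρ : cc < ρ := hc1.trans_le (min_le_right _ _)
    have hfcc : l ≤ f cc := (min_le_left _ _).trans hc2
    set S := Set.Icc b cc ∩ f ⁻¹' Set.Ici l with hS
    have hSc : IsClosed S := (hfc b cc hb0 hcρ).preimage_isClosed_of_isClosed isClosed_Icc isClosed_Ici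
    have hSn : S.Nonempty := ⟨cc, ⟨hb1.le, le_rfl⟩, hfcc⟩
    have hSb : BddBelow S := ⟨b, fun t ht => ht.1.1⟩
    have hr := hSc.csInf_mem hSn hSb
    have hfb : f b < l := hb2.trans_le (min_le_right _ _)
    refine ⟨b, sInf S, hb0, ?_, ?_, hb2.trans_le (min_le_left _ _), hr.2, ?_⟩
    · refine lt_of_le_of_ne hr.1.1 ?_
      intro hE
      have := hr.2
      rw [← hE] at this
      exact absurd this (not_le.2 hfb)
    · exact hr.1.2.trans_lt (hc1.trans_le (min_le_left _ _))
    · intro t ht1 ht2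
      by_contra hcc
      push Not at hcc
      have : t ∈ S := ⟨⟨ht1, ht2.le.trans hr.1.2⟩, hcc⟩
      exact absurd (csInf_le hSb this) (not_le.2 ht2)
  choose b r hb0 hbr hrj hfb hfr hft using key
  have hr0 : ∀ j, 0 < r j := fun j => (hb0 j).trans (hbr j)
  have hj0 : Tendsto (fun j : ℕ => 1/((j:ℝ)+1)) atTop (𝓝 0) := tendsto_one_div_add_atTop_nhds_zero_nat
  have hrt : Tendsto r atTop (𝓝 0) := squeeze_zero (fun j => (hr0 j).le) (fun j => (hrj j).le) hj0
  have hq : ∀ j, b j / r j ∈ Set.Icc (0:ℝ) 1 := fun j => ⟨(div_pos (hb0 j) (hr0 j)).le, (div_le_one (hr0 j)).2 (hbr j).le⟩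
  obtain ⟨q, hqI, ψ, hψ, hψt⟩ := isCompact_Icc.tendsto_subseq hq
  obtain ⟨φ, hφ, V, hV, hVb, hVt⟩ := blow_down hn hs hc H hγ hγn hC0 hC (r := fun j => r (ψ j)) (fun j => hr0 _)
    (hrt.comp hψ.tendsto_atTop)
  have hqt : Tendsto (fun j => b (ψ (φ j)) / r (ψ (φ j))) atTop (𝓝 q) := hψt.comp hφ.tendsto_atTop
  have hVe : l ≤ ‖V e‖ := by
    refine ge_of_tendsto' ((hVt e he0 (fun _ => e) tendsto_const_nhds).norm) (fun j => ?_)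
    rw [norm_smul, Real.norm_eq_abs, abs_of_pos (Real.rpow_pos_of_pos (hr0 _) _)]
    exact hfr _
  have hVe0 : V e = 0 := by
    rcases hqI.1.eq_or_lt with hq0 | hq0
    · apply vfact1 hn hs hta hγ hγn hγm hV hC0 hVb he hl0.le hlK
      intro t ht ht1
      have l1 := ((hVt (t • e) (smul_ne_zero ht.ne' he0) (fun _ => t • e) tendsto_const_nhds).norm).const_mul (t^γ)
      refine le_of_tendsto l1 ?_
      rw [← hq0] at hqt
      filter_upwards [hqt.eventually (gt_mem_nhds ht)] with j hj
      have hp := hr0 (ψ (φ j))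
      rw [div_lt_iff₀ hp] at hj
      have := hft (ψ (φ j)) (t * r (ψ (φ j))) hj.le (by nlinarith)
      rw [norm_smul, smul_smul, Real.norm_eq_abs, abs_of_pos (Real.rpow_pos_of_pos hp _)]
      rw [hf] at this; simp only at this
      rw [Real.mul_rpow ht.le hp.le, mul_comm t] at this
      linarith
    · have hqe : q • e ≠ 0 := smul_ne_zero hq0.ne' he0
      have hVq : V (q • e) = 0 := by
        have l1 := hVt (q • e) hqe (fun j => (b (ψ (φ j)) / r (ψ (φ j))) • e) (hqt.smul_const e)
        have hfb0 : Tendsto (fun j => f (b (ψ (φ j)))) atTop (𝓝 0) := by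
          refine squeeze_zero (fun j => ?_) (fun j => (hfb _).le) ((hj0.comp hψ.tendsto_atTop).comp hφ.tendsto_atTop)
          have := (Real.rpow_pos_of_pos (hb0 (ψ (φ j))) γ).le
          exact mul_nonneg this (norm_nonneg _)
        have l2 : Tendsto (fun j => (b (ψ (φ j)) / r (ψ (φ j)))^(-γ) * f (b (ψ (φ j)))) atTop (𝓝 (q^(-γ) * 0)) :=
          (hqt.rpow_const (Or.inl hq0.ne')).mul hfb0
        rw [mul_zero] at l2
        have l3 : Tendsto (fun j => (r (ψ (φ j)))^γ • W (r (ψ (φ j)) • ((b (ψ (φ j)) / r (ψ (φ j))) • e))) atTop (𝓝 0) := by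
          rw [tendsto_zero_iff_norm_tendsto_zero]
          refine l2.congr (fun j => ?_)
          have hp := hr0 (ψ (φ j))
          have hbp := hb0 (ψ (φ j))
          rw [norm_smul, smul_smul, mul_div_cancel₀ _ hp.ne', Real.norm_eq_abs, abs_of_pos (Real.rpow_pos_of_pos hp _)]
          rw [hf]; simp only
          rw [← mul_assoc, Real.div_rpow hbp.le hp.le, Real.rpow_neg hbp.le, Real.rpow_neg hp.le]
          have := (Real.rpow_pos_of_pos hbp γ).ne'
          have := (Real.rpow_pos_of_pos hp γ).ne'
          field_simp
        exact tendsto_nhds_unique l1 l3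
      ext i
      exact sol_zero hn hc hV hqe (i := i) (by rw [hVq]; rfl) e he0
  rw [hVe0, norm_zero] at hVe
  linarith

lemma caseB {n p : ℕ} (hn : 5 ≤ n) {s γ C ρ L : ℝ} (hs : 1 < s) (hta : 0 < ta n s) (hγ : γ = 4/(s-1)) (hγn : γ < n - 4) (hγm : ((n:ℝ)-4)/2 < γ)
    {W : EE n → EE p} {h : EE n → Fin p → ℝ} (H : LocSol s (c0 n)⁻¹ ρ L W h)
    (hC0 : 0 ≤ C) (hC : ∀ x ≠ 0, ‖W x‖ ≤ C * ‖x‖^(-γ)) {e : EE n} (he : ‖e‖ = 1)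
    (hb : ∀ θ > 0, ∀ r0 > 0, ∃ t, 0 < t ∧ t < r0 ∧ t^γ * ‖W (t • e)‖ < θ) :
    Tendsto (fun x => ‖x‖^γ * ‖W x‖) (𝓝[≠] 0) (𝓝 0) := by
  have hB := caseB_rad hn hs hta hγ hγn hγm H hC0 hC he hb
  have hc : 0 < (c0 n)⁻¹ := inv_pos.2 (c0_pos hn)
  have he0 : e ≠ 0 := by rintro rfl; simp at he
  apply tendsto_of_subseq_tendsto
  intro ns hns
  obtain ⟨N, hN, hNt⟩ := seq_shift hns
  obtain ⟨ms, hms, V, hV, hVb, hVt, x, hx1, hxt⟩ := seq_blow hn hs hc H hγ hγn hC0 hC hN hNt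
  refine ⟨fun j => ms j + N, ?_⟩
  have hVe : V x = V e := sol_radial hn hs hta hc hV (by rw [hx1, he])
  have hz : ‖V e‖ = 0 := by
    apply le_antisymm _ (norm_nonneg _)
    apply le_of_forall_pos_le_add
    intro ε hε
    rw [zero_add]
    obtain ⟨r0, hr0, hr⟩ := hB ε hε
    refine le_of_tendsto (hVt e he0).norm ?_
    have htn : Tendsto (fun j => ‖ns (ms j + N)‖) atTop (𝓝 0) := tendsto_zero_iff_norm_tendsto_zero.1 (hNt.comp hms.tendsto_atTop)
    filter_upwards [htn.eventually (gt_mem_nhds hr0)] with j hj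
    have hp : 0 < ‖ns (ms j + N)‖ := norm_pos_iff.2 (hN _)
    rw [norm_smul, Real.norm_eq_abs, abs_of_pos (Real.rpow_pos_of_pos hp _)]
    exact (hr _ hp hj).le
  rw [hVe, hz] at hxt
  exact hxt

lemma pot_cont0 {n : ℕ} (hn : 5 ≤ n) {g : EE n → ℝ} (hg : AEStronglyMeasurable g volume) {D R1 : ℝ} (hD : 0 ≤ D) (hR1 : 0 < R1)
    (hgb : ∀ z ≠ 0, |g z| ≤ D * ‖z‖^(-(2:ℝ))) (hgz : ∀ z, R1 ≤ ‖z‖ → g z = 0) :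
    Tendsto (fun x => ∫ z, rk (x - z) * g z) (𝓝 0) (𝓝 (∫ z, rk (0 - z) * g z)) := by
  obtain ⟨C, hC0, hC⟩ := rk_mild hn (b := 2) (by norm_num) (by norm_num)
  have hmeas : ∀ x : EE n, AEStronglyMeasurable (fun z => rk (x - z) * g z) volume := fun x =>
    ((rk_meas.comp (measurable_const.sub measurable_id)).aestronglyMeasurable).mul hg
  have hae : ∀ x : EE n, ∀ᵐ z ∂(volume : Measure (EE n)), ‖rk (x - z) * g z‖ ≤ D * (rk (x - z) * ‖z‖^(-(2:ℝ))) := by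
    intro x
    filter_upwards [ae_ne hn (0 : EE n)] with z hz
    rw [norm_mul, Real.norm_eq_abs, Real.norm_eq_abs, abs_of_nonneg (rk_nonneg _)]
    calc _ ≤ rk (x - z) * (D * ‖z‖^(-(2:ℝ))) := mul_le_mul_of_nonneg_left (hgb z hz) (rk_nonneg _)
      _ = _ := by ring
  have hIon : ∀ σ, 0 < σ → ∀ x ∈ ball (0 : EE n) σ, IntegrableOn (fun z => rk (x - z) * g z) (ball 0 σ) := by
    intro σ hσ x hx
    exact Integrable.mono' (Integrable.const_mul (hC σ hσ x hx).1 D) (hmeas x).restrict (ae_restrict_of_ae (hae x))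
  have hI : ∀ x ∈ ball (0 : EE n) R1, Integrable (fun z => rk (x - z) * g z) := by
    intro x hx
    rw [← integrableOn_univ]
    refine (hIon R1 hR1 x hx).of_forall_diff_eq_zero MeasurableSet.univ ?_
    intro z hz
    have : R1 ≤ ‖z‖ := by
      have := hz.2; simpa using this
    rw [hgz z this, mul_zero]
  have hloc : ∀ σ, 0 < σ → ∀ x ∈ ball (0 : EE n) σ, |∫ z in ball (0 : EE n) σ, rk (x - z) * g z| ≤ D * (C * σ^(2:ℝ)) := by
    intro σ hσ x hx
    rw [← Real.norm_eq_abs]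
    refine (norm_integral_le_of_norm_le (Integrable.const_mul (hC σ hσ x hx).1 D) (ae_restrict_of_ae (hae x))).trans ?_
    rw [integral_const_mul]
    refine mul_le_mul_of_nonneg_left ((hC σ hσ x hx).2.trans_eq ?_) hD
    norm_num
  rw [Metric.tendsto_nhds_nhds]
  intro ε hε
  obtain ⟨σ, hσ0, hσR, hσ⟩ : ∃ σ, 0 < σ ∧ σ < R1 ∧ D * (C * σ^(2:ℝ)) < ε/4 := by
    have : Tendsto (fun σ : ℝ => D * (C * σ^(2:ℝ))) (𝓝[>] 0) (𝓝 0) := by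
      have h := (Real.continuousAt_rpow_const (0:ℝ) (2:ℝ) (Or.inr (by norm_num))).tendsto
      rw [Real.zero_rpow (by norm_num)] at h
      have := ((h.const_mul C).const_mul D)
      simp only [mul_zero] at this
      exact this.mono_left nhdsWithin_le_nhds
    obtain ⟨σ, h1, h2⟩ := ((this.eventually (gt_mem_nhds (by positivity : (0:ℝ) < ε/4))).and (Ioo_mem_nhdsGT hR1)).exists
    exact ⟨σ, h2.1, h2.2, h1⟩
  set J := ∫ z, ‖rk (0 - z) * g z‖ with hJ
  have hJ0 : 0 ≤ J := integral_nonneg fun z => norm_nonneg _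
  set K := (n:ℝ) * 3^n * (J + 1) * (2/σ) with hK
  have hn0 : (0:ℝ) < n := by have : 0 < n := by omega
                             exact_mod_cast this
  have hK0 : 0 < K := by positivity
  refine ⟨min (σ/2) (ε/(4*K)), by positivity, fun x hx => ?_⟩
  rw [dist_zero_right] at hx
  have hx1 : ‖x‖ < σ/2 := hx.trans_le (min_le_left _ _)
  have hx2 : ‖x‖ < ε/(4*K) := hx.trans_le (min_le_right _ _)
  have hxσ : x ∈ ball (0 : EE n) σ := by rw [mem_ball_zero_iff]; linarith
  have hxR : x ∈ ball (0 : EE n) R1 := by rw [mem_ball_zero_iff]; linarith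
  have h0σ : (0 : EE n) ∈ ball (0 : EE n) σ := mem_ball_self hσ0
  have h0R : (0 : EE n) ∈ ball (0 : EE n) R1 := mem_ball_self hR1
  have s1 := integral_add_compl (measurableSet_ball (x := (0 : EE n)) (ε := σ)) (hI x hxR)
  have s2 := integral_add_compl (measurableSet_ball (x := (0 : EE n)) (ε := σ)) (hI 0 h0R)
  rw [Real.dist_eq, ← s1, ← s2]
  have l1 := hloc σ hσ0 x hxσ
  have l2 := hloc σ hσ0 0 h0σ
  have l3 : |(∫ z in (ball (0 : EE n) σ)ᶜ, rk (x - z) * g z) - ∫ z in (ball (0 : EE n) σ)ᶜ, rk (0 - z) * g z| ≤ (n:ℝ) * 3^n * (‖x‖/(σ/2)) * J := by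
    rw [← integral_sub (hI x hxR).integrableOn (hI 0 h0R).integrableOn, ← Real.norm_eq_abs]
    refine (norm_integral_le_of_norm_le (g := fun z => (n:ℝ) * 3^n * (‖x‖/(σ/2)) * ‖rk (0 - z) * g z‖) (Integrable.const_mul (hI 0 h0R).norm.integrableOn _) ?_).trans ?_
    · filter_upwards [ae_restrict_mem measurableSet_ball.compl] with z hz
      have := rk_osc hn (a := (0 : EE n)) (x := x) (x' := 0) (z := z) (s := σ/2) (by positivity) (by rw [mem_ball_zero_iff]; exact hx1) (mem_ball_self (by positivity)) (by rw [show 2*(σ/2) = σ by ring]; exact hz)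
      rw [sub_zero] at this
      rw [← sub_mul, norm_mul, norm_mul, Real.norm_eq_abs, Real.norm_eq_abs (rk (0 - z)), abs_of_nonneg (rk_nonneg (0 - z)), ← mul_assoc]
      exact mul_le_mul_of_nonneg_right this (norm_nonneg _)
    · rw [integral_const_mul]
      refine mul_le_mul_of_nonneg_left ?_ (by positivity)
      exact setIntegral_le_integral (hI 0 h0R).norm (Eventually.of_forall fun z => norm_nonneg _)
  have l4 : (n:ℝ) * 3^n * (‖x‖/(σ/2)) * J ≤ ε/4 := by
    have e : K * ‖x‖ ≤ ε/4 := by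
      rw [lt_div_iff₀ (by positivity)] at hx2
      linarith
    refine le_trans ?_ e
    have : (n:ℝ) * 3^n * (‖x‖/(σ/2)) * J = (n:ℝ) * 3^n * J * (2/σ) * ‖x‖ := by field_simp
    rw [this, hK]
    gcongr
    linarith
  rw [abs_le] at l1 l2 l3
  rw [abs_lt]
  constructor <;> linarith [l1.1, l1.2, l2.1, l2.2, l3.1, l3.2]

lemma nl_ae {n p : ℕ} (hn : 5 ≤ n) {s c ρ L : ℝ} {W : EE n → EE p} {h : EE n → Fin p → ℝ} (H : LocSol s c ρ L W h) (i : Fin p) :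
    AEStronglyMeasurable (fun z => nl s (W z) i) volume := by
  haveI := EE_nontrivial hn
  obtain ⟨x, hx0, hx⟩ : ∃ x : EE n, x ≠ 0 ∧ x ∈ ball (0 : EE n) ρ := by
    obtain ⟨e, he⟩ := exists_norm_eq (EE n) (show 0 ≤ ρ/2 by linarith [H.rpos])
    refine ⟨e, ?_, ?_⟩
    · rintro rfl; rw [norm_zero] at he; linarith [H.rpos]
    · rw [mem_ball_zero_iff, he]; linarith [H.rpos]
  have hi := (H.rep x hx hx0 i).1.aestronglyMeasurable
  have hm : Measurable (fun z : EE n => (rk (x - z))⁻¹) := (rk_meas.comp (measurable_const.sub measurable_id)).inv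
  refine (hm.aestronglyMeasurable.mul hi).congr ?_
  filter_upwards [ae_ne hn x] with z hz
  have : rk (x - z) ≠ 0 := (rk_pos (sub_ne_zero.2 (Ne.symm hz))).ne'
  show (rk (x - z))⁻¹ * (rk (x - z) * nl s (W z) i) = nl s (W z) i
  field_simp

lemma rem_decay {n p : ℕ} (hn : 5 ≤ n) {s γ C ρ L c : ℝ} (hs : 1 < s) (hγ : γ = 4/(s-1)) (hγn : γ < n - 4) (hc : 0 < c)
    {W : EE n → EE p} {h : EE n → Fin p → ℝ} (H : LocSol s c ρ L W h)
    (hC0 : 0 ≤ C) (hC : ∀ x ≠ 0, ‖W x‖ ≤ C * ‖x‖^(-γ))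
    (h0 : Tendsto (fun x => ‖x‖^γ * ‖W x‖) (𝓝[≠] 0) (𝓝 0)) :
    ∃ B, 0 ≤ B ∧ ∀ x ≠ 0, ‖W x‖^s ≤ B * ‖x‖^(-(2:ℝ)) := by
  have hρ := H.rpos
  have hL := H.Lnn
  have hs1 : 0 < s - 1 := by linarith
  have hs0 : 0 < s := by linarith
  have hγ0 : 0 < γ := by rw [hγ]; positivity
  have hγs : γ * (s-1) = 4 := by rw [hγ]; field_simp
  set θ := 2/s with hθ
  have hθ0 : 0 < θ := by positivity
  have hθγ : θ < γ := by
    rw [hθ, hγ, div_lt_div_iff₀ hs0 hs1]; linarith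
  obtain ⟨Cg, hCg0, hCg⟩ := pot_bound hn hγ0 hγn
  obtain ⟨Ct, hCt0, hCt⟩ := pot_bound hn hθ0 (hθγ.trans hγn)
  -- choose eta
  set η := 1/(2*((p:ℝ)*c*(Cg+Ct)+1)) with hη
  have hden : 0 < (p:ℝ)*c*(Cg+Ct)+1 := by positivity
  have hη0 : 0 < η := by positivity
  have hη1 : (p:ℝ)*c*(Cg+Ct)*η ≤ 1/2 := by
    rw [hη, mul_one_div, div_le_div_iff₀ (by positivity) (by norm_num)]
    nlinarith
  have hpc : 0 ≤ (p:ℝ)*c := by positivity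
  have hηg : (p:ℝ)*c*Cg*η ≤ 1/2 := by
    have : 0 ≤ (p:ℝ)*c*Ct*η := by positivity
    nlinarith
  have hηt : (p:ℝ)*c*Ct*η ≤ 1/2 := by
    have : 0 ≤ (p:ℝ)*c*Cg*η := by positivity
    nlinarith
  have hΦ : Tendsto (fun x : EE n => (‖x‖^γ * ‖W x‖)^(s-1)) (𝓝[≠] 0) (𝓝 0) := by
    have := h0.rpow_const (p := s-1) (Or.inr hs1.le)
    rwa [Real.zero_rpow hs1.ne'] at this
  obtain ⟨δ, hδ0, hδ⟩ : ∃ δ > 0, ∀ x : EE n, x ≠ 0 → ‖x‖ < δ → (‖x‖^γ * ‖W x‖)^(s-1) ≤ η := by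
    have := hΦ.eventually (gt_mem_nhds hη0)
    rw [eventually_nhdsWithin_iff, Metric.eventually_nhds_iff] at this
    obtain ⟨δ, hδ0, hδ⟩ := this
    exact ⟨δ, hδ0, fun x hx hxd => (hδ (by rwa [dist_zero_right]) hx).le⟩
  have hsmall : ∀ z : EE n, z ≠ 0 → ‖z‖ < δ → ‖W z‖^s ≤ η * ‖z‖^(-(4:ℝ)) * ‖W z‖ := by
    intro z hz hzd
    have hz0 : 0 < ‖z‖ := norm_pos_iff.2 hz
    have := hδ z hz hzd
    rw [Real.mul_rpow (by positivity) (norm_nonneg _), ← Real.rpow_mul hz0.le, hγs] at this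
    have e1 : ‖W z‖^s = ‖W z‖^(s-1) * ‖W z‖ := by
      rw [← Real.rpow_add_one' (norm_nonneg _) (by linarith)]; congr 1; ring
    rw [e1]
    refine mul_le_mul_of_nonneg_right ?_ (norm_nonneg _)
    rw [Real.rpow_neg hz0.le, ← div_eq_mul_inv, le_div_iff₀ (by positivity)]
    linarith
  set M1 := (C * δ^(-γ))^s with hM1
  have hM10 : 0 ≤ M1 := by positivity
  have hfar : ∀ z : EE n, δ ≤ ‖z‖ → ‖W z‖^s ≤ M1 := by
    intro z hz
    have hz0 : z ≠ 0 := by rintro rfl; rw [norm_zero] at hz; linarith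
    refine Real.rpow_le_rpow (norm_nonneg _) ((hC z hz0).trans (mul_le_mul_of_nonneg_left ?_ hC0)) hs0.le
    exact Real.rpow_le_rpow_of_nonpos hδ0 hz (by linarith)
  have hfar2 : ∀ (κ : ℝ), 0 ≤ κ → ∀ z : EE n, δ ≤ ‖z‖ → ‖W z‖^s ≤ M1 * (2*ρ)^κ * ‖z‖^(-κ) := by
    intro κ hκ z hz
    have hz0 : 0 < ‖z‖ := by linarith
    by_cases hzr : 2*ρ ≤ ‖z‖
    · rw [H.zero z hzr, norm_zero, Real.zero_rpow hs0.ne']; positivity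
    · push Not at hzr
      refine (hfar z hz).trans ?_
      rw [mul_assoc, Real.rpow_neg hz0.le, ← div_eq_mul_inv]
      apply le_mul_of_one_le_right hM10
      rw [one_le_div (by positivity)]
      exact Real.rpow_le_rpow hz0.le hzr.le hκ
  set M2 := M1 * (2*ρ)^(4+θ) with hM2
  have hM20 : 0 ≤ M2 := by positivity
  set M3 := (p:ℝ) * (c * M2 * Ct + L * ρ^θ) with hM3
  have hM30 : 0 ≤ M3 := by positivity
  -- far bound for W
  have hWfar : ∀ x : EE n, ρ/2 ≤ ‖x‖ → ‖W x‖ ≤ L * (2*ρ)^θ * ‖x‖^(-θ) := by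
    intro z hz
    have hz0 : 0 < ‖z‖ := by linarith
    by_cases hzr : 2*ρ ≤ ‖z‖
    · rw [H.zero z hzr, norm_zero]; positivity
    · push Not at hzr
      refine (H.far z hz).trans ?_
      rw [mul_assoc, Real.rpow_neg hz0.le, ← div_eq_mul_inv]
      apply le_mul_of_one_le_right hL
      rw [one_le_div (by positivity)]
      exact Real.rpow_le_rpow hz0.le hzr.le hθ0.le
  set b := max (2*M3) (L * (2*ρ)^θ) with hb
  have hb0 : 0 ≤ b := le_max_of_le_left (by positivity)
  have step : ∀ a, 0 ≤ a → (∀ x : EE n, x ≠ 0 → ‖W x‖ ≤ a * ‖x‖^(-γ) + b * ‖x‖^(-θ)) →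
      ∀ x : EE n, x ≠ 0 → ‖W x‖ ≤ (a/2) * ‖x‖^(-γ) + b * ‖x‖^(-θ) := by
    intro a ha hyp x hx
    have hx0 : 0 < ‖x‖ := norm_pos_iff.2 hx
    have hxg : 0 ≤ ‖x‖^(-γ) := by positivity
    have hxt : 0 ≤ ‖x‖^(-θ) := by positivity
    by_cases hxρ : ‖x‖ < ρ
    swap
    · push Not at hxρ
      have h1 := hWfar x (by linarith)
      have h2 : L * (2*ρ)^θ * ‖x‖^(-θ) ≤ b * ‖x‖^(-θ) := mul_le_mul_of_nonneg_right (le_max_right _ _) hxt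
      have : 0 ≤ a/2 * ‖x‖^(-γ) := by positivity
      linarith
    have hpt : ∀ z : EE n, z ≠ 0 → ‖W z‖^s ≤ (η*a) * ‖z‖^(-4-γ) + (η*b+M2) * ‖z‖^(-4-θ) := by
      intro z hz
      have hz0 : 0 < ‖z‖ := norm_pos_iff.2 hz
      have eg : ‖z‖^(-4-γ) = ‖z‖^(-(4:ℝ)) * ‖z‖^(-γ) := by rw [← Real.rpow_add hz0]; congr 1
      have et : ‖z‖^(-4-θ) = ‖z‖^(-(4:ℝ)) * ‖z‖^(-θ) := by rw [← Real.rpow_add hz0]; congr 1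
      by_cases hzd : ‖z‖ < δ
      · refine (hsmall z hz hzd).trans ?_
        have h1 : η * ‖z‖^(-(4:ℝ)) * ‖W z‖ ≤ η * ‖z‖^(-(4:ℝ)) * (a * ‖z‖^(-γ) + b * ‖z‖^(-θ)) := mul_le_mul_of_nonneg_left (hyp z hz) (by positivity)
        have h2 : 0 ≤ M2 * (‖z‖^(-(4:ℝ)) * ‖z‖^(-θ)) := by positivity
        rw [eg, et]
        linarith
      · push Not at hzd
        have h1 := hfar2 (4+θ) (by positivity) z hzd
        rw [show -(4+θ) = -4-θ by ring] at h1
        have h2 : 0 ≤ (η*a) * ‖z‖^(-4-γ) := by positivity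
        have h3 : 0 ≤ (η*b) * ‖z‖^(-4-θ) := by positivity
        have h4 : ‖W z‖^s ≤ M2 * ‖z‖^(-4-θ) := h1
        linarith
    have hcoord : ∀ i, |W x i| ≤ c * ((η*a) * (Cg * ‖x‖^(-γ)) + (η*b+M2) * (Ct * ‖x‖^(-θ))) + L * ρ^θ * ‖x‖^(-θ) := by
      intro i
      rw [abs_of_nonneg (H.nn x i)]
      have hxb : x ∈ ball (0 : EE n) ρ := by rwa [mem_ball_zero_iff]
      obtain ⟨hi, he⟩ := H.rep x hxb hx i
      rw [he]
      have hI := ((hCg x hx).1.const_mul (η*a)).add ((hCt x hx).1.const_mul (η*b+M2))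
      have i1 : ∫ z, rk (x - z) * nl s (W z) i ≤ (η*a) * (Cg * ‖x‖^(-γ)) + (η*b+M2) * (Ct * ‖x‖^(-θ)) := by
        have : ∫ z, rk (x - z) * nl s (W z) i ≤ ∫ z, ((η*a) * (rk (x - z) * ‖z‖^(-4-γ)) + (η*b+M2) * (rk (x - z) * ‖z‖^(-4-θ))) := by
          refine integral_mono_ae hi hI ?_
          filter_upwards [ae_ne hn (0 : EE n)] with z hz
          have h1 : nl s (W z) i ≤ ‖W z‖^s := (le_abs_self _).trans (nl_abs_le hs _ i)
          have h2 := mul_le_mul_of_nonneg_left (h1.trans (hpt z hz)) (rk_nonneg (x - z))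
          linarith
        refine this.trans ?_
        rw [integral_add ((hCg x hx).1.const_mul (η*a)) ((hCt x hx).1.const_mul (η*b+M2)), integral_const_mul, integral_const_mul]
        have q1 := mul_le_mul_of_nonneg_left (hCg x hx).2 (by positivity : 0 ≤ η*a)
        have q2 := mul_le_mul_of_nonneg_left (hCt x hx).2 (by positivity : 0 ≤ η*b+M2)
        linarith
      have i2 : h x i ≤ L * ρ^θ * ‖x‖^(-θ) := by
        refine ((le_abs_self _).trans (H.hb x hxb i)).trans ?_
        rw [mul_assoc, Real.rpow_neg hx0.le, ← div_eq_mul_inv]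
        apply le_mul_of_one_le_right hL
        rw [one_le_div (by positivity)]
        exact Real.rpow_le_rpow hx0.le hxρ.le hθ0.le
      have := mul_le_mul_of_nonneg_left i1 hc.le
      linarith
    have hsum : ‖W x‖ ≤ (p:ℝ) * (c * ((η*a) * (Cg * ‖x‖^(-γ)) + (η*b+M2) * (Ct * ‖x‖^(-θ))) + L * ρ^θ * ‖x‖^(-θ)) := by
      refine (norm_le_sum _).trans ((Finset.sum_le_sum fun i _ => hcoord i).trans_eq ?_)
      rw [Finset.sum_const, Finset.card_univ, Fintype.card_fin, nsmul_eq_mul]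
    have e : (p:ℝ) * (c * ((η*a) * (Cg * ‖x‖^(-γ)) + (η*b+M2) * (Ct * ‖x‖^(-θ))) + L * ρ^θ * ‖x‖^(-θ))
        = ((p:ℝ)*c*Cg*η) * (a * ‖x‖^(-γ)) + ((p:ℝ)*c*Ct*η) * (b * ‖x‖^(-θ)) + M3 * ‖x‖^(-θ) := by
      rw [hM3]; ring
    rw [e] at hsum
    have k1 := mul_le_mul_of_nonneg_right hηg (by positivity : 0 ≤ a * ‖x‖^(-γ))
    have k2 := mul_le_mul_of_nonneg_right hηt (by positivity : 0 ≤ b * ‖x‖^(-θ))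
    have k3 : M3 * ‖x‖^(-θ) ≤ (b/2) * ‖x‖^(-θ) := mul_le_mul_of_nonneg_right (by have := le_max_left (2*M3) (L * (2*ρ)^θ); linarith) hxt
    linarith
  have iter : ∀ k : ℕ, ∀ x : EE n, x ≠ 0 → ‖W x‖ ≤ (C/2^k) * ‖x‖^(-γ) + b * ‖x‖^(-θ) := by
    intro k
    induction k with
    | zero =>
      intro x hx
      have := hC x hx
      have h2 : 0 ≤ b * ‖x‖^(-θ) := by positivity
      simp only [pow_zero, div_one]
      linarith
    | succ k ih =>
      have := step (C/2^k) (by positivity) ih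
      intro x hx
      have h2 := this x hx
      rwa [div_div, ← pow_succ] at h2
  have hfin : ∀ x : EE n, x ≠ 0 → ‖W x‖ ≤ b * ‖x‖^(-θ) := by
    intro x hx
    have t : Tendsto (fun k : ℕ => (C/2^k) * ‖x‖^(-γ) + b * ‖x‖^(-θ)) atTop (𝓝 (0 * ‖x‖^(-γ) + b * ‖x‖^(-θ))) := by
      refine Tendsto.add_const _ (Tendsto.mul_const _ ?_)
      exact tendsto_const_nhds.div_atTop (tendsto_pow_atTop_atTop_of_one_lt (by norm_num))
    rw [zero_mul, zero_add] at t
    exact ge_of_tendsto' t (fun k => iter k x hx)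
  refine ⟨b^s, by positivity, fun x hx => ?_⟩
  have hx0 : 0 < ‖x‖ := norm_pos_iff.2 hx
  refine (Real.rpow_le_rpow (norm_nonneg _) (hfin x hx) hs0.le).trans_eq ?_
  rw [Real.mul_rpow hb0 (by positivity), ← Real.rpow_mul hx0.le]
  congr 2
  rw [hθ]; field_simp

lemma rem_ext {n p : ℕ} (hn : 5 ≤ n) {s γ C ρ L c : ℝ} (hs : 1 < s) (hγ : γ = 4/(s-1)) (hγn : γ < n - 4) (hc : 0 < c)
    {W : EE n → EE p} {h : EE n → Fin p → ℝ} (H : LocSol s c ρ L W h)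
    (hC0 : 0 ≤ C) (hC : ∀ x ≠ 0, ‖W x‖ ≤ C * ‖x‖^(-γ))
    (h0 : Tendsto (fun x => ‖x‖^γ * ‖W x‖) (𝓝[≠] 0) (𝓝 0)) (i : Fin p) :
    ∃ l, Tendsto (fun x => W x i) (𝓝[≠] 0) (𝓝 l) := by
  obtain ⟨B, hB0, hB⟩ := rem_decay hn hs hγ hγn hc H hC0 hC h0
  have hρ := H.rpos
  have hp := pot_cont0 hn (nl_ae hn H i) hB0 (by linarith : 0 < 2*ρ) (fun z hz => (nl_abs_le hs _ i).trans (hB z hz)) (fun z hz => by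
    rw [H.zero z hz]; simp [nl])
  have hh : Tendsto (fun x => h x i) (𝓝 0) (𝓝 (h 0 i)) := by
    rw [Metric.tendsto_nhds_nhds]
    intro ε hε
    have hL := H.Lnn
    refine ⟨min ρ (ε/(L+1)), by positivity, fun x hx => ?_⟩
    rw [dist_zero_right] at hx
    have h1 := H.hl x (by rw [mem_ball_zero_iff]; exact hx.trans_le (min_le_left _ _)) 0 (mem_ball_self hρ) i
    rw [sub_zero] at h1
    rw [Real.dist_eq]
    have h2 := hx.trans_le (min_le_right _ _)
    rw [lt_div_iff₀ (by positivity)] at h2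
    nlinarith [norm_nonneg x]
  have t := ((hp.const_mul c).add hh).mono_left (nhdsWithin_le_nhds (s := {0}ᶜ))
  refine ⟨_, t.congr' ?_⟩
  filter_upwards [self_mem_nhdsWithin, mem_nhdsWithin_of_mem_nhds (ball_mem_nhds (0 : EE n) hρ)] with x hx hxb
  exact (H.rep x hxb hx i).2.symm

lemma K0_eq_KK {n : ℕ} {s : ℝ} (hs : 1 < s) : K0 n s = KK n (4/(s-1)) := by
  have h : s - 1 ≠ 0 := by linarith
  unfold K0 KK
  field_simp
  ring

lemma vnorm_eq {n p : ℕ} (U : Fin p → EE n → ℝ) (x : EE n) :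
    vnorm U x = ‖(WithLp.toLp 2 (fun i => U i x) : EE p)‖ := by
  rw [EuclideanSpace.norm_eq]
  simp [vnorm]

lemma ext_contra {n : ℕ} {R l : ℝ} (u : EE n → ℝ) (hu : ContinuousOn u (ball 0 R \ {0}))
    (hl : Tendsto u (𝓝[≠] 0) (𝓝 l)) :
    ∃ g : EE n → ℝ, ContinuousOn g (ball 0 R) ∧ ∀ x ∈ ball (0 : EE n) R \ {0}, g x = u x := by
  classical
  refine ⟨Function.update u 0 l, ?_, fun x hx => Function.update_of_ne hx.2 _ _⟩
  intro x hx
  apply ContinuousAt.continuousWithinAt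
  by_cases h : x = 0
  · subst h
    exact continuousAt_update_same.2 hl
  · have ho : IsOpen (ball (0 : EE n) R \ {0}) := isOpen_ball.sdiff isClosed_singleton
    exact (continuousAt_update_of_ne h).2 (hu.continuousAt (ho.mem_nhds ⟨hx, h⟩))

theorem statement6 (n p : ℕ) (hn : 5 ≤ n) (hp : 1 ≤ p) (s : ℝ)
    (hs1 : (n : ℝ) / ((n : ℝ) - 4) < s) (hs2 : s < ((n : ℝ) + 4) / ((n : ℝ) - 4))
    (R : ℝ) (hR : 0 < R)
    (U : Fin p → EuclideanSpace ℝ (Fin n) → ℝ)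
    (hnonneg : ∀ i, ∀ x ∈ Metric.ball (0 : EuclideanSpace ℝ (Fin n)) R \ {0}, 0 ≤ U i x)
    (hC4 : ∀ i, ContDiffOn ℝ 4 (U i)
      (Metric.ball (0 : EuclideanSpace ℝ (Fin n)) R \ {0}))
    (hsuper : ∀ i, ∀ x ∈ Metric.ball (0 : EuclideanSpace ℝ (Fin n)) R \ {0},
      0 < -lap (U i) x)
    (hpde : ∀ i, ∀ x ∈ Metric.ball (0 : EuclideanSpace ℝ (Fin n)) R \ {0},
      bilap (U i) x = (vnorm U x) ^ (s - 1) * U i x)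
    (hsing : ∃ i, ¬ ∃ g : EuclideanSpace ℝ (Fin n) → ℝ,
      ContinuousOn g (Metric.ball (0 : EuclideanSpace ℝ (Fin n)) R) ∧
      ∀ x ∈ Metric.ball (0 : EuclideanSpace ℝ (Fin n)) R \ {0}, g x = U i x) :
    Tendsto
      (fun x : EuclideanSpace ℝ (Fin n) => ‖x‖ ^ (4 / (s - 1)) * vnorm U x)
      (𝓝[Metric.ball (0 : EuclideanSpace ℝ (Fin n)) R \ {0}] 0)
      (𝓝 ((K0 n s) ^ (1 / (s - 1)))) := by
  have hn5 : (5:ℝ) ≤ n := by exact_mod_cast hn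
  have h4 : (0:ℝ) < (n:ℝ) - 4 := by linarith
  have h1 : (n:ℝ) < s * (n - 4) := (div_lt_iff₀ h4).1 hs1
  have h2 : s * ((n:ℝ) - 4) < n + 4 := (lt_div_iff₀ h4).1 hs2
  have hs : 1 < s := by
    by_contra hcon
    have : s ≤ 1 := not_lt.1 hcon
    nlinarith
  have hs0 : 0 < s - 1 := by linarith
  have hta : 0 < ta n s := by unfold ta; linarith
  have hγn : 4/(s-1) < (n:ℝ) - 4 := by rw [div_lt_iff₀ hs0]; linarith
  have hγm : ((n:ℝ)-4)/2 < 4/(s-1) := by rw [lt_div_iff₀ hs0]; linarith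
  obtain ⟨ρ, L, W, h, hρR, H, hW⟩ := locsol_setup hn hs1 hR U hnonneg hC4 hsuper hpde
  have hc : 0 < (c0 n)⁻¹ := inv_pos.2 (c0_pos hn)
  obtain ⟨C, hC0, hC⟩ := upper_bound hn hs hta hc H rfl
  haveI := EE_nontrivial hn
  obtain ⟨e, he⟩ : ∃ e : EE n, ‖e‖ = 1 := exists_norm_eq (EE n) zero_le_one
  have hWev : ∀ᶠ x in 𝓝[≠] (0 : EE n), W x = WithLp.toLp 2 (fun i => U i x) := by
    filter_upwards [self_mem_nhdsWithin, nhdsWithin_le_nhds (ball_mem_nhds (0 : EE n) H.rpos)] with x hx hx2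
    exact hW x hx2 hx
  by_cases hcase : ∃ θ > 0, ∃ r0 > 0, ∀ t, 0 < t → t < r0 → θ ≤ t^(4/(s-1)) * ‖W (t • e)‖
  · obtain ⟨θ, hθ, r0, hr0, hb⟩ := hcase
    have key := caseA hn hs hta rfl hγn hγm H hC0 hC he hθ hr0 hb
    rw [K0_eq_KK hs]
    refine Tendsto.mono_left ?_ (nhdsWithin_mono (0 : EE n) (fun x hx => hx.2 : ball (0 : EE n) R \ {0} ⊆ {0}ᶜ))
    refine key.congr' ?_
    filter_upwards [hWev] with x hx
    rw [hx, vnorm_eq]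
  · exfalso
    push Not at hcase
    have h0 := caseB hn hs hta rfl hγn hγm H hC0 hC he hcase
    obtain ⟨i, hi⟩ := hsing
    obtain ⟨l, hl⟩ := rem_ext hn hs rfl hγn hc H hC0 hC h0 i
    apply hi
    refine ext_contra (l := l) (U i) (hC4 i).continuousOn (hl.congr' ?_)
    filter_upwards [hWev] with x hx
    rw [hx]
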